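/- For every natural number K ≥ 1 there are infinitely many natural numbers n such that ω(p_n − 1) < ω(p_{n+1} − 1) < ⋯ < ω(p_{n+K−1} − 1), i.e., the number of distinct prime factors of the shifted primes p − 1 is strictly increasing along some run of K consecutive primes, for infinitely many starting indices n. -/

import Mathlib

section
open Finset
namespace OIR

/-- Abel summation bound. -/
theorem abel_bound (f φ : ℕ → ℂ) (B : ℝ)
    (hf : ∀ N, ‖∑ n ∈ range N, f n‖ ≤ B) (N : ℕ) :
    ‖∑ n ∈ range N, f n * φ n‖ ≤ B * (‖φ N‖ + ∑ n ∈ range N, ‖φ (n+1) - φ n‖) := by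
  have key : ∀ N, ∑ n ∈ range N, f n * φ n = (∑ n ∈ range N, f n) * φ N
      - ∑ n ∈ range N, (∑ m ∈ range (n+1), f m) * (φ (n+1) - φ n) := by
    intro N
    induction N with
    | zero => simp
    | succ N ih =>
      rw [sum_range_succ, ih, sum_range_succ (fun n => (∑ m ∈ range (n+1), f m) * (φ (n+1) - φ n)),
        sum_range_succ f]
      ring
  rw [key, mul_add, mul_sum]
  refine (norm_sub_le _ _).trans (add_le_add ?_ ((norm_sum_le _ _).trans (sum_le_sum ?_)))
  · rw [norm_mul]; exact mul_le_mul_of_nonneg_right (hf N) (norm_nonneg _)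
  · intro n _
    rw [norm_mul]; exact mul_le_mul_of_nonneg_right (hf _) (norm_nonneg _)

/-- Periodic functions with mean zero have bounded partial sums. -/
theorem periodic_partial (f : ℕ → ℂ) (q : ℕ) (hq : 0 < q) (hper : ∀ n, f (n + q) = f n)
    (h0 : ∑ n ∈ range q, f n = 0) (h1 : ∀ n, ‖f n‖ ≤ 1) (N : ℕ) :
    ‖∑ n ∈ range N, f n‖ ≤ q := by
  induction N using Nat.strong_induction_on with
  | _ N ih =>
    by_cases h : N ≤ q
    · calc ‖∑ n ∈ range N, f n‖ ≤ ∑ n ∈ range N, ‖f n‖ := norm_sum_le _ _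
        _ ≤ ∑ n ∈ range N, (1:ℝ) := sum_le_sum (fun n _ => h1 n)
        _ = N := by simp
        _ ≤ q := by exact_mod_cast h
    · push Not at h
      obtain ⟨M, rfl⟩ : ∃ M, N = q + M := ⟨N - q, by omega⟩
      rw [sum_range_add, h0, zero_add]
      have : ∀ n, f (q + n) = f n := fun n => by rw [add_comm]; exact hper n
      simp only [this]
      exact ih M (by omega)

theorem char_norm_le {q : ℕ} (χ : DirichletCharacter ℂ q) (a : ZMod q) : ‖χ a‖ ≤ 1 :=
  DirichletCharacter.norm_le_one χ a

theorem sum_range_zmod {q : ℕ} [NeZero q] (f : ZMod q → ℂ) :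
    ∑ n ∈ range q, f (n : ZMod q) = ∑ a : ZMod q, f a := by
  symm
  refine sum_bij' (fun a _ => a.val) (fun n _ => (n : ZMod q)) ?_ ?_ ?_ ?_ ?_
  · intro a _; simpa using ZMod.val_lt a
  · simp
  · intro a _; simp
  · intro n hn; exact ZMod.val_cast_of_lt (by simpa using hn)
  · intro a _; simp

theorem char_partial {q : ℕ} [NeZero q] (χ : DirichletCharacter ℂ q) (h : χ ≠ 1) (N : ℕ) :
    ‖∑ n ∈ range N, χ (n : ZMod q)‖ ≤ q := by
  refine periodic_partial (fun n => χ (n : ZMod q)) q (NeZero.pos q) ?_ ?_ ?_ N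
  · intro n; simp
  · rw [sum_range_zmod (fun a => χ a)]; exact MulChar.sum_eq_zero_of_ne_one h
  · intro n; exact char_norm_le _ _

/-- index type of characters -/
abbrev PC := Σ q : ℕ, DirichletCharacter ℂ q

/-- value at a natural number -/
noncomputable def PC.ev (c : PC) (n : ℕ) : ℂ := c.2 (n : ZMod c.1)

theorem PC.ev_le (c : PC) (n : ℕ) : ‖c.ev n‖ ≤ 1 := char_norm_le _ _

theorem PC.ev_mul (c : PC) (m n : ℕ) : c.ev (m * n) = c.ev m * c.ev n := by
  simp [PC.ev]

theorem PC.ev_zero (c : PC) (n : ℕ) (h : ¬ n.Coprime c.1) : c.ev n = 0 :=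
  MulChar.map_nonunit _ (fun h' => h ((ZMod.isUnit_iff_coprime _ _).mp h'))

theorem changeLevel_nat {q m : ℕ} (h : q ∣ m) (χ : DirichletCharacter ℂ q) (n : ℕ)
    (hn : n.Coprime m) :
    DirichletCharacter.changeLevel h χ (n : ZMod m) = χ (n : ZMod q) := by
  have := DirichletCharacter.changeLevel_eq_cast_of_dvd' χ h (a := (n : ℤ))
    (Nat.isCoprime_iff_coprime.mpr hn)
  simpa using this

/-- distinct primitive characters become distinct at the product level -/
theorem distinct_prim (c d : PC) (hc : 0 < c.1) (hd : 0 < d.1) (pc : c.2.IsPrimitive)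
    (pd : d.2.IsPrimitive) (hne : c ≠ d) :
    DirichletCharacter.changeLevel (Dvd.intro d.1 rfl : c.1 ∣ c.1 * d.1) c.2 ≠
    DirichletCharacter.changeLevel (Dvd.intro_left c.1 rfl : d.1 ∣ c.1 * d.1) d.2 := by
  obtain ⟨q, χ⟩ := c
  obtain ⟨r, ψ⟩ := d
  simp only at *
  intro h
  have : NeZero (q * r) := ⟨by positivity⟩
  have h1 := congrArg DirichletCharacter.conductor h
  rw [DirichletCharacter.conductor_changeLevel, DirichletCharacter.conductor_changeLevel] at h1
  rw [DirichletCharacter.isPrimitive_def] at pc pd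
  rw [pc, pd] at h1
  subst h1
  apply hne
  have := DirichletCharacter.changeLevel_injective (R := ℂ) (Dvd.intro q rfl : q ∣ q * q) h
  rw [this]

theorem prim_pair_partial (c d : PC) (hc : 0 < c.1) (hd : 0 < d.1) (pc : c.2.IsPrimitive)
    (pd : d.2.IsPrimitive) (hne : c ≠ d) (N : ℕ) :
    ‖∑ n ∈ range N, c.ev n * (starRingEnd ℂ) (d.ev n)‖ ≤ (c.1 * d.1 : ℕ) := by
  have : NeZero (c.1 * d.1) := ⟨by positivity⟩
  set χ1 := DirichletCharacter.changeLevel (Dvd.intro d.1 rfl : c.1 ∣ c.1 * d.1) c.2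
  set χ2 := DirichletCharacter.changeLevel (Dvd.intro_left c.1 rfl : d.1 ∣ c.1 * d.1) d.2
  have hne' : χ1 * χ2⁻¹ ≠ 1 := by
    intro h
    exact distinct_prim c d hc hd pc pd hne (mul_inv_eq_one.mp h)
  have hev : ∀ n : ℕ,
      c.ev n * (starRingEnd ℂ) (d.ev n) = (χ1 * χ2⁻¹) (n : ZMod (c.1 * d.1)) := by
    intro n
    by_cases hn : n.Coprime (c.1 * d.1)
    · rw [MulChar.mul_apply, ← MulChar.star_apply']
      have h1 := changeLevel_nat (Dvd.intro d.1 rfl : c.1 ∣ c.1 * d.1) c.2 n hn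
      have h2 := changeLevel_nat (Dvd.intro_left c.1 rfl : d.1 ∣ c.1 * d.1) d.2 n hn
      simp only [χ1, χ2]
      rw [h1, h2]; rfl
    · rw [MulChar.map_nonunit _ (fun h => hn ((ZMod.isUnit_iff_coprime _ _).mp h))]
      rw [Nat.coprime_mul_iff_right, not_and_or] at hn
      rcases hn with hn | hn
      · rw [PC.ev_zero c n hn, zero_mul]
      · rw [PC.ev_zero d n hn]; simp
  simp only [hev]
  exact char_partial _ hne' N

end OIR
end

section
open Finset
namespace OIR

theorem abel_antitone (f : ℕ → ℂ) (B : ℝ) (hf : ∀ N, ‖∑ n ∈ range N, f n‖ ≤ B)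
    (φ : ℕ → ℝ) (hφ : Antitone φ) (h0 : ∀ n, 0 ≤ φ n) (a b : ℕ) :
    ‖∑ n ∈ Ico a b, f n * (φ n : ℂ)‖ ≤ 2 * B * φ a := by
  rw [sum_Ico_eq_sum_range]
  have hf' : ∀ N, ‖∑ n ∈ range N, f (a + n)‖ ≤ 2 * B := by
    intro N
    have : ∑ n ∈ range N, f (a + n) = ∑ n ∈ range (a + N), f n - ∑ n ∈ range a, f n := by
      rw [sum_range_add]; ring
    rw [this]
    linarith [norm_sub_le (∑ n ∈ range (a + N), f n) (∑ n ∈ range a, f n), hf (a+N), hf a]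
  refine (abel_bound (fun n => f (a+n)) (fun n => (φ (a + n) : ℂ)) (2*B) hf' (b - a)).trans ?_
  have hB : 0 ≤ B := (norm_nonneg _).trans (hf 0)
  refine mul_le_mul_of_nonneg_left (le_of_eq ?_) (by positivity)
  have : ∀ n, ‖(φ (a + (n+1)) : ℂ) - (φ (a + n) : ℂ)‖ = φ (a + n) - φ (a + (n+1)) := by
    intro n
    rw [← Complex.ofReal_sub, Complex.norm_real, Real.norm_eq_abs, abs_of_nonpos]
    · ring
    · linarith [hφ (show a + n ≤ a + (n+1) by omega)]
  simp only [this]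
  rw [Finset.sum_range_sub' (fun n => φ (a + n)), Complex.norm_real, Real.norm_eq_abs,
    abs_of_nonneg (h0 _)]
  simp

/-- Duality form of the large sieve. -/
theorem duality {ι : Type*} (F : Finset ι) (S : Finset ℕ) (a : ℕ → ℂ) (w : ℕ → ℝ)
    (hw : ∀ n ∈ S, 0 ≤ w n) (e : ι → ℕ → ℂ) (M : ℝ) (hM0 : 0 ≤ M)
    (hM : ∀ c ∈ F, ∑ d ∈ F, ‖∑ n ∈ S, (w n : ℂ) * (e c n * (starRingEnd ℂ) (e d n))‖ ≤ M) :
    ∑ c ∈ F, ‖∑ n ∈ S, a n * e c n * w n‖ ^ 2 ≤ (∑ n ∈ S, ‖a n‖ ^ 2 * w n) * M := by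
  set A : ι → ℂ := fun c => ∑ n ∈ S, a n * e c n * w n with hA
  set E := ∑ n ∈ S, ‖a n‖ ^ 2 * w n with hE
  set T := ∑ c ∈ F, ‖A c‖ ^ 2 with hT
  have hE0 : 0 ≤ E := sum_nonneg (fun n hn => mul_nonneg (sq_nonneg _) (hw n hn))
  have hT0 : 0 ≤ T := sum_nonneg (fun n hn => sq_nonneg _)
  set b : ℕ → ℂ := fun n => ∑ c ∈ F, (starRingEnd ℂ) (A c) * e c n with hb
  set G := ∑ n ∈ S, ‖b n‖ ^ 2 * w n with hG
  have h1 : (T : ℂ) = ∑ n ∈ S, a n * w n * b n := by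
    rw [hT]; push_cast
    have : ∀ c ∈ F, ((‖A c‖ : ℂ)) ^ 2 = ∑ n ∈ S, a n * w n * ((starRingEnd ℂ) (A c) * e c n) := by
      intro c _
      rw [← Complex.mul_conj']
      conv_lhs => rw [hA]
      simp only []
      rw [sum_mul]
      refine sum_congr rfl (fun n _ => by ring)
    rw [sum_congr rfl this, sum_comm]
    refine sum_congr rfl (fun n _ => by rw [hb, mul_sum])
  have h2 : T ≤ ∑ n ∈ S, (‖a n‖ * Real.sqrt (w n)) * (‖b n‖ * Real.sqrt (w n)) := by
    have : T = ‖(T:ℂ)‖ := by rw [Complex.norm_real, Real.norm_eq_abs, abs_of_nonneg hT0]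
    rw [this, h1]
    refine (norm_sum_le _ _).trans (sum_le_sum fun n hn => ?_)
    rw [norm_mul, norm_mul, Complex.norm_real, Real.norm_eq_abs, abs_of_nonneg (hw n hn)]
    apply le_of_eq
    have := Real.mul_self_sqrt (hw n hn)
    calc ‖a n‖ * w n * ‖b n‖ = ‖a n‖ * (√(w n) * √(w n)) * ‖b n‖ := by rw [this]
      _ = _ := by ring
  have h3 : T ^ 2 ≤ E * G := by
    have := sum_mul_sq_le_sq_mul_sq S (fun n => ‖a n‖ * Real.sqrt (w n)) (fun n => ‖b n‖ * Real.sqrt (w n))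
    have e1 : ∑ n ∈ S, (‖a n‖ * √(w n)) ^ 2 = E := by
      refine sum_congr rfl (fun n hn => by rw [mul_pow, Real.sq_sqrt (hw n hn)])
    have e2 : ∑ n ∈ S, (‖b n‖ * √(w n)) ^ 2 = G := by
      refine sum_congr rfl (fun n hn => by rw [mul_pow, Real.sq_sqrt (hw n hn)])
    rw [e1, e2] at this
    exact (pow_le_pow_left₀ hT0 h2 2).trans this
  have h4 : (G : ℂ) = ∑ c ∈ F, ∑ d ∈ F, (starRingEnd ℂ) (A c) * A d *
      ∑ n ∈ S, (w n : ℂ) * (e c n * (starRingEnd ℂ) (e d n)) := by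
    rw [hG]; push_cast
    have : ∀ n ∈ S, (‖b n‖ : ℂ) ^ 2 * w n = ∑ c ∈ F, ∑ d ∈ F, (starRingEnd ℂ) (A c) * A d *
        ((w n : ℂ) * (e c n * (starRingEnd ℂ) (e d n))) := by
      intro n _
      rw [← Complex.mul_conj', hb]
      simp only [map_sum, map_mul, Complex.conj_conj]
      rw [sum_mul_sum, sum_mul]
      refine sum_congr rfl fun c _ => ?_
      rw [sum_mul]
      refine sum_congr rfl fun d _ => by ring
    rw [sum_congr rfl this, sum_comm]
    refine sum_congr rfl fun c _ => ?_
    rw [sum_comm]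
    refine sum_congr rfl fun d _ => by rw [← mul_sum]
  have h5 : G ≤ T * M := by
    have hG0 : 0 ≤ G := sum_nonneg (fun n hn => mul_nonneg (sq_nonneg _) (hw n hn))
    have : G = ‖(G:ℂ)‖ := by rw [Complex.norm_real, Real.norm_eq_abs, abs_of_nonneg hG0]
    set m : ι → ι → ℝ := fun c d => ‖∑ n ∈ S, (w n : ℂ) * (e c n * (starRingEnd ℂ) (e d n))‖ with hm
    have msymm : ∀ c d, m c d = m d c := by
      intro c d
      simp only [hm]
      rw [← Complex.norm_conj]
      congr 1
      simp only [map_sum, map_mul, Complex.conj_conj, Complex.conj_ofReal]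
      refine sum_congr rfl fun n _ => by ring
    have hle : G ≤ ∑ c ∈ F, ∑ d ∈ F, (‖A c‖ ^ 2 + ‖A d‖^2) / 2 * m c d := by
      rw [this, h4]
      refine (norm_sum_le _ _).trans (sum_le_sum fun c _ => (norm_sum_le _ _).trans (sum_le_sum fun d _ => ?_))
      rw [norm_mul, norm_mul, Complex.norm_conj]
      refine mul_le_mul_of_nonneg_right ?_ (norm_nonneg _)
      nlinarith [sq_nonneg (‖A c‖ - ‖A d‖)]
    have s1 : ∑ c ∈ F, ∑ d ∈ F, (‖A c‖ ^ 2 + ‖A d‖^2) / 2 * m c d = ∑ c ∈ F, ‖A c‖^2 * ∑ d ∈ F, m c d := by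
      have t1 : ∑ c ∈ F, ∑ d ∈ F, (‖A c‖ ^ 2 + ‖A d‖^2) / 2 * m c d
        = ∑ c ∈ F, ∑ d ∈ F, ‖A c‖ ^ 2/2 * m c d + ∑ c ∈ F, ∑ d ∈ F, ‖A d‖^2 / 2 * m c d := by
        rw [← sum_add_distrib]
        refine sum_congr rfl fun c _ => ?_
        rw [← sum_add_distrib]
        refine sum_congr rfl fun d _ => by ring
      have t2 : ∑ c ∈ F, ∑ d ∈ F, ‖A d‖^2 / 2 * m c d = ∑ c ∈ F, ∑ d ∈ F, ‖A c‖ ^ 2/2 * m c d := by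
        rw [sum_comm]
        refine sum_congr rfl fun c _ => sum_congr rfl fun d _ => by rw [msymm]
      rw [t1, t2, ← sum_add_distrib]
      refine sum_congr rfl fun c _ => ?_
      rw [← sum_add_distrib, mul_sum]
      refine sum_congr rfl fun d _ => by ring
    rw [s1] at hle
    refine hle.trans ?_
    rw [hT, sum_mul]
    exact sum_le_sum fun c hc => mul_le_mul_of_nonneg_left (hM c hc) (sq_nonneg _)
  rcases hT0.eq_or_lt with h | h
  · rw [← h]
    positivity
  · nlinarith [mul_le_mul_of_nonneg_left h5 hE0]

theorem sum_inv_le (X : ℕ) : ∑ n ∈ Ioc 0 X, (1:ℝ) / n ≤ 1 + Real.log X := by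
  have := harmonic_le_one_add_log X
  rw [harmonic_eq_sum_Icc] at this
  push_cast at this
  have e : Ioc 0 X = Icc 1 X := by ext; simp; omega
  rw [e]; simpa using this

theorem large_sieve (F : Finset PC) (Q : ℝ) (hF : ∀ c ∈ F, 0 < c.1 ∧ (c.1 : ℝ) ≤ Q ∧ c.2.IsPrimitive)
    (hcard : (F.card : ℝ) ≤ Q ^ 2) (U X : ℕ) (hU : 0 < U) (a : ℕ → ℂ) :
    ∑ c ∈ F, ‖∑ n ∈ Ioc U X, a n * c.ev n * ((1 / n : ℝ) : ℂ)‖ ^ 2 ≤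
      (∑ n ∈ Ioc U X, ‖a n‖ ^ 2 * (1 / n : ℝ)) * (1 + Real.log X + 2 * Q ^ 4 / U) := by
  classical
  have : 0 ≤ Real.log X := Real.log_natCast_nonneg X
  refine duality F (Ioc U X) a (fun n => 1 / n) (fun n _ => by positivity) (fun c n => c.ev n) _
    (by positivity) ?_
  intro c hc
  obtain ⟨c1, c2, c3⟩ := hF c hc
  have hQ0 : 0 ≤ Q := (Nat.cast_nonneg _).trans c2
  have hdiag : ‖∑ n ∈ Ioc U X, (((1:ℝ) / n : ℝ) : ℂ) * (c.ev n * (starRingEnd ℂ) (c.ev n))‖ ≤ 1 + Real.log X := by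
    refine (norm_sum_le _ _).trans (le_trans ?_ (sum_inv_le X))
    refine le_trans (sum_le_sum (g := fun n : ℕ => (1:ℝ)/n) fun n _ => ?_) (sum_le_sum_of_subset_of_nonneg ?_ fun _ _ _ => by positivity)
    · rw [norm_mul, norm_mul, Complex.norm_conj, Complex.norm_real, Real.norm_eq_abs, abs_of_nonneg (by positivity)]
      have := c.ev_le n
      have h2 : ‖c.ev n‖ * ‖c.ev n‖ ≤ 1 := by nlinarith [norm_nonneg (c.ev n)]
      exact mul_le_of_le_one_right (by positivity) h2
    · intro n; simp; omega
  have hoff : ∀ d ∈ F.erase c, ‖∑ n ∈ Ioc U X, (((1:ℝ) / n : ℝ) : ℂ) * (c.ev n * (starRingEnd ℂ) (d.ev n))‖ ≤ 2 * Q ^ 2 / U := by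
    intro d hd
    rw [mem_erase] at hd
    obtain ⟨d1, d2, d3⟩ := hF d hd.2
    have hp := prim_pair_partial c d c1 d1 c3 d3 (Ne.symm hd.1)
    have := abel_antitone (fun n => c.ev n * (starRingEnd ℂ) (d.ev n)) _ hp (fun n => 1 / (max n 1 : ℕ))
      (fun a b h => by
        apply one_div_le_one_div_of_le
        · simp
        · exact_mod_cast max_le_max_right 1 h) (fun n => by positivity) (U+1) (X+1)
    have e : ∑ n ∈ Ioc U X, (((1:ℝ) / n : ℝ) : ℂ) * (c.ev n * (starRingEnd ℂ) (d.ev n)) =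
      ∑ n ∈ Ico (U+1) (X+1), (c.ev n * (starRingEnd ℂ) (d.ev n)) * ((1 / (max n 1 : ℕ) : ℝ) : ℂ) := by
      have : Ioc U X = Ico (U+1) (X+1) := by ext; simp
      rw [this]
      refine sum_congr rfl fun n hn => ?_
      rw [mem_Ico] at hn
      rw [max_eq_left (by omega)]; ring
    rw [e]
    refine this.trans ?_
    rw [max_eq_left (by omega)]
    push_cast
    have hUp : (0:ℝ) < U := by exact_mod_cast hU
    have h1 : (c.1 : ℝ) * d.1 ≤ Q ^ 2 := by nlinarith [(Nat.cast_nonneg c.1 : (0:ℝ) ≤ c.1)]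
    rw [mul_one_div]
    apply div_le_div₀ (by positivity) (by linarith) hUp (by linarith)
  rw [← add_sum_erase _ _ hc]
  refine add_le_add hdiag ((sum_le_sum hoff).trans ?_)
  rw [sum_const, nsmul_eq_mul]
  have h1 : ((F.erase c).card : ℝ) ≤ Q ^ 2 := le_trans (by exact_mod_cast card_erase_le) hcard
  calc ((F.erase c).card : ℝ) * (2 * Q ^ 2 / U) ≤ Q ^ 2 * (2 * Q^2 / U) :=
        mul_le_mul_of_nonneg_right h1 (by positivity)
    _ = _ := by ring
end OIR
end

section
open Finset MeasureTheory
open scoped FourierTransform SchwartzMap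
namespace OIR

theorem fourier_sep (h : ℝ → ℂ) (hs : ContDiff ℝ (⊤ : ℕ∞) h) (hc : HasCompactSupport h) :
    ∃ H : ℝ → ℂ, Continuous H ∧ (∀ M : ℕ, Integrable (fun t => |t| ^ M * ‖H t‖)) ∧
      (Integrable H) ∧
      ∀ u : ℝ, h u = ∫ t, H t * Complex.exp (2 * Real.pi * t * u * Complex.I) := by
  set f : 𝓢(ℝ, ℂ) := hc.toSchwartzMap hs
  have hf : (f : ℝ → ℂ) = h := rfl
  refine ⟨(𝓕 f : 𝓢(ℝ, ℂ)), (𝓕 f : 𝓢(ℝ, ℂ)).continuous, ?_, (𝓕 f : 𝓢(ℝ, ℂ)).integrable, ?_⟩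
  · intro M
    have := (𝓕 f : 𝓢(ℝ, ℂ)).integrable_pow_mul (μ := volume) M
    simpa [Real.norm_eq_abs] using this
  · intro u
    have h1 := Continuous.fourierInv_fourier_eq f.continuous f.integrable
      (by rw [← SchwartzMap.fourier_coe]; exact (𝓕 f : 𝓢(ℝ, ℂ)).integrable)
    have h2 := congrFun h1 u
    rw [Real.fourierInv_eq'] at h2
    rw [← hf, ← h2]
    refine integral_congr_ae (Filter.Eventually.of_forall fun t => ?_)
    simp only [smul_eq_mul]
    rw [mul_comm, SchwartzMap.fourier_coe]
    congr 2
    simp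
    ring

/-- the smooth bump -/
noncomputable def bump0 : ContDiffBump (3/4 : ℝ) := ⟨1/8, 1/4, by norm_num, by norm_num⟩

noncomputable def bump : ℝ → ℝ := bump0

theorem bump_nonneg (u : ℝ) : 0 ≤ bump u := bump0.nonneg
theorem bump_le_one (u : ℝ) : bump u ≤ 1 := bump0.le_one
theorem bump_one (u : ℝ) (h1 : 5/8 ≤ u) (h2 : u ≤ 7/8) : bump u = 1 := by
  apply bump0.one_of_mem_closedBall
  rw [Metric.mem_closedBall, Real.dist_eq, abs_le]
  change _ ≤ _ ∧ _ ≤ (1/8:ℝ)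
  constructor
  · change -(1/8:ℝ) ≤ _
    linarith
  · linarith
theorem bump_zero_left (u : ℝ) (h : u ≤ 1/2) : bump u = 0 := by
  apply bump0.zero_of_le_dist
  change (1/4:ℝ) ≤ _
  rw [Real.dist_eq, abs_of_nonpos] <;> linarith
theorem bump_zero_right (u : ℝ) (h : 1 ≤ u) : bump u = 0 := by
  apply bump0.zero_of_le_dist
  change (1/4:ℝ) ≤ _
  rw [Real.dist_eq, abs_of_nonneg] <;> linarith
theorem bump_smooth : ContDiff ℝ (⊤ : ℕ∞) bump := bump0.contDiff
theorem bump_compact : HasCompactSupport bump := bump0.hasCompactSupport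
theorem bump_lip : ∃ C : ℝ, 0 ≤ C ∧ ∀ u v, |bump u - bump v| ≤ C * |u - v| := by
  obtain ⟨C, hC⟩ := (bump_smooth.of_le (m := 1) (by exact_mod_cast le_top)).lipschitzWith_of_hasCompactSupport bump_compact (by simp)
  exact ⟨C, C.2, fun u v => by simpa [Real.dist_eq] using hC.dist_le_mul u v⟩

/-- Fourier representation of bump -/
theorem bump_fourier : ∃ H : ℝ → ℂ, Continuous H ∧ Integrable H ∧
      ∀ u : ℝ, (bump u : ℂ) = ∫ t, H t * Complex.exp (2 * Real.pi * t * u * Complex.I) := by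
  obtain ⟨H, h1, _, h3, h4⟩ := fourier_sep (fun u => (bump u : ℂ))
    (Complex.ofRealCLM.contDiff.comp bump_smooth) 
    (bump_compact.comp_left (g := fun x : ℝ => (x:ℂ)) (by simp))
  exact ⟨H, h1, h3, h4⟩

/-- Fourier representation of the modified bump exp(u) bump(u) / u^J -/
theorem bumpJ_fourier (J : ℕ) : ∃ H : ℝ → ℂ, Continuous H ∧ (∀ M : ℕ, Integrable (fun t => |t| ^ M * ‖H t‖)) ∧ Integrable H ∧
      ∀ u : ℝ, ((Real.exp u * bump u / u ^ J : ℝ) : ℂ) = ∫ t, H t * Complex.exp (2 * Real.pi * t * u * Complex.I) := by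
  refine fourier_sep (fun u => ((Real.exp u * bump u / u ^ J : ℝ) : ℂ))
    (Complex.ofRealCLM.contDiff.comp ?_) ?_
  · rw [contDiff_iff_contDiffAt]
    intro u
    rcases lt_or_ge u (1/2) with h | h
    · have : (fun u => Real.exp u * bump u / u ^ J) =ᶠ[nhds u] fun _ => 0 := by
        filter_upwards [Iio_mem_nhds h] with v hv
        rw [bump_zero_left v (le_of_lt hv)]; simp
      exact contDiffAt_const.congr_of_eventuallyEq this
    · exact ((Real.contDiff_exp.contDiffAt).mul bump_smooth.contDiffAt).div
        ((contDiff_id.pow J).contDiffAt) (pow_ne_zero _ (ne_of_gt (lt_of_lt_of_le (by norm_num) h)))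
  · refine HasCompactSupport.comp_left (g := fun x : ℝ => (x:ℂ)) ?_ (by simp)
    refine bump_compact.mono ?_
    intro u hu
    contrapose! hu
    simp only [Function.mem_support, not_not] at hu ⊢
    simp [hu]

end OIR
end

section
open Finset MeasureTheory
open ArithmeticFunction (vonMangoldt moebius)
open scoped ArithmeticFunction.zeta ArithmeticFunction.vonMangoldt ArithmeticFunction.Moebius
namespace OIR

/-- the weight bump(log n/L)/n -/
noncomputable def wt (L : ℝ) (n : ℕ) : ℝ := bump (Real.log n / L) / n

/-- the von Mangoldt sum twisted by e -/
noncomputable def TL (L : ℝ) (e : ℕ → ℂ) : ℂ :=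
  ∑ n ∈ Ioc 0 ⌊Real.exp L⌋₊, ((vonMangoldt n : ℝ) : ℂ) * (e n * (wt L n : ℂ))

theorem wt_zero_large (L : ℝ) (hL : 0 < L) (n : ℕ) (h : ⌊Real.exp L⌋₊ < n) : wt L n = 0 := by
  unfold wt
  have h1 : Real.exp L < n := (Nat.floor_lt (Real.exp_pos _).le).mp h
  have h2 : L ≤ Real.log n := by
    rw [Real.le_log_iff_exp_le (lt_trans (Real.exp_pos _) h1)]; exact h1.le
  rw [bump_zero_right _ ((one_le_div hL).mpr h2)]; simp

theorem wt_zero_small (L : ℝ) (hL : 0 < L) (n : ℕ) (h : (n : ℝ) ≤ Real.exp (L/2)) : wt L n = 0 := by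
  unfold wt
  rcases Nat.eq_zero_or_pos n with rfl | hn
  · simp
  have h2 : Real.log n ≤ L / 2 := by
    rw [Real.log_le_iff_le_exp (by exact_mod_cast hn)]; exact h
  rw [bump_zero_left _ ?_]
  · simp
  rw [div_le_iff₀ hL]; linarith

theorem wt_nonneg (L : ℝ) (n : ℕ) : 0 ≤ wt L n := div_nonneg (bump_nonneg _) (Nat.cast_nonneg _)

theorem wt_le (L : ℝ) (n : ℕ) : wt L n ≤ 1 / n :=
  div_le_div_of_nonneg_right (bump_le_one _) (Nat.cast_nonneg _)

theorem conv_sum (a b : ArithmeticFunction ℝ) (X : ℕ) (φ : ℕ → ℂ) (hφ : ∀ n, X < n → φ n = 0) :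
    ∑ n ∈ Ioc 0 X, (((a * b) n : ℝ) : ℂ) * φ n =
      ∑ l ∈ Ioc 0 X, ∑ m ∈ Ioc 0 X, ((a l : ℝ) : ℂ) * ((b m : ℝ) : ℂ) * φ (l * m) := by
  have h1 : ∑ l ∈ Ioc 0 X, ∑ m ∈ Ioc 0 X, ((a l : ℝ) : ℂ) * ((b m : ℝ) : ℂ) * φ (l * m)
      = ∑ p ∈ (Ioc 0 X ×ˢ Ioc 0 X).filter (fun p => p.1 * p.2 ∈ Ioc 0 X), ((a p.1 : ℝ) : ℂ) * ((b p.2 : ℝ) : ℂ) * φ (p.1 * p.2) := by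
    rw [← sum_product', sum_filter]
    refine sum_congr rfl fun p hp => ?_
    split_ifs with h
    · rfl
    · rw [mem_product, mem_Ioc, mem_Ioc] at hp
      rw [hφ, mul_zero]
      rw [mem_Ioc, not_and] at h
      exact not_le.mp (h (Nat.mul_pos hp.1.1 hp.2.1))
  rw [h1, ← sum_fiberwise_of_maps_to (g := fun p : ℕ × ℕ => p.1 * p.2) (t := Ioc 0 X)
    (fun p hp => (mem_filter.mp hp).2)]
  refine sum_congr rfl fun n hn => ?_
  rw [ArithmeticFunction.mul_apply]
  push_cast
  rw [sum_mul]
  have : n.divisorsAntidiagonal = filter (fun p : ℕ × ℕ => p.1 * p.2 = n)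
      ((Ioc 0 X ×ˢ Ioc 0 X).filter (fun p => p.1 * p.2 ∈ Ioc 0 X)) := by
    ext ⟨x, y⟩
    simp only [Nat.mem_divisorsAntidiagonal, mem_filter, mem_product, mem_Ioc] at hn ⊢
    constructor
    · rintro ⟨rfl, h⟩
      have hx : 0 < x := Nat.pos_of_ne_zero (fun h' => by simp [h'] at h)
      have hy : 0 < y := Nat.pos_of_ne_zero (fun h' => by simp [h'] at h)
      have := Nat.le_mul_of_pos_right x hy
      have := Nat.le_mul_of_pos_left y hx
      refine ⟨⟨⟨⟨hx, by omega⟩, hy, by omega⟩, hn⟩, rfl⟩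
    · rintro ⟨_, h⟩
      exact ⟨h, by omega⟩
  rw [this]
  refine sum_congr rfl fun p hp => ?_
  rw [(mem_filter.mp hp).2]

/-- lower truncation -/
def lo (U : ℕ) (f : ArithmeticFunction ℝ) : ArithmeticFunction ℝ :=
  ⟨fun n => if n ≤ U then f n else 0, by simp⟩
/-- upper truncation -/
def hi (U : ℕ) (f : ArithmeticFunction ℝ) : ArithmeticFunction ℝ :=
  ⟨fun n => if n ≤ U then 0 else f n, by simp⟩

theorem lo_add_hi (U : ℕ) (f : ArithmeticFunction ℝ) : lo U f + hi U f = f := by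
  ext n
  change (if n ≤ U then f n else 0) + (if n ≤ U then 0 else f n) = f n
  split_ifs <;> simp

theorem vaughan (U : ℕ) : (Λ : ArithmeticFunction ℝ) = lo U Λ + lo U (μ : ArithmeticFunction ℝ) * ArithmeticFunction.log
    - (lo U (μ : ArithmeticFunction ℝ) * lo U Λ) * (ζ : ArithmeticFunction ℝ)
    + (hi U (μ : ArithmeticFunction ℝ) * (ζ : ArithmeticFunction ℝ)) * hi U Λ := by
  have h1 := lo_add_hi U Λ
  have h2 := lo_add_hi U (μ : ArithmeticFunction ℝ)
  have h3 : (Λ : ArithmeticFunction ℝ) * (ζ : ArithmeticFunction ℝ) = ArithmeticFunction.log :=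
    ArithmeticFunction.vonMangoldt_mul_zeta
  have h4 : (μ : ArithmeticFunction ℝ) * (ζ : ArithmeticFunction ℝ) = 1 := by
    exact ArithmeticFunction.coe_moebius_mul_coe_zeta
  set a := lo U Λ
  set b := hi U Λ
  set c := lo U (μ : ArithmeticFunction ℝ)
  set d := hi U (μ : ArithmeticFunction ℝ)
  rw [← h3]
  have h5 : (Λ : ArithmeticFunction ℝ) = ((μ : ArithmeticFunction ℝ) * (ζ : ArithmeticFunction ℝ)) * Λ := by rw [h4, one_mul]
  have h6 : a = ((μ : ArithmeticFunction ℝ) * (ζ : ArithmeticFunction ℝ)) * a := by rw [h4, one_mul]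
  calc (Λ : ArithmeticFunction ℝ) = ((c + d) * (ζ : ArithmeticFunction ℝ)) * Λ := by rw [h2]; exact h5
    _ = ((c + d) * (ζ : ArithmeticFunction ℝ)) * a + c * (Λ * (ζ : ArithmeticFunction ℝ)) - (c * a) * (ζ : ArithmeticFunction ℝ) + d * (ζ : ArithmeticFunction ℝ) * b := by
      rw [← h1]; ring
    _ = _ := by rw [h2, ← h6]

end OIR
end

section
open Finset MeasureTheory
open ArithmeticFunction (vonMangoldt moebius)
open scoped ArithmeticFunction.zeta ArithmeticFunction.vonMangoldt ArithmeticFunction.Moebius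
namespace OIR

theorem floor_exp_le (L : ℝ) : ((⌊Real.exp L⌋₊ : ℕ) : ℝ) ≤ Real.exp L :=
  Nat.floor_le (Real.exp_pos _).le

theorem log_floor_exp_le (L : ℝ) (hL : 0 ≤ L) : Real.log ((⌊Real.exp L⌋₊ : ℕ) : ℝ) ≤ L := by
  have h : (1:ℝ) ≤ (⌊Real.exp L⌋₊ : ℕ) := by
    exact_mod_cast (Nat.one_le_floor_iff _).mpr (Real.one_le_exp hL)
  rw [Real.log_le_iff_le_exp (by linarith)]
  exact floor_exp_le L

/-- product difference bound -/
theorem prod3_diff (A A' G G' I I' a g i K : ℝ) (hA : |A| ≤ K) (hA' : |A'| ≤ K) (hG : |G| ≤ 1)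
    (hI' : |I'| ≤ i * 1) (dA : |A' - A| ≤ a) (dG : |G' - G| ≤ g) (d : ℝ) (dI : |I' - I| ≤ d)  :
    |A' * G' * I' - A * G * I| ≤ a * i + K * g * i + K * d := by
  have e : A' * G' * I' - A * G * I = (A' - A) * G * I' + A' * (G' - G) * I' + A * G * (I' - I) := by ring
  rw [e]
  have hK : 0 ≤ K := (abs_nonneg _).trans hA
  have hi : 0 ≤ i := by have := (abs_nonneg _).trans hI'; linarith
  have ha := (abs_nonneg _).trans dA
  have hg := (abs_nonneg _).trans dG
  have hd := (abs_nonneg _).trans dI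
  refine (abs_add_le _ _).trans (add_le_add ((abs_add_le _ _).trans (add_le_add ?_ ?_)) ?_)
  · rw [abs_mul, abs_mul]
    have : |A' - A| * |G| ≤ a * 1 := mul_le_mul dA hG (abs_nonneg _) ha
    calc _ ≤ (a * 1) * (i * 1) := mul_le_mul this hI' (abs_nonneg _) (by linarith)
      _ = _ := by ring
  · rw [abs_mul, abs_mul]
    have : |A'| * |G' - G| ≤ K * g := mul_le_mul hA' dG (abs_nonneg _) hK
    calc _ ≤ (K * g) * (i * 1) := mul_le_mul this hI' (abs_nonneg _) (by positivity)
      _ = _ := by ring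
  · rw [abs_mul, abs_mul]
    have : |A| * |G| ≤ K * 1 := mul_le_mul hA hG (abs_nonneg _) hK
    calc _ ≤ (K * 1) * d := mul_le_mul this dI (abs_nonneg _) (by positivity)
      _ = _ := by ring

theorem typeI : ∃ C : ℝ, 0 ≤ C ∧ ∀ (L : ℝ), 2 ≤ L → ∀ (e : ℕ → ℂ) (B : ℝ),
    (∀ N, ‖∑ n ∈ range N, e n‖ ≤ B) → ∀ l : ℕ, 0 < l → (l : ℝ) ≤ Real.exp (L/2) / 2 →
    ∀ ρ : ℕ → ℝ, (∀ m : ℕ, 0 < m → |ρ m| ≤ 1 + Real.log m ∧ |ρ (m+1) - ρ m| ≤ 1 / m) →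
    ‖∑ m ∈ Ioc 0 ⌊Real.exp L⌋₊, (ρ m : ℂ) * (e m * (wt L (l * m) : ℂ))‖ ≤
      B * C * (1 + L) ^ 2 / Real.exp (L/2) := by
  obtain ⟨Cg, hCg0, hCg⟩ := bump_lip
  refine ⟨2 * (1 + 3 * Cg + 3), by positivity, ?_⟩
  intro L hL e B hB l hl hlU ρ hρ
  have hB0 : 0 ≤ B := (norm_nonneg _).trans (hB 0)
  set X := ⌊Real.exp L⌋₊ with hX
  have hX1 : 1 ≤ X := (Nat.one_le_floor_iff _).mpr (Real.one_le_exp (by linarith))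
  set ψ : ℕ → ℝ := fun m => ρ m * wt L (l * m) with hψ
  have hψ0 : ψ 0 = 0 := by simp [hψ, wt]
  have e1 : ∑ m ∈ Ioc 0 X, (ρ m : ℂ) * (e m * (wt L (l * m) : ℂ)) = ∑ m ∈ range (X+1), e m * (ψ m : ℂ) := by
    rw [sum_range_succ', hψ0]
    have : Ioc 0 X = Ico 1 (X+1) := by ext; simp; omega
    rw [this, sum_Ico_eq_sum_range]
    simp only [Nat.add_sub_cancel, Complex.ofReal_zero, mul_zero, add_zero]
    refine sum_congr rfl fun m _ => ?_
    simp only [hψ]; push_cast; rw [add_comm 1 m]; ring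
  rw [e1]
  refine (abel_bound e (fun m => (ψ m : ℂ)) B hB (X+1)).trans ?_
  have hend : ψ (X+1) = 0 := by
    simp only [hψ]
    rw [wt_zero_large L (by linarith), mul_zero]
    calc X < X + 1 := by omega
      _ ≤ l * (X+1) := Nat.le_mul_of_pos_left _ hl
  rw [hend]
  have hexp : (0:ℝ) < Real.exp (L/2) := Real.exp_pos _
  set D : ℝ := 2 * (1 + 3 * Cg + 3) * (1 + L) / Real.exp (L/2) with hD
  have hvar : ∀ m ∈ Ioc 0 X, ‖(ψ (m+1) : ℂ) - (ψ m : ℂ)‖ ≤ D * (1 / m) := by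
    intro m hm
    rw [mem_Ioc] at hm
    rw [← Complex.ofReal_sub, Complex.norm_real, Real.norm_eq_abs]
    have hmp : (0:ℝ) < m := by exact_mod_cast hm.1
    have hlp : (0:ℝ) < l := by exact_mod_cast hl
    by_cases hsmall : ((l * (m+1) : ℕ) : ℝ) ≤ Real.exp (L/2)
    · have h1 : wt L (l * (m+1)) = 0 := wt_zero_small L (by linarith) _ hsmall
      have h2 : wt L (l * m) = 0 := wt_zero_small L (by linarith) _ (le_trans (by push_cast; nlinarith) hsmall)
      simp only [hψ, h1, h2]
      simp only [mul_zero, sub_zero, abs_zero]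
      positivity
    · push Not at hsmall
      push_cast at hsmall
      have hlm : Real.exp (L/2) / 2 ≤ l * m := by nlinarith
      have hlogm : Real.log m ≤ L := by
        rw [Real.log_le_iff_le_exp hmp]
        exact le_trans (by exact_mod_cast hm.2) (floor_exp_le L)
      have hlogm1 : Real.log (m+1) - Real.log m ≤ 1 / m := by
        rw [← Real.log_div (by positivity) (by positivity)]
        have := Real.log_le_sub_one_of_pos (show (0:ℝ) < (m+1)/m by positivity)
        have e : ((m:ℝ)+1)/m - 1 = 1/m := by field_simp; ring
        linarith
      have hlogm2 : 0 ≤ Real.log (m+1) - Real.log m := by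
        have := Real.log_le_log hmp (by linarith : (m:ℝ) ≤ m + 1)
        linarith
      have hm1 : 1 / (m:ℝ) ≤ 1 := by
        rw [div_le_one hmp]; exact_mod_cast hm.1
      have b1 : |ρ m| ≤ 3 + L := (hρ m hm.1).1.trans (by linarith)
      have b2 : |ρ (m+1)| ≤ 3 + L := by
        have := (hρ (m+1) (by omega)).1
        push_cast at this
        linarith
      have key := prod3_diff (ρ m) (ρ (m+1)) (bump (Real.log ((l * m : ℕ) : ℝ) / L)) (bump (Real.log ((l * (m+1) : ℕ) : ℝ) / L))
        (1 / ((l * m : ℕ) : ℝ)) (1 / ((l * (m+1) : ℕ) : ℝ)) (1 / m) (Cg * (1/m)) (1 / (l * m)) (3 + L) b1 b2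
        (by rw [abs_of_nonneg (bump_nonneg _)]; exact bump_le_one _)
        (by
          rw [abs_of_nonneg (by positivity), mul_one]
          push_cast
          apply one_div_le_one_div_of_le (by positivity); nlinarith)
        (hρ m hm.1).2
        (by
          refine (hCg _ _).trans (mul_le_mul_of_nonneg_left ?_ hCg0)
          push_cast
          rw [Real.log_mul (by positivity) (by positivity), Real.log_mul (by positivity) (by positivity), ← sub_div]
          have : Real.log (l:ℝ) + Real.log ((m:ℝ) + 1) - (Real.log l + Real.log m) = Real.log (m+1) - Real.log m := by ring
          rw [this, abs_of_nonneg (by positivity), div_le_iff₀ (by linarith)]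
          have : 0 ≤ 1 / (m:ℝ) := by positivity
          nlinarith)
        (1 / (l * m) * (1 / m))
        (by
          push_cast
          rw [abs_of_nonpos]
          · have : (1:ℝ) / (l * (m+1)) = 1 / (l*m) - 1/(l*m) * (1 / (m+1)) := by field_simp; ring
            rw [this]
            have h3 : (1:ℝ) / (m+1) ≤ 1 / m := one_div_le_one_div_of_le hmp (by linarith)
            have : (1:ℝ)/(l*m) * (1 / (m+1)) ≤ 1/(l*m) * (1 / m) := mul_le_mul_of_nonneg_left h3 (by positivity)
            linarith
          · have : (1:ℝ) / (l * (m+1)) ≤ 1 / (l * m) := one_div_le_one_div_of_le (by positivity) (by nlinarith)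
            linarith)
      have e2 : ψ (m+1) - ψ m = ρ (m+1) * bump (Real.log ((l * (m+1) : ℕ) : ℝ) / L) * (1 / ((l * (m+1) : ℕ) : ℝ))
          - ρ m * bump (Real.log ((l * m : ℕ) : ℝ) / L) * (1 / ((l * m : ℕ) : ℝ)) := by
        simp only [hψ, wt]; ring
      rw [e2]
      refine key.trans ?_
      have h4 : (1:ℝ) / (l * m) ≤ 2 / Real.exp (L/2) := by
        rw [div_le_div_iff₀ (by positivity) hexp]; linarith
      calc 1 / (m:ℝ) * (1 / (l * m)) + (3 + L) * (Cg * (1 / m)) * (1 / (l * m)) + (3 + L) * (1 / (l * m) * (1 / m))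
          = (1 + (3 + L) * Cg + (3 + L)) * (1 / (l * m)) * (1 / m) := by ring
        _ ≤ (1 + (3 + L) * Cg + (3 + L)) * (2 / Real.exp (L/2)) * (1 / m) := by gcongr
        _ ≤ D * (1 / m) := by
          rw [hD]
          have : (1 + (3 + L) * Cg + (3 + L)) * (2 / Real.exp (L/2)) ≤ 2 * (1 + 3 * Cg + 3) * (1 + L) / Real.exp (L/2) := by
            rw [mul_div_assoc']
            apply div_le_div_of_nonneg_right _ hexp.le
            nlinarith [mul_nonneg hCg0 (by linarith : 0 ≤ L)]
          exact mul_le_mul_of_nonneg_right this (by positivity)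
  have hsum : ∑ n ∈ range (X+1), ‖(ψ (n+1) : ℂ) - (ψ n : ℂ)‖ ≤ D * (1 + L) := by
    rw [sum_range_succ']
    have h0 : ‖(ψ (0+1) : ℂ) - (ψ 0 : ℂ)‖ = 0 := by
      have : ψ 1 = 0 := by
        simp only [hψ]
        rw [wt_zero_small L (by linarith), mul_zero]
        push_cast; linarith
      simp [hψ0, this]
    rw [h0, add_zero]
    have e3 : ∑ k ∈ range X, ‖(ψ (k+1+1) : ℂ) - (ψ (k+1) : ℂ)‖ = ∑ m ∈ Ioc 0 X, ‖(ψ (m+1) : ℂ) - (ψ m : ℂ)‖ := by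
      have : Ioc 0 X = Ico 1 (X+1) := by ext; simp; omega
      rw [this, sum_Ico_eq_sum_range]
      simp only [Nat.add_sub_cancel]
      refine sum_congr rfl fun m _ => by rw [add_comm 1 m]
    rw [e3]
    refine (sum_le_sum hvar).trans ?_
    rw [← mul_sum]
    refine mul_le_mul_of_nonneg_left ((sum_inv_le X).trans ?_) (by positivity)
    linarith [log_floor_exp_le L (by linarith)]
  calc B * (‖((0:ℝ):ℂ)‖ + ∑ n ∈ range (X+1), ‖(ψ (n+1) : ℂ) - (ψ n : ℂ)‖) ≤ B * (D * (1+L)) := by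
        refine mul_le_mul_of_nonneg_left ?_ hB0
        simpa using hsum
    _ = _ := by rw [hD]; ring

end OIR
end

section
open Finset MeasureTheory
open ArithmeticFunction (vonMangoldt moebius)
open scoped ArithmeticFunction.zeta ArithmeticFunction.vonMangoldt ArithmeticFunction.Moebius
namespace OIR

theorem tau_sq (X : ℕ) : ∑ l ∈ Ioc 0 X, ((l.divisors.card : ℝ)) ^ 2 * (1 / l) ≤ (1 + Real.log X) ^ 4 := by
  set h := ∑ n ∈ Ioc 0 X, (1:ℝ) / n with hh
  have h1 : ∑ l ∈ Ioc 0 X, ((l.divisors.card : ℝ)) ^ 2 * (1 / l) =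
      ∑ x ∈ (Ioc 0 X).sigma (fun l => l.divisors ×ˢ l.divisors), (1:ℝ) / x.1 := by
    rw [sum_sigma]
    refine sum_congr rfl fun l _ => ?_
    simp only []
    rw [sum_const, card_product, nsmul_eq_mul]; push_cast; ring
  let φ : (Σ _ : ℕ, ℕ × ℕ) → ((ℕ × ℕ) × (ℕ × ℕ)) := fun x =>
    ((x.2.1.gcd x.2.2, x.2.1 / x.2.1.gcd x.2.2), (x.2.2 / x.2.1.gcd x.2.2, x.1 / x.2.1.lcm x.2.2))
  have hprod : ∀ x ∈ (Ioc 0 X).sigma (fun l => l.divisors ×ˢ l.divisors),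
      (φ x).1.1 * (φ x).1.2 = x.2.1 ∧ (φ x).1.1 * (φ x).2.1 = x.2.2 ∧
      (φ x).1.1 * (φ x).1.2 * (φ x).2.1 * (φ x).2.2 = x.1 ∧ 0 < x.1 ∧ x.1 ≤ X := by
    rintro ⟨l, d, e⟩ hx
    simp only [mem_sigma, mem_Ioc, mem_product, Nat.mem_divisors] at hx
    have a1 : d.gcd e * (d / d.gcd e) = d := Nat.mul_div_cancel' (Nat.gcd_dvd_left _ _)
    have a2 : d.gcd e * (e / d.gcd e) = e := Nat.mul_div_cancel' (Nat.gcd_dvd_right _ _)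
    refine ⟨a1, a2, ?_, hx.1⟩
    have hl : d.lcm e ∣ l := Nat.lcm_dvd hx.2.1.1 hx.2.2.1
    have a3 : d.lcm e * (l / d.lcm e) = l := Nat.mul_div_cancel' hl
    simp only [φ]
    rw [a1]
    have a4 : d * (e / d.gcd e) = d.lcm e := by
      rw [Nat.lcm, Nat.mul_div_assoc _ (Nat.gcd_dvd_right _ _)]
    rw [a4, a3]
  have h2 : ∑ x ∈ (Ioc 0 X).sigma (fun l => l.divisors ×ˢ l.divisors), (1:ℝ) / x.1 =
      ∑ y ∈ ((Ioc 0 X).sigma (fun l => l.divisors ×ˢ l.divisors)).image φ,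
        ((1:ℝ) / y.1.1 * (1 / y.1.2)) * ((1 / y.2.1) * (1 / y.2.2)) := by
    rw [sum_image]
    · refine sum_congr rfl fun x hx => ?_
      obtain ⟨_, _, h3, _⟩ := hprod x hx
      conv_lhs => rw [← h3]
      push_cast
      simp only [one_div, mul_inv]; ring
    · intro x hx y hy hxy
      obtain ⟨p1, p2, p3, _⟩ := hprod x hx
      obtain ⟨q1, q2, q3, _⟩ := hprod y hy
      rw [hxy] at p1 p2 p3
      obtain ⟨l, d, e⟩ := x
      obtain ⟨l', d', e'⟩ := y
      simp only at p1 p2 p3 q1 q2 q3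
      have : l = l' := p3.symm.trans q3
      have h' : d = d' := p1.symm.trans q1
      have h'' : e = e' := p2.symm.trans q2
      subst this h' h''
      rfl
  have h3 : ∑ y ∈ ((Ioc 0 X ×ˢ Ioc 0 X) ×ˢ (Ioc 0 X ×ˢ Ioc 0 X)),
      ((1:ℝ) / y.1.1 * (1 / y.1.2)) * ((1 / y.2.1) * (1 / y.2.2)) = h ^ 4 := by
    have hp : ∑ z ∈ (Ioc 0 X ×ˢ Ioc 0 X), ((1:ℝ) / z.1 * (1 / z.2)) = h * h := by
      rw [hh, sum_mul_sum, sum_product]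
    rw [sum_product]
    simp only []
    rw [← sum_mul_sum, hp]; ring
  rw [h1, h2]
  have h0 : 0 ≤ h := sum_nonneg fun n _ => by positivity
  refine le_trans (sum_le_sum_of_subset_of_nonneg ?_ (fun y _ _ => by positivity)) (h3.le.trans (pow_le_pow_left₀ h0 (sum_inv_le X) 4))
  intro y hy
  rw [mem_image] at hy
  obtain ⟨x, hx, rfl⟩ := hy
  obtain ⟨_, _, p3, p4, p5⟩ := hprod x hx
  set y := φ x
  rw [← p3] at p4 p5
  have b : ∀ a b : ℕ, a ∣ b → 0 < b → b ≤ X → a ∈ Ioc 0 X := fun a b h1 h2 h3 =>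
    mem_Ioc.mpr ⟨Nat.pos_of_dvd_of_pos h1 h2, (Nat.le_of_dvd h2 h1).trans h3⟩
  simp only [mem_product]
  refine ⟨⟨b _ _ ?_ p4 p5, b _ _ ?_ p4 p5⟩, b _ _ ?_ p4 p5, b _ _ ?_ p4 p5⟩
  · exact Dvd.dvd.mul_right (Dvd.dvd.mul_right (dvd_mul_right _ _) _) _
  · exact Dvd.dvd.mul_right (Dvd.dvd.mul_right (dvd_mul_left _ _) _) _
  · exact Dvd.dvd.mul_right (dvd_mul_left _ _) _
  · exact dvd_mul_left _ _

theorem typeII : ∃ C : ℝ, 0 ≤ C ∧ ∀ (L : ℝ), 2 ≤ L → ∀ (F : Finset PC) (Q : ℝ),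
    (∀ c ∈ F, 0 < c.1 ∧ (c.1 : ℝ) ≤ Q ∧ c.2.IsPrimitive) → (F.card : ℝ) ≤ Q ^ 2 →
    ∀ (U X : ℕ), 0 < U → ∀ α β : ℕ → ℝ,
    ∑ c ∈ F, ‖∑ l ∈ Ioc U X, ∑ m ∈ Ioc U X, (α l : ℂ) * (β m : ℂ) * (c.ev (l * m) * (wt L (l * m) : ℂ))‖ ≤
      C * (1 + Real.log X + 2 * Q ^ 4 / U) *
       (Real.sqrt (∑ l ∈ Ioc U X, α l ^ 2 * (1 / l)) * Real.sqrt (∑ l ∈ Ioc U X, β l ^ 2 * (1 / l))) := by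
  obtain ⟨H, Hc, Hi, HF⟩ := bump_fourier
  refine ⟨∫ t, ‖H t‖, integral_nonneg fun _ => norm_nonneg _, ?_⟩
  intro L hL F Q hF hcard U X hU α β
  set M := 1 + Real.log X + 2 * Q ^ 4 / U with hM
  have hM0 : 0 ≤ M := by have : 0 ≤ Real.log X := Real.log_natCast_nonneg X
                         positivity
  let E : ℝ → ℕ → ℂ := fun t l => Complex.exp (2 * Real.pi * t * (Real.log l / L : ℝ) * Complex.I)
  have hE : ∀ t l, ‖E t l‖ = 1 := by
    intro t l
    have : (2 * Real.pi * t * (Real.log l / L : ℝ) * Complex.I : ℂ) = ((2 * Real.pi * t * (Real.log l / L) : ℝ) : ℂ) * Complex.I := by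
      push_cast; ring
    simp only [E]; rw [this, Complex.norm_exp_ofReal_mul_I]
  let A : (ℕ → ℝ) → PC → ℝ → ℂ := fun γ c t => ∑ l ∈ Ioc U X, ((γ l : ℂ) * E t l) * c.ev l * ((1 / l : ℝ) : ℂ)
  have hls : ∀ (γ : ℕ → ℝ) t, ∑ c ∈ F, ‖A γ c t‖ ^ 2 ≤ (∑ l ∈ Ioc U X, γ l ^ 2 * (1 / l)) * M := by
    intro γ t
    have := large_sieve F Q hF hcard U X hU (fun l => (γ l : ℂ) * E t l)
    refine this.trans (le_of_eq ?_)
    congr 1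
    refine sum_congr rfl fun l _ => ?_
    rw [norm_mul, hE, mul_one, Complex.norm_real, Real.norm_eq_abs, sq_abs]
  have hinteg : ∀ u : ℝ, Integrable (fun t : ℝ => H t * Complex.exp (2 * Real.pi * t * u * Complex.I)) := by
    intro u
    refine Hi.mono ?_ ?_
    · apply Continuous.aestronglyMeasurable; fun_prop
    · refine Filter.Eventually.of_forall fun t => ?_
      have : (2 * Real.pi * t * u * Complex.I : ℂ) = ((2 * Real.pi * t * u : ℝ) : ℂ) * Complex.I := by
        push_cast; ring
      rw [norm_mul, this, Complex.norm_exp_ofReal_mul_I, mul_one]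
  let u : ℕ → ℕ → ℝ := fun l m => Real.log (l * m : ℕ) / L
  have hexpand : ∀ c t, H t * (A α c t * A β c t) = ∑ l ∈ Ioc U X, ∑ m ∈ Ioc U X,
      ((α l : ℂ) * (β m : ℂ) * (c.ev (l * m) * ((1 / (l * m : ℕ) : ℝ) : ℂ))) * (H t * Complex.exp (2 * Real.pi * t * (u l m) * Complex.I)) := by
    intro c t
    simp only [A]
    rw [sum_mul_sum, mul_sum]
    refine sum_congr rfl fun l hl => ?_
    rw [mul_sum]
    refine sum_congr rfl fun m hm => ?_
    rw [mem_Ioc] at hl hm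
    have hl0 : (l:ℝ) ≠ 0 := by have : 0 < l := by omega
                               positivity
    have hm0 : (m:ℝ) ≠ 0 := by have : 0 < m := by omega
                               positivity
    have e1 : Complex.exp (2 * Real.pi * t * (u l m) * Complex.I) = E t l * E t m := by
      simp only [E, u]
      rw [← Complex.exp_add]
      congr 1
      push_cast
      rw [← Nat.cast_mul]
      have : (Real.log ((l * m : ℕ) : ℝ) : ℂ) = Real.log l + Real.log m := by
        push_cast
        rw [Real.log_mul hl0 hm0]; push_cast; ring
      push_cast at this ⊢
      rw [this]; ring
    rw [e1, PC.ev_mul]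
    push_cast
    simp only [one_div, mul_inv]
    ring
  have hI : ∀ c, Integrable (fun t => H t * (A α c t * A β c t)) := by
    intro c
    simp only [hexpand]
    exact integrable_finsetSum _ fun l _ => integrable_finsetSum _ fun m _ => (hinteg _).const_mul _
  have hrep : ∀ c : PC, ∑ l ∈ Ioc U X, ∑ m ∈ Ioc U X, (α l : ℂ) * (β m : ℂ) * (c.ev (l * m) * (wt L (l * m) : ℂ)) =
      ∫ t, H t * (A α c t * A β c t) := by
    intro c
    simp only [hexpand]
    rw [integral_finsetSum _ (fun l _ => integrable_finsetSum _ fun m _ => (hinteg _).const_mul _)]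
    refine sum_congr rfl fun l _ => ?_
    rw [integral_finsetSum _ (fun m _ => (hinteg _).const_mul _)]
    refine sum_congr rfl fun m _ => ?_
    rw [integral_const_mul, ← HF]
    simp only [wt, u]
    push_cast; ring
  calc ∑ c ∈ F, ‖∑ l ∈ Ioc U X, ∑ m ∈ Ioc U X, (α l : ℂ) * (β m : ℂ) * (c.ev (l * m) * (wt L (l * m) : ℂ))‖
      ≤ ∑ c ∈ F, ∫ t, ‖H t * (A α c t * A β c t)‖ := by
        refine sum_le_sum fun c _ => ?_
        rw [hrep]; exact norm_integral_le_integral_norm _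
    _ = ∫ t, ∑ c ∈ F, ‖H t * (A α c t * A β c t)‖ := by
        rw [integral_finsetSum _ fun c _ => (hI c).norm]
    _ ≤ ∫ t, ‖H t‖ * (M * (Real.sqrt (∑ l ∈ Ioc U X, α l ^ 2 * (1 / l)) * Real.sqrt (∑ l ∈ Ioc U X, β l ^ 2 * (1 / l)))) := by
        refine integral_mono (integrable_finsetSum _ fun c _ => (hI c).norm) (Hi.norm.mul_const _) fun t => ?_
        simp only [norm_mul]
        rw [← mul_sum]
        refine mul_le_mul_of_nonneg_left ?_ (norm_nonneg _)
        refine (Real.sum_mul_le_sqrt_mul_sqrt F (fun c => ‖A α c t‖) (fun c => ‖A β c t‖)).trans ?_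
        calc _ ≤ Real.sqrt ((∑ l ∈ Ioc U X, α l ^ 2 * (1 / l)) * M) * Real.sqrt ((∑ l ∈ Ioc U X, β l ^ 2 * (1 / l)) * M) :=
              mul_le_mul (Real.sqrt_le_sqrt (hls α t)) (Real.sqrt_le_sqrt (hls β t)) (Real.sqrt_nonneg _) (Real.sqrt_nonneg _)
          _ = _ := by
            rw [Real.sqrt_mul' _ hM0, Real.sqrt_mul' _ hM0]
            have := Real.mul_self_sqrt hM0
            calc _ = (√M * √M) * (Real.sqrt (∑ l ∈ Ioc U X, α l ^ 2 * (1 / l)) * Real.sqrt (∑ l ∈ Ioc U X, β l ^ 2 * (1 / l))) := by ring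
              _ = _ := by rw [this]
    _ = _ := by rw [integral_mul_const]; ring

theorem typeI_total : ∃ C : ℝ, 0 ≤ C ∧ ∀ (L : ℝ), 2 ≤ L → ∀ (c : PC) (B : ℝ),
    (∀ N, ‖∑ n ∈ range N, c.ev n‖ ≤ B) → ∀ V : ℝ, V ≤ Real.exp (L/2) / 2 → 0 ≤ V →
    ∀ a ρ : ArithmeticFunction ℝ, (∀ l : ℕ, 0 < l → |a l| ≤ 1 + Real.log l) → (∀ l : ℕ, V < l → a l = 0) →
    (∀ m : ℕ, 0 < m → |ρ m| ≤ 1 + Real.log m ∧ |ρ (m+1) - ρ m| ≤ 1 / m) →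
    ‖∑ n ∈ Ioc 0 ⌊Real.exp L⌋₊, (((a * ρ) n : ℝ) : ℂ) * (c.ev n * (wt L n : ℂ))‖ ≤
      V * (B * C * (1 + L) ^ 3 / Real.exp (L/2)) := by
  obtain ⟨C, hC0, hC⟩ := typeI
  refine ⟨C, hC0, ?_⟩
  intro L hL c B hB V hV hV0 a ρ ha haV hρ
  have hB0 : 0 ≤ B := (norm_nonneg _).trans (hB 0)
  rw [conv_sum a ρ _ (fun n => c.ev n * (wt L n : ℂ)) (fun n hn => by rw [wt_zero_large L (by linarith) n hn]; simp)]
  set X := ⌊Real.exp L⌋₊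
  set D := B * C * (1 + L) ^ 2 / Real.exp (L/2) with hD
  have hD0 : 0 ≤ D := by positivity
  have h1 : ∀ l ∈ Ioc 0 X, ‖∑ m ∈ Ioc 0 X, ((a l : ℝ) : ℂ) * ((ρ m : ℝ) : ℂ) * (c.ev (l * m) * (wt L (l * m) : ℂ))‖
      ≤ if l ∈ Ioc 0 ⌊V⌋₊ then (1 + L) * D else 0 := by
    intro l hl
    rw [mem_Ioc] at hl
    have e : ∑ m ∈ Ioc 0 X, ((a l : ℝ) : ℂ) * ((ρ m : ℝ) : ℂ) * (c.ev (l * m) * (wt L (l * m) : ℂ)) =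
        ((a l : ℝ) : ℂ) * c.ev l * ∑ m ∈ Ioc 0 X, ((ρ m : ℝ) : ℂ) * (c.ev m * (wt L (l * m) : ℂ)) := by
      rw [mul_sum]
      refine sum_congr rfl fun m _ => by rw [PC.ev_mul]; ring
    rw [e]
    by_cases hlV : l ∈ Ioc 0 ⌊V⌋₊
    · rw [if_pos hlV]
      have hl2 : (l:ℝ) ≤ V := (Nat.le_floor_iff hV0).mp (mem_Ioc.mp hlV).2
      have h2 := hC L hL c.ev B hB l hl.1 (hl2.trans hV) ρ hρ
      rw [norm_mul, norm_mul]
      refine mul_le_mul ?_ h2 (norm_nonneg _) (by linarith)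
      rw [Complex.norm_real, Real.norm_eq_abs]
      have h3 : |a l| ≤ 1 + L := (ha l hl.1).trans (by
        have : Real.log l ≤ L := by
          rw [Real.log_le_iff_le_exp (by exact_mod_cast hl.1)]
          exact le_trans (by exact_mod_cast hl.2) (floor_exp_le L)
        linarith)
      calc |a l| * ‖c.ev l‖ ≤ (1 + L) * 1 := mul_le_mul h3 (c.ev_le l) (norm_nonneg _) (by linarith)
        _ = _ := mul_one _
    · rw [if_neg hlV]
      have : V < l := by
        rw [mem_Ioc, not_and] at hlV
        exact (Nat.floor_lt hV0).mp (not_le.mp (hlV hl.1))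
      rw [haV l this]; simp
  refine (norm_sum_le _ _).trans ((sum_le_sum h1).trans ?_)
  rw [← sum_filter]
  rw [sum_const, nsmul_eq_mul]
  have hc : ((filter (fun l => l ∈ Ioc 0 ⌊V⌋₊) (Ioc 0 X)).card : ℝ) ≤ V := by
    refine le_trans ?_ (Nat.floor_le hV0)
    have : (filter (fun l => l ∈ Ioc 0 ⌊V⌋₊) (Ioc 0 X)).card ≤ (Ioc 0 ⌊V⌋₊).card :=
      card_le_card fun x hx => (mem_filter.mp hx).2
    rw [Nat.card_Ioc] at this
    exact_mod_cast this
  calc _ ≤ V * ((1 + L) * D) := mul_le_mul_of_nonneg_right hc (by positivity)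
    _ = _ := by rw [hD]; ring

theorem nontriv_partial (c : PC) (h1 : 1 < c.1) (hp : c.2.IsPrimitive) (N : ℕ) :
    ‖∑ n ∈ range N, c.ev n‖ ≤ c.1 := by
  have : NeZero c.1 := ⟨by omega⟩
  refine char_partial c.2 ?_ N
  intro h
  rw [DirichletCharacter.eq_one_iff_conductor_eq_one] at h
  rw [DirichletCharacter.isPrimitive_def] at hp
  omega

theorem lo_le (U : ℕ) (f : ArithmeticFunction ℝ) (n : ℕ) : |lo U f n| ≤ |f n| := by
  change |if n ≤ U then f n else 0| ≤ _
  split_ifs <;> simp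
theorem hi_le (U : ℕ) (f : ArithmeticFunction ℝ) (n : ℕ) : |hi U f n| ≤ |f n| := by
  change |if n ≤ U then 0 else f n| ≤ _
  split_ifs <;> simp
theorem lo_zero (U : ℕ) (f : ArithmeticFunction ℝ) (n : ℕ) (h : U < n) : lo U f n = 0 := by
  change (if n ≤ U then f n else 0) = 0
  rw [if_neg (by omega)]
theorem hi_zero (U : ℕ) (f : ArithmeticFunction ℝ) (n : ℕ) (h : n ≤ U) : hi U f n = 0 := by
  change (if n ≤ U then 0 else f n) = 0
  rw [if_pos h]

theorem mu_abs_le (n : ℕ) : |((μ : ArithmeticFunction ℝ) n)| ≤ 1 := by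
  rw [ArithmeticFunction.intCoe_apply]
  exact_mod_cast ArithmeticFunction.abs_moebius_le_one

end OIR
end

section
open Finset MeasureTheory
open ArithmeticFunction (vonMangoldt moebius)
open scoped ArithmeticFunction.zeta ArithmeticFunction.vonMangoldt ArithmeticFunction.Moebius
namespace OIR

theorem log_diff (m : ℕ) (hm : 0 < m) : |Real.log ((m+1 : ℕ) : ℝ) - Real.log m| ≤ 1 / m := by
  have hmp : (0:ℝ) < m := by exact_mod_cast hm
  push_cast
  rw [abs_of_nonneg]
  · rw [← Real.log_div (by positivity) (by positivity)]
    have := Real.log_le_sub_one_of_pos (show (0:ℝ) < (m+1)/m by positivity)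
    have e : ((m:ℝ)+1)/m - 1 = 1/m := by field_simp; ring
    linarith
  · have := Real.log_le_log hmp (by linarith : (m:ℝ) ≤ m + 1)
    linarith

theorem coefb (U : ℕ) (l : ℕ) (hl : 0 < l) :
    |(lo U (μ : ArithmeticFunction ℝ) * lo U Λ) l| ≤ 1 + Real.log l := by
  rw [ArithmeticFunction.mul_apply]
  refine (abs_sum_le_sum_abs _ _).trans ?_
  have h1 : ∑ x ∈ l.divisorsAntidiagonal, |lo U (μ : ArithmeticFunction ℝ) x.1 * lo U Λ x.2| ≤
      ∑ x ∈ l.divisorsAntidiagonal, Λ x.2 := by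
    refine sum_le_sum fun x _ => ?_
    rw [abs_mul]
    have a := (lo_le U (μ : ArithmeticFunction ℝ) x.1).trans (mu_abs_le x.1)
    have b := lo_le U Λ x.2
    rw [abs_of_nonneg (ArithmeticFunction.vonMangoldt_nonneg)] at b
    calc _ ≤ 1 * Λ x.2 := mul_le_mul a b (abs_nonneg _) zero_le_one
      _ = _ := one_mul _
  refine h1.trans ?_
  rw [Nat.sum_divisorsAntidiagonal' (f := fun _ b => (Λ b : ℝ)), ArithmeticFunction.vonMangoldt_sum]
  linarith

theorem coefb_zero (U : ℕ) (l : ℕ) (hl : U * U < l) :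
    (lo U (μ : ArithmeticFunction ℝ) * lo U Λ) l = 0 := by
  rw [ArithmeticFunction.mul_apply]
  refine sum_eq_zero fun x hx => ?_
  rw [Nat.mem_divisorsAntidiagonal] at hx
  by_cases h1 : U < x.1
  · rw [lo_zero U _ _ h1, zero_mul]
  by_cases h2 : U < x.2
  · rw [lo_zero U _ x.2 h2, mul_zero]
  have : x.1 * x.2 ≤ U * U := Nat.mul_le_mul (by omega) (by omega)
  omega

theorem coefa (U : ℕ) (l : ℕ) :
    |(hi U (μ : ArithmeticFunction ℝ) * (ζ : ArithmeticFunction ℝ)) l| ≤ l.divisors.card := by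
  rw [ArithmeticFunction.mul_apply]
  refine (abs_sum_le_sum_abs _ _).trans ?_
  have h1 : ∑ x ∈ l.divisorsAntidiagonal, |hi U (μ : ArithmeticFunction ℝ) x.1 * (ζ : ArithmeticFunction ℝ) x.2| ≤
      ∑ x ∈ l.divisorsAntidiagonal, (1:ℝ) := by
    refine sum_le_sum fun x _ => ?_
    rw [abs_mul]
    have a := (hi_le U (μ : ArithmeticFunction ℝ) x.1).trans (mu_abs_le x.1)
    have b : |(ζ : ArithmeticFunction ℝ) x.2| ≤ 1 := by
      rw [ArithmeticFunction.natCoe_apply, ArithmeticFunction.zeta_apply]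
      split_ifs <;> simp
    calc _ ≤ (1:ℝ) * 1 := mul_le_mul a b (abs_nonneg _) zero_le_one
      _ = _ := one_mul _
  refine h1.trans ?_
  rw [Nat.sum_divisorsAntidiagonal (f := fun _ b => (1 : ℝ))]
  simp

theorem coefa_zero (U : ℕ) (l : ℕ) (hl : l ≤ U) :
    (hi U (μ : ArithmeticFunction ℝ) * (ζ : ArithmeticFunction ℝ)) l = 0 := by
  rw [ArithmeticFunction.mul_apply]
  refine sum_eq_zero fun x hx => ?_
  rw [Nat.mem_divisorsAntidiagonal] at hx
  rw [hi_zero, zero_mul]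
  have := Nat.le_of_dvd (Nat.pos_of_ne_zero hx.2) (Dvd.intro _ hx.1)
  omega

theorem TL_sum : ∃ C : ℝ, 0 ≤ C ∧ ∀ (L : ℝ), 4 ≤ L → ∀ (F : Finset PC) (Q : ℝ), 0 ≤ Q →
    (∀ c ∈ F, 1 < c.1 ∧ (c.1 : ℝ) ≤ Q ∧ c.2.IsPrimitive) → (F.card : ℝ) ≤ Q ^ 2 →
    ∑ c ∈ F, ‖TL L c.ev‖ ≤ C * (1 + L) ^ 5 * (1 + Q ^ 3 * Real.exp (-(L/4)) + Q ^ 4 / ⌊Real.exp (L/8)⌋₊) := by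
  obtain ⟨C1, hC1, H1⟩ := typeI_total
  obtain ⟨C2, hC2, H2⟩ := typeII
  refine ⟨2 * C1 + 2 * C2, by positivity, ?_⟩
  intro L hL F Q hQ hF hcard
  set U := ⌊Real.exp (L/8)⌋₊ with hU
  set X := ⌊Real.exp L⌋₊ with hX
  have hU1 : 1 ≤ U := (Nat.one_le_floor_iff _).mpr (Real.one_le_exp (by linarith))
  have hUe : (U:ℝ) ≤ Real.exp (L/8) := floor_exp_le _
  set V := Real.exp (L/4) with hV
  have hUU : (U:ℝ) * U ≤ V := by
    have : V = Real.exp (L/8) * Real.exp (L/8) := by rw [← Real.exp_add, hV]; congr 1; ring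
    rw [this]; exact mul_le_mul hUe hUe (Nat.cast_nonneg _) (Real.exp_pos _).le
  have hVV : Real.exp (L/2) = V * V := by rw [← Real.exp_add]; congr 1; ring
  have hV2 : 2 ≤ V := by
    have := Real.add_one_le_exp (L/4)
    linarith
  have hV3 : V ≤ Real.exp (L/2) / 2 := by rw [hVV]; nlinarith
  have hU1' : (1:ℝ) ≤ U := by exact_mod_cast hU1
  have hUX : U ≤ X := Nat.floor_le_floor (Real.exp_le_exp.mpr (by linarith))
  set S2 : PC → ℂ := fun c => ∑ n ∈ Ioc 0 X, (((hi U (μ : ArithmeticFunction ℝ) * (ζ : ArithmeticFunction ℝ)) * hi U Λ) n : ℝ) * (c.ev n * (wt L n : ℂ)) with hS2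
  have hdec : ∀ c ∈ F, ‖TL L c.ev‖ ≤ 2 * (V * (Q * C1 * (1 + L) ^ 3 / Real.exp (L/2))) + ‖S2 c‖ := by
    intro c hc
    obtain ⟨c1, c2, c3⟩ := hF c hc
    have hpart : ∀ N, ‖∑ n ∈ range N, c.ev n‖ ≤ Q := fun N => (nontriv_partial c c1 c3 N).trans c2
    have t1 := H1 L (by linarith) c Q hpart V hV3 (by linarith) (lo U (μ : ArithmeticFunction ℝ)) ArithmeticFunction.log
      (fun l hl => ((lo_le U _ l).trans (mu_abs_le l)).trans (by
        have := Real.log_natCast_nonneg l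
        linarith))
      (fun l hl => lo_zero U _ l (by
        have : (U:ℝ) < l := by nlinarith
        exact_mod_cast this))
      (fun m hm => ⟨by
        rw [ArithmeticFunction.log_apply, abs_of_nonneg (Real.log_natCast_nonneg m)]; linarith, by
        rw [ArithmeticFunction.log_apply, ArithmeticFunction.log_apply]; exact log_diff m hm⟩)
    have t2 := H1 L (by linarith) c Q hpart V hV3 (by linarith) (lo U (μ : ArithmeticFunction ℝ) * lo U Λ) (ζ : ArithmeticFunction ℝ)
      (fun l hl => coefb U l hl)
      (fun l hl => coefb_zero U l (by
        have : ((U * U : ℕ):ℝ) < l := by push_cast; linarith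
        exact_mod_cast this))
      (fun m hm => ⟨by
        have := Real.log_natCast_nonneg m
        rw [ArithmeticFunction.natCoe_apply, ArithmeticFunction.zeta_apply, if_neg (by omega)]; simpa using this, by
        rw [ArithmeticFunction.natCoe_apply, ArithmeticFunction.zeta_apply, if_neg (by omega), ArithmeticFunction.natCoe_apply, ArithmeticFunction.zeta_apply, if_neg (by omega)]; simp⟩)
    have hTL : TL L c.ev = ∑ n ∈ Ioc 0 X, (((lo U (μ : ArithmeticFunction ℝ) * ArithmeticFunction.log) n : ℝ) : ℂ) * (c.ev n * (wt L n : ℂ))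
        - ∑ n ∈ Ioc 0 X, ((((lo U (μ : ArithmeticFunction ℝ) * lo U Λ) * (ζ : ArithmeticFunction ℝ)) n : ℝ) : ℂ) * (c.ev n * (wt L n : ℂ)) + S2 c := by
      rw [hS2]
      simp only []
      rw [← sum_sub_distrib, ← sum_add_distrib]
      unfold TL
      refine sum_congr rfl fun n _ => ?_
      have hv : (Λ : ArithmeticFunction ℝ) n = lo U Λ n + (lo U (μ : ArithmeticFunction ℝ) * ArithmeticFunction.log) n - ((lo U (μ : ArithmeticFunction ℝ) * lo U Λ) * (ζ : ArithmeticFunction ℝ)) n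
          + ((hi U (μ : ArithmeticFunction ℝ) * (ζ : ArithmeticFunction ℝ)) * hi U Λ) n := by
        conv_lhs => rw [vaughan U]
        rfl
      rw [hv]
      by_cases hn : n ≤ U
      · have : wt L n = 0 := wt_zero_small L (by linarith) n (by
          have : (n:ℝ) ≤ U := by exact_mod_cast hn
          have h8 : Real.exp (L/8) ≤ Real.exp (L/2) := Real.exp_le_exp.mpr (by linarith)
          linarith)
        rw [this]; simp
      · rw [lo_zero U Λ n (by omega)]
        push_cast; ring
    rw [hTL]
    refine (norm_add_le _ _).trans (add_le_add ((norm_sub_le _ _).trans ?_) le_rfl)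
    linarith
  have hII : ∑ c ∈ F, ‖S2 c‖ ≤ C2 * (1 + L + 2 * Q ^ 4 / U) * ((1 + L) ^ 2 * (1 + L) ^ 2) := by
    have := H2 L (by linarith) F Q (fun c hc => ⟨by have := (hF c hc).1; omega, (hF c hc).2⟩) hcard U X (by omega)
      (fun l => (hi U (μ : ArithmeticFunction ℝ) * (ζ : ArithmeticFunction ℝ)) l) (fun l => hi U Λ l)
    have e : ∀ c ∈ F, ‖S2 c‖ = ‖∑ l ∈ Ioc U X, ∑ m ∈ Ioc U X, (((hi U (μ : ArithmeticFunction ℝ) * (ζ : ArithmeticFunction ℝ)) l : ℝ) : ℂ) * ((hi U Λ m : ℝ) : ℂ) * (c.ev (l * m) * (wt L (l * m) : ℂ))‖ := by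
      intro c _
      congr 1
      rw [hS2]
      simp only []
      rw [conv_sum _ _ X (fun n => c.ev n * (wt L n : ℂ)) (fun n hn => by rw [wt_zero_large L (by linarith) n hn]; simp)]
      have hsub : Ioc U X ⊆ Ioc 0 X := Ioc_subset_Ioc_left (by omega)
      symm
      rw [← sum_subset hsub]
      · refine sum_congr rfl fun l _ => ?_
        refine sum_subset hsub ?_
        intro m hm hm'
        rw [mem_Ioc] at hm hm'
        rw [hi_zero U Λ m (by omega)]; simp
      · intro l hl hl'
        rw [mem_Ioc] at hl hl'
        refine sum_eq_zero fun m _ => ?_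
        rw [coefa_zero U l (by omega)]; simp
    rw [sum_congr rfl e]
    refine this.trans ?_
    have hlogX : Real.log X ≤ L := log_floor_exp_le L (by linarith)
    have hlogX0 : 0 ≤ Real.log X := Real.log_natCast_nonneg X
    have hsub : Ioc U X ⊆ Ioc 0 X := Ioc_subset_Ioc_left (by omega)
    have a1 : Real.sqrt (∑ l ∈ Ioc U X, ((hi U (μ : ArithmeticFunction ℝ) * (ζ : ArithmeticFunction ℝ)) l) ^ 2 * (1 / l)) ≤ (1 + L) ^ 2 := by
      rw [Real.sqrt_le_left (by positivity)]
      calc _ ≤ ∑ l ∈ Ioc U X, ((l.divisors.card : ℝ)) ^ 2 * (1 / l) := by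
            refine sum_le_sum fun l _ => mul_le_mul_of_nonneg_right ?_ (by positivity)
            rw [← sq_abs]
            exact pow_le_pow_left₀ (abs_nonneg _) (coefa U l) 2
        _ ≤ ∑ l ∈ Ioc 0 X, ((l.divisors.card : ℝ)) ^ 2 * (1 / l) :=
            sum_le_sum_of_subset_of_nonneg hsub fun _ _ _ => by positivity
        _ ≤ (1 + Real.log X) ^ 4 := tau_sq X
        _ ≤ (1 + L) ^ 4 := pow_le_pow_left₀ (by linarith) (by linarith) 4
        _ = _ := by ring
    have a2 : Real.sqrt (∑ l ∈ Ioc U X, (hi U Λ l) ^ 2 * (1 / l)) ≤ (1 + L) ^ 2 := by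
      rw [Real.sqrt_le_left (by positivity)]
      calc _ ≤ ∑ l ∈ Ioc U X, L ^ 2 * (1 / (l:ℝ)) := by
            refine sum_le_sum fun l hl => mul_le_mul_of_nonneg_right ?_ (by positivity)
            rw [mem_Ioc] at hl
            rw [← sq_abs]
            refine pow_le_pow_left₀ (abs_nonneg _) ((hi_le U Λ l).trans ?_) 2
            rw [abs_of_nonneg ArithmeticFunction.vonMangoldt_nonneg]
            refine ArithmeticFunction.vonMangoldt_le_log.trans ?_
            refine le_trans ?_ hlogX
            exact Real.log_le_log (by have : 0 < l := by omega
                                      positivity) (by exact_mod_cast hl.2)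
        _ ≤ ∑ l ∈ Ioc 0 X, L ^ 2 * (1 / (l:ℝ)) :=
            sum_le_sum_of_subset_of_nonneg hsub fun _ _ _ => by positivity
        _ ≤ L ^ 2 * (1 + L) := by
            rw [← mul_sum]
            exact mul_le_mul_of_nonneg_left ((sum_inv_le X).trans (by linarith)) (by positivity)
        _ ≤ ((1 + L) ^ 2) ^ 2 := by
            have : L ^ 2 ≤ (1 + L) ^ 2 := pow_le_pow_left₀ (by linarith) (by linarith) 2
            have h3 : (1 + L) ≤ (1 + L)^2 := by nlinarith
            calc L ^ 2 * (1 + L) ≤ (1+L)^2 * (1+L)^2 := mul_le_mul this h3 (by linarith) (by positivity)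
              _ = _ := by ring
    have hq : 0 ≤ 2 * Q ^ 4 / (U:ℝ) := by positivity
    refine mul_le_mul ?_ (mul_le_mul a1 a2 (Real.sqrt_nonneg _) (by positivity)) (by positivity) (by positivity)
    exact mul_le_mul_of_nonneg_left (by linarith) hC2
  calc ∑ c ∈ F, ‖TL L c.ev‖ ≤ ∑ c ∈ F, (2 * (V * (Q * C1 * (1 + L) ^ 3 / Real.exp (L/2))) + ‖S2 c‖) := sum_le_sum hdec
    _ = F.card * (2 * (V * (Q * C1 * (1 + L) ^ 3 / Real.exp (L/2)))) + ∑ c ∈ F, ‖S2 c‖ := by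
        rw [sum_add_distrib, sum_const, nsmul_eq_mul]
    _ ≤ Q^2 * (2 * (V * (Q * C1 * (1 + L) ^ 3 / Real.exp (L/2)))) + C2 * (1 + L + 2 * Q ^ 4 / U) * ((1 + L) ^ 2 * (1 + L) ^ 2) := by
        refine add_le_add (mul_le_mul_of_nonneg_right hcard (by positivity)) hII
    _ = 2 * C1 * (1 + L) ^ 3 * (Q ^ 3 * Real.exp (-(L/4))) + C2 * (1+L)^5 + 2 * C2 * (1+L)^4 * (Q ^ 4 / U) := by
        rw [hVV, Real.exp_neg, ← hV]
        have : V ≠ 0 := by positivity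
        field_simp
        ring
    _ ≤ _ := by
        have p1 : 0 ≤ Q ^ 3 * Real.exp (-(L/4)) := by positivity
        have p2 : 0 ≤ Q ^ 4 / (U:ℝ) := by positivity
        have q1 : (1+L)^3 ≤ (1+L)^5 := pow_le_pow_right₀ (by linarith) (by norm_num)
        have q2 : (1+L)^4 ≤ (1+L)^5 := pow_le_pow_right₀ (by linarith) (by norm_num)
        have q3 : 0 ≤ (1+L)^5 := by positivity
        have r1 : 2 * C1 * (1 + L) ^ 3 * (Q ^ 3 * Real.exp (-(L/4))) ≤ (2 * C1 + 2 * C2) * (1+L)^5 * (Q ^ 3 * Real.exp (-(L/4))) := by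
          refine mul_le_mul_of_nonneg_right (mul_le_mul (by linarith) q1 (by positivity) (by positivity)) p1
        have r2 : 2 * C2 * (1 + L) ^ 4 * (Q ^ 4 / U) ≤ (2 * C1 + 2 * C2) * (1+L)^5 * (Q ^ 4 / U) := by
          refine mul_le_mul_of_nonneg_right (mul_le_mul (by linarith) q2 (by positivity) (by positivity)) p2
        have r3 : C2 * (1+L)^5 ≤ (2 * C1 + 2 * C2) * (1+L)^5 := mul_le_mul_of_nonneg_right (by linarith) q3
        linarith

end OIR
end

section
open Finset MeasureTheory
namespace OIR

theorem log_pow_le_sqrt (i : ℕ) : ∃ C : ℝ, 0 < C ∧ ∀ x : ℝ, 1 ≤ x → (1 + Real.log x) ^ i ≤ C * Real.sqrt x := by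
  refine ⟨2 ^ i * i.factorial * Real.exp (1/2), by positivity, fun x hx => ?_⟩
  have hy := Real.log_nonneg hx
  have h := Real.pow_div_factorial_le_exp ((1 + Real.log x)/2) (by positivity) i
  have hs : Real.sqrt x = Real.exp (Real.log x / 2) := by
    rw [Real.sqrt_eq_rpow, Real.rpow_def_of_pos (by linarith)]; ring_nf
  rw [hs, mul_assoc, ← Real.exp_add, show (1:ℝ)/2 + Real.log x/2 = (1 + Real.log x)/2 by ring]
  rw [div_pow, div_div, div_le_iff₀ (by positivity)] at h
  linarith

/-- continuous version of `(log n)^i n^{-s}` -/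
noncomputable def phi (i : ℕ) (s : ℂ) (x : ℝ) : ℂ := (Real.log x : ℂ) ^ i * Complex.exp (-s * Real.log x)

theorem phi_norm (i : ℕ) (s : ℂ) (x : ℝ) (hx : 1 ≤ x) : ‖phi i s x‖ = (Real.log x)^i * x ^ (-s.re) := by
  have hy := Real.log_nonneg hx
  unfold phi
  rw [norm_mul, norm_pow, Complex.norm_real, Real.norm_of_nonneg hy, Complex.norm_exp,
    Real.rpow_def_of_pos (by linarith)]
  congr 2
  simp [mul_comm]

theorem phi_deriv (i : ℕ) (s : ℂ) (x : ℝ) (hx : 1 ≤ x) :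
    HasDerivAt (phi i s) (((i : ℂ) * (Real.log x : ℂ)^(i-1) * ((x⁻¹ : ℝ) : ℂ)) * Complex.exp (-s * Real.log x)
      + (Real.log x : ℂ)^i * (Complex.exp (-s * Real.log x) * (-s * ((x⁻¹:ℝ):ℂ)))) x := by
  have h1 : HasDerivAt (fun x : ℝ => (Real.log x : ℂ)) ((x⁻¹ : ℝ) : ℂ) x :=
    (Real.hasDerivAt_log (by linarith)).ofReal_comp
  exact (h1.pow i).mul ((h1.const_mul (-s)).cexp)

theorem phi_deriv_bound (i : ℕ) : ∃ C : ℝ, 0 < C ∧ ∀ s : ℂ, 1 < s.re → s.re ≤ 2 → |s.im| ≤ 1 →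
    ∀ x : ℝ, 1 ≤ x → ‖phi i s x‖ ≤ C * (1 / Real.sqrt x) ∧
      ‖((i : ℂ) * (Real.log x : ℂ)^(i-1) * ((x⁻¹ : ℝ) : ℂ)) * Complex.exp (-s * Real.log x)
      + (Real.log x : ℂ)^i * (Complex.exp (-s * Real.log x) * (-s * ((x⁻¹:ℝ):ℂ)))‖ ≤ C * (1 / (2 * x * Real.sqrt x)) := by
  obtain ⟨C, hC, h⟩ := log_pow_le_sqrt i
  refine ⟨2 * (i + 3) * C, by positivity, fun s h1 h2 h3 x hx => ?_⟩
  have hy := Real.log_nonneg hx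
  have hx0 : 0 < x := by linarith
  have hsq : Real.sqrt x * Real.sqrt x = x := Real.mul_self_sqrt hx0.le
  have hsp : 0 < Real.sqrt x := Real.sqrt_pos.mpr hx0
  have hE : ‖Complex.exp (-s * Real.log x)‖ ≤ x⁻¹ := by
    have := phi_norm 0 s x hx
    simp only [phi, pow_zero, one_mul] at this
    rw [this, ← Real.rpow_neg_one]
    exact Real.rpow_le_rpow_of_exponent_le hx (by linarith)
  have hl : Real.log x ^ i ≤ C * Real.sqrt x :=
    (pow_le_pow_left₀ hy (by linarith) i).trans (h x hx)
  have hl' : Real.log x ^ (i-1) ≤ C * Real.sqrt x :=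
    (pow_le_pow_left₀ hy (by linarith : Real.log x ≤ 1 + Real.log x) (i-1)).trans
      ((pow_le_pow_right₀ (by linarith) (by omega)).trans (h x hx))
  have hs : ‖s‖ ≤ 3 := (Complex.norm_le_abs_re_add_abs_im s).trans (by rw [abs_of_pos (by linarith)]; linarith)
  have key : C * Real.sqrt x * x⁻¹ = C * (1 / Real.sqrt x) := by
    field_simp; rw [pow_two, hsq]
  constructor
  · unfold phi
    rw [norm_mul, norm_pow, Complex.norm_real, Real.norm_of_nonneg hy]
    calc _ ≤ C * Real.sqrt x * x⁻¹ := mul_le_mul hl hE (norm_nonneg _) (by positivity)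
      _ = C * (1 / Real.sqrt x) := key
      _ ≤ _ := by
        refine mul_le_mul_of_nonneg_right ?_ (by positivity)
        have : (0:ℝ) ≤ i := by positivity
        nlinarith
  · refine (norm_add_le _ _).trans ?_
    simp only [norm_mul, norm_pow, Complex.norm_real, Real.norm_of_nonneg hy, norm_neg,
      Real.norm_of_nonneg (inv_nonneg.mpr hx0.le), Complex.norm_natCast]
    have hi : (0:ℝ) < x⁻¹ := by positivity
    calc _ ≤ (i * (C * Real.sqrt x) * x⁻¹) * x⁻¹ + (C * Real.sqrt x) * (x⁻¹ * (3 * x⁻¹)) := by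
          gcongr
      _ = (i + 3) * (C * Real.sqrt x * x⁻¹) * x⁻¹ := by ring
      _ = _ := by rw [key]; field_simp

theorem phi_diff (i : ℕ) : ∃ C : ℝ, 0 < C ∧ ∀ s : ℂ, 1 < s.re → s.re ≤ 2 → |s.im| ≤ 1 →
    ∀ n : ℕ, 1 ≤ n → ‖phi i s n‖ ≤ C * (1 / Real.sqrt n) ∧
      ‖phi i s (n+1 : ℕ) - phi i s n‖ ≤ C * (1 / Real.sqrt n) - C * (1 / Real.sqrt (n+1 : ℕ)) := by
  obtain ⟨C, hC, h⟩ := phi_deriv_bound i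
  refine ⟨C, hC, fun s h1 h2 h3 n hn => ?_⟩
  have hn1 : (1:ℝ) ≤ n := by exact_mod_cast hn
  refine ⟨(h s h1 h2 h3 n hn1).1, ?_⟩
  have := @image_norm_le_of_norm_deriv_right_le_deriv_boundary' ℂ _ _ (fun x => phi i s x - phi i s n) (n:ℝ) ((n:ℝ)+1)
    (fun x => ((i : ℂ) * (Real.log x : ℂ)^(i-1) * ((x⁻¹ : ℝ) : ℂ)) * Complex.exp (-s * Real.log x)
      + (Real.log x : ℂ)^i * (Complex.exp (-s * Real.log x) * (-s * ((x⁻¹:ℝ):ℂ))))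
    ?_ ?_ (fun x => C * (1 / Real.sqrt n) - C * (1 / Real.sqrt x)) (fun x => C * (1 / (2 * x * Real.sqrt x))) ?_ ?_ ?_ ?_ (n+1) ?_
  · simpa using this
  · intro x hx
    exact ((phi_deriv i s x (hn1.trans hx.1)).continuousAt.sub continuousAt_const).continuousWithinAt
  · intro x hx
    exact ((phi_deriv i s x (hn1.trans hx.1)).sub_const _).hasDerivWithinAt
  · simp
  · refine ContinuousOn.sub continuousOn_const (ContinuousOn.mul continuousOn_const (ContinuousOn.div continuousOn_const (Real.continuous_sqrt.continuousOn) ?_))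
    intro x hx
    have : 0 < x := by linarith [hx.1]
    positivity
  · intro x hx
    have hx0 : 0 < x := by linarith [hx.1]
    have hsq : Real.sqrt x ^ 2 = x := Real.sq_sqrt hx0.le
    have hsp : 0 < Real.sqrt x := Real.sqrt_pos.mpr hx0
    have hd : HasDerivAt (fun x => C * (1 / Real.sqrt n) - C * (1 / Real.sqrt x)) (C * (1 / (2 * x * Real.sqrt x))) x := by
      have := ((((hasDerivAt_id x).sqrt hx0.ne').inv hsp.ne').const_mul C).const_sub (C * (1 / Real.sqrt n))
      simp only [id] at this
      have e1 : C * (1 / (2 * x * Real.sqrt x)) = -(C * (-(1 / (2 * Real.sqrt x)) / Real.sqrt x ^ 2)) := by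
        rw [hsq]; field_simp
      rw [e1]
      refine this.congr_of_eventuallyEq (Filter.Eventually.of_forall fun y => ?_)
      simp
    exact hd.hasDerivWithinAt
  · intro x hx
    exact (h s h1 h2 h3 x (hn1.trans hx.1)).2
  · constructor <;> linarith

theorem logMul_iter (f : ℕ → ℂ) (i n : ℕ) : (LSeries.logMul^[i] f) n = (Complex.log n) ^ i * f n := by
  induction i with
  | zero => simp
  | succ i ih => rw [Function.iterate_succ_apply']; simp only [LSeries.logMul, ih]; ring

theorem term_phi (f : ℕ → ℂ) (i n : ℕ) (hn : n ≠ 0) (s : ℂ) :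
    LSeries.term (LSeries.logMul^[i] f) s n = f n * phi i s n := by
  rw [LSeries.term_of_ne_zero hn, logMul_iter, phi, Complex.ofReal_log (by positivity),
    Complex.ofReal_natCast, div_eq_mul_inv, ← Complex.cpow_neg, Complex.cpow_def_of_ne_zero (by exact_mod_cast hn)]
  rw [mul_comm (Complex.log _) (-s)]; ring

theorem summable_bdd (f : ℕ → ℂ) (hf : ∀ n, ‖f n‖ ≤ 1) : LSeries.abscissaOfAbsConv f ≤ 1 :=
  LSeries.abscissaOfAbsConv_le_of_le_const ⟨1, fun n _ => hf n⟩

theorem f_bound (i : ℕ) : ∃ C : ℝ, 1 ≤ C ∧ ∀ (e : ℕ → ℂ) (q : ℕ), 2 ≤ q → (∀ n, ‖e n‖ ≤ 1) →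
    (∀ N, ‖∑ n ∈ range N, e n‖ ≤ q) → ∀ s : ℂ, 1 < s.re → s.re ≤ 2 → |s.im| ≤ 1 →
    ‖LSeries (LSeries.logMul^[i] e) s‖ ≤ C * (1 + Real.log q) ^ (i+1) := by
  obtain ⟨C, hC, h⟩ := phi_diff i
  refine ⟨2 ^ (i+1) + 2 * C, by
    have : (1:ℝ) ≤ 2^(i+1) := one_le_pow₀ (by norm_num)
    linarith, fun e q hq he hE s h1 h2 h3 => ?_⟩
  have hq1 : (2:ℝ) ≤ q := by exact_mod_cast hq
  have hlq : 0 ≤ Real.log q := Real.log_nonneg (by linarith)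
  have hsum : LSeriesSummable (LSeries.logMul^[i] e) s := by
    apply LSeriesSummable_of_abscissaOfAbsConv_lt_re
    rw [LSeries.absicssaOfAbsConv_logPowMul]
    exact (summable_bdd e he).trans_lt (by exact_mod_cast h1)
  have ht := hsum.hasSum.tendsto_sum_nat.norm
  refine le_of_tendsto ht ?_
  filter_upwards [Filter.eventually_ge_atTop (q^2)] with M hM
  have hN : 1 ≤ q ^ 2 := Nat.one_le_pow _ _ (by omega)
  rw [← Finset.sum_range_add_sum_Ico _ hM]
  refine (norm_add_le _ _).trans ?_
  rw [add_mul]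
  have hpw : (1:ℝ) ≤ (1 + Real.log q) ^ (i+1) := one_le_pow₀ (by linarith)
  refine add_le_add ?_ ?_
  · have : ∑ n ∈ range (q^2), LSeries.term (LSeries.logMul^[i] e) s n = ∑ n ∈ Ico 1 (q^2), LSeries.term (LSeries.logMul^[i] e) s n := by
      rw [← Finset.sum_range_add_sum_Ico _ hN]; simp
    rw [this]
    calc _ ≤ ∑ n ∈ Ico 1 (q^2), (Real.log (q^2 : ℕ))^i * (1 / (n:ℝ)) := by
          refine norm_sum_le_of_le _ fun n hn => ?_
          rw [mem_Ico] at hn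
          have hn1 : (1:ℝ) ≤ n := by exact_mod_cast hn.1
          rw [term_phi _ _ _ (by omega), norm_mul, phi_norm _ _ _ hn1]
          have : (n:ℝ) ^ (-s.re) ≤ 1 / n := by
            rw [one_div, ← Real.rpow_neg_one]
            exact Real.rpow_le_rpow_of_exponent_le hn1 (by linarith)
          have h4 : Real.log n ^ i ≤ (Real.log (q^2:ℕ))^i := by
            refine pow_le_pow_left₀ (Real.log_nonneg hn1) (Real.log_le_log (by linarith) (by exact_mod_cast hn.2.le)) i
          calc _ ≤ 1 * (Real.log n ^ i * (n:ℝ) ^ (-s.re)) := mul_le_mul_of_nonneg_right (he n) (by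
                have := Real.log_nonneg hn1
                positivity)
            _ ≤ _ := by
              rw [one_mul]
              refine mul_le_mul h4 this (by positivity) (pow_nonneg (Real.log_natCast_nonneg _) _)
      _ ≤ (Real.log (q^2:ℕ))^i * (1 + Real.log (q^2:ℕ)) := by
          rw [← mul_sum]
          refine mul_le_mul_of_nonneg_left ?_ (pow_nonneg (Real.log_natCast_nonneg _) _)
          refine le_trans ?_ (sum_inv_le (q^2))
          refine sum_le_sum_of_subset_of_nonneg (fun n hn => ?_) fun _ _ _ => by positivity
          rw [mem_Ico] at hn; rw [mem_Ioc]; omega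
      _ ≤ _ := by
          push_cast
          rw [Real.log_pow, ← mul_pow, pow_succ (2 * (1 + Real.log q))]
          push_cast
          refine mul_le_mul (pow_le_pow_left₀ (by positivity) (by linarith) i) (by linarith) (by positivity) (by positivity)
  · obtain ⟨P, hP⟩ : ∃ P, P = q^2 := ⟨_, rfl⟩
    rw [← hP] at hM hN ⊢
    have e1 : ∑ n ∈ Ico (P) M, LSeries.term (LSeries.logMul^[i] e) s n =
        ∑ n ∈ range (M - P), e (P + n) * phi i s (P + n : ℕ) := by
      rw [Finset.sum_Ico_eq_sum_range]
      refine sum_congr rfl fun n _ => term_phi _ _ _ (by omega) _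
    rw [e1]
    have hpart : ∀ N, ‖∑ n ∈ range N, e (P + n)‖ ≤ 2 * q := by
      intro N
      have : ∑ n ∈ range N, e (P + n) = ∑ n ∈ range (P + N), e n - ∑ n ∈ range (P), e n := by
        rw [Finset.sum_range_add]; ring
      rw [this]
      exact (norm_sub_le _ _).trans (by linarith [hE (P+N), hE (P)])
    have hab := abel_bound (fun n => e (P+n)) (fun n => phi i s (P+n : ℕ)) (2*q) hpart (M - P)
    refine hab.trans ?_
    have tel : ∑ n ∈ range (M - P), ‖phi i s (P + (n+1) : ℕ) - phi i s (P+n : ℕ)‖ ≤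
        C * (1 / Real.sqrt (P + 0 : ℕ)) - C * (1 / Real.sqrt (P + (M-P) : ℕ)) := by
      rw [← Finset.sum_range_sub' (fun n => C * (1 / Real.sqrt (P + n : ℕ)))]
      exact sum_le_sum fun n _ => (h s h1 h2 h3 (P+n) (by omega)).2
    have hM1 := (h s h1 h2 h3 (P+(M-P)) (by omega)).1
    have : Real.sqrt (P + 0 : ℕ) = q := by rw [add_zero, hP]; push_cast; rw [Real.sqrt_sq (by linarith)]
    rw [this] at tel
    calc _ ≤ 2 * (q:ℝ) * (C * (1 / q)) := by
          refine mul_le_mul_of_nonneg_left ?_ (by positivity)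
          linarith
      _ = 2 * C * 1 := by field_simp
      _ ≤ _ := mul_le_mul_of_nonneg_left hpw (by positivity)

end OIR
end

section
open Finset MeasureTheory
open scoped ArithmeticFunction.vonMangoldt
namespace OIR

theorem zeta_step (ε : ℝ) (hε : 0 < ε) (n : ℕ) (hn : 1 ≤ n) :
    ((n+1 : ℕ):ℝ) ^ (-1-ε) ≤ (1/ε) * (n:ℝ) ^ (-ε) - (1/ε) * ((n+1:ℕ):ℝ)^(-ε) := by
  have hn0 : (0:ℝ) < n := by exact_mod_cast hn
  have h1 : (0:ℝ) < (n+1:ℕ) := by positivity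
  have hlog : 1 / ((n+1:ℕ):ℝ) ≤ Real.log ((n+1:ℕ):ℝ) - Real.log n := by
    have := Real.log_le_sub_one_of_pos (show (0:ℝ) < n / (n+1:ℕ) by positivity)
    rw [Real.log_div (by positivity) (by positivity)] at this
    have e : (n:ℝ) / (n+1:ℕ) - 1 = - (1 / ((n+1:ℕ):ℝ)) := by push_cast; field_simp; ring
    linarith
  have h2 : (n:ℝ) ^ (-ε) = ((n+1:ℕ):ℝ)^(-ε) * Real.exp (ε * (Real.log ((n+1:ℕ):ℝ) - Real.log n)) := by
    rw [Real.rpow_def_of_pos hn0, Real.rpow_def_of_pos h1, ← Real.exp_add]; congr 1; ring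
  have h3 := Real.add_one_le_exp (ε * (Real.log ((n+1:ℕ):ℝ) - Real.log n))
  have h4 : ((n+1 : ℕ):ℝ) ^ (-1-ε) = ((n+1:ℕ):ℝ)^(-ε) * (1 / ((n+1:ℕ):ℝ)) := by
    rw [show -1-ε = -ε + (-1) by ring, Real.rpow_add h1, Real.rpow_neg_one, one_div]
  have hp : 0 < ((n+1:ℕ):ℝ)^(-ε) := by positivity
  rw [h4, h2, ← mul_sub, one_div_mul_eq_div, le_div_iff₀ hε]
  have h5 : ε * (1 / ((n+1:ℕ):ℝ)) ≤ ε * (Real.log ((n+1:ℕ):ℝ) - Real.log n) := mul_le_mul_of_nonneg_left hlog hε.le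
  calc ((n+1:ℕ):ℝ)^(-ε) * (1 / ((n+1:ℕ):ℝ)) * ε = ((n+1:ℕ):ℝ)^(-ε) * (ε * (1 / ((n+1:ℕ):ℝ))) := by ring
    _ ≤ ((n+1:ℕ):ℝ)^(-ε) * (Real.exp (ε * (Real.log ((n+1:ℕ):ℝ) - Real.log n)) - 1) := by
        refine mul_le_mul_of_nonneg_left (by linarith) hp.le
    _ = _ := by ring

theorem zeta_bound (ε : ℝ) (hε : 0 < ε) : Summable (fun n : ℕ => (n:ℝ)^(-1-ε)) ∧
    ∑' n : ℕ, (n:ℝ)^(-1-ε) ≤ 1 + 1/ε := by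
  refine ⟨Real.summable_nat_rpow.mpr (by linarith), ?_⟩
  refine Real.tsum_le_of_sum_range_le (fun n => by positivity) fun N => ?_
  have key : ∀ N : ℕ, ∑ n ∈ range (N+2), (n:ℝ)^(-1-ε) ≤ 1 + 1/ε - (1/ε) * ((N+1:ℕ):ℝ)^(-ε) := by
    intro N
    induction N with
    | zero => simp [sum_range_succ, Real.zero_rpow (show -1-ε ≠ 0 by linarith)]
    | succ N ih =>
      rw [sum_range_succ]
      have := zeta_step ε hε (N+1) (by omega)
      linarith
  refine le_trans ?_ ((key N).trans ?_)
  · exact sum_le_sum_of_subset_of_nonneg (range_mono (by omega)) fun _ _ _ => by positivity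
  · have : 0 ≤ (1/ε) * ((N+1:ℕ):ℝ)^(-ε) := by positivity
    linarith

noncomputable def fL (c : PC) (i : ℕ) (s : ℂ) : ℂ := LSeries (LSeries.logMul^[i] c.ev) s
noncomputable def lam (c : PC) (n : ℕ) : ℂ := c.ev n * ((Λ n : ℝ) : ℂ)
noncomputable def gL (c : PC) (i : ℕ) (s : ℂ) : ℂ := LSeries (LSeries.logMul^[i] (lam c)) s

theorem lam_absc (c : PC) : LSeries.abscissaOfAbsConv (lam c) ≤ 1 := by
  refine LSeries.abscissaOfAbsConv_le_of_forall_lt_LSeriesSummable' fun y hy => ?_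
  exact DirichletCharacter.LSeriesSummable_twist_vonMangoldt c.2 (by simpa using (show (1:ℝ) < y by exact_mod_cast hy))

theorem contDiffAt_LSeries (f : ℕ → ℂ) (hf : LSeries.abscissaOfAbsConv f ≤ 1) (s : ℂ) (hs : 1 < s.re) (n : ℕ) :
    ContDiffAt ℂ n (LSeries f) s := by
  have h := LSeries_analyticOnNhd f s (show s ∈ {s : ℂ | LSeries.abscissaOfAbsConv f < s.re} from
    hf.trans_lt (by exact_mod_cast hs))
  exact h.contDiffAt

theorem leibniz (c : PC) (i : ℕ) (s : ℂ) (hs : 1 < s.re) :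
    fL c (i+1) s = ∑ j ∈ range (i+1), (i.choose j : ℂ) * gL c j s * fL c (i-j) s := by
  have habs : LSeries.abscissaOfAbsConv c.ev ≤ 1 := summable_bdd _ c.ev_le
  have hlt : LSeries.abscissaOfAbsConv c.ev < s.re := habs.trans_lt (by exact_mod_cast hs)
  have hltL : LSeries.abscissaOfAbsConv (lam c) < s.re := (lam_absc c).trans_lt (by exact_mod_cast hs)
  have hev : (LSeries (lam c) * LSeries c.ev) =ᶠ[nhds s] LSeries (LSeries.logMul c.ev) := by
    have : {z : ℂ | 1 < z.re} ∈ nhds s := (isOpen_lt continuous_const Complex.continuous_re).mem_nhds hs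
    filter_upwards [this] with z hz
    have h1 := DirichletCharacter.LSeries_twist_vonMangoldt_eq c.2 hz
    have h2 : LSeries c.ev z ≠ 0 := DirichletCharacter.LSeries_ne_zero_of_one_lt_re c.2 hz
    have h3 := LSeries_deriv (habs.trans_lt (by exact_mod_cast hz : (1:EReal) < z.re))
    have h1' : LSeries (lam c) z = -deriv (LSeries c.ev) z / LSeries c.ev z := h1
    rw [Pi.mul_apply, h1', h3, neg_neg, div_mul_cancel₀ _ h2]
  have h := hev.iteratedDeriv_eq i
  rw [iteratedDeriv_mul (contDiffAt_LSeries _ (lam_absc c) s hs i) (contDiffAt_LSeries _ habs s hs i),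
    LSeries_iteratedDeriv i (by rw [LSeries.abscissaOfAbsConv_logMul]; exact hlt), ← Function.iterate_succ_apply] at h
  have e2 : (-1:ℂ)^i * (-1)^i = 1 := by rw [← mul_pow]; simp
  calc fL c (i+1) s = (-1)^i * ((-1)^i * LSeries (LSeries.logMul^[i+1] c.ev) s) := by
        rw [← mul_assoc, e2, one_mul]; rfl
    _ = _ := by
      rw [← h, mul_sum]
      refine sum_congr rfl fun j hj => ?_
      rw [mem_range] at hj
      rw [LSeries_iteratedDeriv j hltL, LSeries_iteratedDeriv (i-j) hlt]
      have e3 : (-1:ℂ)^i * ((-1)^j * (-1)^(i-j)) = 1 := by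
        rw [← pow_add, show j + (i-j) = i by omega, e2]
      unfold gL fL
      linear_combination ((i.choose j : ℂ) * LSeries (LSeries.logMul^[j] (lam c)) s * LSeries (LSeries.logMul^[i-j] c.ev) s) * e3

theorem leibniz_bound (J : ℕ) : ∃ D : ℝ, 1 ≤ D ∧ ∀ (f G : ℕ → ℂ) (Y δ : ℝ), 1 ≤ Y → 0 < δ → δ ≤ 1 →
    (∀ i, f (i+1) = ∑ j ∈ range (i+1), (i.choose j : ℂ) * G j * f (i-j)) →
    (∀ i ≤ J+1, ‖f i‖ ≤ Y) → δ ≤ ‖f 0‖ → ∀ j ≤ J, ‖G j‖ ≤ D * (Y/δ)^(j+1) := by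
  induction J with
  | zero =>
    refine ⟨1, le_rfl, fun f G Y δ hY hδ hδ1 hrec hf h0 j hj => ?_⟩
    obtain rfl : j = 0 := by omega
    have h := hrec 0
    simp at h
    have h1 := hf 1 le_rfl
    rw [h, norm_mul] at h1
    rw [zero_add, pow_one, one_mul, le_div_iff₀ hδ]
    exact (mul_le_mul_of_nonneg_left h0 (norm_nonneg _)).trans h1
  | succ J ih =>
    obtain ⟨D, hD, h⟩ := ih
    refine ⟨1 + ∑ j ∈ range (J+1), ((J+1).choose j : ℝ) * D + D, by
      have : 0 ≤ ∑ j ∈ range (J+1), ((J+1).choose j : ℝ) * D := sum_nonneg fun _ _ => by positivity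
      linarith, fun f G Y δ hY hδ hδ1 hrec hf h0 j hj => ?_⟩
    have hs0 : 0 ≤ ∑ j ∈ range (J+1), ((J+1).choose j : ℝ) * D := sum_nonneg fun _ _ => by positivity
    have hy : 1 ≤ Y / δ := by rw [le_div_iff₀ hδ]; linarith
    have ihj := h f G Y δ hY hδ hδ1 hrec (fun i hi => hf i (by omega)) h0
    rcases Nat.lt_or_ge j (J+1) with hlt | hge
    · refine (ihj j (by omega)).trans (mul_le_mul_of_nonneg_right (by linarith) (by positivity))
    · obtain rfl : j = J+1 := by omega
      have hr := hrec (J+1)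
      rw [sum_range_succ] at hr
      simp only [Nat.choose_self, Nat.cast_one, one_mul, Nat.sub_self] at hr
      have e : G (J+1) * f 0 = f (J+1+1) - ∑ j ∈ range (J+1), ((J+1).choose j : ℂ) * G j * f (J+1-j) := by
        rw [hr]; ring
      have hb : ‖G (J+1)‖ * δ ≤ Y + ∑ j ∈ range (J+1), ((J+1).choose j : ℝ) * (D * (Y/δ)^(J+1)) * Y := by
        calc ‖G (J+1)‖ * δ ≤ ‖G (J+1)‖ * ‖f 0‖ := mul_le_mul_of_nonneg_left h0 (norm_nonneg _)
          _ = ‖f (J+1+1) - ∑ j ∈ range (J+1), ((J+1).choose j : ℂ) * G j * f (J+1-j)‖ := by rw [← e, norm_mul]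
          _ ≤ _ := by
            refine (norm_sub_le _ _).trans (add_le_add (hf _ le_rfl) (norm_sum_le_of_le _ fun j hj => ?_))
            rw [mem_range] at hj
            rw [norm_mul, norm_mul, Complex.norm_natCast]
            have h6 : ‖G j‖ ≤ D * (Y/δ)^(J+1) := (ihj j (by omega)).trans
              (mul_le_mul_of_nonneg_left (pow_le_pow_right₀ hy (by omega)) (by linarith))
            exact mul_le_mul (mul_le_mul_of_nonneg_left h6 (by positivity)) (hf _ (by omega)) (norm_nonneg _) (by positivity)
      have hb2 : ‖G (J+1)‖ ≤ (Y + ∑ j ∈ range (J+1), ((J+1).choose j : ℝ) * (D * (Y/δ)^(J+1)) * Y) / δ := by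
        rwa [le_div_iff₀ hδ]
      refine hb2.trans ?_
      have e3 : (Y + ∑ j ∈ range (J+1), ((J+1).choose j : ℝ) * (D * (Y/δ)^(J+1)) * Y) / δ =
          (Y/δ) + (∑ j ∈ range (J+1), ((J+1).choose j : ℝ) * D) * (Y/δ)^(J+1+1) := by
        rw [add_div, sum_mul, sum_div]
        congr 1
        refine sum_congr rfl fun j _ => ?_
        rw [pow_succ (Y/δ) (J+1)]; ring
      rw [e3, add_mul, add_mul, one_mul]
      have h7 : Y/δ ≤ (Y/δ)^(J+1+1) := le_self_pow₀ hy (by omega)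
      have h8 : 0 ≤ D * (Y/δ)^(J+1+1) := by positivity
      linarith

theorem gL_sup (J : ℕ) : ∃ C : ℝ, 0 ≤ C ∧ ∀ L : ℝ, 1 ≤ L → ∀ c : PC, ∀ s : ℂ, s.re = 1 + 1/L →
    ‖gL c J s‖ ≤ C * L^(J+2) ∧ Summable (fun n => ‖LSeries.term (LSeries.logMul^[J] (lam c)) s n‖) := by
  refine ⟨(J+1).factorial * 2^(J+1) * 3, by positivity, fun L hL c s hs => ?_⟩
  obtain ⟨z1, z2⟩ := zeta_bound (1/(2*L)) (by positivity)
  have hterm : ∀ n, ‖LSeries.term (LSeries.logMul^[J] (lam c)) s n‖ ≤ (J+1).factorial * (2*L)^(J+1) * (n:ℝ)^(-1-1/(2*L)) := by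
    intro n
    rcases Nat.eq_zero_or_pos n with rfl | hn
    · simp; positivity
    have hn1 : (1:ℝ) ≤ n := by exact_mod_cast hn
    have hl := Real.log_nonneg hn1
    rw [term_phi _ _ _ (by omega), norm_mul, phi_norm _ _ _ hn1, lam, norm_mul, Complex.norm_real,
      Real.norm_of_nonneg ArithmeticFunction.vonMangoldt_nonneg]
    have h1 : ‖c.ev n‖ * Λ n ≤ Real.log n :=
      (mul_le_mul (c.ev_le n) ArithmeticFunction.vonMangoldt_le_log ArithmeticFunction.vonMangoldt_nonneg zero_le_one).trans (by simp)
    have h2 := Real.pow_div_factorial_le_exp (Real.log n / (2*L)) (by positivity) (J+1)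
    rw [div_pow, div_div, div_le_iff₀ (by positivity)] at h2
    have h3 : (n:ℝ)^(-1-1/(2*L)) = Real.exp (Real.log n / (2*L)) * (n:ℝ)^(-s.re) := by
      rw [hs, Real.rpow_def_of_pos (by linarith), Real.rpow_def_of_pos (by linarith), ← Real.exp_add]
      congr 1; field_simp; ring
    rw [h3]
    calc _ ≤ Real.log n * (Real.log n ^ J * (n:ℝ)^(-s.re)) := mul_le_mul_of_nonneg_right h1 (by positivity)
      _ = Real.log n ^ (J+1) * (n:ℝ)^(-s.re) := by ring
      _ ≤ _ := (mul_le_mul_of_nonneg_right h2 (by positivity)).trans (le_of_eq (by ring))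
  have hS : Summable (fun n => ‖LSeries.term (LSeries.logMul^[J] (lam c)) s n‖) :=
    Summable.of_nonneg_of_le (fun _ => norm_nonneg _) hterm (z1.mul_left _)
  refine ⟨?_, hS⟩
  calc ‖gL c J s‖ ≤ ∑' n, ‖LSeries.term (LSeries.logMul^[J] (lam c)) s n‖ := norm_tsum_le_tsum_norm hS
    _ ≤ ∑' n : ℕ, (J+1).factorial * (2*L)^(J+1) * (n:ℝ)^(-1-1/(2*L)) := hS.tsum_le_tsum hterm (z1.mul_left _)
    _ = (J+1).factorial * (2*L)^(J+1) * ∑' n : ℕ, (n:ℝ)^(-1-1/(2*L)) := tsum_mul_left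
    _ ≤ (J+1).factorial * (2*L)^(J+1) * (3 * L) := by
        refine mul_le_mul_of_nonneg_left (z2.trans ?_) (by positivity)
        rw [one_div_one_div]; linarith
    _ = _ := by rw [mul_pow]; ring

end OIR
end

section
open Finset MeasureTheory
open scoped ArithmeticFunction.vonMangoldt
namespace OIR

noncomputable def sT (L t : ℝ) : ℂ := ((1 + 1/L : ℝ) : ℂ) - ((2 * Real.pi * t / L : ℝ) : ℂ) * Complex.I

theorem sT_re (L t : ℝ) : (sT L t).re = 1 + 1/L := by simp [sT]
theorem sT_im (L t : ℝ) : (sT L t).im = -(2 * Real.pi * t / L) := by simp [sT]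

theorem TL_integral (L : ℝ) (hL : 1 ≤ L) (c : PC) (J : ℕ) (H : ℝ → ℂ) (hc : Continuous H) (hH : Integrable H)
    (hrep : ∀ u : ℝ, ((Real.exp u * bump u / u^J : ℝ):ℂ) = ∫ t : ℝ, H t * Complex.exp (2 * Real.pi * t * u * Complex.I)) :
    (L:ℂ)^J * TL L c.ev = ∫ t : ℝ, H t * gL c J (sT L t) := by
  obtain ⟨C, hC, hG⟩ := gL_sup J
  set F : ℕ → ℝ → ℂ := fun n t => H t * LSeries.term (LSeries.logMul^[J] (lam c)) (sT L t) n with hF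
  have hLC : (L:ℂ) ≠ 0 := by exact_mod_cast (by linarith : L ≠ 0)
  have hFn : ∀ n : ℕ, n ≠ 0 → ∀ t, F n t = (lam c n * phi J ((1 + 1/L : ℝ):ℂ) n) * (H t * Complex.exp (2 * Real.pi * t * ((Real.log n / L : ℝ):ℂ) * Complex.I)) := by
    intro n hn t
    simp only [hF]
    rw [term_phi _ _ _ hn]
    have : phi J (sT L t) n = phi J ((1 + 1/L : ℝ):ℂ) n * Complex.exp (2 * Real.pi * t * ((Real.log n / L : ℝ):ℂ) * Complex.I) := by
      unfold phi sT
      rw [mul_assoc ((Real.log (n:ℝ) : ℂ) ^ J), ← Complex.exp_add]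
      congr 2
      push_cast
      field_simp
      ring
    rw [this]; ring
  have hF0 : F 0 = fun _ => 0 := by funext t; simp [hF]
  have hint0 : ∀ u : ℝ, Integrable fun t : ℝ => H t * Complex.exp (2 * Real.pi * t * (u:ℂ) * Complex.I) := by
    intro u
    refine Integrable.mono' hH.norm (Continuous.aestronglyMeasurable (by fun_prop)) (Filter.Eventually.of_forall fun t => ?_)
    rw [norm_mul, show (2 * Real.pi * t * (u:ℂ) * Complex.I) = ((2 * Real.pi * t * u : ℝ):ℂ) * Complex.I by push_cast; ring,
      Complex.norm_exp_ofReal_mul_I, mul_one]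
  have hinteg : ∀ n, Integrable (F n) := by
    intro n
    by_cases hn : n = 0
    · subst hn; rw [hF0]; exact integrable_zero _ _ _
    · have := (hint0 (Real.log n / L)).const_mul (lam c n * phi J ((1 + 1/L : ℝ):ℂ) n)
      refine this.congr (Filter.Eventually.of_forall fun t => ?_)
      exact (hFn n hn t).symm
  have hnorm : ∀ n, ∫ t, ‖F n t‖ = ‖LSeries.term (LSeries.logMul^[J] (lam c)) (sT L 0) n‖ * ∫ t, ‖H t‖ := by
    intro n
    rw [← integral_const_mul]
    congr 1
    funext t
    simp only [hF]
    rw [norm_mul, LSeries.norm_term_eq, LSeries.norm_term_eq, sT_re, sT_re, mul_comm]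
  have hsum : Summable fun n => ∫ t, ‖F n t‖ := by
    simp_rw [hnorm]
    exact ((hG L hL c (sT L 0) (sT_re _ _)).2).mul_right _
  have hs := hasSum_integral_of_summable_integral_norm hinteg hsum
  have e1 : (fun t => ∑' n, F n t) = fun t => H t * gL c J (sT L t) := by
    funext t; simp only [hF]; rw [tsum_mul_left]; rfl
  rw [e1] at hs
  have hv : ∀ n, ∫ t, F n t = (L:ℂ)^J * (((Λ n:ℝ):ℂ) * (c.ev n * (wt L n : ℂ))) := by
    intro n
    by_cases hn : n = 0
    · subst hn; rw [hF0]; simp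
    have hn1 : (1:ℝ) ≤ n := by exact_mod_cast Nat.one_le_iff_ne_zero.mpr hn
    simp_rw [hFn n hn]
    rw [integral_const_mul, ← hrep]
    by_cases hl : Real.log n = 0
    · rw [hl]; simp [wt, hl, bump_zero_left 0 (by norm_num)]
    have hlC : (Real.log n : ℂ) ≠ 0 := by exact_mod_cast hl
    unfold lam phi wt
    have e2 : Complex.exp (-((1 + 1/L : ℝ):ℂ) * Real.log n) = ((n:ℂ))⁻¹ * (((Real.exp (Real.log n / L) : ℝ):ℂ))⁻¹ := by
      have : (n:ℝ)⁻¹ * (Real.exp (Real.log n/L))⁻¹ = Real.exp (-(1+1/L) * Real.log n) := by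
        rw [← Real.exp_neg, ← Real.exp_log (show (0:ℝ) < (n:ℝ)⁻¹ by positivity), ← Real.exp_add, Real.log_inv]
        congr 1; ring
      have h2 := congrArg (fun x : ℝ => (x:ℂ)) this
      push_cast at h2 ⊢
      rw [h2]
    rw [e2]
    have hE : ((Real.exp (Real.log n / L) : ℝ):ℂ) ≠ 0 := by exact_mod_cast (Real.exp_pos _).ne'
    push_cast at hE hlC ⊢
    have hnC : (n:ℂ) ≠ 0 := by exact_mod_cast hn
    rw [div_pow]
    field_simp
  simp_rw [hv] at hs
  have hs2 : HasSum (fun n => (L:ℂ)^J * (((Λ n:ℝ):ℂ) * (c.ev n * (wt L n : ℂ)))) ((L:ℂ)^J * TL L c.ev) := by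
    unfold TL
    rw [mul_sum]
    refine hasSum_sum_of_ne_finset_zero fun n hn => ?_
    by_cases h0 : n = 0
    · subst h0; simp
    · rw [mem_Ioc] at hn
      push Not at hn
      have h1 := hn (Nat.pos_of_ne_zero h0)
      have : wt L n = 0 := wt_zero_large L (by linarith) n h1
      rw [this]; simp
  exact hs2.unique hs


/-- exceptional-ness threshold -/
def NonExc (L : ℝ) (c : PC) : Prop := L ^ (-(3/4) : ℝ) ≤ ‖fL c 0 (sT L 0)‖

theorem fL_deriv_diff (c : PC) (L t Y : ℝ) (hL : 1 ≤ L) (ht : 2 * Real.pi * |t| ≤ L)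
    (hY : ∀ s : ℂ, s.re = 1 + 1/L → |s.im| ≤ 1 → ‖fL c 1 s‖ ≤ Y) :
    ‖fL c 0 (sT L t) - fL c 0 (sT L 0)‖ ≤ Y * (2 * Real.pi * |t| / L) := by
  have hL0 : 0 < L := by linarith
  set S : Set ℂ := {s | s.re = 1 + 1/L ∧ |s.im| ≤ 1}
  have hconv : Convex ℝ S := by
    intro x hx y hy a b ha hb hab
    refine ⟨?_, ?_⟩
    · simp only [Complex.add_re, Complex.real_smul, Complex.re_ofReal_mul, hx.1, hy.1]
      rw [← add_mul, hab, one_mul]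
    · simp only [Complex.add_im, Complex.real_smul, Complex.im_ofReal_mul]
      calc |a * x.im + b * y.im| ≤ |a * x.im| + |b * y.im| := abs_add_le _ _
        _ = a * |x.im| + b * |y.im| := by rw [abs_mul, abs_mul, abs_of_nonneg ha, abs_of_nonneg hb]
        _ ≤ a * 1 + b * 1 := add_le_add (mul_le_mul_of_nonneg_left hx.2 ha) (mul_le_mul_of_nonneg_left hy.2 hb)
        _ = 1 := by linarith
  have hder : ∀ x ∈ S, HasDerivWithinAt (fL c 0) (-(fL c 1 x)) S x := by
    intro x hx
    have : 1 < x.re := by rw [hx.1]; have : 0 < 1/L := by positivity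
                          linarith
    exact (LSeries_hasDerivAt ((summable_bdd _ c.ev_le).trans_lt (by exact_mod_cast this))).hasDerivWithinAt
  have h := hconv.norm_image_sub_le_of_norm_hasDerivWithin_le (C := Y) hder (fun x hx => by
    rw [norm_neg]; exact hY x hx.1 hx.2) (x := sT L 0) (y := sT L t) ⟨sT_re _ _, by rw [sT_im]; simp⟩
    ⟨sT_re _ _, by
      rw [sT_im, abs_neg, abs_div, abs_of_pos hL0, div_le_one hL0, abs_mul, abs_of_pos (by positivity : 0 < 2 * Real.pi)]
      exact ht⟩
  have e : ‖sT L t - sT L 0‖ = 2 * Real.pi * |t| / L := by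
    have : sT L t - sT L 0 = ((-(2 * Real.pi * t / L) : ℝ):ℂ) * Complex.I := by simp [sT]
    rw [this, norm_mul, Complex.norm_I, mul_one, Complex.norm_real, Real.norm_eq_abs, abs_neg, abs_div,
      abs_of_pos hL0, abs_mul, abs_of_pos (by positivity : 0 < 2 * Real.pi)]
  rw [e] at h
  exact h

theorem log_pow_ev (C A ε : ℝ) (hε : 0 < ε) (J : ℕ) : ∀ᶠ L : ℝ in Filter.atTop, C * (1 + A * Real.log L)^J ≤ L ^ ε := by
  have h1 : (fun L : ℝ => C * (1 + A * Real.log L)^J) =o[Filter.atTop] fun L => L ^ ε := by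
    have h2 : (fun L : ℝ => Real.log L) =o[Filter.atTop] fun L => L ^ (ε/(J+1)) := isLittleO_log_rpow_atTop (by positivity)
    have h3 : (fun _ : ℝ => (1:ℝ)) =o[Filter.atTop] fun L : ℝ => L ^ (ε/(J+1)) :=
      Asymptotics.isLittleO_const_left.mpr (Or.inr (by
        have := tendsto_rpow_atTop (show 0 < ε/((J:ℝ)+1) by positivity)
        exact tendsto_norm_atTop_atTop.comp this))
    have h4 := (h3.add (h2.const_mul_left A)).isBigO.pow J
    have h6 := (h4.mul_isLittleO h3).const_mul_left C
    refine h6.congr' (Filter.Eventually.of_forall fun L => by simp) ?_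
    filter_upwards [Filter.eventually_gt_atTop (0:ℝ)] with L hL
    rw [← pow_succ, ← Real.rpow_natCast, ← Real.rpow_mul hL.le]; congr 1; push_cast; field_simp
  have h2 := h1.bound (zero_lt_one)
  filter_upwards [h2, Filter.eventually_ge_atTop (0:ℝ)] with L h hL
  rw [one_mul, Real.norm_of_nonneg (Real.rpow_nonneg hL _)] at h
  exact (Real.le_norm_self _).trans h


theorem small_cond (A : ℝ) (hA : 0 ≤ A) (B : ℕ) : ∀ᶠ L : ℝ in Filter.atTop, ∀ c : PC, 1 < c.1 → (c.1:ℝ) ≤ L ^ A →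
    c.2.IsPrimitive → NonExc L c → ‖TL L c.ev‖ ≤ L ^ (-(B:ℝ)) := by
  set J : ℕ := 5 * (B+2) with hJ
  set M : ℕ := 20 * (B+3) with hM
  obtain ⟨H, hHc, hHM, hHi, hrep⟩ := bumpJ_fourier J
  choose Cf hCf1 hCf using f_bound
  obtain ⟨D, hD, hleib⟩ := leibniz_bound J
  obtain ⟨Cs, hCs, hsup⟩ := gL_sup J
  set C0 : ℝ := ∑ i ∈ range (J+2), Cf i with hC0
  have hCfle : ∀ i ≤ J+1, Cf i ≤ C0 := fun i hi =>
    single_le_sum (f := Cf) (fun j _ => by linarith [hCf1 j]) (mem_range.mpr (by omega))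
  set I0 := ∫ t, ‖H t‖
  set IM := ∫ t, |t|^M * ‖H t‖
  have hI0 : 0 ≤ I0 := integral_nonneg fun _ => norm_nonneg _
  have hIM : 0 ≤ IM := integral_nonneg fun _ => by positivity
  filter_upwards [log_pow_ev (2*C0) A (1/20) (by norm_num) (J+2), log_pow_ev (2 * Real.pi) 0 (3/20) (by norm_num) 0,
    Filter.eventually_ge_atTop (1:ℝ), Filter.eventually_ge_atTop (D * I0 + Cs * IM)] with L hL1 hL2 hL hL3 c hc1 hcA hprim hne
  have hL0 : 0 < L := by linarith
  have hlogL : 0 ≤ Real.log L := Real.log_nonneg hL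
  set Y : ℝ := C0 * (1 + A * Real.log L)^(J+2) with hY
  have hC01 : 1 ≤ C0 := (hCf1 0).trans (hCfle 0 (by omega))
  have hbase : 1 ≤ 1 + A * Real.log L := by nlinarith
  have hY1 : 1 ≤ Y := by
    have : 1 ≤ (1 + A * Real.log L)^(J+2) := one_le_pow₀ hbase
    nlinarith
  have hYL : 2 * Y ≤ L ^ (1/20 : ℝ) := by rw [hY]; linarith
  have hlogq : Real.log c.1 ≤ A * Real.log L := by
    rw [← Real.log_rpow hL0]
    exact Real.log_le_log (by positivity) hcA
  have hlq0 : 0 ≤ Real.log (c.1:ℝ) := Real.log_natCast_nonneg _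
  have hL1' : 0 < 1/L := by positivity
  have hL1'' : 1/L ≤ 1 := by rw [div_le_one hL0]; exact hL
  have hfY : ∀ i ≤ J+1, ∀ s : ℂ, s.re = 1 + 1/L → |s.im| ≤ 1 → ‖fL c i s‖ ≤ Y := by
    intro i hi s hs hsi
    refine (hCf i c.ev c.1 hc1 c.ev_le (nontriv_partial c hc1 hprim) s (by linarith) (by linarith) hsi).trans ?_
    rw [hY]
    refine mul_le_mul (hCfle i hi) ?_ (by positivity) (by linarith)
    exact (pow_le_pow_left₀ (by positivity) (by linarith) _).trans (pow_le_pow_right₀ hbase (by omega))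
  set δ : ℝ := L ^ (-(3/4):ℝ) / 2 with hδ
  have hδ0 : 0 < δ := by positivity
  have hδ1 : δ ≤ 1 := by
    have : L ^ (-(3/4):ℝ) ≤ 1 := Real.rpow_le_one_of_one_le_of_nonpos hL (by norm_num)
    rw [hδ]; linarith
  have hpi : 2 * Real.pi ≤ L ^ (3/20:ℝ) := by simpa using hL2
  have hYδ : Y / δ ≤ L ^ (4/5 : ℝ) := by
    rw [div_le_iff₀ hδ0, hδ, ← mul_div_assoc, ← Real.rpow_add hL0]
    norm_num
    norm_num at hYL
    linarith
  -- near part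
  have hnear : ∀ t : ℝ, |t| ≤ L ^ (1/20:ℝ) → ‖gL c J (sT L t)‖ ≤ D * L ^ (4/5 * (J+1) : ℝ) := by
    intro t ht
    have h1 : 2 * Real.pi * |t| ≤ L ^ (1/5:ℝ) := by
      calc _ ≤ L ^ (3/20:ℝ) * L ^ (1/20:ℝ) := mul_le_mul hpi ht (abs_nonneg _) (by positivity)
        _ = _ := by rw [← Real.rpow_add hL0]; norm_num
    have h2 : L ^ (1/5:ℝ) ≤ L := by
      calc _ ≤ L ^ (1:ℝ) := Real.rpow_le_rpow_of_exponent_le hL (by norm_num)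
        _ = L := Real.rpow_one L
    have h3 := fL_deriv_diff c L t Y hL (h1.trans h2) (hfY 1 (by omega))
    have h4 : Y * (2 * Real.pi * |t| / L) ≤ δ := by
      calc Y * (2 * Real.pi * |t| / L) ≤ (L ^ (1/20:ℝ)/2) * (L ^ (1/5:ℝ) / L) := by
            refine mul_le_mul (by linarith) (div_le_div_of_nonneg_right h1 hL0.le) (by positivity) (by positivity)
        _ = (L ^ (1/20:ℝ) * (L ^ (1/5:ℝ) * L ^ (-1:ℝ)))/2 := by rw [Real.rpow_neg_one]; ring
        _ = (L ^ (-(3/4):ℝ))/2 := by rw [← Real.rpow_add hL0, ← Real.rpow_add hL0]; norm_num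
    have h5 : δ ≤ ‖fL c 0 (sT L t)‖ := by
      have h6 := norm_sub_norm_le (fL c 0 (sT L 0)) (fL c 0 (sT L t))
      rw [norm_sub_rev] at h6
      have h7 : L ^ (-(3/4):ℝ) ≤ ‖fL c 0 (sT L 0)‖ := hne
      have h8 : L ^ (-(3/4):ℝ) = 2 * δ := by rw [hδ]; ring
      linarith
    have him : |(sT L t).im| ≤ 1 := by
      rw [sT_im, abs_neg, abs_div, abs_of_pos hL0, div_le_one hL0, abs_mul, abs_of_pos (by positivity : 0 < 2 * Real.pi)]
      exact h1.trans h2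
    have hre : 1 < (sT L t).re := by rw [sT_re]; linarith
    have h6 := hleib (fun i => fL c i (sT L t)) (fun i => gL c i (sT L t)) Y δ hY1 hδ0 hδ1
      (fun i => leibniz c i _ hre) (fun i hi => hfY i hi _ (sT_re _ _) him) h5 J le_rfl
    refine h6.trans (mul_le_mul_of_nonneg_left ?_ (by linarith))
    calc (Y/δ)^(J+1) ≤ (L ^ (4/5:ℝ))^(J+1) := pow_le_pow_left₀ (by positivity) hYδ _
      _ = _ := by rw [← Real.rpow_natCast, ← Real.rpow_mul hL0.le]; push_cast; rfl
  have hall : ∀ t : ℝ, ‖gL c J (sT L t)‖ ≤ D * L ^ (4/5 * (J+1) : ℝ) + Cs * L^(J+2) * L ^ (-(M:ℝ)/20) * |t|^M := by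
    intro t
    rcases le_or_gt |t| (L ^ (1/20:ℝ)) with h | h
    · exact (hnear t h).trans (le_add_of_nonneg_right (by positivity))
    · refine ((hsup L hL c _ (sT_re _ _)).1).trans ?_
      have h1 : 1 ≤ L ^ (-(M:ℝ)/20) * |t|^M := by
        calc (1:ℝ) = L ^ (-(M:ℝ)/20) * (L ^ (1/20:ℝ))^M := by
              rw [← Real.rpow_natCast, ← Real.rpow_mul hL0.le, ← Real.rpow_add hL0]; ring_nf; simp
          _ ≤ _ := mul_le_mul_of_nonneg_left (pow_le_pow_left₀ (by positivity) h.le _) (by positivity)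
      have h2 : 0 ≤ Cs * L^(J+2) := by positivity
      have h3 : 0 ≤ D * L ^ (4/5 * (J+1) : ℝ) := by positivity
      rw [mul_assoc]
      have := mul_le_mul_of_nonneg_left h1 h2
      linarith
  have hTI := TL_integral L hL c J H hHc hHi hrep
  have hb : L^J * ‖TL L c.ev‖ ≤ D * L ^ (4/5 * (J+1) : ℝ) * I0 + Cs * L^(J+2) * L ^ (-(M:ℝ)/20) * IM := by
    have e1 : L^J * ‖TL L c.ev‖ = ‖(L:ℂ)^J * TL L c.ev‖ := by
      rw [norm_mul, norm_pow, Complex.norm_real, Real.norm_of_nonneg hL0.le]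
    rw [e1, hTI]
    have e2 : D * L ^ (4/5 * (J+1) : ℝ) * I0 + Cs * L^(J+2) * L ^ (-(M:ℝ)/20) * IM =
        ∫ t, (D * L ^ (4/5 * (J+1) : ℝ) * ‖H t‖ + Cs * L^(J+2) * L ^ (-(M:ℝ)/20) * (|t|^M * ‖H t‖)) := by
      rw [integral_add (hHi.norm.const_mul _) ((hHM M).const_mul _), integral_const_mul, integral_const_mul]
    rw [e2]
    refine norm_integral_le_of_norm_le ((hHi.norm.const_mul _).add ((hHM M).const_mul _)) (Filter.Eventually.of_forall fun t => ?_)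
    rw [norm_mul]
    calc _ ≤ ‖H t‖ * (D * L ^ (4/5 * (J+1) : ℝ) + Cs * L^(J+2) * L ^ (-(M:ℝ)/20) * |t|^M) :=
          mul_le_mul_of_nonneg_left (hall t) (norm_nonneg _)
      _ = _ := by ring
  have hJr : (J:ℝ) = 5 * (B+2) := by rw [hJ]; push_cast; ring
  have hMr : (M:ℝ) = 20 * (B+3) := by rw [hM]; push_cast; ring
  have p1 : L ^ (4/5 * (J+1) : ℝ) ≤ L^J * L ^ (-(B:ℝ) - 1) := by
    rw [← Real.rpow_natCast, ← Real.rpow_add hL0]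
    refine Real.rpow_le_rpow_of_exponent_le hL ?_
    rw [hJr]; linarith
  have p2 : L^(J+2) * L ^ (-(M:ℝ)/20) ≤ L^J * L ^ (-(B:ℝ) - 1) := by
    rw [← Real.rpow_natCast, ← Real.rpow_natCast, ← Real.rpow_add hL0, ← Real.rpow_add hL0]
    refine Real.rpow_le_rpow_of_exponent_le hL ?_
    rw [hMr]; push_cast; linarith
  have hb2 : L^J * ‖TL L c.ev‖ ≤ L^J * (L ^ (-(B:ℝ) - 1) * (D * I0 + Cs * IM)) := by
    calc _ ≤ _ := hb
      _ ≤ D * (L^J * L ^ (-(B:ℝ) - 1)) * I0 + Cs * (L^J * L ^ (-(B:ℝ) - 1)) * IM := by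
          refine add_le_add (mul_le_mul_of_nonneg_right (mul_le_mul_of_nonneg_left p1 (by linarith)) hI0)
            (mul_le_mul_of_nonneg_right ?_ hIM)
          rw [mul_assoc]; exact mul_le_mul_of_nonneg_left p2 hCs
      _ = _ := by ring
  have hb3 := le_of_mul_le_mul_left hb2 (by positivity)
  refine hb3.trans ?_
  calc _ ≤ L ^ (-(B:ℝ) - 1) * L := mul_le_mul_of_nonneg_left hL3 (by positivity)
    _ = L ^ (-(B:ℝ) - 1) * L ^ (1:ℝ) := by rw [Real.rpow_one]
    _ = _ := by rw [← Real.rpow_add hL0]; congr 1; ring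

end OIR
end

section
open Finset MeasureTheory
open scoped ArithmeticFunction.vonMangoldt
namespace OIR

theorem prim_pair_char (c d : PC) :
    ∃ χ : DirichletCharacter ℂ (c.1 * d.1), ∀ n : ℕ, c.ev n * (starRingEnd ℂ) (d.ev n) = χ (n : ZMod (c.1 * d.1)) := by
  set χ1 := DirichletCharacter.changeLevel (Dvd.intro d.1 rfl : c.1 ∣ c.1 * d.1) c.2
  set χ2 := DirichletCharacter.changeLevel (Dvd.intro_left c.1 rfl : d.1 ∣ c.1 * d.1) d.2
  refine ⟨χ1 * χ2⁻¹, fun n => ?_⟩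
  by_cases hn : n.Coprime (c.1 * d.1)
  · rw [MulChar.mul_apply, ← MulChar.star_apply']
    have h1 := changeLevel_nat (Dvd.intro d.1 rfl : c.1 ∣ c.1 * d.1) c.2 n hn
    have h2 := changeLevel_nat (Dvd.intro_left c.1 rfl : d.1 ∣ c.1 * d.1) d.2 n hn
    simp only [χ1, χ2]
    rw [h1, h2]; rfl
  · rw [MulChar.map_nonunit _ (fun h => hn ((ZMod.isUnit_iff_coprime _ _).mp h))]
    rw [Nat.coprime_mul_iff_right, not_and_or] at hn
    rcases hn with hn | hn
    · rw [PC.ev_zero c n hn, zero_mul]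
    · rw [PC.ev_zero d n hn]; simp

theorem norm_L_exp (L : ℝ) (hL : 1 ≤ L) (c : PC) : ∃ x : ℝ, ‖LSeries c.ev (sT L 0)‖ = Real.exp x ∧
    HasSum (fun n : ℕ => (c.ev n).re * (Λ n / Real.log n * (n:ℝ)^(-(1+1/L)))) x := by
  have hL0 : 0 < 1/L := by positivity
  have hs : 1 < (sT L 0).re := by rw [sT_re]; linarith
  have h := DirichletCharacter.LSeries_eq_exp_LSeries (χ := c.2) hs
  set g : ℕ → ℂ := fun n => c.2 n * Λ n / Real.log n with hg
  refine ⟨(LSeries g (sT L 0)).re, ?_, ?_⟩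
  · rw [← Complex.norm_exp, h]; rfl
  have hb : ∀ n, ‖g n‖ ≤ 1 := by
    intro n
    simp only [hg]
    rw [norm_div, norm_mul, Complex.norm_real, Complex.norm_real, Real.norm_of_nonneg ArithmeticFunction.vonMangoldt_nonneg,
      Real.norm_of_nonneg (Real.log_natCast_nonneg n)]
    refine div_le_one_of_le₀ ?_ (Real.log_natCast_nonneg n)
    exact (mul_le_mul (c.ev_le n) ArithmeticFunction.vonMangoldt_le_log ArithmeticFunction.vonMangoldt_nonneg zero_le_one).trans (by simp)
  have hsum : LSeriesSummable g (sT L 0) := by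
    apply LSeriesSummable_of_abscissaOfAbsConv_lt_re
    exact (summable_bdd g hb).trans_lt (by exact_mod_cast hs)
  have h2 := Complex.hasSum_re hsum.hasSum
  have e : (fun n : ℕ => (c.ev n).re * (Λ n / Real.log n * (n:ℝ)^(-(1+1/L)))) = fun n => (LSeries.term g (sT L 0) n).re := by
    funext n
    by_cases hn : n = 0
    · subst hn; simp
    have hn1 : (0:ℝ) < n := by exact_mod_cast Nat.pos_of_ne_zero hn
    have h3 := term_phi g 0 n hn (sT L 0)
    simp only [Function.iterate_zero, id] at h3
    have h4 : phi 0 (sT L 0) n = (((n:ℝ)^(-(1+1/L)) : ℝ) : ℂ) := by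
      unfold phi sT
      rw [Real.rpow_def_of_pos hn1]
      push_cast
      simp
      congr 1; ring
    have h5 : g n = c.ev n * ((Λ n / Real.log n : ℝ) : ℂ) := by
      simp only [hg, PC.ev]; push_cast; ring
    rw [h3, h4, h5, mul_assoc, ← Complex.ofReal_mul, Complex.re_mul_ofReal]
  rw [e]; exact h2

theorem re_comb (z w : ℂ) (hz : ‖z‖ ≤ 1) (hw : ‖w‖ ≤ 1) :
    0 ≤ 17 + 12 * z.re + 12 * w.re + 8 * (z * (starRingEnd ℂ) w).re := by
  have h1 : z.re^2 + z.im^2 ≤ 1 := by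
    have := Complex.sq_norm z; rw [Complex.normSq_apply] at this; nlinarith [norm_nonneg z]
  have h2 : w.re^2 + w.im^2 ≤ 1 := by
    have := Complex.sq_norm w; rw [Complex.normSq_apply] at this; nlinarith [norm_nonneg w]
  simp only [Complex.mul_re, Complex.conj_re, Complex.conj_im]
  nlinarith [sq_nonneg (3 + 2 * z.re + 2 * w.re), sq_nonneg (2 * z.im + 2 * w.im)]

theorem zeta_triv (L : ℝ) (hL : 1 ≤ L) : ‖LSeries (PC.ev ⟨1, 1⟩) (sT L 0)‖ ≤ 1 + L := by
  obtain ⟨z1, z2⟩ := zeta_bound (1/L) (by positivity)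
  have ht : ∀ n, ‖LSeries.term (PC.ev ⟨1, 1⟩) (sT L 0) n‖ ≤ (n:ℝ)^(-1-1/L) := by
    intro n
    by_cases hn : n = 0
    · subst hn; simp; positivity
    have hn1 : (1:ℝ) ≤ n := by exact_mod_cast Nat.pos_of_ne_zero hn
    have h3 := term_phi (PC.ev ⟨1, 1⟩) 0 n hn (sT L 0)
    simp only [Function.iterate_zero, id] at h3
    rw [h3, norm_mul, phi_norm _ _ _ hn1, sT_re, pow_zero, one_mul, neg_add', ]
    exact mul_le_of_le_one_left (by positivity) (PC.ev_le _ _)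
  have hS := Summable.of_nonneg_of_le (fun _ => norm_nonneg _) ht z1
  calc _ ≤ ∑' n, ‖LSeries.term (PC.ev ⟨1, 1⟩) (sT L 0) n‖ := norm_tsum_le_tsum_norm hS
    _ ≤ _ := hS.tsum_le_tsum ht z1
    _ ≤ _ := z2.trans (by rw [one_div_one_div])

theorem prod_ge_one (L : ℝ) (hL : 1 ≤ L) (c d e : PC) (he : ∀ n, e.ev n = c.ev n * (starRingEnd ℂ) (d.ev n)) :
    1 ≤ ‖LSeries (PC.ev ⟨1, 1⟩) (sT L 0)‖^17 * ‖LSeries c.ev (sT L 0)‖^12 * ‖LSeries d.ev (sT L 0)‖^12 *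
      ‖LSeries e.ev (sT L 0)‖^8 := by
  obtain ⟨x1, h1, s1⟩ := norm_L_exp L hL ⟨1, 1⟩
  obtain ⟨x2, h2, s2⟩ := norm_L_exp L hL c
  obtain ⟨x3, h3, s3⟩ := norm_L_exp L hL d
  obtain ⟨x4, h4, s4⟩ := norm_L_exp L hL e
  rw [h1, h2, h3, h4, ← Real.exp_nat_mul, ← Real.exp_nat_mul, ← Real.exp_nat_mul, ← Real.exp_nat_mul, ← Real.exp_add,
    ← Real.exp_add, ← Real.exp_add]
  refine Real.one_le_exp ?_
  have hs := (((s1.mul_left 17).add (s2.mul_left 12)).add (s3.mul_left 12)).add (s4.mul_left 8)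
  push_cast
  refine hs.nonneg fun n => ?_
  have hone : (PC.ev ⟨1, 1⟩ n : ℂ) = 1 := by
    unfold PC.ev
    exact MulChar.one_apply (isUnit_of_subsingleton _)
  rw [hone, he]
  have := re_comb _ _ (c.ev_le n) (d.ev_le n)
  have h0 : 0 ≤ Λ n / Real.log n * (n:ℝ)^(-(1+1/L)) := by
    have := @ArithmeticFunction.vonMangoldt_nonneg n
    have := Real.log_natCast_nonneg n
    positivity
  have := mul_nonneg this h0
  simp only [Complex.one_re]
  linarith

theorem exc_unique (A : ℝ) (hA : 0 ≤ A) : ∀ᶠ L : ℝ in Filter.atTop, ∀ c d : PC, 1 < c.1 → 1 < d.1 →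
    (c.1:ℝ) ≤ L ^ A → (d.1:ℝ) ≤ L ^ A → c.2.IsPrimitive → d.2.IsPrimitive → ¬ NonExc L c → ¬ NonExc L d → c = d := by
  obtain ⟨C, hC1, hC⟩ := f_bound 0
  filter_upwards [log_pow_ev (2^17 * C^8) (2*A) (1/2) (by norm_num) 8, Filter.eventually_gt_atTop (1:ℝ)] with
    L hL hL1 c d hc hd hcA hdA pc pd nc nd
  by_contra hne
  have hL0 : 0 < L := by linarith
  obtain ⟨χ, hχ⟩ := prim_pair_char c d
  have hpos : 1 < c.1 * d.1 := Nat.lt_of_lt_of_le hc (Nat.le_mul_of_pos_right _ (by omega))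
  set e : PC := ⟨c.1 * d.1, χ⟩ with he
  have hee : ∀ n, e.ev n = c.ev n * (starRingEnd ℂ) (d.ev n) := fun n => (hχ n).symm
  have hprod := prod_ge_one L hL1.le c d e hee
  have hL1' : 0 < 1/L := by positivity
  have hL1'' : 1/L ≤ 1 := by rw [div_le_one hL0]; exact hL1.le
  have h4 : ‖LSeries e.ev (sT L 0)‖ ≤ C * (1 + 2 * A * Real.log L) := by
    have := hC e.ev (c.1 * d.1) hpos e.ev_le (fun N => by
      simp only [hee]
      exact prim_pair_partial c d (by omega) (by omega) pc pd hne N) (sT L 0) (by rw [sT_re]; linarith)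
      (by rw [sT_re]; linarith) (by rw [sT_im]; simp)
    simp only [Function.iterate_zero, id, zero_add, pow_one] at this
    refine this.trans (mul_le_mul_of_nonneg_left ?_ (by linarith))
    push_cast
    rw [Real.log_mul (by positivity) (by positivity)]
    have l1 : Real.log c.1 ≤ A * Real.log L := by
      rw [← Real.log_rpow hL0]; exact Real.log_le_log (by positivity) hcA
    have l2 : Real.log d.1 ≤ A * Real.log L := by
      rw [← Real.log_rpow hL0]; exact Real.log_le_log (by positivity) hdA
    linarith
  have h1 : ‖LSeries (PC.ev ⟨1, 1⟩) (sT L 0)‖ ≤ 2 * L := (zeta_triv L hL1.le).trans (by linarith)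
  have h2 : ‖LSeries c.ev (sT L 0)‖ ≤ L ^ (-(3/4):ℝ) := (not_le.mp nc).le
  have h3 : ‖LSeries d.ev (sT L 0)‖ ≤ L ^ (-(3/4):ℝ) := (not_le.mp nd).le
  have hlog : 0 ≤ Real.log L := Real.log_nonneg hL1.le
  have : (1:ℝ) ≤ (2*L)^17 * (L ^ (-(3/4):ℝ))^12 * (L ^ (-(3/4):ℝ))^12 * (C * (1 + 2 * A * Real.log L))^8 := by
    refine hprod.trans ?_
    gcongr
  have e1 : (2*L)^17 * (L ^ (-(3/4):ℝ))^12 * (L ^ (-(3/4):ℝ))^12 * (C * (1 + 2 * A * Real.log L))^8 =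
      L ^ (-1:ℝ) * (2^17 * C^8 * (1 + 2 * A * Real.log L)^8) := by
    have : (L ^ (-(3/4):ℝ))^12 * (L ^ (-(3/4):ℝ))^12 = L ^ (-18:ℝ) := by
      rw [← pow_add, ← Real.rpow_natCast, ← Real.rpow_mul hL0.le]; norm_num
    have h5 : L^17 * L ^ (-18:ℝ) = L ^ (-1:ℝ) := by
      rw [← Real.rpow_natCast, ← Real.rpow_add hL0]; norm_num
    rw [← h5, ← this]; ring
  rw [e1] at this
  have h6 : L ^ (-1:ℝ) * (2^17 * C^8 * (1 + 2 * A * Real.log L)^8) ≤ L ^ (-(1/2):ℝ) := by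
    calc _ ≤ L ^ (-1:ℝ) * L ^ (1/2:ℝ) := mul_le_mul_of_nonneg_left hL (by positivity)
      _ = _ := by rw [← Real.rpow_add hL0]; norm_num
  have h7 : L ^ (-(1/2):ℝ) < 1 := Real.rpow_lt_one_of_one_lt_of_neg hL1 (by norm_num)
  linarith

theorem exc_large (Q : ℕ) : ∀ᶠ L : ℝ in Filter.atTop, ∀ c : PC, 1 < c.1 → c.1 ≤ Q → c.2.IsPrimitive → NonExc L c := by
  have key : ∀ q ∈ Icc 2 Q, ∀ᶠ L : ℝ in Filter.atTop, ∀ χ : DirichletCharacter ℂ q, χ ≠ 1 → NonExc L ⟨q, χ⟩ := by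
    intro q hq
    rw [mem_Icc] at hq
    have : NeZero q := ⟨by omega⟩
    rw [Filter.eventually_all]
    intro χ
    by_cases hχ : χ = 1
    · exact Filter.Eventually.of_forall fun _ h => absurd hχ h
    have hne : DirichletCharacter.LFunction χ 1 ≠ 0 := DirichletCharacter.LFunction_ne_zero_of_one_le_re χ (Or.inl hχ) (by simp)
    have hcont := (DirichletCharacter.differentiable_LFunction hχ).continuous
    have hs : Filter.Tendsto (fun L : ℝ => sT L 0) Filter.atTop (nhds 1) := by
      have h1 : Filter.Tendsto (fun L : ℝ => ((1 + 1/L : ℝ):ℂ)) Filter.atTop (nhds ((1 + 0 : ℝ):ℂ)) := by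
        refine (Complex.continuous_ofReal.tendsto _).comp (tendsto_const_nhds.add ?_)
        exact (tendsto_inv_atTop_zero (𝕜 := ℝ)).congr fun x => (one_div x).symm
      simpa [sT] using h1
    have h1 : Filter.Tendsto (fun L : ℝ => ‖DirichletCharacter.LFunction χ (sT L 0)‖) Filter.atTop (nhds ‖DirichletCharacter.LFunction χ 1‖) := ((hcont.tendsto 1).comp hs).norm
    have h2 : Filter.Tendsto (fun L : ℝ => L ^ (-(3/4) : ℝ)) Filter.atTop (nhds 0) := tendsto_rpow_neg_atTop (show (0:ℝ) < 3/4 by norm_num)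
    have hev := Filter.Tendsto.eventually_lt h2 h1 (norm_pos_iff.mpr hne)
    filter_upwards [hev, Filter.eventually_ge_atTop (1:ℝ)] with L hL hL1 _
    have hL0 : 0 < 1/L := by positivity
    have h3 := DirichletCharacter.LFunction_eq_LSeries χ (s := sT L 0) (by rw [sT_re]; linarith)
    rw [h3] at hL
    exact hL.le
  rw [← Filter.eventually_all_finset] at key
  filter_upwards [key] with L hL c hc hcQ hp
  have := hL c.1 (mem_Icc.mpr ⟨hc, hcQ⟩) c.2 ?_
  · exact this
  · intro h
    have : NeZero c.1 := ⟨by omega⟩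
    rw [DirichletCharacter.eq_one_iff_conductor_eq_one] at h
    rw [DirichletCharacter.isPrimitive_def] at hp
    omega

end OIR
end

section
open Finset MeasureTheory
open ArithmeticFunction (vonMangoldt moebius)
namespace OIR

/-- prime weight -/
noncomputable def pw (L : ℝ) (n : ℕ) : ℝ := if n.Prime then Real.log n * wt L n else 0

theorem pw_nonneg (L : ℝ) (n : ℕ) : 0 ≤ pw L n := by
  unfold pw; split_ifs
  · exact mul_nonneg (Real.log_natCast_nonneg n) (wt_nonneg L n)
  · exact le_rfl

/-- prime sum twisted by e -/
noncomputable def TP (L : ℝ) (e : ℕ → ℂ) : ℂ := ∑ n ∈ Ioc 0 ⌊Real.exp L⌋₊, (pw L n : ℂ) * e n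

theorem abel_ineq (a : ℕ → ℝ) (ha : ∀ n, 0 ≤ a n) (N X : ℕ) (hN : 0 < N) (hNX : N ≤ X) :
    ∑ n ∈ Ioc N X, a n / n ≤ (∑ n ∈ Ioc 0 X, a n) / X + ∑ m ∈ Ico N X, (∑ n ∈ Ioc 0 m, a n) / (m * (m+1)) := by
  induction X, hNX using Nat.le_induction with
  | base => simp; exact div_nonneg (sum_nonneg fun n _ => ha n) (Nat.cast_nonneg _)
  | succ X hX ih =>
    rw [sum_Ioc_succ_top (by omega), sum_Ico_succ_top (by omega), sum_Ioc_succ_top (by omega)]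
    have hX0 : (0:ℝ) < X := by exact_mod_cast (by omega : 0 < X)
    have e : (∑ n ∈ Ioc 0 X, a n) / X = (∑ n ∈ Ioc 0 X, a n) / (X+1:ℝ) + (∑ n ∈ Ioc 0 X, a n) / (X * (X+1)) := by
      field_simp
    push_cast
    rw [add_div]
    linarith

theorem psi_theta_nat (n : ℕ) : ∑ m ∈ Ioc 0 n, (if m.Prime then 0 else vonMangoldt m) ≤ 2 * Real.sqrt n * Real.log n := by
  rcases Nat.eq_zero_or_pos n with rfl | hn
  · simp
  have h := Chebyshev.abs_psi_sub_theta_le_sqrt_mul_log (x := n) (by exact_mod_cast hn)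
  refine le_trans (le_of_eq ?_) ((le_abs_self _).trans h)
  unfold Chebyshev.psi Chebyshev.theta
  rw [Nat.floor_natCast, sum_filter, ← sum_sub_distrib]
  refine sum_congr rfl fun m _ => ?_
  split_ifs with h
  · rw [ArithmeticFunction.vonMangoldt_apply_prime h]; simp
  · simp

theorem pp_err : ∀ᶠ L : ℝ in Filter.atTop, ∑ n ∈ Ioc 0 ⌊Real.exp L⌋₊, (if n.Prime then 0 else vonMangoldt n) * wt L n ≤ Real.exp (-(L/5)) := by
  have hdec : Filter.Tendsto (fun L : ℝ => (4 * L * (2 + L)) * Real.exp (-(1/20 * L))) Filter.atTop (nhds 0) := by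
    have h : ∀ k : ℕ, Filter.Tendsto (fun L : ℝ => L^k * Real.exp (-(1/20 * L))) Filter.atTop (nhds 0) := by
      intro k
      have := tendsto_rpow_mul_exp_neg_mul_atTop_nhds_zero k (1/20) (by norm_num)
      simpa using this
    have := ((h 1).const_mul 8).add ((h 2).const_mul 4)
    simp only [mul_zero, add_zero] at this
    refine this.congr fun L => ?_
    ring
  have hev := hdec.eventually_lt_const (show (0:ℝ) < 1 by norm_num)
  filter_upwards [hev, Filter.eventually_ge_atTop (4:ℝ)] with L hL hL4
  set X := ⌊Real.exp L⌋₊ with hX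
  set N := ⌊Real.exp (L/2)⌋₊ with hN
  have hN1 : 1 ≤ N := Nat.le_floor (by simpa using (Real.one_le_exp (by linarith : 0 ≤ L/2)))
  have hNX : N ≤ X := Nat.floor_le_floor (Real.exp_le_exp.mpr (by linarith))
  set a : ℕ → ℝ := fun n => if n.Prime then 0 else vonMangoldt n with ha
  have ha0 : ∀ n, 0 ≤ a n := by
    intro n; simp only [ha]; split_ifs
    · exact le_rfl
    · exact ArithmeticFunction.vonMangoldt_nonneg
  have hXL : ∀ m : ℕ, m ≤ X → Real.log m ≤ L := by
    intro m hm
    rcases Nat.eq_zero_or_pos m with rfl | h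
    · simp; linarith
    rw [Real.log_le_iff_le_exp (by exact_mod_cast h)]
    exact (Nat.le_floor_iff (Real.exp_pos _).le).mp hm
  -- N ≥ exp(L/2)/2
  have hs : Real.exp (L/4) / 2 ≤ Real.sqrt N := by
    apply Real.le_sqrt_of_sq_le
    have h1 := Nat.lt_floor_add_one (Real.exp (L/2))
    have h2 : (Real.exp (L/4))^2 = Real.exp (L/2) := by rw [← Real.exp_nat_mul]; congr 1; push_cast; ring
    have h3 : (1:ℝ) ≤ N := by exact_mod_cast hN1
    rw [← hN] at h1
    rw [div_pow, h2]; linarith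
  have hs0 : 0 < Real.sqrt N := lt_of_lt_of_le (by positivity) hs
  have hA : ∀ m, N ≤ m → m ≤ X → (∑ n ∈ Ioc 0 m, a n) ≤ 2 * L / Real.sqrt N * m := by
    intro m hm hmX
    refine (psi_theta_nat m).trans ?_
    have h1 : Real.sqrt m ≤ m / Real.sqrt N := by
      rw [le_div_iff₀ hs0]
      calc Real.sqrt m * Real.sqrt N ≤ Real.sqrt m * Real.sqrt m := by gcongr
        _ = m := Real.mul_self_sqrt (Nat.cast_nonneg _)
    calc 2 * Real.sqrt m * Real.log m ≤ 2 * (m / Real.sqrt N) * L := by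
          gcongr; exact hXL m hmX
      _ = _ := by ring
  have h1 : ∑ n ∈ Ioc 0 X, a n * wt L n ≤ ∑ n ∈ Ioc N X, a n / n := by
    have hsub : Ioc N X ⊆ Ioc 0 X := Ioc_subset_Ioc_left (by omega)
    rw [← sum_subset hsub]
    · refine sum_le_sum fun n _ => ?_
      have := mul_le_mul_of_nonneg_left (wt_le L n) (ha0 n)
      rwa [mul_one_div] at this
    · intro n hn hn'
      rw [wt_zero_small L (by linarith) n, mul_zero]
      rw [mem_Ioc] at hn hn'
      have : n ≤ N := by omega
      exact (Nat.le_floor_iff (Real.exp_pos _).le).mp this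
  refine h1.trans ((abel_ineq a ha0 N X hN1 hNX).trans ?_)
  have hX0 : (0:ℝ) < X := by exact_mod_cast (by omega : 0 < X)
  have h2 : (∑ n ∈ Ioc 0 X, a n) / X ≤ 2 * L / Real.sqrt N := by
    rw [div_le_iff₀ hX0]; exact hA X hNX le_rfl
  have h3 : ∑ m ∈ Ico N X, (∑ n ∈ Ioc 0 m, a n) / (m * (m+1)) ≤ 2 * L / Real.sqrt N * (1 + L) := by
    calc _ ≤ ∑ m ∈ Ico N X, 2 * L / Real.sqrt N * (1 / (m:ℝ)) := by
          refine sum_le_sum fun m hm => ?_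
          rw [mem_Ico] at hm
          have hm0 : (0:ℝ) < m := by exact_mod_cast (by omega : 0 < m)
          rw [div_le_iff₀ (by positivity)]
          refine (hA m hm.1 hm.2.le).trans ?_
          have : 2 * L / Real.sqrt N * (1 / (m:ℝ)) * (m * (m+1)) = 2 * L / Real.sqrt N * (m+1) := by field_simp
          rw [this]
          have : 0 ≤ 2 * L / Real.sqrt N := by positivity
          nlinarith
      _ = 2 * L / Real.sqrt N * ∑ m ∈ Ico N X, (1 / (m:ℝ)) := by rw [mul_sum]
      _ ≤ 2 * L / Real.sqrt N * ∑ m ∈ Ioc 0 X, (1 / (m:ℝ)) := by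
          gcongr
          intro m hm; rw [mem_Ico] at hm; rw [mem_Ioc]; omega
      _ ≤ _ := by
          gcongr
          exact (sum_inv_le X).trans (by have := hXL X le_rfl; linarith)
  have h4 : 2 * L / Real.sqrt N ≤ 4 * L * Real.exp (-(L/4)) := by
    rw [div_le_iff₀ hs0]
    have : Real.exp (-(L/4)) * Real.exp (L/4) = 1 := by rw [← Real.exp_add]; simp
    calc 2 * L = 4 * L * Real.exp (-(L/4)) * (Real.exp (L/4)/2) := by linear_combination (-2*L) * this
      _ ≤ _ := by gcongr
  calc _ ≤ 2 * L / Real.sqrt N + 2 * L / Real.sqrt N * (1 + L) := add_le_add h2 h3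
    _ = 2 * L / Real.sqrt N * (2 + L) := by ring
    _ ≤ 4 * L * Real.exp (-(L/4)) * (2 + L) := by gcongr
    _ = (4 * L * (2+L)) * Real.exp (-(1/20*L)) * Real.exp (-(L/5)) := by
        have : Real.exp (-(L/4)) = Real.exp (-(1/20*L)) * Real.exp (-(L/5)) := by rw [← Real.exp_add]; congr 1; ring
        rw [this]; ring
    _ ≤ 1 * Real.exp (-(L/5)) := by
        gcongr
    _ = _ := one_mul _

theorem TP_TL (L : ℝ) (e : ℕ → ℂ) (he : ∀ n, ‖e n‖ ≤ 1) :
    ‖TP L e - TL L e‖ ≤ ∑ n ∈ Ioc 0 ⌊Real.exp L⌋₊, (if n.Prime then 0 else vonMangoldt n) * wt L n := by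
  unfold TP TL
  rw [← sum_sub_distrib]
  refine (norm_sum_le _ _).trans (sum_le_sum fun n _ => ?_)
  unfold pw
  split_ifs with h
  · rw [ArithmeticFunction.vonMangoldt_apply_prime h]
    rw [Complex.ofReal_mul, show ((Real.log n : ℝ) : ℂ) * wt L n * e n - (Real.log n : ℝ) * (e n * wt L n) = 0 by ring]
    simp
  · rw [Complex.ofReal_zero, zero_mul, zero_sub, norm_neg, norm_mul, norm_mul, Complex.norm_real, Complex.norm_real,
      Real.norm_of_nonneg ArithmeticFunction.vonMangoldt_nonneg, Real.norm_of_nonneg (wt_nonneg L n)]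
    have h0 : (0:ℝ) ≤ vonMangoldt n := ArithmeticFunction.vonMangoldt_nonneg
    have := mul_le_mul_of_nonneg_right (he n) (wt_nonneg L n)
    rw [one_mul] at this
    exact mul_le_mul_of_nonneg_left this h0

/-- discrepancy bound -/
noncomputable def DM (L : ℝ) (M : ℕ) [NeZero M] : ℝ :=
  (1 / (M.totient : ℝ)) * ∑ χ : DirichletCharacter ℂ M, if χ = 1 then 0 else ‖TP L (fun n => χ (n : ZMod M))‖

theorem DM_prog (L : ℝ) (M : ℕ) [NeZero M] (hL : 0 < L) (hM : (M : ℝ) ≤ Real.exp (L/2)) (a : ℕ) (ha : a.Coprime M) :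
    |∑ n ∈ (Ioc 0 ⌊Real.exp L⌋₊).filter (fun n : ℕ => (n : ZMod M) = a), pw L n
      - (1 / (M.totient : ℝ)) * ∑ n ∈ Ioc 0 ⌊Real.exp L⌋₊, pw L n| ≤ DM L M := by
  have hu : IsUnit (a : ZMod M) := (ZMod.isUnit_iff_coprime a M).mpr ha
  have hphi : (0:ℝ) < M.totient := by exact_mod_cast Nat.totient_pos.mpr (Nat.pos_of_ne_zero (NeZero.ne M))
  have hphi' : (M.totient : ℂ) ≠ 0 := by exact_mod_cast hphi.ne'
  have key : ∑ χ : DirichletCharacter ℂ M, χ (a : ZMod M)⁻¹ * TP L (fun n => χ (n : ZMod M))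
      = M.totient * (∑ n ∈ (Ioc 0 ⌊Real.exp L⌋₊).filter (fun n : ℕ => (n : ZMod M) = a), pw L n : ℝ) := by
    unfold TP
    simp_rw [mul_sum]
    rw [sum_comm]
    push_cast
    rw [mul_sum, sum_filter]
    refine sum_congr rfl fun n _ => ?_
    have := DirichletCharacter.sum_char_inv_mul_char_eq ℂ hu (n : ZMod M)
    calc _ = (pw L n : ℂ) * ∑ χ : DirichletCharacter ℂ M, χ (a : ZMod M)⁻¹ * χ n := by
          rw [mul_sum]; refine sum_congr rfl fun χ _ => by ring
      _ = _ := by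
          rw [this]
          by_cases h : (n : ZMod M) = a
          · rw [if_pos h.symm, if_pos h]; ring
          · rw [if_neg (fun h' => h h'.symm), if_neg h]; ring
  have h1 : (1 : DirichletCharacter ℂ M) (a : ZMod M)⁻¹ * TP L (fun n => (1 : DirichletCharacter ℂ M) (n : ZMod M)) = (∑ n ∈ Ioc 0 ⌊Real.exp L⌋₊, pw L n : ℝ) := by
    have hu' : IsUnit ((a : ZMod M)⁻¹) := by
      obtain ⟨u, hu⟩ := hu
      rw [← hu, ZMod.inv_coe_unit]; exact Units.isUnit _
    rw [MulChar.one_apply hu', one_mul]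
    unfold TP
    push_cast
    refine sum_congr rfl fun n _ => ?_
    by_cases hp : n.Prime
    · by_cases hn : (n : ℝ) ≤ Real.exp (L/2)
      · have : pw L n = 0 := by unfold pw; rw [if_pos hp, wt_zero_small L hL n hn, mul_zero]
        rw [this]; simp
      · have hc : n.Coprime M := by
          rw [hp.coprime_iff_not_dvd]
          intro hd
          have := Nat.le_of_dvd (Nat.pos_of_ne_zero (NeZero.ne M)) hd
          have : (n:ℝ) ≤ M := by exact_mod_cast this
          linarith
        rw [MulChar.one_apply ((ZMod.isUnit_iff_coprime n M).mpr hc), mul_one]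
    · have : pw L n = 0 := by unfold pw; rw [if_neg hp]
      rw [this]; simp
  rw [← sum_erase_add _ _ (mem_univ (1 : DirichletCharacter ℂ M)), h1] at key
  set P := ∑ n ∈ (Ioc 0 ⌊Real.exp L⌋₊).filter (fun n : ℕ => (n : ZMod M) = a), pw L n
  set G := ∑ n ∈ Ioc 0 ⌊Real.exp L⌋₊, pw L n
  have e : ((P - (1 / (M.totient : ℝ)) * G : ℝ) : ℂ) = (1 / (M.totient : ℝ) : ℝ) * ∑ χ ∈ univ.erase (1 : DirichletCharacter ℂ M), χ (a : ZMod M)⁻¹ * TP L (fun n => χ (n : ZMod M)) := by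
    have : ∑ χ ∈ univ.erase (1 : DirichletCharacter ℂ M), χ (a : ZMod M)⁻¹ * TP L (fun n => χ (n : ZMod M)) = M.totient * P - G := by
      linear_combination key
    rw [this]; push_cast; field_simp
  rw [← Real.norm_eq_abs, ← Complex.norm_real, e, norm_mul, Complex.norm_real, Real.norm_of_nonneg (by positivity)]
  unfold DM
  gcongr
  refine (norm_sum_le _ _).trans ?_
  rw [← sum_erase_add univ _ (mem_univ (1 : DirichletCharacter ℂ M)), if_pos rfl, add_zero]
  refine sum_le_sum fun χ hχ => ?_
  rw [if_neg (ne_of_mem_erase hχ), norm_mul]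
  exact mul_le_of_le_one_left (norm_nonneg _) (DirichletCharacter.norm_le_one χ _)

end OIR
end

section
open Finset MeasureTheory
namespace OIR

theorem sqfree_pow_sum (m f : ℕ) (hf : Squarefree f) :
    ((m+1:ℕ):ℝ) ^ f.primeFactors.card = ∑ d ∈ f.divisors, (m:ℝ) ^ d.primeFactors.card := by
  rw [← Nat.divisors_filter_squarefree_of_squarefree hf, Nat.sum_divisors_filter_squarefree hf.ne_zero]
  have h1 : (UniqueFactorizationMonoid.normalizedFactors f).toFinset = f.primeFactors := by
    ext p; rw [Nat.factors_eq]; simp [Nat.mem_primeFactors_of_ne_zero hf.ne_zero]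
  rw [h1]
  have := Finset.sum_pow_mul_eq_add_pow (m:ℝ) 1 f.primeFactors
  push_cast
  rw [← this]
  refine sum_congr rfl fun t ht => ?_
  rw [one_pow, mul_one]
  congr 2
  have h2 : t.val.prod = ∏ p ∈ t, p := by rw [Finset.prod_val]; rfl
  rw [h2, Nat.primeFactors_prod]
  intro p hp
  exact Nat.prime_of_mem_primeFactors (mem_powerset.mp ht hp)

theorem sqfree_sum (m X : ℕ) :
    ∑ f ∈ (Ioc 0 X).filter Squarefree, (m:ℝ) ^ f.primeFactors.card / f ≤ (∑ n ∈ Ioc 0 X, (1:ℝ)/n) ^ m := by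
  induction m with
  | zero =>
    rw [pow_zero]
    calc _ ≤ ∑ f ∈ ({1} : Finset ℕ), ((0:ℕ):ℝ) ^ f.primeFactors.card / f := by
          rw [← sum_filter_ne_zero]
          refine sum_le_sum_of_subset_of_nonneg ?_ fun _ _ _ => by positivity
          intro f hf
          rw [mem_filter, mem_filter, mem_Ioc] at hf
          obtain ⟨hf, h⟩ := hf
          rw [mem_singleton]
          by_contra h1
          apply h
          have : f.primeFactors.card ≠ 0 := by
            rw [Finset.card_ne_zero, Nat.nonempty_primeFactors]; omega
          simp [this]
      _ ≤ _ := by simp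
  | succ m ih =>
    have e : ∀ f ∈ (Ioc 0 X).filter Squarefree, ((m+1:ℕ):ℝ) ^ f.primeFactors.card / f =
        ∑ p ∈ f.divisorsAntidiagonal, ((m:ℝ) ^ p.1.primeFactors.card / p.1) * (1 / p.2) := by
      intro f hf
      rw [mem_filter] at hf
      rw [sqfree_pow_sum m f hf.2, sum_div, ← Nat.sum_divisorsAntidiagonal (fun d _ => (m:ℝ) ^ d.primeFactors.card / (f:ℝ))]
      refine sum_congr rfl fun p hp => ?_
      rw [Nat.mem_divisorsAntidiagonal] at hp
      rw [← hp.1]; push_cast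
      rw [div_mul_div_comm, mul_one]
    rw [sum_congr rfl e, pow_succ]
    have h1 : ∑ f ∈ (Ioc 0 X).filter Squarefree, ∑ p ∈ f.divisorsAntidiagonal, ((m:ℝ) ^ p.1.primeFactors.card / p.1) * (1 / p.2)
      = ∑ p ∈ ((Ioc 0 X).filter Squarefree).biUnion Nat.divisorsAntidiagonal, ((m:ℝ) ^ p.1.primeFactors.card / p.1) * (1 / p.2) := by
      rw [sum_biUnion]
      intro a _ b _ hab
      rw [Function.onFun, disjoint_left]
      intro p hp hp'
      rw [Nat.mem_divisorsAntidiagonal] at hp hp'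
      exact hab (hp.1.symm.trans hp'.1)
    rw [h1]
    calc _ ≤ ∑ p ∈ (Ioc 0 X).filter Squarefree ×ˢ Ioc 0 X, ((m:ℝ) ^ p.1.primeFactors.card / p.1) * (1 / p.2) := by
          refine sum_le_sum_of_subset_of_nonneg ?_ fun _ _ _ => by positivity
          intro p hp
          rw [mem_biUnion] at hp
          obtain ⟨f, hf, hp⟩ := hp
          rw [mem_filter, mem_Ioc] at hf
          rw [Nat.mem_divisorsAntidiagonal] at hp
          have h1 : p.1 ∣ f := Dvd.intro _ hp.1
          have h2 : p.2 ∣ f := Dvd.intro_left _ hp.1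
          rw [mem_product, mem_filter, mem_Ioc, mem_Ioc]
          have := Nat.le_of_dvd hf.1.1 h1
          have := Nat.le_of_dvd hf.1.1 h2
          have := Nat.pos_of_dvd_of_pos h1 hf.1.1
          have := Nat.pos_of_dvd_of_pos h2 hf.1.1
          exact ⟨⟨⟨by omega, by omega⟩, hf.2.squarefree_of_dvd h1⟩, by omega, by omega⟩
      _ = (∑ f ∈ (Ioc 0 X).filter Squarefree, (m:ℝ) ^ f.primeFactors.card / f) * ∑ n ∈ Ioc 0 X, (1:ℝ)/n := by
          rw [sum_mul_sum, sum_product]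
      _ ≤ _ := by gcongr

/-- m^ω(e)/e is O(e^(-1/2)) on squarefree e -/
theorem sqfree_half (m : ℕ) (hm : 1 ≤ m) (e : ℕ) (he : Squarefree e) :
    (m:ℝ) ^ e.primeFactors.card / e ≤ (m:ℝ) ^ (m^2) / Real.sqrt e := by
  have hm' : (1:ℝ) ≤ m := by exact_mod_cast hm
  have h1 : (e:ℝ) = ∏ p ∈ e.primeFactors, (p:ℝ) := by
    conv_lhs => rw [← Nat.prod_primeFactors_of_squarefree he]
    push_cast; rfl
  have hpos : (0:ℝ) < e := by exact_mod_cast Nat.pos_of_ne_zero he.ne_zero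
  have hs : Real.sqrt e = ∏ p ∈ e.primeFactors, Real.sqrt p := by
    rw [Real.sqrt_eq_iff_mul_self_eq hpos.le (prod_nonneg fun _ _ => Real.sqrt_nonneg _), ← prod_mul_distrib, h1]
    exact prod_congr rfl fun p _ => (Real.mul_self_sqrt (Nat.cast_nonneg p)).symm
  have h2 : (m:ℝ) ^ e.primeFactors.card ≤ (m:ℝ)^(m^2) * Real.sqrt e := by
    rw [hs, ← prod_const]
    calc ∏ _p ∈ e.primeFactors, (m:ℝ) ≤ ∏ p ∈ e.primeFactors, ((if p < m^2 then (m:ℝ) else 1) * Real.sqrt p) := by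
          refine prod_le_prod (fun _ _ => by positivity) fun p hp => ?_
          have hp1 : (1:ℝ) ≤ p := by exact_mod_cast (Nat.prime_of_mem_primeFactors hp).one_lt.le
          split_ifs with h
          · exact le_mul_of_one_le_right (by positivity) (Real.one_le_sqrt.mpr hp1)
          · rw [one_mul]
            apply Real.le_sqrt_of_sq_le
            push Not at h
            exact_mod_cast h
      _ = (∏ p ∈ e.primeFactors, (if p < m^2 then (m:ℝ) else 1)) * ∏ p ∈ e.primeFactors, Real.sqrt p := prod_mul_distrib
      _ ≤ _ := by
          gcongr
          rw [prod_ite, prod_const, prod_const_one, mul_one]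
          apply pow_le_pow_right₀ hm'
          calc _ ≤ (range (m^2)).card := card_le_card (by intro p hp; rw [mem_filter] at hp; exact mem_range.mpr hp.2)
            _ = _ := card_range _
  have hs0 : 0 < Real.sqrt e := Real.sqrt_pos.mpr hpos
  rw [div_le_div_iff₀ hpos hs0]
  calc _ ≤ (m:ℝ)^(m^2) * Real.sqrt e * Real.sqrt e := by gcongr
    _ = _ := by rw [mul_assoc, Real.mul_self_sqrt hpos.le]

theorem inv_phi_le (q : ℕ) (hq : Squarefree q) : (1:ℝ) / q.totient ≤ 2 ^ q.primeFactors.card / q := by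
  have hpos : (0:ℝ) < q := by exact_mod_cast Nat.pos_of_ne_zero hq.ne_zero
  have hphi : (0:ℝ) < q.totient := by exact_mod_cast Nat.totient_pos.mpr (Nat.pos_of_ne_zero hq.ne_zero)
  rw [div_le_div_iff₀ hphi hpos, one_mul]
  have : q ≤ 2 ^ q.primeFactors.card * q.totient := by
    have h1 := Nat.totient_eq_prod_factorization hq.ne_zero
    have h2 : q.totient = ∏ p ∈ q.primeFactors, (p - 1) := by
      have h3 := Nat.totient_mul_prod_primeFactors q
      rw [Nat.prod_primeFactors_of_squarefree hq, mul_comm] at h3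
      exact Nat.eq_of_mul_eq_mul_left (Nat.pos_of_ne_zero hq.ne_zero) h3
    rw [h2, ← prod_const, ← prod_mul_distrib]
    conv_lhs => rw [← Nat.prod_primeFactors_of_squarefree hq]
    refine prod_le_prod' fun p hp => ?_
    have := (Nat.prime_of_mem_primeFactors hp).two_le
    omega
  exact_mod_cast this

/-- primitive nontrivial characters of conductor at most Q -/
noncomputable def fam (Q : ℕ) : Finset PC := by
  classical
  exact ((range Q).biUnion fun i => (univ : Finset (DirichletCharacter ℂ (i+1))).image fun χ => (⟨i+1, χ⟩ : PC)).filter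
    fun c => 1 < c.1 ∧ c.2.IsPrimitive

theorem mem_fam (Q : ℕ) (c : PC) : c ∈ fam Q ↔ 1 < c.1 ∧ c.1 ≤ Q ∧ c.2.IsPrimitive := by
  unfold fam
  simp only [mem_filter, mem_biUnion, mem_range, mem_image, mem_univ, true_and]
  constructor
  · rintro ⟨⟨i, hi, χ, rfl⟩, h1, h2⟩
    exact ⟨h1, by simpa using hi, h2⟩
  · rintro ⟨h1, h2, h3⟩
    refine ⟨⟨c.1 - 1, by omega, ?_⟩, h1, h3⟩
    obtain ⟨q, χ⟩ := c
    obtain ⟨r, rfl⟩ : ∃ r, q = r + 1 := ⟨q - 1, by simp at h1; omega⟩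
    exact ⟨χ, rfl⟩

theorem card_fam (Q : ℕ) : (fam Q).card ≤ Q ^ 2 := by
  classical
  unfold fam
  refine (card_filter_le _ _).trans (card_biUnion_le.trans ?_)
  calc _ ≤ ∑ i ∈ range Q, Q := by
        refine sum_le_sum fun i hi => card_image_le.trans ?_
        rw [card_univ, ← Nat.card_eq_fintype_card, DirichletCharacter.card_eq_totient_of_hasEnoughRootsOfUnity]
        exact (Nat.totient_le _).trans (mem_range.mp hi)
    _ = _ := by simp [sq]

theorem TP_prim (L : ℝ) (M : ℕ) [NeZero M] (hL : 0 < L) (hM : (M : ℝ) ≤ Real.exp (L/2)) (χ : DirichletCharacter ℂ M) :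
    TP L (fun n => χ (n : ZMod M)) = TP L (PC.ev ⟨χ.conductor, χ.primitiveCharacter⟩) := by
  unfold TP
  refine sum_congr rfl fun n _ => ?_
  by_cases hp : n.Prime
  · by_cases hn : (n : ℝ) ≤ Real.exp (L/2)
    · have : pw L n = 0 := by unfold pw; rw [if_pos hp, wt_zero_small L hL n hn, mul_zero]
      rw [this]; simp
    · have hc : n.Coprime M := by
        rw [hp.coprime_iff_not_dvd]
        intro hd
        have := Nat.le_of_dvd (Nat.pos_of_ne_zero (NeZero.ne M)) hd
        have : (n:ℝ) ≤ M := by exact_mod_cast this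
        linarith
      congr 1
      have h1 := χ.changeLevel_primitiveCharacter
      have h2 := changeLevel_nat χ.conductor_dvd_level χ.primitiveCharacter n hc
      rw [h1] at h2
      exact h2
  · have : pw L n = 0 := by unfold pw; rw [if_neg hp]
    rw [this]; simp

theorem DM_le (L : ℝ) (M Q : ℕ) [NeZero M] (hL : 0 < L) (hM : (M : ℝ) ≤ Real.exp (L/2)) (hQ : M ≤ Q) :
    DM L M ≤ (1 / (M.totient : ℝ)) * ∑ c ∈ (fam Q).filter (fun c => c.1 ∣ M), ‖TP L c.ev‖ := by
  classical
  unfold DM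
  gcongr
  have hpos : 0 < M := Nat.pos_of_ne_zero (NeZero.ne M)
  calc _ = ∑ χ ∈ univ.filter (fun χ : DirichletCharacter ℂ M => χ ≠ 1), ‖TP L (PC.ev ⟨χ.conductor, χ.primitiveCharacter⟩)‖ := by
        rw [sum_filter]
        refine sum_congr rfl fun χ _ => ?_
        by_cases h : χ = 1
        · simp [h]
        · simp only [h, if_false, ne_eq, not_false_eq_true, if_true]
          rw [TP_prim L M hL hM χ]
    _ = ∑ c ∈ (univ.filter (fun χ : DirichletCharacter ℂ M => χ ≠ 1)).image (fun χ => (⟨χ.conductor, χ.primitiveCharacter⟩ : PC)), ‖TP L (PC.ev c)‖ := by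
        rw [sum_image]
        intro χ _ ψ _ h
        have hgen : ∀ (c : PC) (h1 : c.1 ∣ M) (d : PC) (h2 : d.1 ∣ M), c = d → DirichletCharacter.changeLevel h1 c.2 = DirichletCharacter.changeLevel h2 d.2 := by
          rintro c h1 d h2 rfl; rfl
        have := hgen _ χ.conductor_dvd_level _ ψ.conductor_dvd_level h
        simp only at this
        rwa [χ.changeLevel_primitiveCharacter, ψ.changeLevel_primitiveCharacter] at this
    _ ≤ _ := by
        refine sum_le_sum_of_subset_of_nonneg ?_ fun _ _ _ => norm_nonneg _
        intro c hc
        rw [mem_image] at hc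
        obtain ⟨χ, hχ, rfl⟩ := hc
        rw [mem_filter] at hχ
        rw [mem_filter, mem_fam]
        have hd := χ.conductor_dvd_level
        refine ⟨⟨?_, (Nat.le_of_dvd hpos hd).trans hQ, χ.primitiveCharacter_isPrimitive⟩, hd⟩
        have h0 := Nat.pos_of_dvd_of_pos hd hpos
        have h1 : χ.conductor ≠ 1 := fun h => hχ.2 (χ.eq_one_iff_conductor_eq_one.mpr h)
        show 1 < χ.conductor
        omega

/-- total version of DM -/
noncomputable def DZ (L : ℝ) (M : ℕ) : ℝ := if h : M = 0 then 0 else (have : NeZero M := ⟨h⟩; DM L M)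

theorem DZ_eq (L : ℝ) (M : ℕ) [NeZero M] : DZ L M = DM L M := by
  unfold DZ; rw [dif_neg (NeZero.ne M)]

end OIR
end

section
open Finset MeasureTheory
namespace OIR

theorem poly_exp_ev (K : ℝ) (n : ℕ) (c : ℝ) (hc : 0 < c) : ∀ᶠ L : ℝ in Filter.atTop, K * L ^ n * Real.exp (-(c * L)) ≤ 1 := by
  have h := (tendsto_rpow_mul_exp_neg_mul_atTop_nhds_zero n c hc).const_mul K
  rw [mul_zero] at h
  filter_upwards [h.eventually_le_const (show (0:ℝ) < 1 by norm_num)] with L hL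
  rw [Real.rpow_natCast, neg_mul] at hL
  rwa [mul_assoc]

theorem inner_sum (m X e : ℕ) (hm : 1 ≤ m) (he : 0 < e) (T : Finset ℕ) (hT : ∀ q ∈ T, q ∈ Ioc 0 X ∧ Squarefree q ∧ e ∣ q) :
    ∑ q ∈ T, (m:ℝ) ^ q.primeFactors.card / q ≤ (m:ℝ)^(m^2) / Real.sqrt e * (1 + Real.log X) ^ m := by
  have hR : 0 ≤ (m:ℝ)^(m^2) / Real.sqrt e * (1 + Real.log X) ^ m := by
    have := Real.log_natCast_nonneg X
    positivity
  rcases T.eq_empty_or_nonempty with rfl | ⟨q0, hq0⟩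
  · simpa using hR
  have hesq : Squarefree e := (hT q0 hq0).2.1.squarefree_of_dvd (hT q0 hq0).2.2
  calc ∑ q ∈ T, (m:ℝ) ^ q.primeFactors.card / q
      = ∑ q ∈ T, ((m:ℝ) ^ e.primeFactors.card / e) * ((m:ℝ) ^ (q/e).primeFactors.card / (q/e : ℕ)) := by
        refine sum_congr rfl fun q hq => ?_
        obtain ⟨h1, h2, f, rfl⟩ := hT q hq
        rw [Nat.mul_div_cancel_left _ he]
        have hcop : e.Coprime f := Nat.coprime_of_squarefree_mul h2
        rw [hcop.primeFactors_mul, card_union_of_disjoint hcop.disjoint_primeFactors, pow_add]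
        push_cast
        rw [div_mul_div_comm]
    _ = ((m:ℝ) ^ e.primeFactors.card / e) * ∑ f ∈ T.image (fun q => q / e), ((m:ℝ) ^ f.primeFactors.card / f) := by
        rw [← mul_sum, sum_image]
        intro q hq q' hq' h
        simp only at h
        obtain ⟨_, _, f, rfl⟩ := hT q hq
        obtain ⟨_, _, f', rfl⟩ := hT q' hq'
        rw [Nat.mul_div_cancel_left _ he, Nat.mul_div_cancel_left _ he] at h
        rw [h]
    _ ≤ ((m:ℝ) ^ e.primeFactors.card / e) * ∑ f ∈ (Ioc 0 X).filter Squarefree, ((m:ℝ) ^ f.primeFactors.card / f) := by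
        gcongr
        intro f hf
        rw [mem_image] at hf
        obtain ⟨q, hq, rfl⟩ := hf
        obtain ⟨h1, h2, f, rfl⟩ := hT q hq
        rw [Nat.mul_div_cancel_left _ he]
        rw [mem_Ioc] at h1
        rw [mem_filter, mem_Ioc]
        have hf0 : 0 < f := Nat.pos_of_mul_pos_left h1.1
        exact ⟨⟨hf0, (Nat.le_mul_of_pos_left f he).trans h1.2⟩, h2.squarefree_of_dvd (Dvd.intro_left _ rfl)⟩
    _ ≤ ((m:ℝ)^(m^2) / Real.sqrt e) * (1 + Real.log X) ^ m := by
        refine mul_le_mul (sqfree_half m hm e hesq) ((sqfree_sum m X).trans ?_) (sum_nonneg fun _ _ => by positivity) (by positivity)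
        gcongr
        exact sum_inv_le X

theorem BVa (W : ℕ) (hW : 0 < W) (C : ℕ) (hC : 1 ≤ C) (L : ℝ) (hL : 0 < L) (X : ℕ) (hX : Real.log X ≤ L) (hQ : ((W * X : ℕ) : ℝ) ≤ Real.exp (L/2))
    (S : Finset ℕ) (hS : ∀ q ∈ S, q ∈ Ioc 0 X ∧ Squarefree q ∧ q.Coprime W) :
    ∑ q ∈ S, (C:ℝ) ^ q.primeFactors.card * DZ L (W * q) ≤
      ((2*C:ℕ):ℝ)^((2*C)^2) * Real.sqrt W * (1 + L) ^ (2*C) *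
        ∑ c ∈ (fam (W*X)).filter (fun c => ∃ q ∈ S, c.1 ∣ W * q), ‖TP L c.ev‖ / Real.sqrt c.1 := by
  have h1 : ∀ q ∈ S, (C:ℝ) ^ q.primeFactors.card * DZ L (W * q) ≤
      ∑ c ∈ (fam (W*X)).filter (fun c => ∃ q ∈ S, c.1 ∣ W * q), if c.1 ∣ W * q then (((2*C:ℕ):ℝ) ^ q.primeFactors.card / q) * ‖TP L c.ev‖ else 0 := by
    intro q hq
    obtain ⟨hqX, hsq, hcop⟩ := hS q hq
    rw [mem_Ioc] at hqX
    have hMpos : 0 < W * q := Nat.mul_pos hW hqX.1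
    have : NeZero (W * q) := ⟨hMpos.ne'⟩
    have hMQ : W * q ≤ W * X := Nat.mul_le_mul_left _ hqX.2
    rw [DZ_eq]
    have h2 := DM_le L (W*q) (W*X) hL ((by exact_mod_cast hMQ : ((W*q:ℕ):ℝ) ≤ (W*X:ℕ)).trans hQ) hMQ
    have h3 : (1:ℝ) / (W*q).totient ≤ 2 ^ q.primeFactors.card / q := by
      refine le_trans ?_ (inv_phi_le q hsq)
      have hp : (0:ℝ) < q.totient := by exact_mod_cast Nat.totient_pos.mpr hqX.1
      apply one_div_le_one_div_of_le hp
      rw [Nat.totient_mul hcop.symm]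
      exact_mod_cast Nat.le_mul_of_pos_left _ (Nat.totient_pos.mpr hW)
    rw [← sum_filter, filter_filter]
    calc _ ≤ (C:ℝ) ^ q.primeFactors.card * ((2 ^ q.primeFactors.card / q) * ∑ c ∈ (fam (W*X)).filter (fun c => c.1 ∣ W*q), ‖TP L c.ev‖) := by
          gcongr
          refine h2.trans ?_
          gcongr
      _ = ∑ c ∈ (fam (W*X)).filter (fun c => c.1 ∣ W*q), (((2*C:ℕ):ℝ) ^ q.primeFactors.card / q) * ‖TP L c.ev‖ := by
          rw [← mul_sum]; push_cast; rw [mul_pow]; ring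
      _ = _ := by
          refine sum_congr ?_ fun _ _ => rfl
          ext c
          simp only [mem_filter]
          exact ⟨fun ⟨a, b⟩ => ⟨a, ⟨q, hq, b⟩, b⟩, fun ⟨a, _, b⟩ => ⟨a, b⟩⟩
  refine (sum_le_sum h1).trans ?_
  rw [sum_comm, mul_sum]
  refine sum_le_sum fun c hc => ?_
  rw [mem_filter, mem_fam] at hc
  rw [← sum_filter, ← sum_mul]
  have hc0 : 0 < c.1 := by omega
  set g := Nat.gcd c.1 W with hg
  have hg0 : 0 < g := Nat.gcd_pos_of_pos_left _ hc0
  have he : 0 < c.1 / g := Nat.div_pos (Nat.le_of_dvd hc0 (Nat.gcd_dvd_left _ _)) hg0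
  have h4 := inner_sum (2*C) X (c.1/g) (by omega) he (S.filter (fun q => c.1 ∣ W * q)) (by
    intro q hq
    rw [mem_filter] at hq
    refine ⟨(hS q hq.1).1, (hS q hq.1).2.1, ?_⟩
    have h5 : c.1 / g ∣ W / g * q := by
      rw [← Nat.mul_div_right_comm (Nat.gcd_dvd_right _ _)]
      exact Nat.div_dvd_div (Nat.gcd_dvd_left _ _) hq.2
    exact (Nat.coprime_div_gcd_div_gcd hg0).dvd_of_dvd_mul_left h5)
  have h6 : 1 / Real.sqrt (c.1/g : ℕ) ≤ Real.sqrt W / Real.sqrt c.1 := by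
    rw [← Real.sqrt_div (Nat.cast_nonneg _), ← Real.sqrt_one, ← Real.sqrt_div zero_le_one]
    apply Real.sqrt_le_sqrt
    rw [div_le_div_iff₀ (by exact_mod_cast he) (by exact_mod_cast hc0), one_mul]
    have : c.1 = g * (c.1 / g) := (Nat.mul_div_cancel' (Nat.gcd_dvd_left _ _)).symm
    have h7 : c.1 ≤ W * (c.1/g) := by
      conv_lhs => rw [this]
      exact Nat.mul_le_mul_right _ (Nat.le_of_dvd hW (Nat.gcd_dvd_right _ _))
    exact_mod_cast h7
  have hlog := Real.log_natCast_nonneg X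
  calc _ ≤ (((2*C:ℕ):ℝ)^((2*C)^2) / Real.sqrt (c.1/g:ℕ) * (1 + Real.log X) ^ (2*C)) * ‖TP L c.ev‖ := by gcongr
    _ = (((2*C:ℕ):ℝ)^((2*C)^2) * (1 / Real.sqrt (c.1/g:ℕ)) * (1 + Real.log X) ^ (2*C)) * ‖TP L c.ev‖ := by ring
    _ ≤ (((2*C:ℕ):ℝ)^((2*C)^2) * (Real.sqrt W / Real.sqrt c.1) * (1 + L) ^ (2*C)) * ‖TP L c.ev‖ := by gcongr
    _ = _ := by ring

theorem BV (W : ℕ) (hW : 0 < W) (C : ℕ) (hC : 1 ≤ C) : ∀ᶠ L : ℝ in Filter.atTop, ∃ l : ℕ, l.Prime ∧ ¬ l ∣ W ∧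
    ∑ q ∈ (Ioc 0 ⌊Real.exp (L/50)⌋₊).filter (fun q => Squarefree q ∧ q.Coprime W ∧ ¬ l ∣ q),
      (C:ℝ) ^ q.primeFactors.card * DZ L (W * q) ≤ 1 / L := by
  obtain ⟨C1, hC1, HTL⟩ := TL_sum
  set m := 2 * C with hm
  set a := m + 7 with ha
  set b := m + 2 with hb
  set K : ℝ := (m:ℝ)^(m^2) * Real.sqrt W with hK
  have hK0 : 0 ≤ K := by positivity
  filter_upwards [small_cond ((2*a:ℕ):ℝ) (Nat.cast_nonneg _) (4*a+b), exc_unique ((2*a:ℕ):ℝ) (Nat.cast_nonneg _), exc_large W, pp_err,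
    poly_exp_ev 1 (4*a+b) (1/5) (by norm_num), poly_exp_ev ((W:ℝ)^3) 0 (1/4-3/50) (by norm_num),
    poly_exp_ev (2*(W:ℝ)^4) 0 (1/8-4/50) (by norm_num), poly_exp_ev ((W:ℝ)^2) 0 (1/5-2/50) (by norm_num),
    poly_exp_ev (W:ℝ) 0 (1/2-1/50) (by norm_num), Filter.eventually_ge_atTop (4:ℝ),
    Filter.eventually_ge_atTop (K * 2^m * (3 + 96 * C1))] with L hsm huni hlar hpp e1 e2 e3 e4 e5 hL4 hLK
  simp only [pow_zero, mul_one, one_mul] at e1 e2 e3 e4 e5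
  have hL0 : 0 < L := by linarith
  set X := ⌊Real.exp (L/50)⌋₊ with hX
  set η := Real.exp (-(L/5)) with hη
  have hXe : (X:ℝ) ≤ Real.exp (L/50) := Nat.floor_le (Real.exp_pos _).le
  have hXpos : 0 < X := Nat.floor_pos.mpr (Real.one_le_exp (by positivity))
  -- choice of l
  have hl : ∃ l : ℕ, l.Prime ∧ ¬ l ∣ W ∧ ∀ c : PC, 1 < c.1 → (c.1:ℝ) ≤ L ^ ((2*a:ℕ):ℝ) → c.2.IsPrimitive →
      (∃ q, Squarefree q ∧ q.Coprime W ∧ ¬ l ∣ q ∧ c.1 ∣ W * q) → NonExc L c := by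
    by_cases hex : ∃ d : PC, 1 < d.1 ∧ (d.1:ℝ) ≤ L ^ ((2*a:ℕ):ℝ) ∧ d.2.IsPrimitive ∧ ¬ NonExc L d ∧ ∃ l : ℕ, l.Prime ∧ l ∣ d.1 ∧ ¬ l ∣ W
    · obtain ⟨d, hd1, hd2, hd3, hd4, l, hl1, hl2, hl3⟩ := hex
      refine ⟨l, hl1, hl3, ?_⟩
      rintro c hc1 hc2 hc3 ⟨q, hq1, hq2, hq3, hq4⟩
      by_contra hne
      have := huni c d hc1 hd1 hc2 hd2 hc3 hd3 hne hd4
      subst this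
      rcases (hl1.dvd_mul).mp (hl2.trans hq4) with h | h
      · exact hl3 h
      · exact hq3 h
    · push Not at hex
      obtain ⟨l, hl1, hl2⟩ := Nat.exists_infinite_primes (W+1)
      refine ⟨l, hl2, fun h => by have := Nat.le_of_dvd hW h; omega, ?_⟩
      rintro c hc1 hc2 hc3 ⟨q, hq1, hq2, hq3, hq4⟩
      by_contra hne
      have hall := hex c hc1 hc2 hc3 hne
      have hcop : c.1.Coprime q := by
        apply Nat.coprime_of_dvd
        intro p hp h1 h2
        have h3 := hall p hp h1
        have := Nat.dvd_gcd h2 h3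
        rw [hq2] at this
        exact hp.one_lt.ne' (Nat.dvd_one.mp this)
      have h4 := hcop.dvd_of_dvd_mul_right hq4
      exact hne (hlar c hc1 (Nat.le_of_dvd hW h4) hc3)
  obtain ⟨l, hl1, hl2, hnon⟩ := hl
  refine ⟨l, hl1, hl2, ?_⟩
  set S := (Ioc 0 X).filter (fun q => Squarefree q ∧ q.Coprime W ∧ ¬ l ∣ q) with hSdef
  have hQr : ((W * X : ℕ) : ℝ) ≤ W * Real.exp (L/50) := by push_cast; gcongr
  have hexp : ∀ x y : ℝ, Real.exp x * Real.exp y = Real.exp (x+y) := fun x y => (Real.exp_add x y).symm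
  have hQ : ((W * X : ℕ) : ℝ) ≤ Real.exp (L/2) := by
    refine hQr.trans ?_
    have : Real.exp (L/50) = Real.exp (-((1/2-1/50)*L)) * Real.exp (L/2) := by rw [hexp]; congr 1; ring
    rw [this, ← mul_assoc]
    exact mul_le_of_le_one_left (Real.exp_pos _).le e5
  have hbv := BVa W hW C hC L hL0 X (by
    rw [Real.log_le_iff_le_exp (by exact_mod_cast hXpos)]
    exact hXe.trans (Real.exp_le_exp.mpr (by linarith))) hQ S (by
    intro q hq
    rw [hSdef, mem_filter] at hq
    exact ⟨hq.1, hq.2.1, hq.2.2.1⟩)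
  refine hbv.trans ?_
  have hTP : ∀ c : PC, ‖TP L c.ev‖ ≤ ‖TL L c.ev‖ + η := by
    intro c
    have h1 := (TP_TL L c.ev c.ev_le).trans hpp
    have h2 : TP L c.ev = TL L c.ev + (TP L c.ev - TL L c.ev) := by ring
    calc ‖TP L c.ev‖ = ‖TL L c.ev + (TP L c.ev - TL L c.ev)‖ := by rw [← h2]
      _ ≤ _ := (norm_add_le _ _).trans (by linarith)
  set F := (fam (W*X)).filter (fun c => ∃ q ∈ S, c.1 ∣ W * q) with hF
  have hsmall : ∑ c ∈ F.filter (fun c => (c.1:ℝ) ≤ L ^ (2*a)), ‖TP L c.ev‖ / Real.sqrt c.1 ≤ 2 * (1 / L ^ b) := by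
    have hcard : ((F.filter (fun c => (c.1:ℝ) ≤ L ^ (2*a))).card : ℝ) ≤ L ^ (4*a) := by
      have h1 : (F.filter (fun c => (c.1:ℝ) ≤ L ^ (2*a))) ⊆ fam ⌊L^(2*a)⌋₊ := by
        intro c hc
        rw [mem_filter, hF, mem_filter, mem_fam] at hc
        rw [mem_fam]
        exact ⟨hc.1.1.1, Nat.le_floor hc.2, hc.1.1.2.2⟩
      have h2 := (card_le_card h1).trans (card_fam _)
      calc ((F.filter (fun c => (c.1:ℝ) ≤ L ^ (2*a))).card : ℝ) ≤ (⌊L^(2*a)⌋₊:ℝ)^2 := by exact_mod_cast h2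
        _ ≤ (L^(2*a))^2 := by gcongr; exact Nat.floor_le (by positivity)
        _ = _ := by rw [← pow_mul]; congr 1; ring
    have hter : ∀ c ∈ F.filter (fun c => (c.1:ℝ) ≤ L ^ (2*a)), ‖TP L c.ev‖ / Real.sqrt c.1 ≤ 2 * (1 / L ^ (4*a+b)) := by
      intro c hc
      rw [mem_filter, hF, mem_filter, mem_fam] at hc
      obtain ⟨⟨⟨h1, h2, h3⟩, q, hq, hqd⟩, h4⟩ := hc
      rw [hSdef, mem_filter] at hq
      have h4' : (c.1:ℝ) ≤ L ^ ((2*a:ℕ):ℝ) := by rw [Real.rpow_natCast]; exact h4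
      have hn := hnon c h1 h4' h3 ⟨q, hq.2.1, hq.2.2.1, hq.2.2.2, hqd⟩
      have h5 := hsm c h1 h4' h3 hn
      have hs1 : 1 ≤ Real.sqrt c.1 := Real.one_le_sqrt.mpr (by exact_mod_cast h1.le)
      rw [Real.rpow_neg hL0.le, Real.rpow_natCast, ← one_div] at h5
      have h6 : η ≤ 1 / L ^ (4*a+b) := by
        rw [le_div_iff₀ (by positivity), mul_comm, hη, show -(L/5) = -(1/5*L) by ring]; exact e1
      calc _ ≤ ‖TP L c.ev‖ := div_le_self (norm_nonneg _) hs1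
        _ ≤ _ := by have := hTP c; linarith
    calc _ ≤ ∑ c ∈ F.filter (fun c => (c.1:ℝ) ≤ L ^ (2*a)), 2 * (1 / L ^ (4*a+b)) := sum_le_sum hter
      _ = ((F.filter (fun c => (c.1:ℝ) ≤ L ^ (2*a))).card : ℝ) * (2 * (1 / L ^ (4*a+b))) := by rw [sum_const, nsmul_eq_mul]
      _ ≤ L ^ (4*a) * (2 * (1 / L ^ (4*a+b))) := by gcongr
      _ = _ := by rw [pow_add]; field_simp
  have hlarge : ∑ c ∈ F.filter (fun c => ¬ (c.1:ℝ) ≤ L ^ (2*a)), ‖TP L c.ev‖ / Real.sqrt c.1 ≤ (1 / L ^ a) * (3 * C1 * (1+L)^5 + 1) := by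
    have h1 : ∑ c ∈ fam (W*X), ‖TP L c.ev‖ ≤ 3 * C1 * (1+L)^5 + 1 := by
      have hcard : ((fam (W*X)).card : ℝ) ≤ ((W * X : ℕ) : ℝ)^2 := by exact_mod_cast card_fam (W*X)
      have h2 := HTL L hL4 (fam (W*X)) ((W * X : ℕ) : ℝ) (Nat.cast_nonneg _) (by
        intro c hc; rw [mem_fam] at hc; exact ⟨hc.1, by exact_mod_cast hc.2.1, hc.2.2⟩) hcard
      have h3 : ((W * X : ℕ) : ℝ)^3 * Real.exp (-(L/4)) ≤ 1 := by
        refine le_trans ?_ e2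
        calc _ ≤ (W * Real.exp (L/50))^3 * Real.exp (-(L/4)) := by gcongr
          _ = _ := by rw [mul_pow, ← Real.exp_nat_mul, mul_assoc, hexp]; congr 2; push_cast; ring
      have h4 : ((W * X : ℕ) : ℝ)^4 / ⌊Real.exp (L/8)⌋₊ ≤ 1 := by
        have hf : Real.exp (L/8) / 2 ≤ ⌊Real.exp (L/8)⌋₊ := by
          have g1 := Nat.lt_floor_add_one (Real.exp (L/8))
          have g2 : 1 ≤ ⌊Real.exp (L/8)⌋₊ := Nat.floor_pos.mpr (Real.one_le_exp (by positivity))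
          have g3 : (1:ℝ) ≤ ⌊Real.exp (L/8)⌋₊ := by exact_mod_cast g2
          linarith
        refine le_trans ?_ e3
        calc _ ≤ (W * Real.exp (L/50))^4 / (Real.exp (L/8) / 2) := by gcongr
          _ = 2 * (W:ℝ)^4 * (Real.exp (L/50)^4 * (Real.exp (L/8))⁻¹) := by rw [mul_pow]; field_simp
          _ = _ := by rw [← Real.exp_nat_mul, ← Real.exp_neg, hexp]; congr 2; push_cast; ring
      have h5 : ((W * X : ℕ) : ℝ)^2 * η ≤ 1 := by
        refine le_trans ?_ e4
        calc _ ≤ (W * Real.exp (L/50))^2 * η := by gcongr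
          _ = _ := by rw [mul_pow, ← Real.exp_nat_mul, mul_assoc, hη, hexp]; congr 2; push_cast; ring
      calc _ ≤ ∑ c ∈ fam (W*X), (‖TL L c.ev‖ + η) := sum_le_sum fun c _ => hTP c
        _ = ∑ c ∈ fam (W*X), ‖TL L c.ev‖ + (fam (W*X)).card * η := by rw [sum_add_distrib, sum_const, nsmul_eq_mul]
        _ ≤ C1 * (1+L)^5 * (1 + 1 + 1) + ((W * X : ℕ) : ℝ)^2 * η := by
            refine add_le_add (h2.trans ?_) (by gcongr)
            gcongr
        _ ≤ _ := by linarith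
    calc _ ≤ ∑ c ∈ F.filter (fun c => ¬ (c.1:ℝ) ≤ L ^ (2*a)), (1 / L ^ a) * ‖TP L c.ev‖ := by
          refine sum_le_sum fun c hc => ?_
          rw [mem_filter, not_le] at hc
          have : L ^ a ≤ Real.sqrt c.1 := by
            apply Real.le_sqrt_of_sq_le
            rw [← pow_mul, mul_comm a 2]; exact hc.2.le
          rw [div_eq_mul_one_div, mul_comm]
          gcongr
      _ ≤ (1 / L ^ a) * ∑ c ∈ fam (W*X), ‖TP L c.ev‖ := by
          rw [← mul_sum]
          gcongr
          exact (filter_subset _ _).trans (filter_subset _ _)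
      _ ≤ _ := by gcongr
  have htot : ∑ c ∈ F, ‖TP L c.ev‖ / Real.sqrt c.1 ≤ 2 * (1 / L ^ b) + (1 / L ^ a) * (3 * C1 * (1+L)^5 + 1) := by
    rw [← sum_filter_add_sum_filter_not F (fun c => (c.1:ℝ) ≤ L ^ (2*a))]
    exact add_le_add hsmall hlarge
  have hL2 : 1 + L ≤ 2 * L := by linarith
  have hLb : 1 + L ≤ 2 * L := by linarith
  have hfin : 2 * (1 / L ^ b) + (1 / L ^ a) * (3 * C1 * (1+L)^5 + 1) ≤ (3 + 96 * C1) / L ^ b := by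
    have g1 : (1+L)^5 ≤ 32 * L^5 := by
      calc (1+L)^5 ≤ (2*L)^5 := by gcongr
        _ = _ := by ring
    have g2 : 1 ≤ L^5 := one_le_pow₀ (by linarith)
    have g3 : 3 * C1 * (1+L)^5 + 1 ≤ (96 * C1 + 1) * L^5 := by nlinarith
    have g4 : (1 / L ^ a) * L^5 = 1 / L ^ b := by
      rw [show a = b + 5 by omega, pow_add]; field_simp
    calc _ ≤ 2 * (1 / L ^ b) + (1 / L ^ a) * ((96 * C1 + 1) * L^5) := by gcongr
      _ = 2 * (1 / L ^ b) + (96 * C1 + 1) * ((1 / L ^ a) * L^5) := by ring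
      _ = _ := by rw [g4]; ring
  calc _ ≤ K * (2 * L) ^ m * ((3 + 96 * C1) / L ^ b) := by
        have := htot.trans hfin
        gcongr
    _ = (K * 2^m * (3 + 96 * C1)) / L^2 := by
        rw [mul_pow, hb, pow_add]; field_simp
    _ ≤ L / L^2 := by gcongr
    _ = _ := by field_simp

end OIR
end

section
open Finset MeasureTheory
namespace OIR

/-- positive semidefinite kernel -/
def psd {Z : Type*} [Fintype Z] (K : Z → Z → ℝ) : Prop :=
  (∀ x y, K x y = K y x) ∧ ∀ c : Z → ℝ, 0 ≤ ∑ x, ∑ y, c x * c y * K x y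

theorem psd_iff {Z : Type*} [Fintype Z] (K : Z → Z → ℝ) :
    psd K ↔ (Matrix.of K).PosSemidef := by
  rw [Matrix.posSemidef_iff_dotProduct_mulVec]
  unfold psd
  refine and_congr ?_ ?_
  · rw [Matrix.IsHermitian.ext_iff]
    simp only [Matrix.of_apply, star_trivial]
    exact ⟨fun h i j => h j i, fun h i j => h j i⟩
  · refine forall_congr' fun c => ?_
    have : ∑ x, ∑ y, c x * c y * K x y = star c ⬝ᵥ (Matrix.of K).mulVec c := by
      simp only [dotProduct, Matrix.mulVec, Matrix.of_apply, star_trivial, mul_sum]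
      refine sum_congr rfl fun x _ => sum_congr rfl fun y _ => ?_
      ring
    rw [this]

theorem psd_mul {Z : Type*} [Fintype Z] (K K' : Z → Z → ℝ) (h : psd K) (h' : psd K') :
    psd (fun x y => K x y * K' x y) := by
  rw [psd_iff] at *
  exact h.hadamard h'

theorem psd_add {Z : Type*} [Fintype Z] (K K' : Z → Z → ℝ) (h : psd K) (h' : psd K') :
    psd (fun x y => K x y + K' x y) := by
  rw [psd_iff] at *
  exact h.add h'

theorem psd_pull {Y Z : Type*} [Fintype Y] [Fintype Z] (K : Z → Z → ℝ) (h : psd K) (e : Y → Z) :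
    psd (fun x y => K (e x) (e y)) := by
  rw [psd_iff] at *
  exact h.submatrix e

theorem psd_tensor {P Z : Type*} [Fintype P] [DecidableEq P] [Fintype Z] (A B : P → Z → Z → ℝ)
    (hB : ∀ p, psd (B p)) (hAB : ∀ p, psd (fun x y => A p x y - B p x y)) :
    psd (fun r r' : P → Z => ∏ p, A p (r p) (r' p) - ∏ p, B p (r p) (r' p)) := by
  have hA : ∀ p, psd (A p) := by
    intro p
    have := psd_add _ _ (hAB p) (hB p)
    simpa using this
  have key : ∀ S : Finset P, psd (fun r r' : P → Z => ∏ p ∈ S, A p (r p) (r' p)) ∧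
      psd (fun r r' : P → Z => ∏ p ∈ S, A p (r p) (r' p) - ∏ p ∈ S, B p (r p) (r' p)) := by
    intro S
    induction S using Finset.induction_on with
    | empty =>
      simp only [prod_empty, sub_self]
      refine ⟨⟨fun _ _ => rfl, fun c => ?_⟩, ⟨fun _ _ => rfl, fun c => by simp⟩⟩
      have : ∑ x, ∑ y, c x * c y * 1 = (∑ x, c x) ^ 2 := by
        rw [sq, sum_mul_sum]; simp
      rw [this]; positivity
    | insert q S hq ih =>
      simp only [prod_insert hq]
      refine ⟨psd_mul _ _ (psd_pull _ (hA q) (fun r : P → Z => r q)) ih.1, ?_⟩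
      have h1 := psd_mul _ _ (psd_pull _ (hAB q) (fun r : P → Z => r q)) ih.1
      have h2 := psd_mul _ _ (psd_pull _ (hB q) (fun r : P → Z => r q)) ih.2
      have h3 := psd_add _ _ h1 h2
      convert h3 using 3
      ring
  exact (key univ).2

theorem sq_expand {Z : Type*} [Fintype Z] (c v : Z → ℝ) :
    (∑ x, c x * v x) ^ 2 = ∑ x, ∑ y, c x * c y * (v x * v y) := by
  rw [sq, sum_mul_sum]
  refine sum_congr rfl fun x _ => sum_congr rfl fun y _ => ?_
  ring

/-- kernel with a sum of squares form -/
def sosK {Z Y : Type*} [Fintype Y] (d : Y → ℝ) (V : Y → Z → ℝ) (x y : Z) : ℝ := ∑ z, d z * (V z x * V z y)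

theorem sosK_form {Z Y : Type*} [Fintype Y] [Fintype Z] (d : Y → ℝ) (V : Y → Z → ℝ) (c : Z → ℝ) :
    ∑ x, ∑ y, c x * c y * sosK d V x y = ∑ z, d z * (∑ x, c x * V z x) ^ 2 := by
  simp only [sosK, sq_expand, mul_sum]
  calc ∑ x, ∑ y, ∑ z, c x * c y * (d z * (V z x * V z y))
      = ∑ x, ∑ z, ∑ y, c x * c y * (d z * (V z x * V z y)) := by
        refine sum_congr rfl fun x _ => sum_comm
    _ = ∑ z, ∑ x, ∑ y, c x * c y * (d z * (V z x * V z y)) := sum_comm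
    _ = _ := by
        refine sum_congr rfl fun z _ => sum_congr rfl fun x _ => sum_congr rfl fun y _ => ?_
        ring

theorem sosK_psd {Z Y : Type*} [Fintype Y] [Fintype Z] (d : Y → ℝ) (hd : ∀ z, 0 ≤ d z) (V : Y → Z → ℝ) :
    psd (sosK d V) := by
  refine ⟨fun x y => ?_, fun c => ?_⟩
  · unfold sosK
    refine sum_congr rfl fun z _ => ?_
    ring
  · rw [sosK_form]
    exact sum_nonneg fun z _ => mul_nonneg (hd z) (sq_nonneg _)

theorem sosK_prod {P Z Y : Type*} [Fintype P] [DecidableEq P] [Fintype Z] [Fintype Y] (d : P → Y → ℝ) (V : P → Y → Z → ℝ)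
    (r r' : P → Z) :
    ∏ p, sosK (d p) (V p) (r p) (r' p) =
      sosK (fun s : P → Y => ∏ p, d p (s p)) (fun s r => ∏ p, V p (s p) (r p)) r r' := by
  unfold sosK
  rw [prod_univ_sum, Fintype.piFinset_univ]
  refine sum_congr rfl fun s _ => ?_
  rw [← prod_mul_distrib, ← prod_mul_distrib]

/-- upper bound for tensor forms -/
theorem tensor_up {P Z Y : Type*} [Fintype P] [DecidableEq P] [Fintype Z] [Fintype Y]
    (K : P → Z → Z → ℝ) (hK : ∀ p, psd (K p)) (d : P → Y → ℝ) (V : P → Y → Z → ℝ)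
    (h : ∀ p, ∀ c : Z → ℝ, ∑ x, ∑ y, c x * c y * K p x y ≤ ∑ z, d p z * (∑ x, c x * V p z x) ^ 2)
    (c : (P → Z) → ℝ) :
    ∑ r, ∑ r', c r * c r' * ∏ p, K p (r p) (r' p) ≤
      ∑ s : P → Y, (∏ p, d p (s p)) * (∑ r, c r * ∏ p, V p (s p) (r p)) ^ 2 := by
  have := (psd_tensor (fun p => sosK (d p) (V p)) K hK (fun p => ⟨?_, ?_⟩)).2 c
  · simp only [mul_sub, sum_sub_distrib] at this
    rw [sub_nonneg] at this
    refine this.trans (le_of_eq ?_)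
    simp only [sosK_prod]
    rw [sosK_form]
  · intro x y
    simp only [sosK]
    rw [(hK p).1 x y]
    congr 1; refine sum_congr rfl fun z _ => ?_; ring
  · intro c
    simp only [mul_sub, sum_sub_distrib]
    rw [sub_nonneg, sosK_form]
    exact h p c

/-- lower bound for tensor forms -/
theorem tensor_low {P Z Y : Type*} [Fintype P] [DecidableEq P] [Fintype Z] [Fintype Y]
    (K : P → Z → Z → ℝ) (hK : ∀ p, psd (K p)) (d : P → Y → ℝ) (hd : ∀ p z, 0 ≤ d p z) (V : P → Y → Z → ℝ)
    (h : ∀ p, ∀ c : Z → ℝ, ∑ z, d p z * (∑ x, c x * V p z x) ^ 2 ≤ ∑ x, ∑ y, c x * c y * K p x y)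
    (c : (P → Z) → ℝ) :
    ∑ s : P → Y, (∏ p, d p (s p)) * (∑ r, c r * ∏ p, V p (s p) (r p)) ^ 2 ≤
      ∑ r, ∑ r', c r * c r' * ∏ p, K p (r p) (r' p) := by
  have := (psd_tensor K (fun p => sosK (d p) (V p)) (fun p => sosK_psd _ (hd p) _) (fun p => ⟨?_, ?_⟩)).2 c
  · simp only [mul_sub, sum_sub_distrib] at this
    rw [sub_nonneg] at this
    refine (le_of_eq ?_).trans this
    simp only [sosK_prod]
    rw [sosK_form]
  · intro x y
    simp only [sosK]
    rw [(hK p).1 x y]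
    congr 1; refine sum_congr rfl fun z _ => ?_; ring
  · intro c
    simp only [mul_sub, sum_sub_distrib]
    rw [sub_nonneg, sosK_form]
    exact h p c

/-- the local sieve vector -/
def Xv {ι : Type*} (a : ι → ℕ) (p n : ℕ) : Option ι → ℝ
  | none => 1
  | some i => if p ∣ n + a i then 1 - p else 1

/-- the local Gram kernel -/
noncomputable def Gk {ι : Type*} (a : ι → ℕ) (p : ℕ) (U : Finset ℕ) (x y : Option ι) : ℝ :=
  (∑ w ∈ U, Xv a p w x * Xv a p w y) / (U.card : ℝ)

theorem Gk_form {ι : Type*} [Fintype ι] (a : ι → ℕ) (p : ℕ) (U : Finset ℕ) (c : Option ι → ℝ) :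
    ∑ x, ∑ y, c x * c y * Gk a p U x y = (∑ w ∈ U, (∑ x, c x * Xv a p w x) ^ 2) / (U.card : ℝ) := by
  simp only [Gk, sq_expand]
  simp only [mul_div_assoc', mul_sum, sum_div]
  calc ∑ x, ∑ y, ∑ w ∈ U, c x * c y * (Xv a p w x * Xv a p w y) / (U.card : ℝ)
      = ∑ x, ∑ w ∈ U, ∑ y, c x * c y * (Xv a p w x * Xv a p w y) / (U.card : ℝ) := by
        refine sum_congr rfl fun x _ => sum_comm
    _ = _ := sum_comm

theorem Gk_psd {ι : Type*} [Fintype ι] (a : ι → ℕ) (p : ℕ) (U : Finset ℕ) : psd (Gk a p U) := by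
  refine ⟨fun x y => ?_, fun c => ?_⟩
  · unfold Gk; congr 1; refine sum_congr rfl fun z _ => ?_; ring
  · rw [Gk_form]; positivity

theorem local_sum {ι : Type*} [Fintype ι] [DecidableEq ι] (a : ι → ℕ) (p : ℕ) (U : Finset ℕ)
    (ha : ∀ n i j, p ∣ n + a i → p ∣ n + a j → i = j) (c : Option ι → ℝ) (S : ℝ)
    (hS : S = c none + ∑ i, c (some i)) :
    ∑ w ∈ U, (∑ x, c x * Xv a p w x) ^ 2 = U.card * S ^ 2
      - 2 * p * S * ∑ i, c (some i) * (U.filter (fun w => p ∣ w + a i)).card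
      + p ^ 2 * ∑ i, c (some i) ^ 2 * (U.filter (fun w => p ∣ w + a i)).card := by
  have h1 : ∀ w, ∑ x, c x * Xv a p w x = S - p * ∑ i, c (some i) * (if p ∣ w + a i then 1 else 0) := by
    intro w
    rw [Fintype.sum_option, hS, mul_sum, add_sub_assoc, ← sum_sub_distrib]
    congr 1
    · simp [Xv]
    · refine sum_congr rfl fun i _ => ?_
      simp only [Xv]; split_ifs <;> ring
  have h2 : ∀ w, (∑ i, c (some i) * (if p ∣ w + a i then (1:ℝ) else 0)) ^ 2 =
      ∑ i, c (some i) ^ 2 * (if p ∣ w + a i then 1 else 0) := by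
    intro w
    rw [sq, sum_mul_sum]
    refine sum_congr rfl fun i _ => ?_
    rw [sum_eq_single i]
    · split_ifs <;> ring
    · intro j _ hj
      by_cases h : p ∣ w + a i
      · have : ¬ p ∣ w + a j := fun h' => hj (ha w j i h' h)
        simp [this]
      · simp [h]
    · simp
  have h3 : ∀ i, ((U.filter (fun w => p ∣ w + a i)).card : ℝ) = ∑ w ∈ U, if p ∣ w + a i then (1:ℝ) else 0 := by
    intro i; simp
  have h4 : ∀ w, (∑ x, c x * Xv a p w x) ^ 2 = S ^ 2 - 2 * p * S * ∑ i, c (some i) * (if p ∣ w + a i then (1:ℝ) else 0)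
      + p ^ 2 * ∑ i, c (some i) ^ 2 * (if p ∣ w + a i then (1:ℝ) else 0) := by
    intro w
    rw [← h2, h1]; ring
  simp only [h4, h3]
  rw [sum_add_distrib, sum_sub_distrib, sum_const, nsmul_eq_mul, ← mul_sum, ← mul_sum]
  congr 2
  · congr 1
    rw [sum_comm]
    simp only [mul_sum]
  · rw [sum_comm]
    simp only [mul_sum]

theorem res_card (p : ℕ) (hp : 0 < p) (m : ℕ) : ((range p).filter (fun w => p ∣ w + m)).card = 1 := by
  rw [card_eq_one]
  have hlt : m % p < p := Nat.mod_lt _ hp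
  refine ⟨(p - m % p) % p, ?_⟩
  ext w
  simp only [mem_filter, mem_range, mem_singleton]
  have hd : p ∣ w + m ↔ p ∣ w + m % p := by
    rw [Nat.dvd_iff_mod_eq_zero, Nat.dvd_iff_mod_eq_zero, Nat.add_mod, Nat.add_mod w (m % p), Nat.mod_mod]
  rw [hd]
  clear hd
  generalize m % p = t at *
  rcases Nat.eq_zero_or_pos t with h | h
  · rw [h]
    simp only [add_zero, Nat.sub_zero, Nat.mod_self]
    constructor
    · rintro ⟨h1, h2⟩; exact Nat.eq_zero_of_dvd_of_lt h2 h1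
    · rintro rfl; simp [hp]
  · rw [Nat.mod_eq_of_lt (show p - t < p by omega)]
    constructor
    · rintro ⟨h1, k, h2⟩
      have : k = 1 := by
        have hk1 : k < 2 := by
          by_contra hc
          have : p * 2 ≤ p * k := Nat.mul_le_mul_left _ (by omega)
          omega
        have hk0 : k ≠ 0 := by rintro rfl; omega
        omega
      subst this; omega
    · rintro rfl
      refine ⟨by omega, ?_⟩
      rw [Nat.sub_add_cancel hlt.le]

/-- local inequality for all residues -/
theorem local_full {ι : Type*} [Fintype ι] [DecidableEq ι] (a : ι → ℕ) (p : ℕ) (hp : 0 < p)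
    (ha : ∀ n i j, p ∣ n + a i → p ∣ n + a j → i = j) (c : Option ι → ℝ) :
    ∑ x, ∑ y, c x * c y * Gk a p (range p) x y ≤ c none ^ 2 + p * ∑ i, c (some i) ^ 2 := by
  have hp' : (0:ℝ) < p := by exact_mod_cast hp
  rw [Gk_form, local_sum a p _ ha c _ rfl]
  simp only [res_card p hp, card_range, Nat.cast_one, mul_one]
  rw [div_le_iff₀ hp']
  nlinarith [mul_nonneg hp'.le (sq_nonneg (∑ i, c (some i)))]

/-- local inequality for residues prime to a shift -/
theorem local_unit {ι : Type*} [Fintype ι] [DecidableEq ι] (a : ι → ℕ) (p : ℕ) (hp : 2 ≤ p) (m : ι)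
    (ha : ∀ n i j, p ∣ n + a i → p ∣ n + a j → i = j) (c : Option ι → ℝ) :
    (1 - 1 / ((p:ℝ) - 1) ^ 2) * (c none + c (some m)) ^ 2
      + ((p:ℝ) - 4 * Fintype.card ι) * ∑ i ∈ univ.erase m, c (some i) ^ 2 ≤
    ∑ x, ∑ y, c x * c y * Gk a p ((range p).filter (fun w => ¬ p ∣ w + a m)) x y := by
  have hp' : (2:ℝ) ≤ p := by exact_mod_cast hp
  set U := (range p).filter (fun w => ¬ p ∣ w + a m) with hU
  have hUc : (U.card : ℝ) = p - 1 := by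
    have h := card_filter_add_card_filter_not (s := range p) (fun w => p ∣ w + a m)
    rw [res_card p (by omega), card_range] at h
    have : U.card + 1 = p := by rw [hU]; omega
    have h2 : ((U.card + 1 : ℕ) : ℝ) = p := by rw [this]
    push_cast at h2; linarith
  have hci : ∀ i, ((U.filter (fun w => p ∣ w + a i)).card : ℝ) = if i = m then 0 else 1 := by
    intro i
    split_ifs with h
    · subst h
      rw [hU, filter_filter]
      simp
    · rw [hU, filter_filter]
      have : (range p).filter (fun w => ¬ p ∣ w + a m ∧ p ∣ w + a i) = (range p).filter (fun w => p ∣ w + a i) := by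
        refine filter_congr fun w _ => ⟨fun h => h.2, fun h' => ⟨fun h'' => h (ha w i m h' h''), h'⟩⟩
      rw [this, res_card p (by omega)]; simp
  rw [Gk_form, local_sum a p _ ha c _ rfl]
  simp only [hci, hUc]
  have e1 : ∀ f : ι → ℝ, ∑ i, f i * (if i = m then 0 else 1) = ∑ i ∈ univ.erase m, f i := by
    intro f
    rw [← add_sum_erase univ _ (mem_univ m)]
    simp only [if_true, mul_zero, zero_add]
    refine sum_congr rfl fun i hi => ?_
    rw [if_neg (ne_of_mem_erase hi), mul_one]
  rw [e1, e1 (fun i => c (some i) ^ 2), ← add_sum_erase univ _ (mem_univ m), ← add_assoc]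
  set C := c none + c (some m)
  set s := ∑ i ∈ univ.erase m, c (some i) with hs
  set Q := ∑ i ∈ univ.erase m, c (some i) ^ 2 with hQ
  have hQ0 : 0 ≤ Q := sum_nonneg fun i _ => sq_nonneg _
  have hsQ : s ^ 2 ≤ Fintype.card ι * Q := by
    have h1 := sq_sum_le_card_mul_sum_sq (s := univ.erase m) (f := fun i => c (some i))
    refine h1.trans ?_
    gcongr
    exact_mod_cast (card_le_univ _)
  rw [le_div_iff₀ (by linarith)]
  set q : ℝ := (p:ℝ) - 1 with hq
  have hpq : (p:ℝ) = q + 1 := by rw [hq]; ring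
  have hq1 : 1 ≤ q := by linarith
  rw [hpq]
  set κ : ℝ := (Fintype.card ι : ℝ)
  have hk0 : 0 ≤ κ * Q := mul_nonneg (Nat.cast_nonneg _) hQ0
  have e2 : (1 - 1 / q ^ 2) * C ^ 2 * q = q * C ^ 2 - C ^ 2 / q := by field_simp
  have e3 : C ^ 2 / q - 2 * C * (-s) + q * s ^ 2 ≥ 0 := by
    have : C ^ 2 / q - 2 * C * (-s) + q * s ^ 2 = (C + q * s) ^ 2 / q := by field_simp; ring
    rw [this]; positivity
  have e4 : C ^ 2 / q - 2 * C * s + q * s ^ 2 ≥ 0 := by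
    have : C ^ 2 / q - 2 * C * s + q * s ^ 2 = (C - q * s) ^ 2 / q := by field_simp; ring
    rw [this]; positivity
  rw [add_mul, e2]
  nlinarith [mul_le_mul_of_nonneg_left hsQ (show (0:ℝ) ≤ q + (q + 2) by linarith), mul_nonneg hk0 (sub_nonneg.mpr hq1)]

end OIR
end

section
open Finset MeasureTheory
namespace OIR

section gen
set_option linter.unusedSectionVars false
variable {P ι : Type*} [Fintype P] [DecidableEq P] [Fintype ι] [DecidableEq ι]

def sup (r : P → Option ι) : Finset P := univ.filter (fun p => r p ≠ none)

theorem mem_sup (r : P → Option ι) (p : P) : p ∈ sup r ↔ r p ≠ none := by simp [sup]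

def Xr (a : ι → ℕ) (pr : P → ℕ) (n : ℕ) (r : P → Option ι) : ℝ := ∏ p, Xv a (pr p) n (r p)

def nu (a : ι → ℕ) (pr : P → ℕ) (c : (P → Option ι) → ℝ) (n : ℕ) : ℝ := ∑ r, c r * Xr a pr n r

def pp (p : ℕ) : Option ι → ℝ
  | none => 1
  | some _ => p

theorem Xv_mod (a : ι → ℕ) (p n : ℕ) (x : Option ι) : Xv a p (n % p) x = Xv a p n x := by
  cases x with
  | none => rfl
  | some i =>
    simp only [Xv]
    have : p ∣ n % p + a i ↔ p ∣ n + a i := by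
      rw [Nat.dvd_iff_mod_eq_zero, Nat.dvd_iff_mod_eq_zero, Nat.mod_add_mod]
    simp only [this]

theorem Xv_le (a : ι → ℕ) (p n : ℕ) (hp : 1 ≤ p) (x : Option ι) : |Xv a p n x| ≤ pp p x := by
  have hp' : (1:ℝ) ≤ p := by exact_mod_cast hp
  cases x with
  | none => simp [Xv, pp]
  | some i =>
    simp only [Xv, pp]
    split_ifs
    · rw [abs_le]; constructor <;> linarith
    · simpa using hp'

theorem Xv_sum (a : ι → ℕ) (p : ℕ) (hp : 1 ≤ p) (i : ι) : ∑ w ∈ range p, |Xv a p w (some i)| ≤ 2 * p := by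
  have hp' : (1:ℝ) ≤ p := by exact_mod_cast hp
  calc ∑ w ∈ range p, |Xv a p w (some i)| ≤ ∑ w ∈ range p, (1 + p * (if p ∣ w + a i then (1:ℝ) else 0)) := by
        refine sum_le_sum fun w _ => ?_
        simp only [Xv]
        split_ifs
        · rw [abs_le]; constructor <;> linarith
        · simp
    _ = p + p * (((range p).filter (fun w => p ∣ w + a i)).card : ℝ) := by
        rw [sum_add_distrib, ← mul_sum]; simp
    _ = 2 * p := by rw [res_card p (by omega)]; push_cast; ring

theorem Xv_pair (a : ι → ℕ) (p : ℕ) (hp : 1 ≤ p) (U : Finset ℕ) (hU : U ⊆ range p) (x y : Option ι)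
    (h : x ≠ none ∨ y ≠ none) : ∑ w ∈ U, |Xv a p w x * Xv a p w y| ≤ 2 * (pp p x * pp p y) := by
  have key : ∀ x y : Option ι, x ≠ none → ∑ w ∈ range p, |Xv a p w x * Xv a p w y| ≤ 2 * (pp p x * pp p y) := by
    intro x y hx
    obtain ⟨i, rfl⟩ := Option.ne_none_iff_exists'.mp hx
    have hy : 0 ≤ pp p y := (abs_nonneg _).trans (Xv_le a p 0 hp y)
    calc ∑ w ∈ range p, |Xv a p w (some i) * Xv a p w y| ≤ ∑ w ∈ range p, |Xv a p w (some i)| * pp p y := by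
          refine sum_le_sum fun w _ => ?_
          rw [abs_mul]
          exact mul_le_mul_of_nonneg_left (Xv_le a p w hp y) (abs_nonneg _)
      _ ≤ (2 * p) * pp p y := by
          rw [← sum_mul]
          exact mul_le_mul_of_nonneg_right (Xv_sum a p hp i) hy
      _ = _ := by simp only [pp]; ring
  refine (sum_le_sum_of_subset_of_nonneg hU fun _ _ _ => abs_nonneg _).trans ?_
  rcases h with h | h
  · exact key x y h
  · have := key y x h
    simpa only [mul_comm] using this

theorem pair_bound (a : ι → ℕ) (pr : P → ℕ) (N : Finset ℕ) (f : ℕ → ℝ) (U : P → Finset ℕ)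
    (hU0 : ∀ p, (U p).Nonempty) (hN : ∀ n ∈ N, ∀ p, n % pr p ∈ U p) (G : ℝ) (d : ℝ)
    (r r' : P → Option ι) (T : Finset P) (hT : ∀ p, p ∉ T → r p = none ∧ r' p = none)
    (hE : ∀ w : P → ℕ, (∀ p ∈ T, w p ∈ U p) →
      |∑ n ∈ N.filter (fun n => ∀ p ∈ T, n % pr p = w p), f n - G / ∏ p ∈ T, ((U p).card : ℝ)| ≤ d) :
    |∑ n ∈ N, f n * (Xr a pr n r * Xr a pr n r') - G * ∏ p, Gk a (pr p) (U p) (r p) (r' p)| ≤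
      d * ∏ p ∈ T, ∑ w ∈ U p, |Xv a (pr p) w (r p) * Xv a (pr p) w (r' p)| := by
  classical
  set t : P → Finset ℕ := fun p => if p ∈ T then U p else {0} with ht
  set φ : P → ℕ → ℝ := fun p w => Xv a (pr p) w (r p) * Xv a (pr p) w (r' p) with hφ
  have hφ1 : ∀ p, p ∉ T → ∀ w, φ p w = 1 := by
    intro p hp w
    simp only [hφ, (hT p hp).1, (hT p hp).2, Xv, mul_one]
  set m : ℕ → P → ℕ := fun n p => if p ∈ T then n % pr p else 0 with hm
  have hmaps : ∀ n ∈ N, m n ∈ Fintype.piFinset t := by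
    intro n hn
    rw [Fintype.mem_piFinset]
    intro p
    simp only [hm, ht]
    split_ifs with h
    · exact hN n hn p
    · simp
  have hXX : ∀ n, Xr a pr n r * Xr a pr n r' = ∏ p, φ p (m n p) := by
    intro n
    unfold Xr
    rw [← prod_mul_distrib]
    refine prod_congr rfl fun p _ => ?_
    simp only [hm]
    split_ifs with h
    · simp only [hφ, Xv_mod]
    · rw [hφ1 p h, (hT p h).1, (hT p h).2]; simp [Xv]
  have h1 : ∑ n ∈ N, f n * (Xr a pr n r * Xr a pr n r') =
      ∑ w ∈ Fintype.piFinset t, (∑ n ∈ N.filter (fun n => m n = w), f n) * ∏ p, φ p (w p) := by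
    rw [← sum_fiberwise_of_maps_to hmaps]
    refine sum_congr rfl fun w _ => ?_
    rw [sum_mul]
    refine sum_congr rfl fun n hn => ?_
    rw [hXX, (mem_filter.mp hn).2]
  have hcard : ∀ p, ((U p).card : ℝ) ≠ 0 := fun p => by
    have := (hU0 p).card_pos
    positivity
  have h2 : G * ∏ p, Gk a (pr p) (U p) (r p) (r' p) =
      ∑ w ∈ Fintype.piFinset t, (G / ∏ p ∈ T, ((U p).card : ℝ)) * ∏ p, φ p (w p) := by
    rw [← mul_sum, ← prod_univ_sum]
    have e1 : ∏ p, Gk a (pr p) (U p) (r p) (r' p) = ∏ p ∈ T, Gk a (pr p) (U p) (r p) (r' p) := by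
      symm
      refine prod_subset (subset_univ _) fun p _ hp => ?_
      rw [(hT p hp).1, (hT p hp).2]
      simp only [Gk, Xv, mul_one, sum_const, nsmul_eq_mul]
      exact div_self (hcard p)
    have e2 : ∏ p, ∑ j ∈ t p, φ p j = ∏ p ∈ T, ∑ j ∈ U p, φ p j := by
      rw [← prod_subset (subset_univ T)]
      · refine prod_congr rfl fun p hp => ?_
        simp only [ht, if_pos hp]
      · intro p _ hp
        simp only [ht, if_neg hp, sum_singleton, hφ1 p hp]
    rw [e1, e2, div_mul_eq_mul_div, mul_div_assoc, ← prod_div_distrib]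
    rfl
  have h3 : ∏ p ∈ T, ∑ w ∈ U p, |φ p w| = ∑ w ∈ Fintype.piFinset t, ∏ p, |φ p (w p)| := by
    refine Eq.trans ?_ (prod_univ_sum t (fun p w => |φ p w|))
    rw [← prod_subset (subset_univ T)]
    · refine prod_congr rfl fun p hp => ?_
      simp only [ht, if_pos hp]
    · intro p _ hp
      simp only [ht, if_neg hp, sum_singleton, hφ1 p hp, abs_one]
  rw [h1, h2, ← sum_sub_distrib, h3, mul_sum]
  refine (abs_sum_le_sum_abs _ _).trans (sum_le_sum fun w hw => ?_)
  rw [← sub_mul, abs_mul, abs_prod]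
  refine mul_le_mul_of_nonneg_right ?_ (prod_nonneg fun _ _ => abs_nonneg _)
  rw [Fintype.mem_piFinset] at hw
  have hw' : ∀ p ∈ T, w p ∈ U p := by
    intro p hp
    have := hw p
    simpa only [ht, if_pos hp] using this
  have hw0 : ∀ p, p ∉ T → w p = 0 := by
    intro p hp
    have := hw p
    simpa only [ht, if_neg hp, mem_singleton] using this
  have e3 : N.filter (fun n => m n = w) = N.filter (fun n => ∀ p ∈ T, n % pr p = w p) := by
    refine filter_congr fun n _ => ⟨fun h p hp => ?_, fun h => ?_⟩
    · rw [← h]; simp only [hm, if_pos hp]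
    · funext p
      by_cases hp : p ∈ T
      · simp only [hm, if_pos hp]; exact h p hp
      · simp only [hm, if_neg hp]; exact (hw0 p hp).symm
  rw [e3]
  exact hE w hw'

theorem pp_prod (pr : P → ℕ) (r : P → Option ι) (T : Finset P) (h : sup r ⊆ T) :
    ∏ p ∈ T, pp (pr p) (r p) = ∏ p ∈ sup r, (pr p : ℝ) := by
  rw [← prod_subset h]
  · refine prod_congr rfl fun p hp => ?_
    rw [mem_sup] at hp
    obtain ⟨i, hi⟩ := Option.ne_none_iff_exists'.mp hp
    rw [hi]; rfl
  · intro p _ hp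
    rw [mem_sup, not_not] at hp
    rw [hp]; rfl

theorem card_pairs (T : Finset P) :
    ((univ : Finset ((P → Option ι) × (P → Option ι))).filter (fun z => sup z.1 ∪ sup z.2 = T)).card ≤
      ((Fintype.card ι + 1) ^ 2) ^ T.card := by
  classical
  have : (Finset.univ : Finset (T → Option ι × Option ι)).card = ((Fintype.card ι + 1) ^ 2) ^ T.card := by
    rw [card_univ, Fintype.card_fun, Fintype.card_prod, Fintype.card_option, Fintype.card_coe, sq]
  rw [← this]
  refine card_le_card_of_injOn (fun z p => (z.1 p, z.2 p)) (fun _ _ => mem_univ _) ?_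
  intro z hz z' hz' h
  simp only [coe_filter, mem_univ, true_and, Set.mem_ofPred_eq] at hz hz'
  have hn : ∀ z : (P → Option ι) × (P → Option ι), sup z.1 ∪ sup z.2 = T → ∀ p ∉ T, z.1 p = none ∧ z.2 p = none := by
    intro z hz p hp
    rw [← hz, mem_union, mem_sup, mem_sup] at hp
    tauto
  have key : ∀ p, z.1 p = z'.1 p ∧ z.2 p = z'.2 p := by
    intro p
    by_cases hp : p ∈ T
    · have := congrFun h ⟨p, hp⟩
      simpa using this
    · rw [(hn z hz p hp).1, (hn z hz p hp).2, (hn z' hz' p hp).1, (hn z' hz' p hp).2]; simp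
  refine Prod.ext ?_ ?_
  · funext p; exact (key p).1
  · funext p; exact (key p).2

theorem gen_sieve (a : ι → ℕ) (pr : P → ℕ) (hpr : ∀ p, 1 ≤ pr p) (N : Finset ℕ) (f : ℕ → ℝ) (U : P → Finset ℕ)
    (hU0 : ∀ p, (U p).Nonempty) (hUr : ∀ p, U p ⊆ range (pr p)) (hN : ∀ n ∈ N, ∀ p, n % pr p ∈ U p)
    (G : ℝ) (D : Finset P → ℝ) (hD0 : ∀ T, 0 ≤ D T) (Q : ℕ) (c : (P → Option ι) → ℝ)
    (hc : ∀ r, |c r| ≤ 1 / ∏ p ∈ sup r, (pr p : ℝ))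
    (hcs : ∀ r r', c r ≠ 0 → c r' ≠ 0 → ∏ p ∈ sup r ∪ sup r', pr p ≤ Q)
    (hE : ∀ T : Finset P, ∏ p ∈ T, pr p ≤ Q → ∀ w : P → ℕ, (∀ p ∈ T, w p ∈ U p) →
      |∑ n ∈ N.filter (fun n => ∀ p ∈ T, n % pr p = w p), f n - G / ∏ p ∈ T, ((U p).card : ℝ)| ≤ D T) :
    |∑ n ∈ N, f n * nu a pr c n ^ 2 - G * ∑ r, ∑ r', c r * c r' * ∏ p, Gk a (pr p) (U p) (r p) (r' p)| ≤
      ∑ T ∈ (univ : Finset (Finset P)).filter (fun T => ∏ p ∈ T, pr p ≤ Q),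
        ((2 * (Fintype.card ι + 1) ^ 2 : ℕ) : ℝ) ^ T.card * D T := by
  classical
  have h1 : ∑ n ∈ N, f n * nu a pr c n ^ 2 - G * ∑ r, ∑ r', c r * c r' * ∏ p, Gk a (pr p) (U p) (r p) (r' p)
      = ∑ z : (P → Option ι) × (P → Option ι), (c z.1 * c z.2) *
        (∑ n ∈ N, f n * (Xr a pr n z.1 * Xr a pr n z.2) - G * ∏ p, Gk a (pr p) (U p) (z.1 p) (z.2 p)) := by
    rw [Fintype.sum_prod_type]
    simp only [mul_sub, sum_sub_distrib]
    congr 1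
    · simp only [nu, sq_expand, mul_sum]
      rw [sum_comm]
      refine sum_congr rfl fun r _ => ?_
      rw [sum_comm]
      refine sum_congr rfl fun r' _ => sum_congr rfl fun n _ => ?_
      ring
    · simp only [mul_sum]
      refine sum_congr rfl fun r _ => sum_congr rfl fun r' _ => ?_
      ring
  have h2 : ∀ z : (P → Option ι) × (P → Option ι), |(c z.1 * c z.2) *
        (∑ n ∈ N, f n * (Xr a pr n z.1 * Xr a pr n z.2) - G * ∏ p, Gk a (pr p) (U p) (z.1 p) (z.2 p))| ≤
        (if ∏ p ∈ sup z.1 ∪ sup z.2, pr p ≤ Q then 2 ^ (sup z.1 ∪ sup z.2).card * D (sup z.1 ∪ sup z.2) else 0) := by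
    rintro ⟨r, r'⟩
    simp only
    split_ifs with hQ
    swap
    · have : c r * c r' = 0 := by
        by_contra hne
        exact hQ (hcs r r' (left_ne_zero_of_mul hne) (right_ne_zero_of_mul hne))
      rw [this]; simp
    set T := sup r ∪ sup r' with hT
    have hTn : ∀ p, p ∉ T → r p = none ∧ r' p = none := by
      intro p hp
      rw [hT, mem_union, mem_sup, mem_sup] at hp
      tauto
    have hpb := pair_bound a pr N f U hU0 hN G (D T) r r' T hTn (hE T hQ)
    have hprod : ∏ p ∈ T, ∑ w ∈ U p, |Xv a (pr p) w (r p) * Xv a (pr p) w (r' p)| ≤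
        2 ^ T.card * ((∏ p ∈ sup r, (pr p : ℝ)) * ∏ p ∈ sup r', (pr p : ℝ)) := by
      rw [← pp_prod pr r T subset_union_left, ← pp_prod pr r' T subset_union_right, ← prod_mul_distrib,
        ← prod_const, ← prod_mul_distrib]
      refine prod_le_prod (fun p _ => sum_nonneg fun _ _ => abs_nonneg _) fun p hp => ?_
      refine Xv_pair a (pr p) (hpr p) (U p) (hUr p) _ _ ?_
      rwa [hT, mem_union, mem_sup, mem_sup] at hp
    have hpos : ∀ r : P → Option ι, 0 < ∏ p ∈ sup r, (pr p : ℝ) := fun r =>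
      prod_pos fun p _ => by exact_mod_cast hpr p
    rw [abs_mul, abs_mul]
    calc |c r| * |c r'| * _ ≤ (1 / ∏ p ∈ sup r, (pr p : ℝ)) * (1 / ∏ p ∈ sup r', (pr p : ℝ)) *
          (D T * (2 ^ T.card * ((∏ p ∈ sup r, (pr p : ℝ)) * ∏ p ∈ sup r', (pr p : ℝ)))) := by
          refine mul_le_mul ?_ (hpb.trans (mul_le_mul_of_nonneg_left hprod (hD0 T))) (abs_nonneg _) ?_
          · exact mul_le_mul (hc r) (hc r') (abs_nonneg _) (one_div_nonneg.mpr (hpos r).le)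
          · have := (hpos r).le; have := (hpos r').le; positivity
      _ = 2 ^ T.card * D T := by
          have := (hpos r).ne'; have := (hpos r').ne'
          field_simp
  rw [h1]
  refine (abs_sum_le_sum_abs _ _).trans ((sum_le_sum fun z _ => h2 z).trans ?_)
  rw [← sum_fiberwise univ (fun z : (P → Option ι) × (P → Option ι) => sup z.1 ∪ sup z.2), sum_filter]
  refine sum_le_sum fun T _ => ?_
  have : ∑ z ∈ univ.filter (fun z : (P → Option ι) × (P → Option ι) => sup z.1 ∪ sup z.2 = T),
      (if ∏ p ∈ sup z.1 ∪ sup z.2, pr p ≤ Q then (2:ℝ) ^ (sup z.1 ∪ sup z.2).card * D (sup z.1 ∪ sup z.2) else 0) =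
      ∑ z ∈ univ.filter (fun z : (P → Option ι) × (P → Option ι) => sup z.1 ∪ sup z.2 = T),
      (if ∏ p ∈ T, pr p ≤ Q then (2:ℝ) ^ T.card * D T else 0) := by
    refine sum_congr rfl fun z hz => ?_
    rw [(mem_filter.mp hz).2]
  rw [this, sum_const, nsmul_eq_mul]
  split_ifs with h
  · have hc := card_pairs (ι := ι) T
    have hc' : (((univ : Finset ((P → Option ι) × (P → Option ι))).filter (fun z => sup z.1 ∪ sup z.2 = T)).card : ℝ) ≤
      (((Fintype.card ι + 1) ^ 2 : ℕ) : ℝ) ^ T.card := by exact_mod_cast hc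
    calc _ ≤ (((Fintype.card ι + 1) ^ 2 : ℕ) : ℝ) ^ T.card * (2 ^ T.card * D T) :=
          mul_le_mul_of_nonneg_right hc' (mul_nonneg (by positivity) (hD0 T))
      _ = _ := by
          rw [← mul_assoc, ← mul_pow]; push_cast; ring
  · simp

end gen
end OIR
end

section
open Finset MeasureTheory
namespace OIR

/-- cutoff -/
noncomputable def Hc (t : ℝ) : ℝ := max 0 (min 1 (4 * (1 - t)))

theorem Hc_nonneg (t : ℝ) : 0 ≤ Hc t := le_max_left _ _
theorem Hc_le_one (t : ℝ) : Hc t ≤ 1 := max_le (by norm_num) (min_le_left _ _)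
theorem Hc_one (t : ℝ) (h : t ≤ 3 / 4) : Hc t = 1 := by
  unfold Hc
  rw [min_eq_left (by linarith), max_eq_right (by norm_num)]
theorem Hc_zero (t : ℝ) (h : 1 ≤ t) : Hc t = 0 := by
  unfold Hc
  rw [max_eq_left ((min_le_right _ _).trans (by linarith))]
theorem Hc_anti (s t : ℝ) (h : s ≤ t) : Hc t ≤ Hc s := by
  unfold Hc
  exact max_le_max le_rfl (min_le_min le_rfl (by linarith))
theorem Hc_lip (s t : ℝ) (h : 0 ≤ t) : Hc s - Hc (s + t) ≤ 4 * t := by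
  unfold Hc
  rcases max_cases 0 (min 1 (4 * (1 - s))) with h1 | h1 <;> rcases max_cases 0 (min 1 (4 * (1 - (s + t)))) with h2 | h2 <;>
  rcases min_cases 1 (4 * (1 - s)) with h3 | h3 <;> rcases min_cases 1 (4 * (1 - (s+t))) with h4 | h4 <;>
  simp only [h1.1, h2.1] <;> linarith

noncomputable def g0 (β u : ℝ) : ℝ := 1 / (1 + β * u)

theorem g0_pos (β u : ℝ) (hβ : 0 ≤ β) (hu : 0 ≤ u) : 0 < g0 β u := by unfold g0; positivity
theorem g0_le_one (β u : ℝ) (hβ : 0 ≤ β) (hu : 0 ≤ u) : g0 β u ≤ 1 := by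
  unfold g0
  rw [div_le_one (by positivity)]
  nlinarith [mul_nonneg hβ hu]
theorem g0_anti (β u v : ℝ) (hβ : 0 ≤ β) (hu : 0 ≤ u) (h : u ≤ v) : g0 β v ≤ g0 β u := by
  unfold g0
  have := mul_nonneg hβ hu
  apply one_div_le_one_div_of_le (by linarith)
  have := mul_le_mul_of_nonneg_left h hβ
  linarith
theorem g0_lip (β u v : ℝ) (hβ : 0 ≤ β) (hu : 0 ≤ u) (hv : 0 ≤ v) : g0 β u - g0 β (u + v) ≤ g0 β u * (β * v) := by
  unfold g0
  have h1 := mul_nonneg hβ hu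
  have h2 := mul_nonneg hβ hv
  have : 1 / (1 + β * u) - 1 / (1 + β * (u + v)) = 1 / (1 + β * u) * (β * v) * (1 / (1 + β * (u + v))) := by
    have a1 : 1 + β * u ≠ 0 := by linarith
    have a2 : 1 + β * (u + v) ≠ 0 := by nlinarith
    field_simp
    ring
  rw [this]
  have h3 : 1 / (1 + β * (u + v)) ≤ 1 := by
    rw [div_le_one (by nlinarith)]
    nlinarith
  exact mul_le_of_le_one_right (mul_nonneg (by positivity) h2) h3

theorem gH_diff (β u v U : ℝ) (hβ : 0 ≤ β) (hu : 0 ≤ u) (hv : 0 ≤ v) :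
    |g0 β u * Hc U - g0 β (u + v) * Hc (U + v)| ≤ g0 β u * ((β + 4) * v) := by
  have h1 := g0_lip β u v hβ hu hv
  have h2 := Hc_lip U v hv
  have h3 := g0_anti β u (u + v) hβ hu (by linarith)
  have h4 := Hc_anti U (U + v) (by linarith)
  have h5 := (g0_pos β u hβ hu).le
  have h6 := (g0_pos β (u+v) hβ (by linarith)).le
  rw [abs_of_nonneg (sub_nonneg.mpr (mul_le_mul h3 h4 (Hc_nonneg _) h5))]
  have e : g0 β u * Hc U - g0 β (u + v) * Hc (U + v) = g0 β u * (Hc U - Hc (U + v)) + Hc (U + v) * (g0 β u - g0 β (u + v)) := by ring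
  rw [e]
  have e1 := mul_le_mul_of_nonneg_left h2 h5
  have e2 := mul_le_of_le_one_left (sub_nonneg.mpr h3) (Hc_le_one (U + v))
  nlinarith

section main
set_option linter.unusedSectionVars false
variable {P ι : Type*} [Fintype P] [DecidableEq P] [Fintype ι] [DecidableEq ι]

def us (δ : P → ℝ) (S : Finset P) : ℝ := ∑ p ∈ S, δ p
def qs (pr : P → ℕ) (S : Finset P) : ℝ := ∏ p ∈ S, (pr p : ℝ)
def fib (r : P → Option ι) (i : ι) : Finset P := univ.filter (fun p => r p = some i)

theorem mem_fib (r : P → Option ι) (i : ι) (p : P) : p ∈ fib r i ↔ r p = some i := by simp [fib]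

theorem sup_eq (r : P → Option ι) : sup r = univ.biUnion (fib r) := by
  ext p
  simp only [mem_sup, mem_biUnion, mem_univ, true_and, mem_fib]
  exact Option.ne_none_iff_exists'

theorem fib_disj (r : P → Option ι) (i j : ι) (h : i ≠ j) : Disjoint (fib r i) (fib r j) := by
  rw [disjoint_left]
  intro p h1 h2
  rw [mem_fib] at h1 h2
  rw [h1] at h2
  exact h (Option.some_injective _ h2)

theorem sup_prod {M : Type*} [CommMonoid M] (r : P → Option ι) (F : P → M) : ∏ p ∈ sup r, F p = ∏ i, ∏ p ∈ fib r i, F p := by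
  rw [sup_eq, prod_biUnion]
  intro i _ j _ h
  exact fib_disj r i j h

theorem sup_sum {M : Type*} [AddCommMonoid M] (r : P → Option ι) (F : P → M) : ∑ p ∈ sup r, F p = ∑ i, ∑ p ∈ fib r i, F p := by
  rw [sup_eq, sum_biUnion]
  intro i _ j _ h
  exact fib_disj r i j h

theorem fib_inj (r r' : P → Option ι) (h : fib r = fib r') : r = r' := by
  funext p
  have key : ∀ i, r p = some i ↔ r' p = some i := by
    intro i
    rw [← mem_fib, ← mem_fib, h]
  exact Option.ext (fun i => by simpa [Option.mem_def] using key i)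

noncomputable def yv (β : ℝ) (δ : P → ℝ) (r : P → Option ι) : ℝ := (∏ i, g0 β (us δ (fib r i))) * Hc (us δ (sup r))
noncomputable def cv (β : ℝ) (δ : P → ℝ) (pr : P → ℕ) (r : P → Option ι) : ℝ := yv β δ r / qs pr (sup r)
noncomputable def wv (β : ℝ) (δ : P → ℝ) (pr : P → ℕ) (S : Finset P) : ℝ :=
  if us δ S ≤ 1 then g0 β (us δ S) ^ 2 / qs pr S else 0

theorem us_nonneg {δ : P → ℝ} (hδ : ∀ p, 0 ≤ δ p) (S : Finset P) : 0 ≤ us δ S := sum_nonneg fun p _ => hδ p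
theorem us_mono {δ : P → ℝ} (hδ : ∀ p, 0 ≤ δ p) {S T : Finset P} (h : S ⊆ T) : us δ S ≤ us δ T :=
  sum_le_sum_of_subset_of_nonneg h fun p _ _ => hδ p
theorem us_sup (δ : P → ℝ) (r : P → Option ι) : us δ (sup r) = ∑ i, us δ (fib r i) := sup_sum r δ
theorem qs_pos {pr : P → ℕ} (hpr : ∀ p, 1 ≤ pr p) (S : Finset P) : 0 < qs pr S :=
  prod_pos fun p _ => by exact_mod_cast hpr p
theorem qs_sup (pr : P → ℕ) (r : P → Option ι) : qs pr (sup r) = ∏ i, qs pr (fib r i) := sup_prod r _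

theorem fib_sub_sup (r : P → Option ι) (i : ι) : fib r i ⊆ sup r := by
  intro p hp
  rw [mem_fib] at hp
  rw [mem_sup, hp]; simp

theorem yv_nonneg (β : ℝ) (hβ : 0 ≤ β) (δ : P → ℝ) (hδ : ∀ p, 0 ≤ δ p) (r : P → Option ι) : 0 ≤ yv β δ r :=
  mul_nonneg (prod_nonneg fun i _ => (g0_pos β _ hβ (us_nonneg hδ _)).le) (Hc_nonneg _)

theorem yv_le_one (β : ℝ) (hβ : 0 ≤ β) (δ : P → ℝ) (hδ : ∀ p, 0 ≤ δ p) (r : P → Option ι) : yv β δ r ≤ 1 := by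
  have h := prod_le_one (s := (univ : Finset ι)) (f := fun i => g0 β (us δ (fib r i))) (fun i _ => (g0_pos β _ hβ (us_nonneg hδ _)).le)
    (fun i _ => g0_le_one β _ hβ (us_nonneg hδ _))
  exact mul_le_one₀ h (Hc_nonneg _) (Hc_le_one _)

theorem yv_le (β : ℝ) (hβ : 0 ≤ β) (δ : P → ℝ) (hδ : ∀ p, 0 ≤ δ p) (r : P → Option ι) : yv β δ r ≤ if us δ (sup r) ≤ 1 then ∏ i, g0 β (us δ (fib r i)) else 0 := by
  unfold yv
  have h : 0 ≤ ∏ i, g0 β (us δ (fib r i)) := prod_nonneg fun i _ => (g0_pos β _ hβ (us_nonneg hδ _)).le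
  split_ifs with h1
  · exact mul_le_of_le_one_right h (Hc_le_one _)
  · rw [Hc_zero _ (by linarith)]; simp

theorem ev_sq (β : ℝ) (hβ : 0 ≤ β) (δ : P → ℝ) (hδ : ∀ p, 0 ≤ δ p) (pr : P → ℕ) (hpr : ∀ p, 1 ≤ pr p) (r : P → Option ι) : (if us δ (sup r) ≤ 1 then ∏ i, g0 β (us δ (fib r i)) else 0) ^ 2 / qs pr (sup r) ≤
    ∏ i, wv β δ pr (fib r i) := by
  have hw : ∀ S, 0 ≤ wv β δ pr S := by
    intro S; unfold wv
    have := (qs_pos hpr S).le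
    split_ifs <;> positivity
  split_ifs with h
  · have : ∀ i, wv β δ pr (fib r i) = g0 β (us δ (fib r i)) ^ 2 / qs pr (fib r i) := by
      intro i
      unfold wv
      rw [if_pos]
      exact (us_mono hδ (fib_sub_sup r i)).trans h
    simp only [this]
    rw [prod_div_distrib, prod_pow, qs_sup]
  · simpa using prod_nonneg fun i _ => hw _

theorem wv_nonneg (β : ℝ) (hβ : 0 ≤ β) (δ : P → ℝ) (hδ : ∀ p, 0 ≤ δ p) (pr : P → ℕ) (hpr : ∀ p, 1 ≤ pr p) (S : Finset P) : 0 ≤ wv β δ pr S := by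
  unfold wv
  have := (qs_pos hpr S).le
  split_ifs <;> positivity

theorem sum_fib_le (β : ℝ) (hβ : 0 ≤ β) (δ : P → ℝ) (hδ : ∀ p, 0 ≤ δ p) (pr : P → ℕ) (hpr : ∀ p, 1 ≤ pr p) : ∑ r : P → Option ι, ∏ i, wv β δ pr (fib r i) ≤ (∑ S, wv β δ pr S) ^ (Fintype.card ι) := by
  have e : (∑ S, wv β δ pr S) ^ (Fintype.card ι) = ∑ t : ι → Finset P, ∏ i, wv β δ pr (t i) := by
    rw [← card_univ, ← prod_const, prod_univ_sum, Fintype.piFinset_univ]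
  rw [e]
  rw [← sum_image (f := fun t : ι → Finset P => ∏ i, wv β δ pr (t i)) (g := fib) (s := univ) (fun r _ r' _ h => fib_inj r r' h)]
  exact sum_le_sum_of_subset_of_nonneg (subset_univ _) fun t _ _ => prod_nonneg fun i _ => wv_nonneg β hβ δ hδ pr hpr _

theorem cv_abs (β : ℝ) (hβ : 0 ≤ β) (δ : P → ℝ) (hδ : ∀ p, 0 ≤ δ p) (pr : P → ℕ) (hpr : ∀ p, 1 ≤ pr p) (r : P → Option ι) : |cv β δ pr r| ≤ 1 / ∏ p ∈ sup r, (pr p : ℝ) := by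
  unfold cv
  rw [abs_div, abs_of_nonneg (yv_nonneg β hβ δ hδ r), abs_of_pos (qs_pos hpr _)]
  exact div_le_div_of_nonneg_right (yv_le_one β hβ δ hδ r) (qs_pos hpr _).le

theorem main_S1 (β : ℝ) (hβ : 0 ≤ β) (δ : P → ℝ) (hδ : ∀ p, 0 ≤ δ p) (pr : P → ℕ) (hpr : ∀ p, 1 ≤ pr p) (a : ι → ℕ) (ha : ∀ p, ∀ n i j, pr p ∣ n + a i → pr p ∣ n + a j → i = j) :
    ∑ r, ∑ r', cv β δ pr r * cv β δ pr r' * ∏ p, Gk a (pr p) (range (pr p)) (r p) (r' p) ≤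
      (∑ S, wv β δ pr S) ^ (Fintype.card ι) := by
  refine (tensor_up (fun p => Gk a (pr p) (range (pr p))) (fun p => Gk_psd _ _ _) (fun p => pp (pr p))
    (fun p z x => if x = z then 1 else 0) ?_ (cv β δ pr)).trans (le_trans ?_ (sum_fib_le β hβ δ hδ pr hpr))
  · intro p c
    refine (local_full a (pr p) (hpr p) (ha p) c).trans (le_of_eq ?_)
    simp only [mul_ite, mul_one, mul_zero, sum_ite_eq', mem_univ, if_true]
    rw [Fintype.sum_option, mul_sum]
    simp [pp]
  · refine sum_le_sum fun s _ => ?_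
    have e1 : ∀ r : P → Option ι, ∏ p, (if r p = s p then (1:ℝ) else 0) = if r = s then 1 else 0 := by
      intro r
      rw [prod_ite_zero]
      simp [funext_iff]
    simp only [e1, mul_ite, mul_one, mul_zero, sum_ite_eq', mem_univ, if_true]
    rw [pp_prod pr s univ (subset_univ _)]
    refine le_trans ?_ (ev_sq β hβ δ hδ pr hpr s)
    have hq := qs_pos hpr (sup s)
    have : (∏ p ∈ sup s, (pr p : ℝ)) * cv β δ pr s ^ 2 = yv β δ s ^ 2 / qs pr (sup s) := by
      unfold cv
      change qs pr (sup s) * _ = _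
      field_simp
    rw [this]
    refine div_le_div_of_nonneg_right ?_ hq.le
    exact pow_le_pow_left₀ (yv_nonneg β hβ δ hδ s) (yv_le β hβ δ hδ s) 2

end main
end OIR
end

section
open Finset MeasureTheory
namespace OIR

section main
set_option linter.unusedSectionVars false
set_option linter.unusedVariables false
variable {P ι : Type*} [Fintype P] [DecidableEq P] [Fintype ι] [DecidableEq ι]

theorem sup_upd (s : P → Option ι) (p0 : P) (i : ι) : sup (Function.update s p0 (some i)) = insert p0 (sup s) := by
  ext p
  rw [mem_insert, mem_sup, mem_sup]
  by_cases h : p = p0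
  · subst h; simp
  · simp [h]

theorem fib_upd_self (s : P → Option ι) (p0 : P) (i : ι) :
    fib (Function.update s p0 (some i)) i = insert p0 (fib s i) := by
  ext p
  rw [mem_insert, mem_fib, mem_fib]
  by_cases h : p = p0
  · subst h; simp
  · simp [h]

theorem fib_upd_ne (s : P → Option ι) (p0 : P) (hs : s p0 = none) (i i' : ι) (hi : i' ≠ i) :
    fib (Function.update s p0 (some i)) i' = fib s i' := by
  ext p
  rw [mem_fib, mem_fib]
  by_cases h : p = p0
  · subst h; simp [hs, hi.symm]
  · simp [Function.update_of_ne h]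

/-- envelope -/
noncomputable def Ev (β : ℝ) (δ : P → ℝ) (r : P → Option ι) : ℝ :=
  if us δ (sup r) ≤ 1 then ∏ i, g0 β (us δ (fib r i)) else 0

theorem y_upd (β : ℝ) (hβ : 0 ≤ β) (δ : P → ℝ) (hδ : ∀ p, 0 ≤ δ p) (s : P → Option ι) (p0 : P) (hs : s p0 = none) (i : ι) :
    |yv β δ s - yv β δ (Function.update s p0 (some i))| ≤ Ev β δ s * ((β + 4) * δ p0) ∧
    yv β δ (Function.update s p0 (some i)) ≤ Ev β δ s := by
  have hn1 : p0 ∉ sup s := by rw [mem_sup]; simp [hs]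
  have hn2 : p0 ∉ fib s i := by rw [mem_fib]; simp [hs]
  have e1 : yv β δ s = (∏ i' ∈ univ.erase i, g0 β (us δ (fib s i'))) * (g0 β (us δ (fib s i)) * Hc (us δ (sup s))) := by
    unfold yv
    rw [← mul_prod_erase univ _ (mem_univ i)]; ring
  have e2 : yv β δ (Function.update s p0 (some i)) = (∏ i' ∈ univ.erase i, g0 β (us δ (fib s i'))) *
      (g0 β (us δ (fib s i) + δ p0) * Hc (us δ (sup s) + δ p0)) := by
    unfold yv
    rw [← mul_prod_erase univ _ (mem_univ i), fib_upd_self, sup_upd]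
    have : ∏ i' ∈ univ.erase i, g0 β (us δ (fib (Function.update s p0 (some i)) i')) = ∏ i' ∈ univ.erase i, g0 β (us δ (fib s i')) := by
      refine prod_congr rfl fun i' hi' => ?_
      rw [fib_upd_ne s p0 hs i i' (ne_of_mem_erase hi')]
    rw [this]
    have u1 : us δ (insert p0 (fib s i)) = us δ (fib s i) + δ p0 := by unfold us; rw [sum_insert hn2, add_comm]
    have u2 : us δ (insert p0 (sup s)) = us δ (sup s) + δ p0 := by unfold us; rw [sum_insert hn1, add_comm]
    rw [u1, u2]; ring
  set u := us δ (fib s i) with hu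
  have hu0 : 0 ≤ u := us_nonneg hδ _
  set Z := ∏ i' ∈ univ.erase i, g0 β (us δ (fib s i'))
  have hZ : 0 ≤ Z := prod_nonneg fun i' _ => (g0_pos β _ hβ (us_nonneg hδ _)).le
  rw [e1, e2]
  unfold Ev
  split_ifs with h
  · rw [← mul_prod_erase univ _ (mem_univ i)]
    constructor
    · rw [← mul_sub, abs_mul, abs_of_nonneg hZ]
      have := mul_le_mul_of_nonneg_left (gH_diff β u (δ p0) (us δ (sup s)) hβ hu0 (hδ p0)) hZ
      refine this.trans (le_of_eq ?_)
      ring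
    · rw [mul_comm]
      refine mul_le_mul_of_nonneg_right ?_ hZ
      refine (mul_le_of_le_one_right (g0_pos β _ hβ (add_nonneg hu0 (hδ p0))).le (Hc_le_one _)).trans ?_
      exact g0_anti β _ _ hβ hu0 (le_add_of_nonneg_right (hδ p0))
  · have h1 : 1 ≤ us δ (sup s) := by linarith
    rw [Hc_zero _ h1, Hc_zero _ (le_add_of_le_of_nonneg h1 (hδ p0))]
    simp

theorem c_upd (β : ℝ) (hβ : 0 ≤ β) (δ : P → ℝ) (hδ : ∀ p, 0 ≤ δ p) (pr : P → ℕ) (hpr : ∀ p, 1 ≤ pr p)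
    (a : ι → ℕ) (ha : ∀ p, ∀ n i j, pr p ∣ n + a i → pr p ∣ n + a j → i = j)
    (p0 : P) (w0 : ℕ) (j : ι) (hw : pr p0 ∣ w0 + a j) (s : P → Option ι) (hs : s p0 = none) :
    |∑ x, cv β δ pr (Function.update s p0 x) * Xv a (pr p0) w0 x| ≤
      Ev β δ s / qs pr (sup s) * ((β + 4) * δ p0 + Fintype.card ι / pr p0) := by
  have hn1 : p0 ∉ sup s := by rw [mem_sup]; simp [hs]
  have hq := qs_pos hpr (sup s)
  have hp : (0:ℝ) < pr p0 := by exact_mod_cast hpr p0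
  have hX : ∀ i, Xv a (pr p0) w0 (some i) = 1 - if i = j then (pr p0 : ℝ) else 0 := by
    intro i
    simp only [Xv]
    by_cases h : i = j
    · subst h; simp [hw]
    · rw [if_neg (fun h' => h (ha p0 w0 i j h' hw)), if_neg h, sub_zero]
  have hc : ∀ i, cv β δ pr (Function.update s p0 (some i)) = yv β δ (Function.update s p0 (some i)) / (qs pr (sup s) * pr p0) := by
    intro i
    unfold cv
    rw [sup_upd]
    congr 1
    unfold qs
    rw [prod_insert hn1, mul_comm]
  rw [Fintype.sum_option]
  have h0 : cv β δ pr (Function.update s p0 none) * Xv a (pr p0) w0 none = yv β δ s / qs pr (sup s) := by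
    rw [← hs, Function.update_eq_self, hs]
    simp [Xv, cv]
  rw [h0]
  set Y := fun i => yv β δ (Function.update s p0 (some i)) with hY
  have h1 : yv β δ s / qs pr (sup s) + ∑ i, cv β δ pr (Function.update s p0 (some i)) * Xv a (pr p0) w0 (some i) =
      ((yv β δ s - Y j) + (∑ i, Y i) / pr p0) / qs pr (sup s) := by
    simp only [hc, hX]
    have : ∀ i, yv β δ (Function.update s p0 (some i)) / (qs pr (sup s) * pr p0) * (1 - if i = j then (pr p0 : ℝ) else 0) =
        Y i / pr p0 / qs pr (sup s) - (if i = j then Y i / qs pr (sup s) else 0) := by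
      intro i
      by_cases h : i = j
      · subst h; simp only [if_true]; field_simp; simp only [hY]; ring
      · simp only [if_neg h]; field_simp; ring
    simp only [this]
    rw [sum_sub_distrib, sum_ite_eq' univ j, if_pos (mem_univ j), sum_div, add_div, sum_div, sub_div]
    ring
  rw [h1, abs_div, abs_of_pos hq, div_mul_eq_mul_div]
  refine div_le_div_of_nonneg_right ?_ hq.le
  refine (abs_add_le _ _).trans ?_
  rw [mul_add]
  refine add_le_add (y_upd β hβ δ hδ s p0 hs j).1 ?_
  have hY0 : ∀ i, 0 ≤ Y i := fun i => yv_nonneg β hβ δ hδ _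
  rw [abs_of_nonneg (div_nonneg (sum_nonneg fun i _ => hY0 i) hp.le), mul_div_assoc']
  refine div_le_div_of_nonneg_right ?_ hp.le
  refine (sum_le_sum fun i _ => (y_upd β hβ δ hδ s p0 hs i).2).trans (le_of_eq ?_)
  rw [sum_const, nsmul_eq_mul, card_univ, mul_comm]

theorem main_S3 (β : ℝ) (hβ : 0 ≤ β) (δ : P → ℝ) (hδ : ∀ p, 0 ≤ δ p) (pr : P → ℕ) (hpr : ∀ p, 1 ≤ pr p)
    (a : ι → ℕ) (ha : ∀ p, ∀ n i j, pr p ∣ n + a i → pr p ∣ n + a j → i = j)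
    (p0 : P) (w0 : ℕ) (j : ι) (hw : pr p0 ∣ w0 + a j) :
    ∑ r, ∑ r', cv β δ pr r * cv β δ pr r' * ∏ p, Gk a (pr p) (if p = p0 then {w0} else range (pr p)) (r p) (r' p) ≤
      (∑ S, wv β δ pr S) ^ (Fintype.card ι) * ((β + 4) * δ p0 + Fintype.card ι / pr p0) ^ 2 := by
  set B := (β + 4) * δ p0 + Fintype.card ι / pr p0
  refine (tensor_up (fun p => Gk a (pr p) (if p = p0 then {w0} else range (pr p))) (fun p => Gk_psd _ _ _)
    (fun p z => if p = p0 then 1 else pp (pr p) z)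
    (fun p z x => if p = p0 then (if z = none then Xv a (pr p) w0 x else 0) else (if x = z then 1 else 0)) ?_ (cv β δ pr)).trans
    (le_trans ?_ (mul_le_mul_of_nonneg_right (sum_fib_le β hβ δ hδ pr hpr) (sq_nonneg B)))
  · intro p c
    by_cases h : p = p0
    · simp only [if_pos h]
      rw [Gk_form, Fintype.sum_option]
      simp
    · simp only [if_neg h]
      refine (local_full a (pr p) (hpr p) (ha p) c).trans (le_of_eq ?_)
      simp only [mul_ite, mul_one, mul_zero, sum_ite_eq', mem_univ, if_true]
      rw [Fintype.sum_option, mul_sum]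
      simp [pp]
  · rw [sum_mul]
    refine sum_le_sum fun s _ => ?_
    have hR : 0 ≤ (∏ i, wv β δ pr (fib s i)) * B ^ 2 :=
      mul_nonneg (prod_nonneg fun i _ => wv_nonneg β hβ δ hδ pr hpr _) (sq_nonneg B)
    by_cases hs : s p0 = none
    swap
    · have : ∀ r : P → Option ι, ∏ p, (if p = p0 then (if s p = none then Xv a (pr p) w0 (r p) else 0) else (if r p = s p then (1:ℝ) else 0)) = 0 := by
        intro r
        refine prod_eq_zero (mem_univ p0) ?_
        simp [hs]
      simp only [this]
      simpa using hR
    have hsum : ∑ r, cv β δ pr r * ∏ p, (if p = p0 then (if s p = none then Xv a (pr p) w0 (r p) else 0) else (if r p = s p then (1:ℝ) else 0))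
        = ∑ x, cv β δ pr (Function.update s p0 x) * Xv a (pr p0) w0 x := by
      have hinj : Set.InjOn (fun x => Function.update s p0 x) ((univ : Finset (Option ι)) : Set (Option ι)) := by
        intro x _ x' _ h
        have := congrFun h p0
        simpa using this
      rw [← sum_subset (subset_univ (univ.image (fun x => Function.update s p0 x))), sum_image hinj]
      · refine sum_congr rfl fun x _ => ?_
        congr 1
        rw [← mul_prod_erase univ _ (mem_univ p0)]
        have : ∏ p ∈ univ.erase p0, (if p = p0 then (if s p = none then Xv a (pr p) w0 (Function.update s p0 x p) else 0) else (if Function.update s p0 x p = s p then (1:ℝ) else 0)) = 1 := by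
          refine prod_eq_one fun p hp => ?_
          have := ne_of_mem_erase hp
          simp [this]
        rw [this]
        simp [hs]
      · intro r _ hr
        have : ∃ p, p ≠ p0 ∧ r p ≠ s p := by
          by_contra hcon
          push Not at hcon
          apply hr
          rw [mem_image]
          refine ⟨r p0, mem_univ _, ?_⟩
          funext p
          by_cases h : p = p0
          · subst h; simp
          · rw [Function.update_of_ne h, hcon p h]
        obtain ⟨p, hp, hp'⟩ := this
        rw [prod_eq_zero (mem_univ p), mul_zero]
        simp [hp, hp']
    rw [hsum]
    have hd : ∏ p, (if p = p0 then (1:ℝ) else pp (pr p) (s p)) = qs pr (sup s) := by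
      unfold qs
      rw [← pp_prod pr s univ (subset_univ _)]
      refine prod_congr rfl fun p _ => ?_
      split_ifs with h
      · subst h; rw [hs]; rfl
      · rfl
    rw [hd]
    have hq := qs_pos hpr (sup s)
    have h1 := c_upd β hβ δ hδ pr hpr a ha p0 w0 j hw s hs
    have h2 := pow_le_pow_left₀ (abs_nonneg _) h1 2
    rw [sq_abs] at h2
    calc _ ≤ qs pr (sup s) * (Ev β δ s / qs pr (sup s) * B) ^ 2 := mul_le_mul_of_nonneg_left h2 hq.le
      _ = (Ev β δ s ^ 2 / qs pr (sup s)) * B ^ 2 := by field_simp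
      _ ≤ _ := mul_le_mul_of_nonneg_right (ev_sq β hβ δ hδ pr hpr s) (sq_nonneg B)

end main
end OIR
end

section
open Finset MeasureTheory
namespace OIR

section mom
set_option linter.unusedSectionVars false
set_option linter.unusedVariables false
variable {P ι : Type*} [Fintype P] [DecidableEq P] [Fintype ι] [DecidableEq ι]

theorem prod_sum_fun (h : ι → Finset P → ℝ) : ∑ t : ι → Finset P, ∏ i, h i (t i) = ∏ i, ∑ S, h i S := by
  rw [prod_univ_sum, Fintype.piFinset_univ]

theorem mom_one (π : ι → Finset P → ℝ) (h1 : ∀ i, ∑ S, π i S = 1) (F : Finset P → ℝ) (i0 : ι) :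
    ∑ t : ι → Finset P, (∏ i, π i (t i)) * F (t i0) = ∑ S, π i0 S * F S := by
  have e : ∀ t : ι → Finset P, (∏ i, π i (t i)) * F (t i0) = ∏ i, (π i (t i) * if i = i0 then F (t i) else 1) := by
    intro t
    rw [prod_mul_distrib, prod_ite_eq' univ i0, if_pos (mem_univ i0)]
  simp only [e]
  rw [prod_sum_fun (fun i S => π i S * if i = i0 then F S else 1), ← mul_prod_erase univ _ (mem_univ i0)]
  simp only [if_true]
  rw [prod_eq_one, mul_one]
  intro i hi
  simp [ne_of_mem_erase hi, h1]

theorem mom_two (π : ι → Finset P → ℝ) (h1 : ∀ i, ∑ S, π i S = 1) (F : Finset P → ℝ) (i0 j0 : ι) (hij : i0 ≠ j0) :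
    ∑ t : ι → Finset P, (∏ i, π i (t i)) * (F (t i0) * F (t j0)) = (∑ S, π i0 S * F S) * ∑ S, π j0 S * F S := by
  have e : ∀ t : ι → Finset P, (∏ i, π i (t i)) * (F (t i0) * F (t j0)) =
      ∏ i, (π i (t i) * ((if i = i0 then F (t i) else 1) * (if i = j0 then F (t i) else 1))) := by
    intro t
    rw [prod_mul_distrib, prod_mul_distrib, prod_ite_eq' univ i0, if_pos (mem_univ i0), prod_ite_eq' univ j0, if_pos (mem_univ j0)]
  simp only [e]
  rw [prod_sum_fun (fun i S => π i S * ((if i = i0 then F S else 1) * (if i = j0 then F S else 1))), ← mul_prod_erase univ _ (mem_univ i0),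
    ← mul_prod_erase (univ.erase i0) _ (mem_erase.mpr ⟨hij.symm, mem_univ j0⟩)]
  simp only [if_true, if_neg hij, if_neg hij.symm, mul_one, one_mul]
  rw [prod_eq_one, mul_one]
  intro i hi
  rw [mem_erase, mem_erase] at hi
  simp [hi.1, hi.2.1, h1]

theorem mem_range_fib (t : ι → Finset P) (ht : ∀ i j, i ≠ j → Disjoint (t i) (t j)) : ∃ r : P → Option ι, fib r = t := by
  classical
  refine ⟨fun p => if h : ∃ i, p ∈ t i then some h.choose else none, ?_⟩
  funext i
  ext p
  rw [mem_fib]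
  constructor
  · intro h
    split_ifs at h with h'
    have := h'.choose_spec
    rw [Option.some_injective _ h] at this
    exact this
  · intro h
    have h' : ∃ i, p ∈ t i := ⟨i, h⟩
    rw [dif_pos h']
    congr 1
    by_contra hne
    exact disjoint_left.mp (ht _ _ hne) h'.choose_spec h

theorem good_mass (π : ι → Finset P → ℝ) (h0 : ∀ i S, 0 ≤ π i S) (h1 : ∀ i, ∑ S, π i S = 1) (ε : P → ℝ) (hε : ∀ p, 0 ≤ ε p)
    (hp : ∀ i p, ∑ S, π i S * (if p ∈ S then 1 else 0) ≤ ε p) (δ : P → ℝ) (hδ : ∀ p, 0 ≤ δ p) (μ : ℝ)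
    (hu : ∀ i, ∑ S, π i S * us δ S ≤ μ) (B : ℝ) (hB : 0 ≤ B) :
    1 - (2 * Fintype.card ι * μ + (Fintype.card ι ^ 2 + B * Fintype.card ι) * ∑ p, ε p ^ 2) ≤
      ∑ s : P → Option ι, if us δ (sup s) ≤ 1 / 2 ∧ B * us ε (sup s) ≤ 1 then ∏ i, π i (fib s i) else 0 := by
  classical
  set bad : (ι → Finset P) → ℝ := fun t => 2 * ∑ i, us δ (t i) +
    ∑ i, ∑ j ∈ univ.erase i, ∑ p, (if p ∈ t i then (1:ℝ) else 0) * (if p ∈ t j then 1 else 0) + B * ∑ i, us ε (t i) with hbad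
  have hπ : ∀ t : ι → Finset P, 0 ≤ ∏ i, π i (t i) := fun t => prod_nonneg fun i _ => h0 i _
  have hI : ∀ (t : ι → Finset P) i p, (0:ℝ) ≤ if p ∈ t i then 1 else 0 := by
    intro t i p; split_ifs <;> norm_num
  have b1 : ∀ t : ι → Finset P, 0 ≤ ∑ i, us δ (t i) := fun t => sum_nonneg fun i _ => us_nonneg hδ _
  have b2 : ∀ t : ι → Finset P, 0 ≤ ∑ i, ∑ j ∈ univ.erase i, ∑ p, (if p ∈ t i then (1:ℝ) else 0) * (if p ∈ t j then 1 else 0) :=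
    fun t => sum_nonneg fun i _ => sum_nonneg fun j _ => sum_nonneg fun p _ => mul_nonneg (hI t i p) (hI t j p)
  have b3 : ∀ t : ι → Finset P, 0 ≤ B * ∑ i, us ε (t i) := fun t => mul_nonneg hB (sum_nonneg fun i _ => us_nonneg hε _)
  -- expectation of bad
  have hEb : ∑ t : ι → Finset P, (∏ i, π i (t i)) * bad t ≤
      2 * Fintype.card ι * μ + (Fintype.card ι ^ 2 + B * Fintype.card ι) * ∑ p, ε p ^ 2 := by
    have e1 : ∑ t : ι → Finset P, (∏ i, π i (t i)) * (2 * ∑ i, us δ (t i)) ≤ 2 * Fintype.card ι * μ := by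
      calc ∑ t : ι → Finset P, (∏ i, π i (t i)) * (2 * ∑ i, us δ (t i))
          = 2 * ∑ i0, ∑ t : ι → Finset P, (∏ i, π i (t i)) * us δ (t i0) := by
            rw [sum_comm, mul_sum]
            refine sum_congr rfl fun t _ => ?_
            rw [← mul_sum]; ring
        _ ≤ 2 * ∑ i0 : ι, μ := by
            refine mul_le_mul_of_nonneg_left (sum_le_sum fun i0 _ => ?_) (by norm_num)
            rw [mom_one π h1 (us δ) i0]
            exact hu i0
        _ = _ := by rw [sum_const, nsmul_eq_mul, card_univ]; ring
    have huε : ∀ i, ∑ S, π i S * us ε S ≤ ∑ p, ε p ^ 2 := by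
      intro i
      calc ∑ S, π i S * us ε S = ∑ p, ε p * ∑ S, π i S * (if p ∈ S then 1 else 0) := by
            simp only [mul_sum]
            rw [sum_comm]
            refine sum_congr rfl fun S _ => ?_
            unfold us
            rw [mul_sum, ← sum_subset (subset_univ S)]
            · refine sum_congr rfl fun p hp => ?_
              rw [if_pos hp]; ring
            · intro p _ hp
              rw [if_neg hp]; ring
        _ ≤ ∑ p, ε p * ε p := sum_le_sum fun p _ => mul_le_mul_of_nonneg_left (hp i p) (hε p)
        _ = _ := by simp only [sq]
    have e3 : ∑ t : ι → Finset P, (∏ i, π i (t i)) * (B * ∑ i, us ε (t i)) ≤ B * Fintype.card ι * ∑ p, ε p ^ 2 := by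
      calc ∑ t : ι → Finset P, (∏ i, π i (t i)) * (B * ∑ i, us ε (t i))
          = B * ∑ i0, ∑ t : ι → Finset P, (∏ i, π i (t i)) * us ε (t i0) := by
            rw [sum_comm, mul_sum]
            refine sum_congr rfl fun t _ => ?_
            rw [← mul_sum]; ring
        _ ≤ B * ∑ i0 : ι, ∑ p, ε p ^ 2 := by
            refine mul_le_mul_of_nonneg_left (sum_le_sum fun i0 _ => ?_) hB
            rw [mom_one π h1 (us ε) i0]
            exact huε i0
        _ = _ := by rw [sum_const, nsmul_eq_mul, card_univ]; ring
    have e2 : ∑ t : ι → Finset P, (∏ i, π i (t i)) *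
        (∑ i, ∑ j ∈ univ.erase i, ∑ p, (if p ∈ t i then (1:ℝ) else 0) * (if p ∈ t j then 1 else 0)) ≤
        Fintype.card ι ^ 2 * ∑ p, ε p ^ 2 := by
      calc ∑ t : ι → Finset P, (∏ i, π i (t i)) *
          (∑ i, ∑ j ∈ univ.erase i, ∑ p, (if p ∈ t i then (1:ℝ) else 0) * (if p ∈ t j then 1 else 0))
          = ∑ i, ∑ j ∈ univ.erase i, ∑ p, ∑ t : ι → Finset P, (∏ i, π i (t i)) *
              ((if p ∈ t i then (1:ℝ) else 0) * (if p ∈ t j then 1 else 0)) := by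
            simp only [mul_sum]
            rw [sum_comm]
            refine sum_congr rfl fun i _ => ?_
            rw [sum_comm]
            refine sum_congr rfl fun j _ => ?_
            rw [sum_comm]
        _ ≤ ∑ i : ι, ∑ j ∈ univ.erase i, ∑ p, ε p ^ 2 := by
            refine sum_le_sum fun i _ => sum_le_sum fun j hj => sum_le_sum fun p _ => ?_
            rw [mom_two π h1 (fun S => if p ∈ S then (1:ℝ) else 0) i j (ne_of_mem_erase hj).symm, sq]
            refine mul_le_mul (hp i p) (hp j p) ?_ (hε p)
            refine sum_nonneg fun S _ => mul_nonneg (h0 _ _) ?_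
            split_ifs <;> norm_num
        _ ≤ ∑ i : ι, ∑ j : ι, ∑ p, ε p ^ 2 := by
            refine sum_le_sum fun i _ => sum_le_sum_of_subset_of_nonneg (subset_univ _) fun j _ _ => ?_
            exact sum_nonneg fun p _ => sq_nonneg _
        _ = _ := by simp only [sum_const, nsmul_eq_mul, card_univ]; ring
    calc _ = ∑ t : ι → Finset P, (∏ i, π i (t i)) * (2 * ∑ i, us δ (t i)) + ∑ t : ι → Finset P, (∏ i, π i (t i)) *
        (∑ i, ∑ j ∈ univ.erase i, ∑ p, (if p ∈ t i then (1:ℝ) else 0) * (if p ∈ t j then 1 else 0)) +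
        ∑ t : ι → Finset P, (∏ i, π i (t i)) * (B * ∑ i, us ε (t i)) := by
          rw [← sum_add_distrib, ← sum_add_distrib]
          refine sum_congr rfl fun t _ => ?_
          simp only [hbad]; ring
      _ ≤ _ := by linarith
  have hE1 : ∑ t : ι → Finset P, ∏ i, π i (t i) = 1 := by
    rw [prod_sum_fun]; exact prod_eq_one fun i _ => h1 i
  calc _ ≤ ∑ t : ι → Finset P, (∏ i, π i (t i)) * (1 - bad t) := by
        simp only [mul_sub, mul_one, sum_sub_distrib]
        rw [hE1]; linarith
    _ ≤ ∑ t ∈ univ.image (fib : (P → Option ι) → ι → Finset P), (∏ i, π i (t i)) * (1 - bad t) := by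
        rw [← sum_filter_add_sum_filter_not univ (fun t => t ∈ univ.image (fib : (P → Option ι) → ι → Finset P))]
        have : ∑ t ∈ univ.filter (fun t => t ∉ univ.image (fib : (P → Option ι) → ι → Finset P)), (∏ i, π i (t i)) * (1 - bad t) ≤ 0 := by
          refine sum_nonpos fun t ht => ?_
          refine mul_nonpos_of_nonneg_of_nonpos (hπ t) ?_
          have hnd : ¬ ∀ i j, i ≠ j → Disjoint (t i) (t j) := by
            intro hd
            obtain ⟨r, hr⟩ := mem_range_fib t hd
            exact (mem_filter.mp ht).2 (mem_image.mpr ⟨r, mem_univ _, hr⟩)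
          push Not at hnd
          obtain ⟨i, j, hij, hd⟩ := hnd
          rw [not_disjoint_iff] at hd
          obtain ⟨p, hpi, hpj⟩ := hd
          have : (1:ℝ) ≤ ∑ i, ∑ j ∈ univ.erase i, ∑ p, (if p ∈ t i then (1:ℝ) else 0) * (if p ∈ t j then 1 else 0) := by
            have s1 := single_le_sum (f := fun i => ∑ j ∈ univ.erase i, ∑ p, (if p ∈ t i then (1:ℝ) else 0) * (if p ∈ t j then 1 else 0))
              (fun i _ => sum_nonneg fun j _ => sum_nonneg fun p _ => mul_nonneg (hI t i p) (hI t j p)) (mem_univ i)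
            have s2 := single_le_sum (f := fun j => ∑ p, (if p ∈ t i then (1:ℝ) else 0) * (if p ∈ t j then 1 else 0))
              (fun j _ => sum_nonneg fun p _ => mul_nonneg (hI t i p) (hI t j p)) (mem_erase.mpr ⟨hij.symm, mem_univ j⟩)
            have s3 := single_le_sum (f := fun p => (if p ∈ t i then (1:ℝ) else 0) * (if p ∈ t j then 1 else 0))
              (fun p _ => mul_nonneg (hI t i p) (hI t j p)) (mem_univ p)
            simp only [if_pos hpi, if_pos hpj, mul_one] at s3
            linarith
          have := b1 t
          have := b3 t
          simp only [hbad]; linarith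
        have e : univ.filter (fun t => t ∈ univ.image (fib : (P → Option ι) → ι → Finset P)) = univ.image fib := by
          ext t; simp
        rw [e]; linarith
    _ = ∑ s : P → Option ι, (∏ i, π i (fib s i)) * (1 - bad (fib s)) :=
        sum_image fun r _ r' _ h => fib_inj r r' h
    _ ≤ _ := by
        refine sum_le_sum fun s _ => ?_
        have hb0 : 0 ≤ bad (fib s) := by
          have := b1 (fib s); have := b2 (fib s); have := b3 (fib s)
          simp only [hbad]; linarith
        split_ifs with hg
        · exact mul_le_of_le_one_right (hπ _) (by linarith)
        · refine mul_nonpos_of_nonneg_of_nonpos (hπ _) ?_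
          have := b1 (fib s); have := b2 (fib s); have := b3 (fib s)
          rw [us_sup, us_sup] at hg
          simp only [hbad]
          by_cases h : ∑ i, us δ (fib s i) ≤ 1 / 2
          · have : ¬ B * ∑ i, us ε (fib s i) ≤ 1 := fun h' => hg ⟨h, h'⟩
            linarith
          · linarith

end mom
end OIR
end

section
open Finset MeasureTheory
namespace OIR

section mainTwo
set_option linter.unusedSectionVars false
set_option linter.unusedVariables false
variable {P ι : Type*} [Fintype P] [DecidableEq P] [Fintype ι] [DecidableEq ι]

theorem one_sub_sum_le_prod {κ : Type*} [DecidableEq κ] (s : Finset κ) (x : κ → ℝ) (h0 : ∀ p ∈ s, 0 ≤ x p) (h1 : ∀ p ∈ s, x p ≤ 1) :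
    1 - ∑ p ∈ s, x p ≤ ∏ p ∈ s, (1 - x p) := by
  induction s using Finset.induction_on with
  | empty => simp
  | insert a s ha ih =>
    rw [sum_insert ha, prod_insert ha]
    have ih' := ih (fun p hp => h0 p (mem_insert_of_mem hp)) (fun p hp => h1 p (mem_insert_of_mem hp))
    have a0 := h0 a (mem_insert_self _ _)
    have a1 := h1 a (mem_insert_self _ _)
    have s0 : 0 ≤ ∑ p ∈ s, x p := sum_nonneg fun p hp => h0 p (mem_insert_of_mem hp)
    have := mul_le_mul_of_nonneg_left ih' (sub_nonneg.mpr a1)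
    nlinarith [mul_nonneg a0 s0]

/-- removing a finite set of primes from a multiplicative type sum -/
theorem remove_primes (pr : P → ℕ) (hpr : ∀ p, 1 ≤ pr p) (f : Finset P → ℝ) (hf : ∀ S, 0 ≤ f S)
    (hm : ∀ p S, p ∉ S → f (insert p S) ≤ f S / pr p) (F : Finset P) :
    ∑ S, f S ≤ (∏ p ∈ F, (1 + 1 / (pr p : ℝ))) * ∑ S ∈ Fᶜ.powerset, f S := by
  induction F using Finset.induction_on with
  | empty => simp
  | insert p F hp ih =>
    refine ih.trans ?_
    rw [prod_insert hp, mul_comm (1 + _), mul_assoc]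
    have h0 : 0 ≤ ∏ p ∈ F, (1 + 1 / (pr p : ℝ)) := prod_nonneg fun p _ => by positivity
    refine mul_le_mul_of_nonneg_left ?_ h0
    have e : Fᶜ = insert p (insert p F)ᶜ := by
      ext q
      simp only [mem_compl, mem_insert]
      by_cases h : q = p
      · subst h; simp [hp]
      · simp [h]
    have hn : p ∉ (insert p F)ᶜ := by simp
    rw [e, sum_powerset_insert hn, add_mul, one_mul, mul_sum]
    refine add_le_add le_rfl (sum_le_sum fun S hS => ?_)
    refine (hm p S (fun h => hn (mem_powerset.mp hS h))).trans (le_of_eq (by ring))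

theorem mass_prime (pr : P → ℕ) (hpr : ∀ p, 1 ≤ pr p) (f : Finset P → ℝ) (hf : ∀ S, 0 ≤ f S)
    (hm : ∀ p S, p ∉ S → f (insert p S) ≤ f S / pr p) (p : P) :
    ∑ S, f S * (if p ∈ S then 1 else 0) ≤ (∑ S, f S) / pr p := by
  have hn : p ∉ univ.erase p := notMem_erase _ _
  have e : (univ : Finset (Finset P)) = (insert p (univ.erase p)).powerset := by
    rw [insert_erase (mem_univ p), powerset_univ]
  have hp : (0:ℝ) < pr p := by exact_mod_cast hpr p
  rw [e, sum_powerset_insert hn, sum_powerset_insert hn]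
  have z : ∑ t ∈ (univ.erase p).powerset, f t * (if p ∈ t then 1 else 0) = 0 := by
    refine sum_eq_zero fun t ht => ?_
    rw [if_neg (fun h => hn (mem_powerset.mp ht h)), mul_zero]
  rw [z, zero_add, add_div]
  have : 0 ≤ (∑ t ∈ (univ.erase p).powerset, f (insert p t)) / pr p := div_nonneg (sum_nonneg fun t _ => hf _) hp.le
  refine le_trans ?_ (le_add_of_nonneg_right this)
  rw [sum_div]
  refine sum_le_sum fun t ht => ?_
  rw [if_pos (mem_insert_self _ _), mul_one]
  exact hm p t (fun h => hn (mem_powerset.mp ht h))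

theorem us_insert (δ : P → ℝ) (p : P) (S : Finset P) (h : p ∉ S) : us δ (insert p S) = δ p + us δ S := sum_insert h
theorem qs_insert (pr : P → ℕ) (p : P) (S : Finset P) (h : p ∉ S) : qs pr (insert p S) = pr p * qs pr S := prod_insert h

theorem wv_mult (β : ℝ) (hβ : 0 ≤ β) (δ : P → ℝ) (hδ : ∀ p, 0 ≤ δ p) (pr : P → ℕ) (hpr : ∀ p, 1 ≤ pr p) (p : P) (S : Finset P) (h : p ∉ S) :
    wv β δ pr (insert p S) ≤ wv β δ pr S / pr p := by
  have hp : (0:ℝ) < pr p := by exact_mod_cast hpr p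
  by_cases h1 : us δ (insert p S) ≤ 1
  · have h2 : us δ S ≤ 1 := (us_mono hδ (subset_insert p S)).trans h1
    unfold wv
    rw [if_pos h1, if_pos h2, qs_insert pr p S h, mul_comm, ← div_div]
    refine div_le_div_of_nonneg_right (div_le_div_of_nonneg_right ?_ (qs_pos hpr S).le) hp.le
    exact pow_le_pow_left₀ (g0_pos β _ hβ (us_nonneg hδ _)).le (g0_anti β _ _ hβ (us_nonneg hδ _) (us_mono hδ (subset_insert p S))) 2
  · have : wv β δ pr (insert p S) = 0 := by unfold wv; rw [if_neg h1]
    rw [this]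
    exact div_nonneg (wv_nonneg β hβ δ hδ pr hpr S) hp.le

/-- one dimensional linear weight -/
noncomputable def lv (β : ℝ) (δ : P → ℝ) (pr : P → ℕ) (S : Finset P) : ℝ :=
  if us δ S ≤ 1 / 4 then g0 β (us δ S) / qs pr S else 0

theorem lv_nonneg (β : ℝ) (hβ : 0 ≤ β) (δ : P → ℝ) (hδ : ∀ p, 0 ≤ δ p) (pr : P → ℕ) (hpr : ∀ p, 1 ≤ pr p) (S : Finset P) : 0 ≤ lv β δ pr S := by
  unfold lv
  split_ifs
  · exact div_nonneg (g0_pos β _ hβ (us_nonneg hδ _)).le (qs_pos hpr S).le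
  · exact le_rfl

theorem lv_mult (β : ℝ) (hβ : 0 ≤ β) (δ : P → ℝ) (hδ : ∀ p, 0 ≤ δ p) (pr : P → ℕ) (hpr : ∀ p, 1 ≤ pr p) (p : P) (S : Finset P) (h : p ∉ S) :
    lv β δ pr (insert p S) ≤ lv β δ pr S / pr p := by
  have hp : (0:ℝ) < pr p := by exact_mod_cast hpr p
  by_cases h1 : us δ (insert p S) ≤ 1 / 4
  · have h2 : us δ S ≤ 1 / 4 := (us_mono hδ (subset_insert p S)).trans h1
    unfold lv
    rw [if_pos h1, if_pos h2, qs_insert pr p S h, mul_comm, ← div_div]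
    refine div_le_div_of_nonneg_right (div_le_div_of_nonneg_right ?_ (qs_pos hpr S).le) hp.le
    exact g0_anti β _ _ hβ (us_nonneg hδ _) (us_mono hδ (subset_insert p S))
  · have : lv β δ pr (insert p S) = 0 := by unfold lv; rw [if_neg h1]
    rw [this]
    exact div_nonneg (lv_nonneg β hβ δ hδ pr hpr S) hp.le

/-- place the set `S` in the coordinate `m` -/
def plc (m : ι) (s : P → Option ι) (S : Finset P) (p : P) : Option ι := if p ∈ S then some m else s p

theorem plc_cv (β : ℝ) (hβ : 0 ≤ β) (δ : P → ℝ) (hδ : ∀ p, 0 ≤ δ p) (pr : P → ℕ) (hpr : ∀ p, 1 ≤ pr p) (m : ι)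
    (s : P → Option ι) (hm : fib s m = ∅) (hs : us δ (sup s) ≤ 1 / 2) (S : Finset P) (hS : S ⊆ (sup s)ᶜ) :
    (∏ i ∈ univ.erase m, g0 β (us δ (fib s i))) / qs pr (sup s) * lv β δ pr S ≤ cv β δ pr (plc m s S) := by
  have hc0 : 0 ≤ cv β δ pr (plc m s S) := div_nonneg (yv_nonneg β hβ δ hδ _) (qs_pos hpr _).le
  by_cases h : us δ S ≤ 1 / 4
  swap
  · have : lv β δ pr S = 0 := by unfold lv; rw [if_neg h]
    rw [this, mul_zero]; exact hc0
  have hd : Disjoint (sup s) S := by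
    rw [disjoint_right]
    intro p hp
    simpa using hS hp
  have e1 : sup (plc m s S) = sup s ∪ S := by
    ext p
    rw [mem_union, mem_sup, mem_sup]
    unfold plc
    by_cases hp : p ∈ S <;> simp [hp]
  have e2 : fib (plc m s S) m = S := by
    ext p
    rw [mem_fib]
    unfold plc
    by_cases hp : p ∈ S
    · simp [hp]
    · have : p ∉ fib s m := by rw [hm]; simp
      rw [mem_fib] at this
      simp [hp, this]
  have e3 : ∀ i ∈ univ.erase m, fib (plc m s S) i = fib s i := by
    intro i hi
    have hi := ne_of_mem_erase hi
    ext p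
    rw [mem_fib, mem_fib]
    unfold plc
    by_cases hp : p ∈ S
    · have : p ∉ sup s := by simpa using hS hp
      rw [mem_sup, not_not] at this
      simp [hp, this, hi.symm]
    · simp [hp]
  have u1 : us δ (sup s ∪ S) = us δ (sup s) + us δ S := sum_union hd
  have q1 : qs pr (sup s ∪ S) = qs pr (sup s) * qs pr S := prod_union hd
  have e4 : ∏ i ∈ univ.erase m, g0 β (us δ (fib (plc m s S) i)) = ∏ i ∈ univ.erase m, g0 β (us δ (fib s i)) :=
    prod_congr rfl (fun i hi => by rw [e3 i hi])
  unfold cv yv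
  rw [e1, q1, ← mul_prod_erase univ _ (mem_univ m), e2, e4, u1, Hc_one _ (by linarith)]
  unfold lv
  rw [if_pos h]
  apply le_of_eq
  have := (qs_pos hpr S).ne'
  have := (qs_pos hpr (sup s)).ne'
  field_simp

theorem inner_S2 (β : ℝ) (hβ : 0 ≤ β) (δ : P → ℝ) (hδ : ∀ p, 0 ≤ δ p) (pr : P → ℕ) (hpr : ∀ p, 1 ≤ pr p) (m : ι)
    (s : P → Option ι) (hm : fib s m = ∅) (hs : us δ (sup s) ≤ 1 / 2) (hq : us (fun p => 1 / (pr p : ℝ)) (sup s) ≤ 1 / 8) :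
    (∏ i ∈ univ.erase m, g0 β (us δ (fib s i))) / qs pr (sup s) * ((∑ S, lv β δ pr S) / 2) ≤
    ∑ r, cv β δ pr r * ∏ p, (if (if r p = some m then none else r p) = s p then (1:ℝ) else 0) := by
  have h0 : 0 ≤ (∏ i ∈ univ.erase m, g0 β (us δ (fib s i))) / qs pr (sup s) :=
    div_nonneg (prod_nonneg fun i _ => (g0_pos β _ hβ (us_nonneg hδ _)).le) (qs_pos hpr _).le
  have hsm : ∀ p, s p ≠ some m := by
    intro p hp
    have : p ∈ fib s m := by rw [mem_fib, hp]
    rw [hm] at this; simp at this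
  have hA : (∑ S, lv β δ pr S) / 2 ≤ ∑ S ∈ (sup s)ᶜ.powerset, lv β δ pr S := by
    have h1 := remove_primes pr hpr (lv β δ pr) (lv_nonneg β hβ δ hδ pr hpr) (lv_mult β hβ δ hδ pr hpr) (sup s)
    have h2 : ∏ p ∈ sup s, (1 + 1 / (pr p : ℝ)) ≤ 2 := by
      refine (Real.prod_one_add_le_exp_sum (sup s) (fun p => by positivity)).trans ?_
      have h3 : Real.exp (∑ p ∈ sup s, 1 / (pr p : ℝ)) ≤ Real.exp (1 / 8) := Real.exp_le_exp.mpr hq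
      refine h3.trans ?_
      have h4 : Real.exp (1/8) ≤ Real.exp (Real.log 2) := Real.exp_le_exp.mpr (by linarith [Real.log_two_gt_d9])
      rwa [Real.exp_log (by norm_num)] at h4
    have h3 : 0 ≤ ∑ S ∈ (sup s)ᶜ.powerset, lv β δ pr S := sum_nonneg fun S _ => lv_nonneg β hβ δ hδ pr hpr S
    have := mul_le_mul_of_nonneg_right h2 h3
    linarith
  refine (mul_le_mul_of_nonneg_left hA h0).trans ?_
  rw [mul_sum]
  have hinj : Set.InjOn (plc m s) (((sup s)ᶜ.powerset : Finset (Finset P)) : Set (Finset P)) := by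
    intro S _ S' _ h
    ext p
    have := congrFun h p
    unfold plc at this
    by_cases h1 : p ∈ S <;> by_cases h2 : p ∈ S' <;> simp [h1, h2] at this ⊢
    · exact hsm p this.symm
    · exact hsm p this
  calc _ ≤ ∑ S ∈ (sup s)ᶜ.powerset, cv β δ pr (plc m s S) :=
        sum_le_sum fun S hS => plc_cv β hβ δ hδ pr hpr m s hm hs S (mem_powerset.mp hS)
    _ = ∑ S ∈ (sup s)ᶜ.powerset, cv β δ pr (plc m s S) * ∏ p, (if (if plc m s S p = some m then none else plc m s S p) = s p then (1:ℝ) else 0) := by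
        refine sum_congr rfl fun S hS => ?_
        rw [prod_eq_one, mul_one]
        intro p _
        rw [if_pos]
        unfold plc
        by_cases hp : p ∈ S
        · have : p ∉ sup s := by simpa using (mem_powerset.mp hS) hp
          rw [mem_sup, not_not] at this
          simp [hp, this]
        · simp [hp, hsm p]
    _ = ∑ r ∈ (sup s)ᶜ.powerset.image (plc m s), cv β δ pr r * ∏ p, (if (if r p = some m then none else r p) = s p then (1:ℝ) else 0) :=
        (sum_image (f := fun r => cv β δ pr r * ∏ p, (if (if r p = some m then none else r p) = s p then (1:ℝ) else 0)) hinj).symm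
    _ ≤ _ := by
        refine sum_le_sum_of_subset_of_nonneg (subset_univ _) fun r _ _ => ?_
        refine mul_nonneg (div_nonneg (yv_nonneg β hβ δ hδ _) (qs_pos hpr _).le) (prod_nonneg fun p _ => ?_)
        split_ifs <;> norm_num

theorem main_S2 (β : ℝ) (hβ : 0 ≤ β) (δ : P → ℝ) (hδ : ∀ p, 0 ≤ δ p) (pr : P → ℕ) (hpr : ∀ p, 16 * Fintype.card ι ≤ pr p)
    (a : ι → ℕ) (ha : ∀ p, ∀ n i j, pr p ∣ n + a i → pr p ∣ n + a j → i = j) (m : ι)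
    (hsq : ∑ p, (1 / (pr p : ℝ)) ^ 2 ≤ 1 / 16) (hA : 0 < ∑ S, wv β δ pr S)
    (hmass : 2 * Fintype.card ι * ((∑ S, wv β δ pr S * us δ S) / ∑ S, wv β δ pr S) + 9 * Fintype.card ι ^ 2 * ∑ p, (1 / (pr p : ℝ)) ^ 2 ≤ 1 / 2) :
    (∑ S, lv β δ pr S) ^ 2 / 32 * (∑ S, wv β δ pr S) ^ (Fintype.card ι - 1) ≤
    ∑ r, ∑ r', cv β δ pr r * cv β δ pr r' * ∏ p, Gk a (pr p) ((range (pr p)).filter (fun w => ¬ pr p ∣ w + a m)) (r p) (r' p) := by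
  have hκ : 1 ≤ Fintype.card ι := Fintype.card_pos_iff.mpr ⟨m⟩
  have hκ' : (1:ℝ) ≤ Fintype.card ι := by exact_mod_cast hκ
  have hpr1 : ∀ p, 1 ≤ pr p := fun p => by have := hpr p; omega
  have hprR : ∀ p, 16 * (Fintype.card ι : ℝ) ≤ pr p := fun p => by exact_mod_cast hpr p
  set A := ∑ S, wv β δ pr S with hAdef
  set A1 := ∑ S, lv β δ pr S with hA1
  have hA10 : 0 ≤ A1 := sum_nonneg fun S _ => lv_nonneg β hβ δ hδ pr hpr1 S
  set d : P → Option ι → ℝ := fun p z => match z with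
    | none => 1 - 1 / ((pr p : ℝ) - 1) ^ 2
    | some i => if i = m then 0 else (pr p : ℝ) - 4 * Fintype.card ι with hd
  have hsmall : ∀ p, 1 / ((pr p : ℝ) - 1) ^ 2 ≤ 4 * (1 / (pr p : ℝ)) ^ 2 := by
    intro p
    have := hprR p
    have h1 : (0:ℝ) < (pr p - 1) := by linarith
    rw [div_pow, one_pow, mul_one_div, div_le_div_iff₀ (by positivity) (by nlinarith)]
    nlinarith
  have hsmall1 : ∀ p, 4 * (1 / (pr p : ℝ)) ^ 2 ≤ 1 := by
    intro p
    have := hprR p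
    have h1 : (1 / (pr p : ℝ)) ≤ 1 / 2 := one_div_le_one_div_of_le (by norm_num) (by linarith)
    have h2 : 0 ≤ (1 / (pr p : ℝ)) := by positivity
    nlinarith
  have hd0 : ∀ p z, 0 ≤ d p z := by
    intro p z
    rcases z with _ | i
    · simp only [hd]; linarith [hsmall p, hsmall1 p]
    · simp only [hd]; split_ifs
      · exact le_rfl
      · linarith [hprR p]
  refine le_trans ?_ (tensor_low (fun p => Gk a (pr p) ((range (pr p)).filter (fun w => ¬ pr p ∣ w + a m))) (fun p => Gk_psd _ _ _) d hd0
    (fun p z x => if (if x = some m then none else x) = z then 1 else 0) ?_ (cv β δ pr))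
  swap
  · intro p c
    refine le_trans (le_of_eq ?_) (local_unit a (pr p) (by have := hpr p; omega) m (ha p) c)
    rw [Fintype.sum_option]
    congr 1
    · simp only [hd]
      congr 2
      rw [Fintype.sum_option]
      have : ∀ i, c (some i) * (if (if some i = some m then none else some i) = (none : Option ι) then (1:ℝ) else 0) = if i = m then c (some i) else 0 := by
        intro i
        by_cases h : i = m <;> simp [h]
      simp only [this]
      simp
    · rw [← add_sum_erase univ _ (mem_univ m)]
      simp only [hd, if_true, zero_mul, zero_add]
      rw [mul_sum]
      refine sum_congr rfl fun i hi => ?_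
      have hi := ne_of_mem_erase hi
      rw [if_neg hi]
      congr 2
      rw [Fintype.sum_option]
      have : ∀ i', c (some i') * (if (if some i' = some m then none else some i') = some i then (1:ℝ) else 0) = if i' = i then c (some i') else 0 := by
        intro i'
        by_cases h : i' = m
        · subst h; simp [hi.symm]
        · simp [h]
      simp only [this]
      simp
  -- the probability weights
  set π : ι → Finset P → ℝ := fun i S => if i = m then (if S = ∅ then 1 else 0) else wv β δ pr S / A with hπ
  have hw0 := wv_nonneg β hβ δ hδ pr hpr1
  have hgm := good_mass π ?_ ?_ (fun p => 1 / (pr p : ℝ)) (fun p => by positivity) ?_ δ hδ ((∑ S, wv β δ pr S * us δ S) / A) ?_ (8 * Fintype.card ι) (by positivity)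
  · have hhalf : (1:ℝ) / 2 ≤ ∑ s : P → Option ι, if us δ (sup s) ≤ 1 / 2 ∧ 8 * (Fintype.card ι : ℝ) * us (fun p => 1 / (pr p : ℝ)) (sup s) ≤ 1 then ∏ i, π i (fib s i) else 0 := by
      refine le_trans ?_ hgm
      have : ((Fintype.card ι : ℝ) ^ 2 + 8 * Fintype.card ι * Fintype.card ι) = 9 * Fintype.card ι ^ 2 := by ring
      rw [this]; linarith
    have hAk : 0 < A ^ (Fintype.card ι - 1) := pow_pos hA _
    calc A1 ^ 2 / 32 * A ^ (Fintype.card ι - 1) = A1 ^ 2 / 16 * A ^ (Fintype.card ι - 1) * (1 / 2) := by ring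
      _ ≤ A1 ^ 2 / 16 * A ^ (Fintype.card ι - 1) * _ := mul_le_mul_of_nonneg_left hhalf (by positivity)
      _ ≤ _ := by
        rw [mul_sum]
        refine sum_le_sum fun s _ => ?_
        have hR : 0 ≤ (∏ p, d p (s p)) * (∑ r, cv β δ pr r * ∏ p, (if (if r p = some m then none else r p) = s p then (1:ℝ) else 0)) ^ 2 :=
          mul_nonneg (prod_nonneg fun p _ => hd0 _ _) (sq_nonneg _)
        split_ifs with hg
        swap
        · rw [mul_zero]; exact hR
        by_cases hm : fib s m = ∅
        swap
        · rw [prod_eq_zero (mem_univ m), mul_zero]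
          · exact hR
          · simp [hπ, hm]
        have hq8 : us (fun p => 1 / (pr p : ℝ)) (sup s) ≤ 1 / 8 := by
          have h0 : 0 ≤ us (fun p => 1 / (pr p : ℝ)) (sup s) := us_nonneg (fun p => by positivity) _
          nlinarith [hg.2]
        have hin := inner_S2 β hβ δ hδ pr hpr1 m s hm hg.1 hq8
        set G := ∏ i ∈ univ.erase m, g0 β (us δ (fib s i)) with hG
        have hG0 : 0 ≤ G := prod_nonneg fun i _ => (g0_pos β _ hβ (us_nonneg hδ _)).le
        have hqp := qs_pos hpr1 (sup s)
        have hlow0 : 0 ≤ G / qs pr (sup s) * (A1 / 2) := by positivity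
        have hin2 := pow_le_pow_left₀ hlow0 hin 2
        -- product of d
        have hdp : 1 / 4 * qs pr (sup s) ≤ ∏ p, d p (s p) := by
          set x : P → ℝ := fun p => if s p = none then 1 / ((pr p : ℝ) - 1) ^ 2 else 4 * Fintype.card ι * (1 / (pr p : ℝ)) with hx
          have hsm : ∀ p, s p ≠ some m := by
            intro p hp
            have : p ∈ fib s m := by rw [mem_fib, hp]
            rw [hm] at this; simp at this
          have e : ∀ p, d p (s p) = (1 - x p) * pp (pr p) (s p) := by
            intro p
            simp only [hx]
            rcases h : s p with _ | i
            · simp [hd, pp]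
            · have him : i ≠ m := fun h' => hsm p (by rw [h, h'])
              have : (pr p : ℝ) ≠ 0 := by have := hprR p; intro h; linarith
              simp only [hd, pp, if_neg him, reduceCtorEq, if_false]
              field_simp
          have hx0 : ∀ p ∈ univ, 0 ≤ x p := by
            intro p _; simp only [hx]; split_ifs <;> positivity
          have hx1 : ∀ p ∈ univ, x p ≤ 1 := by
            intro p _; simp only [hx]; split_ifs
            · linarith [hsmall p, hsmall1 p]
            · have := hprR p
              rw [mul_one_div, div_le_one (by linarith)]; linarith
          have hprod := one_sub_sum_le_prod univ x hx0 hx1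
          have hsum : ∑ p, x p ≤ 3 / 4 := by
            have : ∀ p, x p ≤ 4 * (1 / (pr p : ℝ)) ^ 2 + 4 * Fintype.card ι * (if p ∈ sup s then 1 / (pr p : ℝ) else 0) := by
              intro p
              simp only [hx, mem_sup]
              by_cases h : s p = none
              · simp only [h, if_true, ne_eq, not_true, if_false, mul_zero, add_zero]; exact hsmall p
              · simp only [h, if_false, ne_eq, not_false_iff, if_true]
                exact le_add_of_nonneg_left (by positivity)
            refine (sum_le_sum fun p _ => this p).trans ?_
            rw [sum_add_distrib, ← mul_sum, ← mul_sum, sum_ite_mem, univ_inter]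
            have h2 := hg.2
            unfold us at h2
            nlinarith
          simp only [e]
          rw [prod_mul_distrib, pp_prod pr s univ (subset_univ _)]
          exact mul_le_mul_of_nonneg_right (by linarith) hqp.le
        have hpi : ∏ i, π i (fib s i) = G ^ 2 / qs pr (sup s) / A ^ (Fintype.card ι - 1) := by
          rw [← mul_prod_erase univ _ (mem_univ m)]
          have e1 : π m (fib s m) = 1 := by simp [hπ, hm]
          have e2 : ∏ i ∈ univ.erase m, π i (fib s i) = ∏ i ∈ univ.erase m, (g0 β (us δ (fib s i)) ^ 2 / qs pr (fib s i) / A) := by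
            refine prod_congr rfl fun i hi => ?_
            simp only [hπ, if_neg (ne_of_mem_erase hi)]
            unfold wv
            rw [if_pos]
            exact (us_mono hδ (fib_sub_sup s i)).trans (by linarith [hg.1])
          have e3 : qs pr (sup s) = ∏ i ∈ univ.erase m, qs pr (fib s i) := by
            rw [qs_sup, ← mul_prod_erase univ _ (mem_univ m), hm]
            simp [qs]
          rw [e1, e2, prod_div_distrib, prod_div_distrib, prod_pow, e3, prod_const, card_erase_of_mem (mem_univ m), card_univ, one_mul]
        rw [hpi]
        calc A1 ^ 2 / 16 * A ^ (Fintype.card ι - 1) * (G ^ 2 / qs pr (sup s) / A ^ (Fintype.card ι - 1))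
            = 1 / 4 * qs pr (sup s) * (G / qs pr (sup s) * (A1 / 2)) ^ 2 := by
              field_simp
              ring
          _ ≤ _ := mul_le_mul hdp hin2 (sq_nonneg _) (prod_nonneg fun p _ => hd0 _ _)
  · intro i S
    simp only [hπ]
    split_ifs
    · norm_num
    · norm_num
    · exact div_nonneg (hw0 S) hA.le
  · intro i
    simp only [hπ]
    by_cases h : i = m
    · simp [h]
    · simp only [if_neg h]
      rw [← sum_div, div_self hA.ne']
  · intro i p
    simp only [hπ]
    by_cases h : i = m
    · simp only [if_pos h]
      refine le_trans (le_of_eq ?_) (by positivity : (0:ℝ) ≤ 1 / (pr p : ℝ))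
      refine sum_eq_zero fun S _ => ?_
      by_cases hS : S = ∅ <;> simp [hS]
    · simp only [if_neg h]
      have := mass_prime pr hpr1 (wv β δ pr) hw0 (wv_mult β hβ δ hδ pr hpr1) p
      simp only [div_mul_eq_mul_div]
      rw [← sum_div, div_le_iff₀ hA, one_div_mul_eq_div]
      exact this
  · intro i
    simp only [hπ]
    have hU : 0 ≤ (∑ S, wv β δ pr S * us δ S) / A := div_nonneg (sum_nonneg fun S _ => mul_nonneg (hw0 S) (us_nonneg hδ S)) hA.le
    by_cases h : i = m
    · simp only [if_pos h]
      refine le_trans (le_of_eq ?_) hU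
      refine sum_eq_zero fun S _ => ?_
      by_cases hS : S = ∅ <;> simp [hS, us]
    · simp only [if_neg h, div_mul_eq_mul_div]
      rw [← sum_div]

end mainTwo
end OIR
end

section
open Finset MeasureTheory
namespace OIR

section oneD
set_option linter.unusedSectionVars false
set_option linter.unusedVariables false
variable {P : Type*} [Fintype P] [DecidableEq P]

noncomputable def Nc (δ : P → ℝ) (pr : P → ℕ) (t : ℝ) : ℝ := ∑ S : Finset P, if us δ S ≤ t then 1 / qs pr S else 0

theorem layer_up (J : ℕ) (x : ℝ) (hx : 0 ≤ x) (hxJ : x ≤ 8 ^ J) :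
    ∃ j ∈ range (J + 1), x ≤ 8 ^ j ∧ (1 / (1 + x)) ^ 2 ≤ 64 * (1 / 64) ^ j := by
  have hex : ∃ j : ℕ, x ≤ 8 ^ j := ⟨J, hxJ⟩
  classical
  refine ⟨Nat.find hex, mem_range.mpr (Nat.lt_succ_of_le (Nat.find_min' hex hxJ)), Nat.find_spec hex, ?_⟩
  have hx1 : 1 / (1 + x) ≤ 1 := by rw [div_le_one (by linarith)]; linarith
  have hx0 : 0 ≤ 1 / (1 + x) := by positivity
  rcases h : Nat.find hex with _ | j
  · have := pow_le_one₀ (n := 2) hx0 hx1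
    rw [pow_zero]; linarith
  · have hlt : ¬ x ≤ 8 ^ j := Nat.find_min hex (by omega)
    push Not at hlt
    have h8 : (0:ℝ) < 8 ^ j := by positivity
    have h1 : 1 / (1 + x) ≤ 1 / 8 ^ j := one_div_le_one_div_of_le h8 (by linarith)
    have h2 := pow_le_pow_left₀ hx0 h1 2
    refine h2.trans (le_of_eq ?_)
    rw [div_pow, one_pow, ← pow_mul, mul_comm j 2, pow_mul, pow_succ (1 / 64 : ℝ) j, one_div_pow]
    norm_num
    ring

theorem geom_le (r : ℝ) (h0 : 0 ≤ r) (h1 : r < 1) (n : ℕ) : ∑ j ∈ range n, r ^ j ≤ 1 / (1 - r) := by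
  rw [one_div, ← tsum_geometric_of_lt_one h0 h1]
  exact (summable_geometric_of_lt_one h0 h1).sum_le_tsum _ (fun i _ => pow_nonneg h0 i)

theorem layer_low (J : ℕ) (x : ℝ) (hx : 0 ≤ x) :
    ∑ j ∈ range J, (7 / 16 * (1 / 8) ^ j * if x ≤ 8 ^ j then 1 else 0) ≤ 1 / (1 + x) := by
  induction J generalizing x with
  | zero => simp; positivity
  | succ J ih =>
    by_cases h : x ≤ 1
    · have : ∑ j ∈ range (J + 1), (7 / 16 * (1 / 8 : ℝ) ^ j * if x ≤ 8 ^ j then 1 else 0) ≤ ∑ j ∈ range (J + 1), 7 / 16 * (1 / 8 : ℝ) ^ j := by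
        refine sum_le_sum fun j _ => ?_
        have : (0:ℝ) ≤ 7 / 16 * (1 / 8) ^ j := by positivity
        split_ifs <;> simp
      refine this.trans ?_
      rw [← mul_sum]
      have h2 := geom_le (1/8) (by norm_num) (by norm_num) (J + 1)
      have h3 : 1 / 2 ≤ 1 / (1 + x) := one_div_le_one_div_of_le (by linarith) (by linarith)
      have h4 : (1:ℝ) / (1 - 1 / 8) = 8 / 7 := by norm_num
      rw [h4] at h2
      linarith
    · rw [sum_range_succ']
      have e : ∀ j : ℕ, (7 / 16 * (1 / 8 : ℝ) ^ (j + 1) * if x ≤ 8 ^ (j + 1) then 1 else 0) = 1 / 8 * (7 / 16 * (1 / 8) ^ j * if x / 8 ≤ 8 ^ j then 1 else 0) := by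
        intro j
        have : (x ≤ 8 ^ (j + 1)) ↔ (x / 8 ≤ 8 ^ j) := by
          rw [pow_succ, div_le_iff₀ (by norm_num : (0:ℝ) < 8)]
        simp only [this]
        rw [pow_succ]; ring
      simp only [e]
      rw [← mul_sum]
      have hi := ih (x / 8) (by positivity)
      have hz : (7 / 16 * (1 / 8 : ℝ) ^ 0 * if x ≤ 8 ^ 0 then 1 else 0) = 0 := by
        rw [pow_zero, pow_zero, if_neg h, mul_zero]
      rw [hz, add_zero]
      push Not at h
      have : 1 / 8 * (1 / (1 + x / 8)) ≤ 1 / (1 + x) := by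
        rw [one_div_mul_one_div]
        apply one_div_le_one_div_of_le <;> linarith
      linarith


theorem oneD_A_up (δ : P → ℝ) (hδ : ∀ p, 0 ≤ δ p) (pr : P → ℕ) (hpr : ∀ p, 1 ≤ pr p) (J : ℕ) (Λ : ℝ) (hΛ : 0 < Λ)
    (hN : ∀ j ≤ J, Nc δ pr (8 ^ j / 8 ^ J) ≤ 2 * Λ * (8 ^ j / 8 ^ J)) :
    ∑ S, wv (8 ^ J) δ pr S ≤ 147 * Λ / 8 ^ J ∧ ∑ S, wv (8 ^ J) δ pr S * us δ S ≤ 128 * (J + 1) * Λ / (8 ^ J) ^ 2 := by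
  have h8 : (0:ℝ) < 8 ^ J := by positivity
  have key : ∀ S : Finset P, ∀ F : ℕ → ℝ, (∀ j, 0 ≤ F j) → ∀ G : ℝ, 0 ≤ G → (∀ j, us δ S ≤ 8 ^ j / 8 ^ J → G ≤ F j) →
      wv (8 ^ J) δ pr S * G ≤ ∑ j ∈ range (J + 1), 64 * (1 / 64) ^ j * F j * (if us δ S ≤ 8 ^ j / 8 ^ J then 1 / qs pr S else 0) := by
    intro S F hF G hG hGF
    have hq := qs_pos hpr S
    have hnn : ∀ j ∈ range (J + 1), 0 ≤ 64 * (1 / 64 : ℝ) ^ j * F j * (if us δ S ≤ 8 ^ j / 8 ^ J then 1 / qs pr S else 0) := by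
      intro j _
      refine mul_nonneg (mul_nonneg (by positivity) (hF j)) ?_
      split_ifs <;> positivity
    unfold wv
    split_ifs with h1
    · have hu := us_nonneg hδ S
      obtain ⟨j, hj, hj1, hj2⟩ := layer_up J (8 ^ J * us δ S) (by positivity) (by nlinarith)
      refine le_trans ?_ (single_le_sum hnn hj)
      have hle : us δ S ≤ 8 ^ j / 8 ^ J := by rw [le_div_iff₀ h8, mul_comm]; exact hj1
      rw [if_pos hle, div_mul_eq_mul_div, mul_one_div]
      refine div_le_div_of_nonneg_right ?_ hq.le
      exact mul_le_mul hj2 (hGF j hle) hG (by positivity)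
    · rw [zero_mul]; exact sum_nonneg hnn
  constructor
  · calc ∑ S, wv (8 ^ J) δ pr S = ∑ S, wv (8 ^ J) δ pr S * 1 := by simp
      _ ≤ ∑ S, ∑ j ∈ range (J + 1), 64 * (1 / 64) ^ j * 1 * (if us δ S ≤ 8 ^ j / 8 ^ J then 1 / qs pr S else 0) :=
          sum_le_sum fun S _ => key S (fun _ => 1) (fun _ => zero_le_one) 1 zero_le_one (fun _ _ => le_rfl)
      _ = ∑ j ∈ range (J + 1), 64 * (1 / 64) ^ j * Nc δ pr (8 ^ j / 8 ^ J) := by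
          rw [sum_comm]
          refine sum_congr rfl fun j _ => ?_
          rw [← mul_sum, mul_one]; rfl
      _ ≤ ∑ j ∈ range (J + 1), 128 * Λ / 8 ^ J * (1 / 8) ^ j := by
          refine sum_le_sum fun j hj => ?_
          refine (mul_le_mul_of_nonneg_left (hN j (by simpa [Nat.lt_succ_iff] using hj)) (by positivity)).trans (le_of_eq ?_)
          have : (1 / 64 : ℝ) ^ j * 8 ^ j = (1 / 8) ^ j := by rw [← mul_pow]; norm_num
          rw [← this]; field_simp
          ring
      _ ≤ 128 * Λ / 8 ^ J * (8 / 7) := by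
          rw [← mul_sum]
          refine mul_le_mul_of_nonneg_left ?_ (by positivity)
          have := geom_le (1/8) (by norm_num) (by norm_num) (J + 1)
          norm_num at this ⊢; linarith
      _ ≤ 147 * Λ / 8 ^ J := by
          rw [div_mul_eq_mul_div]
          refine div_le_div_of_nonneg_right ?_ h8.le
          linarith
  · calc ∑ S, wv (8 ^ J) δ pr S * us δ S
        ≤ ∑ S, ∑ j ∈ range (J + 1), 64 * (1 / 64) ^ j * (8 ^ j / 8 ^ J) * (if us δ S ≤ 8 ^ j / 8 ^ J then 1 / qs pr S else 0) :=
          sum_le_sum fun S _ => key S (fun j => 8 ^ j / 8 ^ J) (fun _ => by positivity) _ (us_nonneg hδ S) (fun _ h => h)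
      _ = ∑ j ∈ range (J + 1), 64 * (1 / 64) ^ j * (8 ^ j / 8 ^ J) * Nc δ pr (8 ^ j / 8 ^ J) := by
          rw [sum_comm]
          refine sum_congr rfl fun j _ => ?_
          rw [← mul_sum]; rfl
      _ ≤ ∑ j ∈ range (J + 1), 128 * Λ / (8 ^ J) ^ 2 := by
          refine sum_le_sum fun j hj => ?_
          refine (mul_le_mul_of_nonneg_left (hN j (by simpa [Nat.lt_succ_iff] using hj)) (by positivity)).trans (le_of_eq ?_)
          have : (1 / 64 : ℝ) ^ j * (8 ^ j * 8 ^ j) = 1 := by rw [← mul_pow, ← mul_pow]; norm_num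
          calc _ = ((1 / 64 : ℝ) ^ j * (8 ^ j * 8 ^ j)) * (128 * Λ / (8 ^ J) ^ 2) := by field_simp; ring
            _ = _ := by rw [this, one_mul]
      _ = _ := by rw [sum_const, card_range, nsmul_eq_mul]; push_cast; ring

theorem oneD_low (δ : P → ℝ) (hδ : ∀ p, 0 ≤ δ p) (pr : P → ℕ) (hpr : ∀ p, 1 ≤ pr p) (J : ℕ) (Λ : ℝ) (hΛ : 0 < Λ)
    (hN : ∀ j ≤ J, Λ / 4 * (8 ^ j / 8 ^ J) ≤ Nc δ pr (8 ^ j / 8 ^ J)) :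
    Λ / (16 * 8 ^ J) ≤ ∑ S, wv (8 ^ J) δ pr S ∧ 7 / 64 * J * Λ / 8 ^ J ≤ ∑ S, lv (8 ^ J) δ pr S := by
  have h8 : (0:ℝ) < 8 ^ J := by positivity
  have h81 : (1:ℝ) ≤ 8 ^ J := one_le_pow₀ (by norm_num)
  constructor
  · calc Λ / (16 * 8 ^ J) = 1 / 4 * (Λ / 4 * (8 ^ 0 / 8 ^ J)) := by field_simp; norm_num
      _ ≤ 1 / 4 * Nc δ pr (8 ^ 0 / 8 ^ J) := mul_le_mul_of_nonneg_left (hN 0 (Nat.zero_le _)) (by norm_num)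
      _ ≤ _ := by
        unfold Nc
        rw [mul_sum]
        refine sum_le_sum fun S _ => ?_
        have hq := qs_pos hpr S
        have hu := us_nonneg hδ S
        split_ifs with h
        · have hle : 8 ^ J * us δ S ≤ 1 := by
            rw [pow_zero, le_div_iff₀ h8] at h; linarith
          unfold wv
          rw [if_pos (by nlinarith), mul_one_div]
          refine div_le_div_of_nonneg_right ?_ hq.le
          have : 1 / 2 ≤ g0 (8 ^ J) (us δ S) := by
            unfold g0
            apply one_div_le_one_div_of_le
            · positivity
            · linarith
          nlinarith
        · rw [mul_zero]; exact wv_nonneg _ h8.le δ hδ pr hpr S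
  · calc 7 / 64 * J * Λ / 8 ^ J = ∑ j ∈ range J, 7 / 64 * Λ / 8 ^ J := by
          rw [sum_const, card_range, nsmul_eq_mul]; ring
      _ ≤ ∑ j ∈ range J, 7 / 16 * (1 / 8) ^ j * Nc δ pr (8 ^ j / 8 ^ J) := by
          refine sum_le_sum fun j hj => ?_
          refine le_trans (le_of_eq ?_) (mul_le_mul_of_nonneg_left (hN j (mem_range.mp hj).le) (by positivity))
          have : (1 / 8 : ℝ) ^ j * 8 ^ j = 1 := by rw [← mul_pow]; norm_num
          calc _ = ((1 / 8 : ℝ) ^ j * 8 ^ j) * (7 / 64 * Λ / 8 ^ J) := by rw [this, one_mul]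
            _ = _ := by field_simp; ring
      _ = ∑ S, (∑ j ∈ range J, 7 / 16 * (1 / 8) ^ j * if 8 ^ J * us δ S ≤ 8 ^ j then 1 else 0) / qs pr S := by
          unfold Nc
          simp only [mul_sum]
          rw [sum_comm]
          refine sum_congr rfl fun S _ => ?_
          rw [sum_div]
          refine sum_congr rfl fun j _ => ?_
          have : us δ S ≤ 8 ^ j / 8 ^ J ↔ 8 ^ J * us δ S ≤ 8 ^ j := by rw [le_div_iff₀ h8, mul_comm]
          simp only [this]
          split_ifs <;> ring
      _ ≤ _ := by
          refine sum_le_sum fun S _ => ?_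
          have hq := qs_pos hpr S
          have hu := us_nonneg hδ S
          unfold lv
          split_ifs with h
          · refine div_le_div_of_nonneg_right ?_ hq.le
            exact layer_low J (8 ^ J * us δ S) (by positivity)
          · rw [sum_eq_zero, zero_div]
            intro j hj
            rw [if_neg, mul_zero]
            intro h'
            have h1 : (8:ℝ) ^ j * 8 ≤ 8 ^ J := by
              rw [← pow_succ]; exact pow_le_pow_right₀ (by norm_num) (mem_range.mp hj)
            push Not at h
            nlinarith

end oneD
end OIR
end

section
open Finset MeasureTheory
namespace OIR

theorem sum_cover {α β : Type*} [DecidableEq β] (T : Finset β) (X : Finset α) (g : α → β) (f : β → ℝ) (hf : ∀ b, 0 ≤ f b)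
    (h : T ⊆ X.image g) : ∑ b ∈ T, f b ≤ ∑ x ∈ X, f (g x) := by
  refine (sum_le_sum_of_subset_of_nonneg h fun b _ _ => hf b).trans ?_
  rw [← sum_fiberwise_of_maps_to (s := X) (t := X.image g) (g := g) (fun x hx => mem_image_of_mem g hx)]
  refine sum_le_sum fun b hb => ?_
  obtain ⟨x, hx, rfl⟩ := mem_image.mp hb
  exact single_le_sum (f := fun x => f (g x)) (fun x _ => hf _) (mem_filter.mpr ⟨hx, rfl⟩)

/-- reciprocal sum over integers prime to W -/
noncomputable def EW (W X : ℕ) : ℝ := ∑ n ∈ (Ioc 0 X).filter (fun n => W.Coprime n), (1:ℝ) / n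

theorem EW_block (W : ℕ) (hW : 0 < W) (m : ℕ) :
    EW W ((m + 1) * W) = EW W (m * W) + ∑ n ∈ (Ioc (m * W) ((m + 1) * W)).filter (fun n => W.Coprime n), (1:ℝ) / n := by
  unfold EW
  rw [← sum_union]
  · rw [← filter_union, Ioc_union_Ioc_eq_Ioc (Nat.zero_le _) (Nat.mul_le_mul_right _ (by omega))]
  · refine disjoint_filter_filter ?_
    rw [disjoint_left]
    intro n h1 h2
    rw [mem_Ioc] at h1 h2
    omega

theorem block_card (W : ℕ) (m : ℕ) : ((Ioc (m * W) ((m + 1) * W)).filter (fun n => W.Coprime n)).card = W.totient := by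
  rw [← Nat.filter_coprime_Ico_eq_totient W (m * W + 1)]
  congr 2
  ext n
  rw [mem_Ioc, mem_Ico, add_mul, one_mul]
  omega

theorem EW_lower (W : ℕ) (hW : 0 < W) (m : ℕ) : (W.totient : ℝ) / W * (harmonic m : ℝ) ≤ EW W (m * W) := by
  have hW' : (0:ℝ) < W := by exact_mod_cast hW
  induction m with
  | zero => simp [EW]
  | succ m ih =>
    rw [EW_block W hW, harmonic_succ]
    push_cast
    rw [mul_add]
    refine add_le_add ih ?_
    have : ∀ n ∈ (Ioc (m * W) ((m + 1) * W)).filter (fun n => W.Coprime n), 1 / (((m:ℝ) + 1) * W) ≤ (1:ℝ) / n := by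
      intro n hn
      rw [mem_filter, mem_Ioc] at hn
      apply one_div_le_one_div_of_le
      · have : 0 < n := by omega
        exact_mod_cast this
      · exact_mod_cast hn.1.2
    refine le_trans (le_of_eq ?_) (card_nsmul_le_sum _ _ _ this)
    rw [block_card, nsmul_eq_mul]
    field_simp

theorem EW_upper (W : ℕ) (hW : 0 < W) (m : ℕ) : EW W ((m + 1) * W) ≤ W + (W.totient : ℝ) / W * (harmonic m : ℝ) := by
  have hW' : (0:ℝ) < W := by exact_mod_cast hW
  induction m with
  | zero =>
    simp only [zero_add, one_mul, harmonic_zero, Rat.cast_zero, mul_zero, add_zero]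
    unfold EW
    refine (sum_le_sum_of_subset_of_nonneg (filter_subset _ _) fun n _ _ => by positivity).trans ?_
    refine (sum_le_sum (g := fun _ => (1:ℝ)) fun n hn => ?_).trans (by simp)
    rw [mem_Ioc] at hn
    rw [div_le_one]
    · exact_mod_cast hn.1
    · exact_mod_cast hn.1
  | succ m ih =>
    rw [EW_block W hW, harmonic_succ]
    push_cast
    rw [mul_add, ← add_assoc]
    refine add_le_add ih ?_
    have : ∀ n ∈ (Ioc ((m + 1) * W) ((m + 1 + 1) * W)).filter (fun n => W.Coprime n), (1:ℝ) / n ≤ 1 / (((m:ℝ) + 1) * W) := by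
      intro n hn
      rw [mem_filter, mem_Ioc] at hn
      apply one_div_le_one_div_of_le
      · positivity
      · exact_mod_cast hn.1.1.le
    refine (sum_le_card_nsmul _ _ _ this).trans (le_of_eq ?_)
    rw [block_card, nsmul_eq_mul]
    field_simp

theorem EW_mono (W X Y : ℕ) (h : X ≤ Y) : EW W X ≤ EW W Y := by
  unfold EW
  refine sum_le_sum_of_subset_of_nonneg (filter_subset_filter _ (Ioc_subset_Ioc_right h)) fun n _ _ => by positivity

theorem EW_lo (W : ℕ) (hW : 0 < W) (X : ℕ) (hX : 0 < X) : (W.totient : ℝ) / W * (Real.log X - Real.log W) ≤ EW W X := by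
  have hW' : (0:ℝ) < W := by exact_mod_cast hW
  have hX' : (0:ℝ) < X := by exact_mod_cast hX
  have h1 := (EW_lower W hW (X / W)).trans (EW_mono W _ X (Nat.div_mul_le_self X W))
  refine le_trans (mul_le_mul_of_nonneg_left ?_ (by positivity)) h1
  refine le_trans ?_ (log_add_one_le_harmonic (X / W))
  rw [← Real.log_div hX'.ne' hW'.ne']
  apply Real.log_le_log (by positivity)
  rw [div_le_iff₀ hW']
  have := Nat.lt_div_mul_add (a := X) hW
  have h2 : X ≤ (X / W + 1) * W := by rw [add_mul, one_mul]; omega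
  exact_mod_cast h2

theorem EW_up (W : ℕ) (hW : 0 < W) (X : ℕ) (hX : 0 < X) : EW W X ≤ W + (W.totient : ℝ) / W * (1 + Real.log X) := by
  have h2 : X ≤ (X / W + 1) * W := by
    have := Nat.lt_div_mul_add (a := X) hW
    rw [add_mul, one_mul]; omega
  refine (EW_mono W _ _ h2).trans ((EW_upper W hW _).trans ?_)
  refine add_le_add le_rfl (mul_le_mul_of_nonneg_left ?_ (by positivity))
  refine (harmonic_le_one_add_log _).trans (add_le_add le_rfl ?_)
  by_cases h : X / W = 0
  · rw [h]; simp; exact Real.log_natCast_nonneg X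
  · apply Real.log_le_log
    · exact_mod_cast Nat.pos_of_ne_zero h
    · exact_mod_cast Nat.div_le_self X W

theorem sum_inv_sq_le (X : ℕ) : ∑ e ∈ Ioc 0 X, (1:ℝ) / (e:ℝ) ^ 2 ≤ 2 := by
  rcases Nat.eq_zero_or_pos X with h | h
  · subst h; simp
  · have h1 := sum_Ioc_inv_sq_le_sub (α := ℝ) (k := 1) (n := X) one_ne_zero h
    have : Ioc 0 X = insert 1 (Ioc 1 X) := by
      ext n; rw [mem_insert, mem_Ioc, mem_Ioc]; omega
    rw [this, sum_insert (by simp)]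
    simp only [one_div]
    have : (0:ℝ) ≤ (X:ℝ)⁻¹ := by positivity
    norm_num at h1 ⊢
    linarith

/-- sieving primes -/
noncomputable def PS (D0 : ℕ) (L : ℝ) (l : ℕ) : Finset ℕ := (Ioc D0 ⌊Real.exp (L / 100)⌋₊).filter (fun p => p.Prime ∧ p ≠ l)

theorem mem_PS (D0 : ℕ) (L : ℝ) (l p : ℕ) : p ∈ PS D0 L l ↔ (D0 < p ∧ (p:ℝ) ≤ Real.exp (L / 100)) ∧ p.Prime ∧ p ≠ l := by
  unfold PS
  rw [mem_filter, mem_Ioc, Nat.le_floor_iff (Real.exp_pos _).le]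

noncomputable def prS (D0 : ℕ) (L : ℝ) (l : ℕ) (p : PS D0 L l) : ℕ := (p : ℕ)
noncomputable def dlS (D0 : ℕ) (L : ℝ) (l : ℕ) (p : PS D0 L l) : ℝ := Real.log (p : ℕ) / (L / 100)

/-- the integer attached to a set of primes -/
noncomputable def nS (D0 : ℕ) (L : ℝ) (l : ℕ) (S : Finset (PS D0 L l)) : ℕ := ∏ p ∈ S, (p : ℕ)

theorem prS_prime (D0 : ℕ) (L : ℝ) (l : ℕ) (p : PS D0 L l) : (prS D0 L l p).Prime := ((mem_PS D0 L l p).mp p.2).2.1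
theorem prS_gt (D0 : ℕ) (L : ℝ) (l : ℕ) (p : PS D0 L l) : D0 < prS D0 L l p := ((mem_PS D0 L l p).mp p.2).1.1
theorem prS_pos (D0 : ℕ) (L : ℝ) (l : ℕ) (p : PS D0 L l) : 1 ≤ prS D0 L l p := (prS_prime D0 L l p).one_lt.le
theorem dlS_nonneg (D0 : ℕ) (L : ℝ) (hL : 0 < L) (l : ℕ) (p : PS D0 L l) : 0 ≤ dlS D0 L l p :=
  div_nonneg (Real.log_natCast_nonneg _) (by positivity)

theorem nS_qs (D0 : ℕ) (L : ℝ) (l : ℕ) (S : Finset (PS D0 L l)) : (nS D0 L l S : ℝ) = qs (prS D0 L l) S := by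
  unfold nS qs prS; push_cast; rfl

theorem nS_image (D0 : ℕ) (L : ℝ) (l : ℕ) (S : Finset (PS D0 L l)) : nS D0 L l S = ∏ p ∈ S.image Subtype.val, p := by
  unfold nS
  rw [prod_image]
  intro p _ q _ h
  exact Subtype.ext h

theorem nS_primeFactors (D0 : ℕ) (L : ℝ) (l : ℕ) (S : Finset (PS D0 L l)) : (nS D0 L l S).primeFactors = S.image Subtype.val := by
  rw [nS_image, Nat.primeFactors_prod]
  intro p hp
  obtain ⟨q, _, rfl⟩ := mem_image.mp hp
  exact prS_prime D0 L l q

theorem nS_inj (D0 : ℕ) (L : ℝ) (l : ℕ) : Function.Injective (nS D0 L l) := by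
  intro S S' h
  have := congrArg Nat.primeFactors h
  rw [nS_primeFactors, nS_primeFactors] at this
  exact image_injective Subtype.val_injective this

theorem nS_pos (D0 : ℕ) (L : ℝ) (l : ℕ) (S : Finset (PS D0 L l)) : 0 < nS D0 L l S :=
  prod_pos fun p _ => prS_pos D0 L l p

theorem nS_sqfree (D0 : ℕ) (L : ℝ) (l : ℕ) (S : Finset (PS D0 L l)) : Squarefree (nS D0 L l S) := by
  unfold nS
  apply Finset.squarefree_prod_of_pairwise_isCoprime
  · intro p _ q _ hpq
    refine Nat.coprime_iff_isRelPrime.mp ((Nat.coprime_primes (prS_prime D0 L l p) (prS_prime D0 L l q)).mpr ?_)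
    exact fun h => hpq (Subtype.ext h)
  · intro p _
    exact (prS_prime D0 L l p).squarefree

theorem us_log (D0 : ℕ) (L : ℝ) (l : ℕ) (S : Finset (PS D0 L l)) : us (dlS D0 L l) S = Real.log (nS D0 L l S) / (L / 100) := by
  unfold us dlS nS
  push_cast
  rw [Real.log_prod, sum_div]
  intro p _
  exact_mod_cast (prS_prime D0 L l p).ne_zero

theorem us_le_iff (D0 : ℕ) (L : ℝ) (hL : 0 < L) (l : ℕ) (S : Finset (PS D0 L l)) (t : ℝ) :
    us (dlS D0 L l) S ≤ t ↔ nS D0 L l S ≤ ⌊Real.exp (t * (L / 100))⌋₊ := by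
  rw [us_log, div_le_iff₀ (by positivity), Nat.le_floor_iff (Real.exp_pos _).le,
    Real.log_le_iff_le_exp (by exact_mod_cast nS_pos D0 L l S)]

theorem Nc_eq (D0 : ℕ) (L : ℝ) (hL : 0 < L) (l : ℕ) (t : ℝ) :
    Nc (dlS D0 L l) (prS D0 L l) t = ∑ S ∈ univ.filter (fun S => nS D0 L l S ≤ ⌊Real.exp (t * (L / 100))⌋₊), (1:ℝ) / (nS D0 L l S : ℝ) := by
  unfold Nc
  rw [sum_filter]
  refine sum_congr rfl fun S _ => ?_
  simp only [us_le_iff D0 L hL l, nS_qs]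

theorem nS_coprime (D0 : ℕ) (L : ℝ) (l W : ℕ) (hW : ∀ p : ℕ, p.Prime → p ∣ W → p ≤ D0) (S : Finset (PS D0 L l)) : W.Coprime (nS D0 L l S) := by
  unfold nS
  apply Nat.Coprime.prod_right
  intro p _
  rw [Nat.coprime_comm]
  refine (Nat.Prime.coprime_iff_not_dvd (prS_prime D0 L l p)).mpr ?_
  intro h
  have := hW _ (prS_prime D0 L l p) h
  have := prS_gt D0 L l p
  unfold prS at *
  omega

theorem Nc_up (D0 : ℕ) (L : ℝ) (hL : 0 < L) (l W : ℕ) (hW : ∀ p : ℕ, p.Prime → p ∣ W → p ≤ D0) (t : ℝ) :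
    Nc (dlS D0 L l) (prS D0 L l) t ≤ EW W ⌊Real.exp (t * (L / 100))⌋₊ := by
  rw [Nc_eq D0 L hL]
  rw [← sum_image (f := fun n : ℕ => (1:ℝ) / n) (g := nS D0 L l) (fun S _ S' _ h => nS_inj D0 L l h)]
  unfold EW
  refine sum_le_sum_of_subset_of_nonneg ?_ fun n _ _ => by positivity
  intro n hn
  obtain ⟨S, hS, rfl⟩ := mem_image.mp hn
  rw [mem_filter, mem_Ioc]
  exact ⟨⟨nS_pos D0 L l S, (mem_filter.mp hS).2⟩, nS_coprime D0 L l W hW S⟩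

theorem sqfree_split (l : ℕ) (hl : l.Prime) (f : ℕ) (hf : Squarefree f) : ∃ ε ∈ range 2, ∃ g, f = l ^ ε * g ∧ ¬ l ∣ g ∧ Squarefree g := by
  by_cases h : l ∣ f
  · obtain ⟨g, rfl⟩ := h
    refine ⟨1, by simp, g, by simp, ?_, hf.of_mul_right⟩
    intro h'
    obtain ⟨g', rfl⟩ := h'
    have := hf l ⟨g', by ring⟩
    exact hl.one_lt.ne' (by simpa using this)
  · exact ⟨0, by simp, f, by simp, h, hf⟩

theorem Nc_lo (D0 : ℕ) (L : ℝ) (hL : 0 < L) (l W : ℕ) (hl : l.Prime) (hW : ∀ p : ℕ, p.Prime → p ≤ D0 → p ∣ W) (t : ℝ) (ht : t ≤ 1) :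
    EW W ⌊Real.exp (t * (L / 100))⌋₊ ≤ 3 * Nc (dlS D0 L l) (prS D0 L l) t := by
  rw [Nc_eq D0 L hL]
  set X := ⌊Real.exp (t * (L / 100))⌋₊ with hX
  set T := univ.filter (fun S => nS D0 L l S ≤ X) with hT
  have hXle : X ≤ ⌊Real.exp (L / 100)⌋₊ := by
    apply Nat.floor_le_floor
    apply Real.exp_le_exp.mpr
    exact mul_le_of_le_one_left (by positivity) ht
  have hcov : (Ioc 0 X).filter (fun n => W.Coprime n) ⊆ ((Ioc 0 X) ×ˢ (range 2) ×ˢ T).image (fun x => x.1 ^ 2 * (l ^ x.2.1 * nS D0 L l x.2.2)) := by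
    intro n hn
    rw [mem_filter, mem_Ioc] at hn
    obtain ⟨f, e, hef, hf⟩ := Nat.sq_mul_squarefree n
    obtain ⟨ε, hε, g, hg, hlg, hgs⟩ := sqfree_split l hl f hf
    have hn0 : n ≠ 0 := by omega
    have hgn : g ∣ n := ⟨e ^ 2 * l ^ ε, by rw [← hef, hg]; ring⟩
    have hg0 : g ≠ 0 := fun h => hn0 (by rw [h] at hgn; simpa using hgn)
    have he0 : e ≠ 0 := fun h => hn0 (by rw [← hef, h]; ring)
    have hgle : g ≤ n := Nat.le_of_dvd (by omega) hgn
    have hele : e ≤ n := Nat.le_of_dvd (by omega) ⟨e * f, by rw [← hef]; ring⟩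
    set S : Finset (PS D0 L l) := univ.filter (fun p => (p:ℕ) ∣ g) with hS
    have hSg : nS D0 L l S = g := by
      rw [nS_image, ← Nat.prod_primeFactors_of_squarefree hgs]
      congr 1
      ext p
      rw [mem_image, Nat.mem_primeFactors]
      constructor
      · rintro ⟨q, hq, rfl⟩
        exact ⟨prS_prime D0 L l q, (mem_filter.mp hq).2, hg0⟩
      · rintro ⟨hp, hpg, _⟩
        have hmem : p ∈ PS D0 L l := by
          rw [PS, mem_filter, mem_Ioc]
          refine ⟨⟨?_, ?_⟩, hp, ?_⟩
          · by_contra hcon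
            push Not at hcon
            have h1 := hW p hp hcon
            have h2 : p ∣ n := hpg.trans hgn
            have := Nat.dvd_gcd h1 h2
            rw [hn.2] at this
            exact hp.one_lt.ne' (Nat.dvd_one.mp this)
          · have := Nat.le_of_dvd (Nat.pos_of_ne_zero hg0) hpg
            omega
          · rintro rfl; exact hlg hpg
        exact ⟨⟨p, hmem⟩, mem_filter.mpr ⟨mem_univ _, hpg⟩, rfl⟩
    rw [mem_image]
    refine ⟨(e, ε, S), ?_, ?_⟩
    · rw [mem_product, mem_product, mem_Ioc, hT, mem_filter]
      exact ⟨⟨Nat.pos_of_ne_zero he0, by omega⟩, hε, mem_univ _, by rw [hSg]; omega⟩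
    · simp only [hSg]
      rw [← hg, hef]
  unfold EW
  refine (sum_cover _ _ _ (fun n : ℕ => (1:ℝ) / n) (fun n => by positivity) hcov).trans ?_
  have e : ∀ x ∈ (Ioc 0 X) ×ˢ (range 2) ×ˢ T, (1:ℝ) / ((x.1 ^ 2 * (l ^ x.2.1 * nS D0 L l x.2.2) : ℕ) : ℝ) =
      (1 / (x.1 : ℝ) ^ 2) * ((1 / (l:ℝ)) ^ x.2.1 * (1 / (nS D0 L l x.2.2 : ℝ))) := by
    intro x _
    push_cast
    rw [one_div_pow, one_div_mul_one_div, one_div_mul_one_div]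
  rw [sum_congr rfl e, sum_product]
  simp only [sum_product, ← mul_sum, ← sum_mul]
  have h1 := sum_inv_sq_le X
  have h2 : ∑ i ∈ range 2, (1 / (l:ℝ)) ^ i ≤ 3 / 2 := by
    rw [sum_range_succ, sum_range_one, pow_zero, pow_one]
    have : (1:ℝ) / l ≤ 1 / 2 := one_div_le_one_div_of_le (by norm_num) (by exact_mod_cast hl.two_le)
    linarith
  have h3 : 0 ≤ ∑ S ∈ T, (1:ℝ) / (nS D0 L l S : ℝ) := sum_nonneg fun S _ => by positivity
  have h4 : 0 ≤ ∑ i ∈ range 2, (1 / (l:ℝ)) ^ i := sum_nonneg fun i _ => by positivity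
  rw [← mul_assoc]
  refine mul_le_mul_of_nonneg_right ?_ h3
  calc _ ≤ (2:ℝ) * (3 / 2) := mul_le_mul h1 h2 h4 (by norm_num)
    _ = 3 := by norm_num

theorem Nc_bounds (D0 W J : ℕ) (hW0 : 0 < W) (hW : ∀ p : ℕ, p.Prime → (p ∣ W ↔ p ≤ D0)) :
    ∀ᶠ L : ℝ in Filter.atTop, ∀ l : ℕ, l.Prime → ∀ j ≤ J,
      ((W.totient : ℝ) / W * (L / 100)) / 4 * (8 ^ j / 8 ^ J) ≤ Nc (dlS D0 L l) (prS D0 L l) (8 ^ j / 8 ^ J) ∧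
      Nc (dlS D0 L l) (prS D0 L l) (8 ^ j / 8 ^ J) ≤ 2 * ((W.totient : ℝ) / W * (L / 100)) * (8 ^ j / 8 ^ J) := by
  have hW' : (0:ℝ) < W := by exact_mod_cast hW0
  have hφ : (0:ℝ) < (W.totient : ℝ) / W := div_pos (by exact_mod_cast Nat.totient_pos.mpr hW0) hW'
  have hφ1 : (W.totient : ℝ) / W ≤ 1 := by rw [div_le_one hW']; exact_mod_cast Nat.totient_le W
  have h8 : (0:ℝ) < 8 ^ J := by positivity
  filter_upwards [Filter.eventually_gt_atTop 0, Filter.eventually_ge_atTop (400 * 8 ^ J * (1 + Real.log W)),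
    Filter.eventually_ge_atTop (100 * 8 ^ J * ((W + 1) / ((W.totient : ℝ) / W)))] with L hL h1 h2 l hl j hj
  have ht1 : (8:ℝ) ^ j / 8 ^ J ≤ 1 := by
    rw [div_le_one h8]; exact pow_le_pow_right₀ (by norm_num) hj
  have ht0 : 1 / 8 ^ J ≤ (8:ℝ) ^ j / 8 ^ J := div_le_div_of_nonneg_right (one_le_pow₀ (by norm_num)) h8.le
  set t := (8:ℝ) ^ j / 8 ^ J
  have htp : 0 < t := lt_of_lt_of_le (by positivity) ht0
  have hx : 0 ≤ t * (L / 100) := by positivity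
  have hxe : 1 ≤ Real.exp (t * (L / 100)) := Real.one_le_exp hx
  set X := ⌊Real.exp (t * (L / 100))⌋₊ with hX
  have hX1 : 1 ≤ X := Nat.one_le_floor_iff _ |>.mpr hxe
  have hXp : (0:ℝ) < X := by exact_mod_cast hX1
  have hXlog : Real.log X ≤ t * (L / 100) := by
    rw [Real.log_le_iff_le_exp hXp]; exact Nat.floor_le (Real.exp_pos _).le
  have hXlog2 : t * (L / 100) - 1 ≤ Real.log X := by
    rw [Real.le_log_iff_exp_le hXp, Real.exp_sub]
    have h3 := Nat.lt_floor_add_one (Real.exp (t * (L / 100)))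
    rw [div_le_iff₀ (Real.exp_pos 1)]
    have he : (2:ℝ) ≤ Real.exp 1 := by have := Real.exp_one_gt_d9; linarith
    have : (1:ℝ) ≤ X := by exact_mod_cast hX1
    rw [← hX] at h3
    nlinarith
  have hLt : L / (100 * 8 ^ J) ≤ t * (L / 100) := by
    have := mul_le_mul_of_nonneg_right ht0 (by positivity : 0 ≤ L / 100)
    refine le_trans (le_of_eq ?_) this
    field_simp
  constructor
  · have a1 := EW_lo W hW0 X hX1
    have a2 := Nc_lo D0 L hL l W hl (fun p hp h => (hW p hp).mpr h) t ht1
    have a3 : 1 + Real.log W ≤ 1 / 4 * (t * (L / 100)) := by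
      have : 4 * (1 + Real.log W) ≤ L / (100 * 8 ^ J) := by
        rw [le_div_iff₀ (by positivity)]; linarith
      linarith
    have a4 : (W.totient : ℝ) / W * (3 / 4 * (t * (L / 100))) ≤ (W.totient : ℝ) / W * (Real.log X - Real.log W) :=
      mul_le_mul_of_nonneg_left (by linarith) hφ.le
    nlinarith
  · have a1 := EW_up W hW0 X hX1
    have a2 := Nc_up D0 L hL l W (fun p hp h => (hW p hp).mp h) t
    have a3 : (W + 1) / ((W.totient : ℝ) / W) ≤ t * (L / 100) := by
      refine le_trans ?_ hLt
      rw [le_div_iff₀ (by positivity)]; linarith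
    rw [div_le_iff₀ hφ] at a3
    have a4 : (W.totient : ℝ) / W * (1 + Real.log X) ≤ (W.totient : ℝ) / W * (1 + t * (L / 100)) :=
      mul_le_mul_of_nonneg_left (by linarith) hφ.le
    nlinarith

end OIR
end

section
open Finset MeasureTheory
namespace OIR

theorem class_count (q c : ℕ) (hq : 0 < q) : ∑ n ∈ range q, (if n ≡ c [MOD q] then (1:ℂ) else 0) = 1 := by
  rw [sum_eq_single (c % q)]
  · rw [if_pos (Nat.mod_modEq c q)]
  · intro n hn hne
    rw [if_neg]
    intro h
    apply hne
    have : n % q = c % q := h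
    rwa [Nat.mod_eq_of_lt (mem_range.mp hn)] at this
  · intro h; exact absurd (mem_range.mpr (Nat.mod_lt _ hq)) h

theorem equi (q c N0 X : ℕ) (hq : 0 < q) :
    |∑ n ∈ (Ioc N0 X).filter (fun n => n ≡ c [MOD q]), (1:ℝ) / n - (∑ n ∈ Ioc N0 X, (1:ℝ) / n) / q| ≤ 2 * q / (N0 + 1) := by
  have hq' : (0:ℝ) < q := by exact_mod_cast hq
  set f : ℕ → ℂ := fun n => (if n ≡ c [MOD q] then (1:ℂ) else 0) - 1 / q with hf
  set φ : ℕ → ℝ := fun n => 1 / ((max n 1 : ℕ) : ℝ) with hφ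
  have hpart : ∀ N, ‖∑ n ∈ range N, f n‖ ≤ (q:ℝ) := by
    refine periodic_partial f q hq ?_ ?_ ?_
    · intro n
      simp only [hf]
      congr 2
      simp only [Nat.ModEq, Nat.add_mod_right]
    · simp only [hf, sum_sub_distrib]
      rw [class_count q c hq]
      rw [sum_const, card_range, nsmul_eq_mul, mul_one_div_cancel (by exact_mod_cast hq.ne'), sub_self]
    · intro n
      have h1 : (1:ℝ) / q ≤ 1 := by rw [div_le_one hq']; exact_mod_cast hq
      have h0 : (0:ℝ) ≤ 1 / q := by positivity
      have : f n = (((if n ≡ c [MOD q] then (1:ℝ) else 0) - 1 / q : ℝ) : ℂ) := by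
        simp only [hf]; push_cast; split_ifs <;> simp
      rw [this, Complex.norm_real, Real.norm_eq_abs, abs_le]
      split_ifs <;> constructor <;> linarith
  have hanti : Antitone φ := by
    intro m n hmn
    simp only [hφ]
    refine one_div_le_one_div_of_le (by positivity) ?_
    exact_mod_cast max_le_max hmn le_rfl
  have key := abel_antitone f q hpart φ hanti (fun n => by positivity) (N0 + 1) (X + 1)
  have he : ∑ n ∈ Ico (N0 + 1) (X + 1), f n * (φ n : ℂ) =
      ((∑ n ∈ (Ioc N0 X).filter (fun n => n ≡ c [MOD q]), (1:ℝ) / n - (∑ n ∈ Ioc N0 X, (1:ℝ) / n) / q : ℝ) : ℂ) := by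
    have hI : Ico (N0 + 1) (X + 1) = Ioc N0 X := by ext; simp only [mem_Ico, mem_Ioc]; omega
    rw [hI, sum_filter, sum_div, ← sum_sub_distrib]
    push_cast
    refine sum_congr rfl fun n hn => ?_
    have hn1 : max n 1 = n := max_eq_left (by have := (mem_Ioc.mp hn).1; omega)
    simp only [hf, hφ, hn1]
    push_cast
    split_ifs <;> push_cast <;> ring
  rw [he, Complex.norm_real, Real.norm_eq_abs] at key
  refine key.trans (le_of_eq ?_)
  simp only [hφ]
  rw [max_eq_left (by omega)]
  push_cast
  ring

/-- the Chinese remainder theorem for a set of the sieving primes -/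
theorem crt (D0 : ℕ) (L : ℝ) (l W : ℕ) (hW : ∀ p : ℕ, p.Prime → p ∣ W → p ≤ D0) (b : ℕ) (T : Finset (PS D0 L l)) (w : PS D0 L l → ℕ)
    (hw : ∀ p ∈ T, w p < prS D0 L l p) :
    ∃ c : ℕ, ∀ n : ℕ, (n ≡ b [MOD W] ∧ ∀ p ∈ T, n % prS D0 L l p = w p) ↔ n ≡ c [MOD W * nS D0 L l T] := by
  classical
  induction T using Finset.induction_on with
  | empty => exact ⟨b, fun n => by simp [nS]⟩
  | insert q T hq ih =>
    obtain ⟨c, hc⟩ := ih fun p hp => hw p (mem_insert_of_mem hp)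
    have hqp := prS_prime D0 L l q
    have hcop : (W * nS D0 L l T).Coprime (prS D0 L l q) := by
      refine Nat.Coprime.mul_left ?_ ?_
      · refine (Nat.Coprime.symm ((Nat.Prime.coprime_iff_not_dvd hqp).mpr fun h => ?_))
        exact absurd (hW _ hqp h) (not_le.mpr (prS_gt D0 L l q))
      · unfold nS
        refine Nat.Coprime.prod_left fun p hp => ?_
        refine (Nat.coprime_primes (prS_prime D0 L l p) hqp).mpr fun h => ?_
        apply hq
        have : p = q := Subtype.ext h
        rwa [← this]
    obtain ⟨d, hd1, hd2⟩ := Nat.chineseRemainder hcop c (w q)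
    refine ⟨d, fun n => ?_⟩
    have hprod : W * nS D0 L l (insert q T) = (W * nS D0 L l T) * prS D0 L l q := by
      unfold nS prS
      rw [prod_insert hq]; ring
    rw [hprod, ← Nat.modEq_and_modEq_iff_modEq_mul hcop]
    have h1 : n ≡ d [MOD W * nS D0 L l T] ↔ (n ≡ b [MOD W] ∧ ∀ p ∈ T, n % prS D0 L l p = w p) := by
      rw [hc n]
      exact ⟨fun h => h.trans hd1, fun h => h.trans hd1.symm⟩
    have h2 : n ≡ d [MOD prS D0 L l q] ↔ n % prS D0 L l q = w q := by
      have hwq := hw q (mem_insert_self _ _)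
      constructor
      · intro h
        have : n % prS D0 L l q = w q % prS D0 L l q := h.trans hd2
        rwa [Nat.mod_eq_of_lt hwq] at this
      · intro h
        refine Nat.ModEq.trans ?_ hd2.symm
        change n % prS D0 L l q = w q % prS D0 L l q
        rw [Nat.mod_eq_of_lt hwq, h]
    rw [h1, h2, forall_mem_insert]
    tauto

theorem cv_supp {ι : Type*} [Fintype ι] [DecidableEq ι] (D0 : ℕ) (L : ℝ) (hL : 0 < L) (l : ℕ) (β : ℝ)
    (r : PS D0 L l → Option ι) (h : cv β (dlS D0 L l) (prS D0 L l) r ≠ 0) :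
    (nS D0 L l (sup r) : ℝ) ≤ Real.exp (L / 100) := by
  have hu : us (dlS D0 L l) (sup r) ≤ 1 := by
    by_contra hcon
    apply h
    unfold cv yv
    rw [Hc_zero _ (not_le.mp hcon).le]
    simp
  rw [us_le_iff D0 L hL l _ 1, one_mul, Nat.le_floor_iff (Real.exp_pos _).le] at hu
  exact hu

theorem cv_hcs {ι : Type*} [Fintype ι] [DecidableEq ι] (D0 : ℕ) (L : ℝ) (hL : 0 < L) (l : ℕ) (β : ℝ)
    (r r' : PS D0 L l → Option ι) (h : cv β (dlS D0 L l) (prS D0 L l) r ≠ 0) (h' : cv β (dlS D0 L l) (prS D0 L l) r' ≠ 0) :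
    ∏ p ∈ sup r ∪ sup r', prS D0 L l p ≤ ⌊Real.exp (L / 50)⌋₊ := by
  rw [Nat.le_floor_iff (Real.exp_pos _).le]
  have h1 := cv_supp D0 L hL l β r h
  have h2 := cv_supp D0 L hL l β r' h'
  have h3 : ∏ p ∈ sup r ∪ sup r', prS D0 L l p ≤ nS D0 L l (sup r) * nS D0 L l (sup r') := by
    have := prod_union_inter (s₁ := sup r) (s₂ := sup r') (f := prS D0 L l)
    change _ ≤ (∏ p ∈ sup r, prS D0 L l p) * ∏ p ∈ sup r', prS D0 L l p
    rw [← this]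
    exact Nat.le_mul_of_pos_right _ (prod_pos fun p _ => prS_pos D0 L l p)
  calc ((∏ p ∈ sup r ∪ sup r', prS D0 L l p : ℕ) : ℝ) ≤ (nS D0 L l (sup r) : ℝ) * nS D0 L l (sup r') := by exact_mod_cast h3
    _ ≤ Real.exp (L / 100) * Real.exp (L / 100) := by gcongr
    _ = Real.exp (L / 50) := by rw [← Real.exp_add]; ring_nf

/-- transfer of the sum over sets of primes to squarefree integers -/
theorem T_sum (D0 : ℕ) (L : ℝ) (l W C : ℕ) (hl : l.Prime) (hW : ∀ p : ℕ, p.Prime → p ∣ W → p ≤ D0) (Q : ℕ) (D : ℕ → ℝ) (hD : ∀ q, 0 ≤ D q) :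
    ∑ T ∈ (univ : Finset (Finset (PS D0 L l))).filter (fun T => ∏ p ∈ T, prS D0 L l p ≤ Q), (C:ℝ) ^ T.card * D (nS D0 L l T) ≤
      ∑ q ∈ (Ioc 0 Q).filter (fun q => Squarefree q ∧ q.Coprime W ∧ ¬ l ∣ q), (C:ℝ) ^ q.primeFactors.card * D q := by
  classical
  have h1 : ∀ T : Finset (PS D0 L l), T.card = (nS D0 L l T).primeFactors.card := by
    intro T
    rw [nS_primeFactors, card_image_of_injective _ Subtype.val_injective]
  calc _ = ∑ q ∈ ((univ : Finset (Finset (PS D0 L l))).filter (fun T => ∏ p ∈ T, prS D0 L l p ≤ Q)).image (nS D0 L l),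
        (C:ℝ) ^ q.primeFactors.card * D q := by
        rw [sum_image (f := fun q : ℕ => (C:ℝ) ^ q.primeFactors.card * D q) (fun x _ y _ h => nS_inj D0 L l h)]
        exact sum_congr rfl fun T _ => by rw [h1 T]
    _ ≤ _ := by
        refine sum_le_sum_of_subset_of_nonneg ?_ fun q _ _ => mul_nonneg (by positivity) (hD q)
        intro q hq
        obtain ⟨T, hT, rfl⟩ := mem_image.mp hq
        have hT' := (mem_filter.mp hT).2
        refine mem_filter.mpr ⟨mem_Ioc.mpr ⟨nS_pos D0 L l T, hT'⟩, nS_sqfree D0 L l T, (nS_coprime D0 L l W hW T).symm, ?_⟩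
        intro hd
        have : l ∈ (nS D0 L l T).primeFactors := Nat.mem_primeFactors.mpr ⟨hl, hd, (nS_pos D0 L l T).ne'⟩
        rw [nS_primeFactors] at this
        obtain ⟨p, _, hp⟩ := mem_image.mp this
        exact ((mem_PS D0 L l p).mp p.2).2.2 hp

theorem T_sum_const (D0 : ℕ) (L : ℝ) (hL : 0 ≤ L) (l C : ℕ) (hl : l.Prime) :
    ∑ T ∈ (univ : Finset (Finset (PS D0 L l))).filter (fun T => ∏ p ∈ T, prS D0 L l p ≤ ⌊Real.exp (L / 50)⌋₊), (C:ℝ) ^ T.card ≤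
      Real.exp (L / 50) * (1 + L) ^ C := by
  have h := T_sum D0 L l 1 C hl (fun p hp h => absurd (Nat.dvd_one.mp h) hp.one_lt.ne') ⌊Real.exp (L / 50)⌋₊ (fun _ => 1) (fun _ => by norm_num)
  simp only [mul_one] at h
  refine h.trans ?_
  set Q := ⌊Real.exp (L / 50)⌋₊
  have hQ1 : 1 ≤ Q := Nat.one_le_floor_iff _ |>.mpr (Real.one_le_exp (by positivity))
  have hQ : (Q:ℝ) ≤ Real.exp (L / 50) := Nat.floor_le (Real.exp_pos _).le
  have hQ0 : (0:ℝ) < Q := by exact_mod_cast hQ1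
  calc _ ≤ ∑ q ∈ (Ioc 0 Q).filter Squarefree, (Q:ℝ) * ((C:ℝ) ^ q.primeFactors.card / q) := by
        refine (sum_le_sum_of_subset_of_nonneg (t := (Ioc 0 Q).filter Squarefree) ?_ fun q _ _ => by positivity).trans ?_
        · intro q hq
          rw [mem_filter] at hq ⊢
          exact ⟨hq.1, hq.2.1⟩
        · refine sum_le_sum fun q hq => ?_
          have hq' := mem_Ioc.mp (mem_filter.mp hq).1
          have h0 : (0:ℝ) < q := by exact_mod_cast hq'.1
          have h1 : (q:ℝ) ≤ Q := by exact_mod_cast hq'.2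
          rw [← mul_div_assoc, le_div_iff₀ h0, mul_comm]
          exact mul_le_mul_of_nonneg_right h1 (by positivity)
    _ ≤ Q * (1 + L) ^ C := by
        rw [← mul_sum]
        refine mul_le_mul_of_nonneg_left ((sqfree_sum C Q).trans ?_) hQ0.le
        refine pow_le_pow_left₀ (sum_nonneg fun n _ => by positivity) ((sum_inv_le Q).trans ?_) _
        have : Real.log Q ≤ L / 50 := by rw [Real.log_le_iff_le_exp hQ0]; exact hQ
        linarith
    _ ≤ _ := by gcongr

end OIR
end

section
open Finset MeasureTheory
namespace OIR

noncomputable def N0 (L : ℝ) : ℕ := ⌊Real.exp (L / 2) / 2⌋₊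
noncomputable def N1 (L : ℝ) (W b : ℕ) : Finset ℕ := (Ioc (N0 L) ⌊Real.exp L⌋₊).filter (fun n => n ≡ b [MOD W])
/-- the error allowed for the unweighted sums -/
noncomputable def err1 (L : ℝ) (W C : ℕ) : ℝ := (Real.exp (L / 50) * (1 + L) ^ C) * (4 * W * Real.exp (3 * L / 100) * Real.exp (-(L / 2)))

theorem G1_le (L : ℝ) (hL : 0 < L) : ∑ n ∈ Ioc (N0 L) ⌊Real.exp L⌋₊, (1:ℝ) / n ≤ 1 + L := by
  have h1 : 1 ≤ ⌊Real.exp L⌋₊ := Nat.one_le_floor_iff _ |>.mpr (Real.one_le_exp hL.le)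
  refine (sum_le_sum_of_subset_of_nonneg (t := Ioc 0 ⌊Real.exp L⌋₊) ?_ fun n _ _ => by positivity).trans ((sum_inv_le _).trans ?_)
  · exact Ioc_subset_Ioc_left (Nat.zero_le _)
  · have : Real.log (⌊Real.exp L⌋₊ : ℝ) ≤ L := by
      rw [Real.log_le_iff_le_exp (by exact_mod_cast h1)]
      exact Nat.floor_le (Real.exp_pos _).le
    linarith

theorem equi' (L : ℝ) (W q c : ℕ) (hq : 0 < q) (hq2 : (q:ℝ) ≤ W * Real.exp (3 * L / 100)) :
    |∑ n ∈ (Ioc (N0 L) ⌊Real.exp L⌋₊).filter (fun n => n ≡ c [MOD q]), (1:ℝ) / n - (∑ n ∈ Ioc (N0 L) ⌊Real.exp L⌋₊, (1:ℝ) / n) / q| ≤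
      4 * W * Real.exp (3 * L / 100) * Real.exp (-(L / 2)) := by
  refine (equi q c (N0 L) ⌊Real.exp L⌋₊ hq).trans ?_
  have h1 : Real.exp (L / 2) / 2 ≤ (N0 L : ℝ) + 1 := (Nat.lt_floor_add_one _).le
  rw [div_le_iff₀ (by positivity), Real.exp_neg]
  have he := Real.exp_pos (L / 2)
  calc 2 * (q:ℝ) ≤ 2 * (W * Real.exp (3 * L / 100)) := by linarith
    _ = 4 * W * Real.exp (3 * L / 100) * (Real.exp (L / 2))⁻¹ * (Real.exp (L / 2) / 2) := by field_simp; ring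
    _ ≤ _ := by gcongr

theorem err1_sum (D0 : ℕ) (L : ℝ) (hL : 0 ≤ L) (l W C : ℕ) (hl : l.Prime) :
    ∑ T ∈ (univ : Finset (Finset (PS D0 L l))).filter (fun T => ∏ p ∈ T, prS D0 L l p ≤ ⌊Real.exp (L / 50)⌋₊),
      (C:ℝ) ^ T.card * (4 * W * Real.exp (3 * L / 100) * Real.exp (-(L / 2))) ≤ err1 L W C := by
  rw [← sum_mul]
  exact mul_le_mul_of_nonneg_right (T_sum_const D0 L hL l C hl) (by positivity)

theorem prS_le_exp (D0 : ℕ) (L : ℝ) (l : ℕ) (p : PS D0 L l) : (prS D0 L l p : ℝ) ≤ Real.exp (L / 100) := ((mem_PS D0 L l p).mp p.2).1.2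

theorem S1_bound {ι : Type*} [Fintype ι] [DecidableEq ι] (D0 : ℕ) (L : ℝ) (hL : 0 < L) (l W : ℕ) (hl : l.Prime) (hW0 : 0 < W)
    (hW : ∀ p : ℕ, p.Prime → p ∣ W → p ≤ D0) (b : ℕ) (β : ℝ) (hβ : 0 ≤ β) (a : ι → ℕ)
    (ha : ∀ p : PS D0 L l, ∀ n i j, prS D0 L l p ∣ n + a i → prS D0 L l p ∣ n + a j → i = j) :
    ∑ n ∈ N1 L W b, (1:ℝ) / n * nu a (prS D0 L l) (cv β (dlS D0 L l) (prS D0 L l)) n ^ 2 ≤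
      (1 + L) / W * (∑ S, wv β (dlS D0 L l) (prS D0 L l) S) ^ Fintype.card ι + err1 L W (2 * (Fintype.card ι + 1) ^ 2) := by
  have hW' : (0:ℝ) < W := by exact_mod_cast hW0
  have hδ := dlS_nonneg D0 L hL l
  have hpr := prS_pos D0 L l
  set G1 := ∑ n ∈ Ioc (N0 L) ⌊Real.exp L⌋₊, (1:ℝ) / n with hG1
  have hG10 : 0 ≤ G1 := sum_nonneg fun n _ => by positivity
  have key := gen_sieve a (prS D0 L l) hpr (N1 L W b) (fun n => (1:ℝ) / n) (fun p => range (prS D0 L l p))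
    (fun p => ⟨0, mem_range.mpr (hpr p)⟩) (fun p => le_rfl) (fun n _ p => mem_range.mpr (Nat.mod_lt _ (hpr p)))
    (G1 / W) (fun _ => 4 * W * Real.exp (3 * L / 100) * Real.exp (-(L / 2))) (fun _ => by positivity) ⌊Real.exp (L / 50)⌋₊
    (cv β (dlS D0 L l) (prS D0 L l)) (cv_abs β hβ _ hδ _ hpr) (fun r r' h h' => cv_hcs D0 L hL l β r r' h h') ?_
  · have h2 := key.trans (err1_sum D0 L hL.le l W _ hl)
    have h3 := (abs_le.mp h2).2
    have h4 := main_S1 β hβ (dlS D0 L l) hδ (prS D0 L l) hpr a ha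
    have hA : 0 ≤ (∑ S, wv β (dlS D0 L l) (prS D0 L l) S) ^ Fintype.card ι :=
      pow_nonneg (sum_nonneg fun S _ => wv_nonneg β hβ _ hδ _ hpr S) _
    have h5 := mul_le_mul_of_nonneg_left h4 (div_nonneg hG10 hW'.le)
    have h6 : G1 / W * (∑ S, wv β (dlS D0 L l) (prS D0 L l) S) ^ Fintype.card ι ≤
      (1 + L) / W * (∑ S, wv β (dlS D0 L l) (prS D0 L l) S) ^ Fintype.card ι :=
      mul_le_mul_of_nonneg_right (div_le_div_of_nonneg_right (G1_le L hL) hW'.le) hA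
    linarith
  · intro T hT w hw
    obtain ⟨c, hc⟩ := crt D0 L l W hW b T w (fun p hp => mem_range.mp (hw p hp))
    have hfil : (N1 L W b).filter (fun n => ∀ p ∈ T, n % prS D0 L l p = w p) =
        (Ioc (N0 L) ⌊Real.exp L⌋₊).filter (fun n => n ≡ c [MOD W * nS D0 L l T]) := by
      unfold N1
      rw [filter_filter]
      exact filter_congr fun n _ => hc n
    rw [hfil]
    have hprod : G1 / W / ∏ p ∈ T, ((range (prS D0 L l p)).card : ℝ) = G1 / ((W * nS D0 L l T : ℕ) : ℝ) := by
      rw [div_div]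
      congr 1
      unfold nS prS
      push_cast
      simp
    rw [hprod]
    refine equi' L W (W * nS D0 L l T) c (Nat.mul_pos hW0 (nS_pos D0 L l T)) ?_
    have hT' : (nS D0 L l T : ℝ) ≤ Real.exp (L / 50) := by
      rw [Nat.le_floor_iff (Real.exp_pos _).le] at hT; exact hT
    push_cast
    refine mul_le_mul_of_nonneg_left (hT'.trans (Real.exp_le_exp.mpr (by linarith))) hW'.le

theorem S3_bound {ι : Type*} [Fintype ι] [DecidableEq ι] (D0 : ℕ) (L : ℝ) (hL : 0 < L) (l W : ℕ) (hl : l.Prime) (hW0 : 0 < W)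
    (hW : ∀ p : ℕ, p.Prime → p ∣ W → p ≤ D0) (b : ℕ) (β : ℝ) (hβ : 0 ≤ β) (a : ι → ℕ)
    (ha : ∀ p : PS D0 L l, ∀ n i j, prS D0 L l p ∣ n + a i → prS D0 L l p ∣ n + a j → i = j) (p0 : PS D0 L l) (j : ι) :
    ∑ n ∈ (N1 L W b).filter (fun n => prS D0 L l p0 ∣ n + a j), (1:ℝ) / n * nu a (prS D0 L l) (cv β (dlS D0 L l) (prS D0 L l)) n ^ 2 ≤
      (1 + L) / (W * prS D0 L l p0) * ((∑ S, wv β (dlS D0 L l) (prS D0 L l) S) ^ Fintype.card ι *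
        ((β + 4) * dlS D0 L l p0 + Fintype.card ι / prS D0 L l p0) ^ 2) + err1 L W (2 * (Fintype.card ι + 1) ^ 2) := by
  classical
  have hW' : (0:ℝ) < W := by exact_mod_cast hW0
  have hδ := dlS_nonneg D0 L hL l
  have hpr := prS_pos D0 L l
  have hp0 : (0:ℝ) < prS D0 L l p0 := by exact_mod_cast hpr p0
  set G1 := ∑ n ∈ Ioc (N0 L) ⌊Real.exp L⌋₊, (1:ℝ) / n with hG1
  have hG10 : 0 ≤ G1 := sum_nonneg fun n _ => by positivity
  -- the residue
  obtain ⟨w0, hw0, hw0d⟩ : ∃ w0 < prS D0 L l p0, ∀ n, (prS D0 L l p0 ∣ n + a j ↔ n % prS D0 L l p0 = w0) := by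
    set P := prS D0 L l p0 with hP
    have hPp : 0 < P := hpr p0
    refine ⟨(P - a j % P) % P, Nat.mod_lt _ hPp, fun n => ?_⟩
    have h1 : P ∣ (P - a j % P) + a j := by
      have h2 := Nat.mod_lt (a j) hPp
      have h3 := Nat.div_add_mod (a j) P
      have : (P - a j % P) + a j = P * (a j / P + 1) := by rw [mul_add]; omega
      rw [this]; exact dvd_mul_right _ _
    constructor
    · intro h
      have : n ≡ P - a j % P [MOD P] := by
        refine Nat.ModEq.add_right_cancel' (a j) ?_
        exact ((Nat.modEq_zero_iff_dvd).mpr h).trans ((Nat.modEq_zero_iff_dvd).mpr h1).symm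
      exact this
    · intro h
      have : n ≡ P - a j % P [MOD P] := h
      exact (Nat.modEq_zero_iff_dvd).mp ((this.add_right (a j)).trans ((Nat.modEq_zero_iff_dvd).mpr h1))
  have hdw : prS D0 L l p0 ∣ w0 + a j := (hw0d w0).mpr (Nat.mod_eq_of_lt hw0)
  set U : PS D0 L l → Finset ℕ := fun p => if p = p0 then {w0} else range (prS D0 L l p) with hU
  have key := gen_sieve a (prS D0 L l) hpr ((N1 L W b).filter (fun n => prS D0 L l p0 ∣ n + a j)) (fun n => (1:ℝ) / n) U
    (fun p => by
      simp only [hU]; split_ifs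
      · exact singleton_nonempty _
      · exact ⟨0, mem_range.mpr (hpr p)⟩)
    (fun p => by
      simp only [hU]; split_ifs with h
      · subst h; exact singleton_subset_iff.mpr (mem_range.mpr hw0)
      · exact le_rfl)
    (fun n hn p => by
      simp only [hU]; split_ifs with h
      · subst h; exact mem_singleton.mpr ((hw0d n).mp (mem_filter.mp hn).2)
      · exact mem_range.mpr (Nat.mod_lt _ (hpr p)))
    (G1 / (W * prS D0 L l p0)) (fun _ => 4 * W * Real.exp (3 * L / 100) * Real.exp (-(L / 2))) (fun _ => by positivity) ⌊Real.exp (L / 50)⌋₊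
    (cv β (dlS D0 L l) (prS D0 L l)) (cv_abs β hβ _ hδ _ hpr) (fun r r' h h' => cv_hcs D0 L hL l β r r' h h') ?_
  · have h2 := key.trans (err1_sum D0 L hL.le l W _ hl)
    have h3 := (abs_le.mp h2).2
    have h4 := main_S3 β hβ (dlS D0 L l) hδ (prS D0 L l) hpr a ha p0 w0 j hdw
    have hA : 0 ≤ (∑ S, wv β (dlS D0 L l) (prS D0 L l) S) ^ Fintype.card ι *
        ((β + 4) * dlS D0 L l p0 + Fintype.card ι / prS D0 L l p0) ^ 2 :=
      mul_nonneg (pow_nonneg (sum_nonneg fun S _ => wv_nonneg β hβ _ hδ _ hpr S) _) (sq_nonneg _)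
    have h5 := mul_le_mul_of_nonneg_left h4 (div_nonneg hG10 (mul_pos hW' hp0).le)
    have h6 := mul_le_mul_of_nonneg_right (div_le_div_of_nonneg_right (G1_le L hL) (mul_pos hW' hp0).le) hA
    linarith
  · intro T hT w hw
    have hwT : ∀ p ∈ insert p0 T, Function.update w p0 w0 p < prS D0 L l p := by
      intro p hp
      by_cases h : p = p0
      · subst h; rw [Function.update_self]; exact hw0
      · rw [Function.update_of_ne h]
        have := hw p (mem_of_mem_insert_of_ne hp h)
        simp only [hU, if_neg h, mem_range] at this
        exact this
    obtain ⟨c, hc⟩ := crt D0 L l W hW b (insert p0 T) _ hwT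
    have hfil : ((N1 L W b).filter (fun n => prS D0 L l p0 ∣ n + a j)).filter (fun n => ∀ p ∈ T, n % prS D0 L l p = w p) =
        (Ioc (N0 L) ⌊Real.exp L⌋₊).filter (fun n => n ≡ c [MOD W * nS D0 L l (insert p0 T)]) := by
      unfold N1
      ext n
      simp only [mem_filter, and_assoc]
      refine and_congr_right fun _ => ?_
      rw [← hc n, hw0d n]
      refine and_congr_right fun _ => ?_
      constructor
      · rintro ⟨h2, h3⟩
        intro p hp
        by_cases h : p = p0
        · subst h; rw [Function.update_self]; exact h2
        · rw [Function.update_of_ne h]; exact h3 p (mem_of_mem_insert_of_ne hp h)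
      · intro h2
        have h3 := h2 p0 (mem_insert_self _ _)
        rw [Function.update_self] at h3
        refine ⟨h3, fun p hp => ?_⟩
        by_cases h : p = p0
        · subst h
          have h4 := hw p hp
          simp only [hU, if_true, mem_singleton] at h4
          rw [h4]; exact h3
        · have := h2 p (mem_insert_of_mem hp)
          rwa [Function.update_of_ne h] at this
    rw [hfil]
    have hn1 : (nS D0 L l (insert p0 T) : ℝ) = prS D0 L l p0 * ∏ p ∈ T, ((U p).card : ℝ) := by
      rw [show insert p0 T = insert p0 (T.erase p0) by ext x; simp only [mem_insert, mem_erase]; tauto, nS, prod_insert (notMem_erase _ _)]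
      rw [← prod_erase T (a := p0) (f := fun p => ((U p).card : ℝ)) (by simp [hU])]
      push_cast
      congr 1
      refine prod_congr rfl fun p hp => ?_
      simp only [hU, if_neg (ne_of_mem_erase hp), card_range]
      rfl
    have hprod : G1 / (W * prS D0 L l p0) / ∏ p ∈ T, ((U p).card : ℝ) = G1 / ((W * nS D0 L l (insert p0 T) : ℕ) : ℝ) := by
      rw [div_div]
      congr 1
      push_cast
      rw [hn1, mul_assoc]
    rw [hprod]
    refine equi' L W (W * nS D0 L l (insert p0 T)) c (Nat.mul_pos hW0 (nS_pos D0 L l _)) ?_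
    have hT' : (nS D0 L l T : ℝ) ≤ Real.exp (L / 50) := by
      rw [Nat.le_floor_iff (Real.exp_pos _).le] at hT; exact hT
    have hTi : (nS D0 L l (insert p0 T) : ℝ) ≤ prS D0 L l p0 * nS D0 L l T := by
      rw [hn1]
      refine mul_le_mul_of_nonneg_left ?_ hp0.le
      unfold nS
      push_cast
      refine prod_le_prod (fun p _ => by positivity) fun p hp => ?_
      simp only [hU]
      split_ifs with h
      · simp only [card_singleton, Nat.cast_one]; exact_mod_cast hpr p
      · rw [card_range]; exact le_rfl
    push_cast
    refine mul_le_mul_of_nonneg_left (hTi.trans ?_) hW'.le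
    calc (prS D0 L l p0 : ℝ) * nS D0 L l T ≤ Real.exp (L / 100) * Real.exp (L / 50) := by
          gcongr
          exact prS_le_exp D0 L l p0
      _ = _ := by rw [← Real.exp_add]; ring_nf

end OIR
end

section
open Finset MeasureTheory
namespace OIR

theorem DZ_nonneg (L : ℝ) (M : ℕ) : 0 ≤ DZ L M := by
  unfold DZ
  split_ifs with h
  · exact le_rfl
  · unfold DM
    refine mul_nonneg (by positivity) (sum_nonneg fun χ _ => ?_)
    split_ifs
    · exact le_rfl
    · exact norm_nonneg _

theorem pw_zero_small (L : ℝ) (hL : 0 < L) (n : ℕ) (h : (n : ℝ) ≤ Real.exp (L / 2)) : pw L n = 0 := by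
  unfold pw; split_ifs
  · rw [wt_zero_small L hL n h, mul_zero]
  · rfl

theorem pw_zero_large (L : ℝ) (hL : 0 < L) (n : ℕ) (h : ⌊Real.exp L⌋₊ < n) : pw L n = 0 := by
  unfold pw; split_ifs
  · rw [wt_zero_large L hL n h, mul_zero]
  · rfl

theorem U_card (p : ℕ) (hp : 0 < p) (m : ℕ) : ((range p).filter (fun w => ¬ p ∣ w + m)).card = p - 1 := by
  have h := card_filter_add_card_filter_not (s := range p) (fun w => p ∣ w + m)
  rw [res_card p hp m, card_range] at h
  omega

noncomputable def N2 (L : ℝ) (W b h : ℕ) : Finset ℕ :=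
  (range (⌊Real.exp L⌋₊ + 1)).filter (fun n => n ≡ b [MOD W] ∧ (n + h).Prime ∧ Real.exp (L / 2) < ((n + h : ℕ) : ℝ) ∧ n + h ≤ ⌊Real.exp L⌋₊)

theorem shift_sum (L : ℝ) (hL : 0 < L) (W b h : ℕ) (hh : (h:ℝ) ≤ Real.exp (L / 2)) (Pr : ℕ → Prop) [DecidablePred Pr] (q c : ℕ)
    (hc : ∀ n : ℕ, (n ≡ b [MOD W] ∧ Pr n) ↔ n ≡ c [MOD q]) :
    ∑ n ∈ (N2 L W b h).filter Pr, pw L (n + h) =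
      ∑ n ∈ (Ioc 0 ⌊Real.exp L⌋₊).filter (fun n : ℕ => (n : ZMod q) = ((c + h : ℕ) : ZMod q)), pw L n := by
  rw [← sum_image (f := fun n => pw L n) (g := fun n => n + h) (s := (N2 L W b h).filter Pr) (fun x _ y _ hxy => Nat.add_right_cancel hxy)]
  refine sum_subset ?_ ?_
  · intro n hn
    obtain ⟨m, hm, rfl⟩ := mem_image.mp hn
    obtain ⟨hm1, hm2⟩ := mem_filter.mp hm
    obtain ⟨_, hm3, hm4, hm5, hm6⟩ := mem_filter.mp hm1
    refine mem_filter.mpr ⟨mem_Ioc.mpr ⟨hm4.pos, hm6⟩, ?_⟩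
    rw [ZMod.natCast_eq_natCast_iff]
    exact ((hc m).mp ⟨hm3, hm2⟩).add_right h
  · intro n hn hnot
    obtain ⟨hn1, hn2⟩ := mem_filter.mp hn
    by_cases hs : (n:ℝ) ≤ Real.exp (L / 2)
    · exact pw_zero_small L hL n hs
    by_cases hp : n.Prime
    · exfalso
      apply hnot
      push Not at hs
      have hhn : h ≤ n := by
        have : (h:ℝ) ≤ n := hh.trans hs.le
        exact_mod_cast this
      obtain ⟨m, rfl⟩ := Nat.exists_eq_add_of_le' hhn
      rw [ZMod.natCast_eq_natCast_iff] at hn2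
      have hm := (hc m).mpr (Nat.ModEq.add_right_cancel' h hn2)
      have hX := (mem_Ioc.mp hn1).2
      refine mem_image.mpr ⟨m, mem_filter.mpr ⟨mem_filter.mpr ⟨mem_range.mpr (by omega), hm.1, hp, hs, hX⟩, hm.2⟩, rfl⟩
    · unfold pw; rw [if_neg hp]

theorem S2_bound {ι : Type*} [Fintype ι] [DecidableEq ι] (D0 : ℕ) (L : ℝ) (hL : 0 < L) (l W : ℕ) (hl : l.Prime) (hW0 : 0 < W)
    (hW : ∀ p : ℕ, p.Prime → p ∣ W → p ≤ D0) (b : ℕ) (β : ℝ) (hβ : 0 ≤ β) (a : ι → ℕ)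
    (hWL : (W:ℝ) * Real.exp (L / 50) ≤ Real.exp (L / 2)) (m : ι) (hh : (a m : ℝ) ≤ Real.exp (L / 2) / 2) (hb : (b + a m).Coprime W)
    (hBV : ∑ q ∈ (Ioc 0 ⌊Real.exp (L/50)⌋₊).filter (fun q => Squarefree q ∧ q.Coprime W ∧ ¬ l ∣ q),
      ((2 * (Fintype.card ι + 1) ^ 2 : ℕ) : ℝ) ^ q.primeFactors.card * DZ L (W * q) ≤ 1 / L) (F : ℝ)
    (hF : F ≤ ∑ r, ∑ r', cv β (dlS D0 L l) (prS D0 L l) r * cv β (dlS D0 L l) (prS D0 L l) r' *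
      ∏ p, Gk a (prS D0 L l p) ((range (prS D0 L l p)).filter (fun w => ¬ prS D0 L l p ∣ w + a m)) (r p) (r' p)) :
    (∑ n ∈ Ioc 0 ⌊Real.exp L⌋₊, pw L n) / W.totient * F - 1 / L ≤
      ∑ n ∈ N1 L W b, pw L (n + a m) * nu a (prS D0 L l) (cv β (dlS D0 L l) (prS D0 L l)) n ^ 2 := by
  have hW' : (0:ℝ) < W := by exact_mod_cast hW0
  have hδ := dlS_nonneg D0 L hL l
  have hpr := prS_pos D0 L l
  have hhe : (a m : ℝ) ≤ Real.exp (L / 2) := hh.trans (by linarith [Real.exp_pos (L/2)])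
  set G2 := ∑ n ∈ Ioc 0 ⌊Real.exp L⌋₊, pw L n with hG2
  have hG20 : 0 ≤ G2 := sum_nonneg fun n _ => pw_nonneg L n
  have hsub : N2 L W b (a m) ⊆ N1 L W b := by
    intro n hn
    obtain ⟨hn1, hn2, hn3, hn4, hn5⟩ := mem_filter.mp hn
    refine mem_filter.mpr ⟨mem_Ioc.mpr ⟨?_, by omega⟩, hn2⟩
    unfold N0
    rw [Nat.floor_lt (by positivity)]
    push_cast at hn4
    linarith
  refine le_trans ?_ (sum_le_sum_of_subset_of_nonneg hsub fun n _ _ => mul_nonneg (pw_nonneg L _) (sq_nonneg _))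
  have key := gen_sieve a (prS D0 L l) hpr (N2 L W b (a m)) (fun n => pw L (n + a m))
    (fun p => (range (prS D0 L l p)).filter (fun w => ¬ prS D0 L l p ∣ w + a m))
    (fun p => by
      rw [← card_pos, U_card _ (hpr p)]
      have := (prS_prime D0 L l p).one_lt; omega)
    (fun p => filter_subset _ _)
    (fun n hn p => by
      obtain ⟨_, _, hn3, hn4, _⟩ := mem_filter.mp hn
      refine mem_filter.mpr ⟨mem_range.mpr (Nat.mod_lt _ (hpr p)), fun hd => ?_⟩
      have h1 : prS D0 L l p ∣ n + a m := by
        rw [Nat.dvd_iff_mod_eq_zero, Nat.add_mod, Nat.mod_mod, ← Nat.add_mod] at hd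
        exact Nat.dvd_of_mod_eq_zero hd
      have h2 := (Nat.prime_dvd_prime_iff_eq (prS_prime D0 L l p) hn3).mp h1
      rw [← h2] at hn4
      have h3 := prS_le_exp D0 L l p
      have h4 : Real.exp (L / 100) ≤ Real.exp (L / 2) := Real.exp_le_exp.mpr (by linarith)
      linarith)
    (G2 / W.totient) (fun T => DZ L (W * nS D0 L l T)) (fun _ => DZ_nonneg _ _) ⌊Real.exp (L / 50)⌋₊
    (cv β (dlS D0 L l) (prS D0 L l)) (cv_abs β hβ _ hδ _ hpr) (fun r r' h h' => cv_hcs D0 L hL l β r r' h h') ?_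
  · have h2 := key.trans ((T_sum D0 L l W _ hl hW ⌊Real.exp (L / 50)⌋₊ (fun q => DZ L (W * q)) (fun _ => DZ_nonneg _ _)).trans hBV)
    have h3 := (abs_le.mp h2).1
    have h5 := mul_le_mul_of_nonneg_left hF (div_nonneg hG20 (Nat.cast_nonneg W.totient))
    linarith
  · intro T hT w hw
    obtain ⟨c, hc⟩ := crt D0 L l W hW b T w (fun p hp => mem_range.mp (mem_filter.mp (hw p hp)).1)
    rw [shift_sum L hL W b (a m) hhe _ _ c hc]
    have hq0 : 0 < W * nS D0 L l T := Nat.mul_pos hW0 (nS_pos D0 L l T)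
    have : NeZero (W * nS D0 L l T) := ⟨hq0.ne'⟩
    obtain ⟨hcW, hcT⟩ := (hc c).mpr rfl
    have hcop : (c + a m).Coprime (W * nS D0 L l T) := by
      refine Nat.Coprime.mul_right ?_ ?_
      · have : (c + a m) ≡ (b + a m) [MOD W] := hcW.add_right _
        unfold Nat.Coprime at hb ⊢
        rw [this.gcd_eq]; exact hb
      · unfold nS
        refine Nat.Coprime.prod_right fun p hp => ?_
        refine Nat.Coprime.symm ((Nat.Prime.coprime_iff_not_dvd (prS_prime D0 L l p)).mpr fun hd => ?_)
        apply (mem_filter.mp (hw p hp)).2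
        rw [← hcT p hp, Nat.dvd_iff_mod_eq_zero, Nat.add_mod, Nat.mod_mod, ← Nat.add_mod]
        exact Nat.mod_eq_zero_of_dvd hd
    have hqle : ((W * nS D0 L l T : ℕ) : ℝ) ≤ Real.exp (L / 2) := by
      have hT' : (nS D0 L l T : ℝ) ≤ Real.exp (L / 50) := by
        rw [Nat.le_floor_iff (Real.exp_pos _).le] at hT; exact hT
      push_cast
      exact (mul_le_mul_of_nonneg_left hT' hW'.le).trans hWL
    have h1 := DM_prog L (W * nS D0 L l T) hL hqle (c + a m) hcop
    rw [DZ_eq]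
    convert h1 using 2
    congr 1
    have htot : (W * nS D0 L l T).totient = W.totient * ∏ p ∈ T, (prS D0 L l p - 1) := by
      rw [Nat.totient_mul (nS_coprime D0 L l W hW T), Nat.totient_eq_prod_factorization (nS_pos D0 L l T).ne']
      congr 1
      rw [Nat.prod_factorization_eq_prod_primeFactors, nS_primeFactors, prod_image (fun x _ y _ h => Subtype.ext h)]
      refine prod_congr rfl fun p hp => ?_
      have hf : (nS D0 L l T).factorization (p:ℕ) = 1 := by
        refine Nat.factorization_eq_one_of_squarefree (nS_sqfree D0 L l T) ?_ ?_
        · exact prS_prime D0 L l p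
        · exact dvd_prod_of_mem (fun p : PS D0 L l => (p:ℕ)) hp
      rw [hf]; simp [prS]
    rw [htot]
    have hU : ∏ p ∈ T, ((((range (prS D0 L l p)).filter (fun w => ¬ prS D0 L l p ∣ w + a m)).card : ℕ) : ℝ) = ((∏ p ∈ T, (prS D0 L l p - 1) : ℕ) : ℝ) := by
      push_cast
      refine prod_congr rfl fun p _ => ?_
      rw [U_card _ (hpr p)]
    rw [hU]
    push_cast
    rw [div_div]
    ring

end OIR
end

section
open Finset MeasureTheory
namespace OIR

theorem theta_layer : ∀ᶠ y : ℕ in Filter.atTop, 2 * (y:ℝ) ≤ Chebyshev.theta ((8 * y : ℕ) : ℝ) - Chebyshev.theta (y:ℝ) := by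
  have h0 := (isLittleO_log_rpow_atTop (r := 1/2) (by norm_num)).bound (c := 1/32) (by norm_num)
  have h1 : Filter.Tendsto (fun y : ℕ => ((8 * y : ℕ) : ℝ)) Filter.atTop Filter.atTop :=
    tendsto_natCast_atTop_atTop.comp (Filter.tendsto_atTop_mono (fun n => by simp only [id]; omega) Filter.tendsto_id)
  have h2 : Filter.Tendsto (fun y : ℕ => ((8 * y : ℕ) : ℝ) + 1) Filter.atTop Filter.atTop := Filter.tendsto_atTop_add_const_right _ _ h1
  filter_upwards [h1.eventually h0, h2.eventually h0, Filter.eventually_ge_atTop 1] with y ha hb hy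
  have hy' : (1:ℝ) ≤ y := by exact_mod_cast hy
  rw [Real.norm_eq_abs, Real.norm_eq_abs, ← Real.sqrt_eq_rpow, abs_of_nonneg (Real.sqrt_nonneg _)] at ha hb
  have ha' := (le_abs_self _).trans ha
  have hb' := (le_abs_self _).trans hb
  have g1 := Chebyshev.theta_ge (8 * y)
  have g2 := Chebyshev.theta_le_log4_mul_x (x := (y:ℝ)) (by positivity)
  have h4 : Real.log 4 = 2 * Real.log 2 := by
    rw [show (4:ℝ) = 2 ^ 2 by norm_num, Real.log_pow]; norm_num
  have hl2 := Real.log_two_gt_d9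
  have e1 : 2 * √((8 * y : ℕ) : ℝ) * Real.log ((8 * y : ℕ) : ℝ) ≤ y / 2 := by
    calc _ ≤ 2 * √((8 * y : ℕ) : ℝ) * (1 / 32 * √((8 * y : ℕ) : ℝ)) := by gcongr
      _ = 1 / 16 * (√((8 * y : ℕ) : ℝ)) ^ 2 := by ring
      _ = _ := by rw [Real.sq_sqrt (by positivity)]; push_cast; ring
  have e2 : Real.log (((8 * y : ℕ) : ℝ) + 1) ≤ y := by
    refine hb'.trans ?_
    have : √(((8 * y : ℕ) : ℝ) + 1) ≤ ((8 * y : ℕ) : ℝ) + 1 := by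
      rw [Real.sqrt_le_left (by positivity)]
      push_cast; nlinarith
    push_cast at this ⊢
    linarith
  rw [h4] at g2
  push_cast at g1 e1 e2 ⊢
  nlinarith

theorem theta_diff (y : ℕ) : Chebyshev.theta ((8 * y : ℕ) : ℝ) - Chebyshev.theta (y:ℝ) = ∑ n ∈ Ioc y (8 * y), if n.Prime then Real.log n else 0 := by
  unfold Chebyshev.theta
  rw [Nat.floor_natCast, Nat.floor_natCast, sum_filter, sum_filter, ← sum_Ioc_consecutive _ (Nat.zero_le y) (by omega : y ≤ 8 * y)]
  ring

theorem G2_lower : ∀ᶠ L : ℝ in Filter.atTop, L / 40 ≤ ∑ n ∈ Ioc 0 ⌊Real.exp L⌋₊, pw L n := by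
  obtain ⟨Y, hY⟩ := Filter.eventually_atTop.mp theta_layer
  have hl2 := Real.log_two_gt_d9
  have hl2' := Real.log_two_lt_d9
  have hl8 : Real.log 8 = 3 * Real.log 2 := by
    rw [show (8:ℝ) = 2 ^ 3 by norm_num, Real.log_pow]; norm_num
  set c := Real.log 8 with hc
  have hc0 : 0 < c := by linarith
  filter_upwards [Filter.eventually_ge_atTop 200, Filter.eventually_ge_atTop (Real.log (Y + 1) * 2)] with L hL hLY
  have hL0 : 0 < L := by linarith
  set j0 := ⌈5 * L / (8 * c)⌉₊ with hj0
  set j1 := ⌊7 * L / (8 * c)⌋₊ with hj1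
  have b0 : 5 * L / (8 * c) ≤ j0 := Nat.le_ceil _
  have b0' : (j0:ℝ) < 5 * L / (8 * c) + 1 := Nat.ceil_lt_add_one (by positivity)
  have b1 : (j1:ℝ) ≤ 7 * L / (8 * c) := Nat.floor_le (by positivity)
  have b1' : 7 * L / (8 * c) < j1 + 1 := Nat.lt_floor_add_one _
  have hcnt : L / 10 ≤ (j1:ℝ) - j0 := by
    have : L / 9 ≤ L / (4 * c) := div_le_div_of_nonneg_left hL0.le (by positivity) (by linarith)
    have e : 7 * L / (8 * c) - 5 * L / (8 * c) = L / (4 * c) := by field_simp; ring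
    linarith
  have hjle : j0 ≤ j1 := by
    have : (j0:ℝ) ≤ j1 := by linarith
    exact_mod_cast this
  have hpow : ∀ j : ℕ, Real.log ((8:ℝ) ^ j) = j * c := fun j => by rw [Real.log_pow]
  have hlay : ∀ j ∈ Ico j0 j1, (1:ℝ) / 4 ≤ ∑ n ∈ Ioc (8 ^ j) (8 ^ (j + 1)), pw L n := by
    intro j hj
    obtain ⟨hj2, hj3⟩ := mem_Ico.mp hj
    have hj2' : (j0:ℝ) ≤ j := by exact_mod_cast hj2
    have hj3' : (j:ℝ) + 1 ≤ j1 := by exact_mod_cast hj3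
    have lo : 5 * L / 8 ≤ j * c := by
      have : 5 * L / (8 * c) ≤ j := b0.trans hj2'
      rw [div_le_iff₀ (by positivity)] at this
      linarith
    have hi : (j + 1) * c ≤ 7 * L / 8 := by
      have : (j:ℝ) + 1 ≤ 7 * L / (8 * c) := hj3'.trans b1
      rw [le_div_iff₀ (by positivity)] at this
      linarith
    have hYj : Y ≤ 8 ^ j := by
      have h1 : Real.log (Y + 1) ≤ Real.log ((8:ℝ) ^ j) := by rw [hpow]; linarith
      have h2 := (Real.log_le_log_iff (by positivity) (by positivity)).mp h1
      have h3 : (Y:ℝ) ≤ ((8 ^ j : ℕ) : ℝ) := by push_cast; linarith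
      exact_mod_cast h3
    have h1 := hY (8 ^ j) hYj
    rw [theta_diff, show 8 * 8 ^ j = 8 ^ (j + 1) by ring] at h1
    have h8 : (0:ℝ) < ((8 ^ j : ℕ) : ℝ) := by positivity
    calc (1:ℝ) / 4 = 2 * ((8 ^ j : ℕ) : ℝ) / (8 * ((8 ^ j : ℕ) : ℝ)) := by field_simp; norm_num
      _ ≤ (∑ n ∈ Ioc (8 ^ j) (8 ^ (j + 1)), if n.Prime then Real.log n else 0) / (8 * ((8 ^ j : ℕ) : ℝ)) := by gcongr
      _ ≤ _ := by
        rw [sum_div]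
        refine sum_le_sum fun n hn => ?_
        obtain ⟨hn1, hn2⟩ := mem_Ioc.mp hn
        have hn0 : (0:ℝ) < n := by exact_mod_cast (by positivity : 0 < 8 ^ j).trans hn1
        have hn1' : ((8:ℝ)) ^ j ≤ n := by exact_mod_cast hn1.le
        have hn2' : (n:ℝ) ≤ (8:ℝ) ^ (j + 1) := by exact_mod_cast hn2
        unfold pw
        split_ifs with hp
        · unfold wt
          have l1 : j * c ≤ Real.log n := by rw [← hpow]; exact Real.log_le_log (by positivity) hn1'
          have l2 : Real.log n ≤ (j + 1) * c := by
            have := Real.log_le_log hn0 hn2'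
            rw [hpow] at this; push_cast at this; exact this
          rw [bump_one (Real.log n / L) (by rw [le_div_iff₀ hL0]; linarith) (by rw [div_le_iff₀ hL0]; linarith), mul_one_div]
          refine div_le_div_of_nonneg_left (Real.log_natCast_nonneg n) hn0 ?_
          push_cast
          rw [pow_succ] at hn2'
          linarith
        · simp
  have hsum : ∀ J : ℕ, j0 ≤ J → ∑ j ∈ Ico j0 J, ∑ n ∈ Ioc (8 ^ j) (8 ^ (j + 1)), pw L n = ∑ n ∈ Ioc (8 ^ j0) (8 ^ J), pw L n := by
    intro J hJ
    induction J, hJ using Nat.le_induction with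
    | base => simp
    | succ J hJ ih =>
      rw [sum_Ico_succ_top hJ, ih, sum_Ioc_consecutive _ (Nat.pow_le_pow_right (by norm_num) hJ) (Nat.pow_le_pow_right (by norm_num) (Nat.le_succ J))]
  have hX : 8 ^ j1 ≤ ⌊Real.exp L⌋₊ := by
    rw [Nat.le_floor_iff (Real.exp_pos _).le]
    push_cast
    rw [← Real.log_le_iff_le_exp (by positivity), hpow]
    rw [le_div_iff₀ (by positivity)] at b1
    linarith
  calc L / 40 ≤ ((j1:ℝ) - j0) * (1 / 4) := by linarith
    _ = ∑ j ∈ Ico j0 j1, (1:ℝ) / 4 := by rw [sum_const, Nat.card_Ico, nsmul_eq_mul, Nat.cast_sub hjle]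
    _ ≤ _ := sum_le_sum hlay
    _ = _ := hsum j1 hjle
    _ ≤ _ := sum_le_sum_of_subset_of_nonneg (Ioc_subset_Ioc (Nat.zero_le _) hX) fun n _ _ => pw_nonneg L n

theorem mertens_up (X : ℕ) (hX : 1 ≤ X) : ∑ n ∈ Ioc 1 X, (if n.Prime then Real.log n else 0) / n ≤ 2 + 2 * Real.log X := by
  have h4 : Real.log 4 = 2 * Real.log 2 := by
    rw [show (4:ℝ) = 2 ^ 2 by norm_num, Real.log_pow]; norm_num
  have hl2' := Real.log_two_lt_d9
  have hth : ∀ m : ℕ, ∑ n ∈ Ioc 0 m, (if n.Prime then Real.log n else 0) ≤ 2 * (m:ℝ) := by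
    intro m
    have := Chebyshev.theta_le_log4_mul_x (x := (m:ℝ)) (by positivity)
    unfold Chebyshev.theta at this
    rw [Nat.floor_natCast, sum_filter] at this
    refine this.trans (mul_le_mul_of_nonneg_right (by linarith) (by positivity))
  have hX' : (0:ℝ) < X := by exact_mod_cast hX
  refine (abel_ineq (fun n => if n.Prime then Real.log n else 0) (fun n => by
    split_ifs
    · exact Real.log_natCast_nonneg n
    · exact le_rfl) 1 X one_pos hX).trans ?_
  have t1 : (∑ n ∈ Ioc 0 X, (if n.Prime then Real.log n else 0)) / X ≤ 2 := by
    rw [div_le_iff₀ hX']; exact hth X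
  have t2 : ∑ m ∈ Ico 1 X, (∑ n ∈ Ioc 0 m, (if n.Prime then Real.log n else 0)) / (m * (m + 1)) ≤ 2 * Real.log X := by
    calc _ ≤ ∑ m ∈ Ico 1 X, 2 * (1 / ((m:ℝ) + 1)) := by
          refine sum_le_sum fun m hm => ?_
          have hm1 : (0:ℝ) < m := by exact_mod_cast (mem_Ico.mp hm).1
          calc _ ≤ 2 * (m:ℝ) / (m * (m + 1)) := by gcongr; exact hth m
            _ = _ := by field_simp
      _ ≤ _ := by
          rw [← mul_sum]
          refine mul_le_mul_of_nonneg_left ?_ (by norm_num)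
          have hs := sum_inv_le X
          have e : ∑ n ∈ Ioc 0 X, (1:ℝ) / n = 1 + ∑ m ∈ Ico 1 X, 1 / ((m:ℝ) + 1) := by
            clear hs t1 hX' hth
            induction X, hX using Nat.le_induction with
            | base => simp
            | succ X hX ih =>
              rw [sum_Ioc_succ_top (Nat.zero_le X), ih, sum_Ico_succ_top hX]
              push_cast; ring
          linarith
  linarith

theorem PS_logsum (D0 : ℕ) (hD0 : 1 ≤ D0) (L : ℝ) (hL : 100 ≤ L) (l : ℕ) : ∑ p : PS D0 L l, dlS D0 L l p / prS D0 L l p ≤ 4 := by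
  have hL0 : 0 < L := by linarith
  have hX1 : 1 ≤ ⌊Real.exp (L / 100)⌋₊ := Nat.one_le_floor_iff _ |>.mpr (Real.one_le_exp (by positivity))
  have h1 := mertens_up ⌊Real.exp (L / 100)⌋₊ hX1
  have h2 : Real.log ⌊Real.exp (L / 100)⌋₊ ≤ L / 100 := by
    rw [Real.log_le_iff_le_exp (by exact_mod_cast hX1)]; exact Nat.floor_le (Real.exp_pos _).le
  have h3 : ∑ p : PS D0 L l, dlS D0 L l p / prS D0 L l p = ∑ p ∈ PS D0 L l, (Real.log p / p) / (L / 100) := by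
    rw [← sum_coe_sort (PS D0 L l) (fun p => (Real.log p / p) / (L / 100))]
    refine sum_congr rfl fun p _ => ?_
    unfold dlS prS
    ring
  rw [h3, ← sum_div, div_le_iff₀ (by positivity)]
  have h4 : ∑ p ∈ PS D0 L l, Real.log p / p ≤ ∑ n ∈ Ioc 1 ⌊Real.exp (L / 100)⌋₊, (if n.Prime then Real.log n else 0) / n := by
    unfold PS
    rw [sum_filter]
    refine (sum_le_sum_of_subset_of_nonneg (t := Ioc 1 ⌊Real.exp (L / 100)⌋₊) (Ioc_subset_Ioc_left hD0) fun n _ _ => ?_).trans (sum_le_sum fun n _ => ?_)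
    · split_ifs
      · exact div_nonneg (Real.log_natCast_nonneg n) (by positivity)
      · exact le_rfl
    · have := div_nonneg (Real.log_natCast_nonneg n) (by positivity : (0:ℝ) ≤ n)
      by_cases hp : n.Prime <;> by_cases hq : n = l <;> simp_all
  linarith

theorem PS_sqsum (D0 : ℕ) (hD0 : 1 ≤ D0) (L : ℝ) (l : ℕ) : ∑ p : PS D0 L l, (1 / (prS D0 L l p : ℝ)) ^ 2 ≤ 1 / (D0:ℝ) := by
  have h3 : ∑ p : PS D0 L l, (1 / (prS D0 L l p : ℝ)) ^ 2 = ∑ p ∈ PS D0 L l, ((p:ℝ) ^ 2)⁻¹ := by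
    rw [← sum_coe_sort (PS D0 L l) (fun p => ((p:ℝ) ^ 2)⁻¹)]
    refine sum_congr rfl fun p _ => ?_
    unfold prS
    rw [div_pow, one_pow, one_div]
  rw [h3]
  rcases le_total D0 ⌊Real.exp (L / 100)⌋₊ with h | h
  · have := sum_Ioc_inv_sq_le_sub (α := ℝ) (k := D0) (n := ⌊Real.exp (L / 100)⌋₊) (by omega) h
    have h5 : (0:ℝ) ≤ (⌊Real.exp (L / 100)⌋₊ : ℝ)⁻¹ := by positivity
    refine (sum_le_sum_of_subset_of_nonneg (filter_subset _ _) fun n _ _ => by positivity).trans (this.trans ?_)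
    rw [one_div]; linarith
  · unfold PS
    rw [Ioc_eq_empty (by omega)]
    simp

end OIR
end

section
open Finset MeasureTheory
namespace OIR

theorem pw_le (L : ℝ) (hL : 0 < L) (n h : ℕ) (hn : 0 < n) : pw L (n + h) ≤ if (n + h).Prime then L / n else 0 := by
  have hn' : (0:ℝ) < n := by exact_mod_cast hn
  split_ifs with hp
  · by_cases hX : n + h ≤ ⌊Real.exp L⌋₊
    · unfold pw
      rw [if_pos hp]
      have h0 : (0:ℝ) < ((n + h : ℕ) : ℝ) := by exact_mod_cast hp.pos
      have h1 : Real.log ((n + h : ℕ) : ℝ) ≤ L := by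
        rw [Real.log_le_iff_le_exp h0, ← Nat.le_floor_iff (Real.exp_pos _).le]; exact hX
      calc _ ≤ L * (1 / ((n + h : ℕ) : ℝ)) := mul_le_mul h1 (wt_le L _) (wt_nonneg L _) hL.le
        _ ≤ L * (1 / n) := by
            refine mul_le_mul_of_nonneg_left (one_div_le_one_div_of_le hn' ?_) hL.le
            push_cast; have : (0:ℝ) ≤ h := by positivity
            linarith
        _ = L / n := by ring
    · rw [pw_zero_large L hL _ (not_le.mp hX)]; positivity
  · unfold pw; rw [if_neg hp]

theorem upper_n (L : ℝ) (hL : 0 < L) {Q : Type*} [Fintype Q] (pr : Q → ℕ) (k K B : ℕ) (hB : 0 < B) (h h' : Fin k → ℕ) (n : ℕ) (hn : 0 < n)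
    (hbad : (univ.filter (fun m => (n + h m).Prime)).card < K ∨ ∃ j, B < (univ.filter (fun p => pr p ∣ n + h' j)).card) :
    ∑ m, pw L (n + h m) ≤ L * (1 / (n:ℝ)) * (K + (k:ℝ) / B * ∑ j, ∑ p, if pr p ∣ n + h' j then (1:ℝ) else 0) := by
  have hn' : (0:ℝ) < n := by exact_mod_cast hn
  have hB' : (0:ℝ) < B := by exact_mod_cast hB
  have hS0 : 0 ≤ ∑ j, ∑ p, if pr p ∣ n + h' j then (1:ℝ) else 0 := sum_nonneg fun j _ => sum_nonneg fun p _ => by split_ifs <;> norm_num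
  have h1 : ∑ m, pw L (n + h m) ≤ L * (1 / (n:ℝ)) * (univ.filter (fun m => (n + h m).Prime)).card := by
    refine (sum_le_sum fun m _ => pw_le L hL n (h m) hn).trans (le_of_eq ?_)
    rw [← sum_filter, sum_const, nsmul_eq_mul]; ring
  refine h1.trans (mul_le_mul_of_nonneg_left ?_ (by positivity))
  rcases hbad with hb | ⟨j, hj⟩
  · have : ((univ.filter (fun m => (n + h m).Prime)).card : ℝ) ≤ K := by exact_mod_cast hb.le
    have h3 : 0 ≤ (k:ℝ) / B * ∑ j, ∑ p, if pr p ∣ n + h' j then (1:ℝ) else 0 := by positivity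
    linarith
  · have h2 : ((univ.filter (fun m => (n + h m).Prime)).card : ℝ) ≤ k := by
      have := card_filter_le (univ : Finset (Fin k)) (fun m => (n + h m).Prime)
      rw [card_univ, Fintype.card_fin] at this
      exact_mod_cast this
    have h3 : (B:ℝ) ≤ ∑ j, ∑ p, if pr p ∣ n + h' j then (1:ℝ) else 0 := by
      calc (B:ℝ) ≤ ((univ.filter (fun p => pr p ∣ n + h' j)).card : ℝ) := by exact_mod_cast hj.le
        _ = ∑ p, if pr p ∣ n + h' j then (1:ℝ) else 0 := by rw [sum_boole]
        _ ≤ _ := single_le_sum (f := fun j => ∑ p, if pr p ∣ n + h' j then (1:ℝ) else 0)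
            (fun j _ => sum_nonneg fun p _ => by split_ifs <;> norm_num) (mem_univ j)
    have h4 : (k:ℝ) ≤ (k:ℝ) / B * ∑ j, ∑ p, if pr p ∣ n + h' j then (1:ℝ) else 0 := by
      calc (k:ℝ) = (k:ℝ) / B * B := by field_simp
        _ ≤ _ := by gcongr
    have : (0:ℝ) ≤ K := by positivity
    linarith

theorem upper_sum (L : ℝ) (hL : 0 < L) {Q : Type*} [Fintype Q] (pr : Q → ℕ) (k K B : ℕ) (hB : 0 < B) (h h' : Fin k → ℕ) (N : Finset ℕ)
    (hN : ∀ n ∈ N, 0 < n) (v : ℕ → ℝ)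
    (hbad : ∀ n ∈ N, (univ.filter (fun m => (n + h m).Prime)).card < K ∨ ∃ j, B < (univ.filter (fun p => pr p ∣ n + h' j)).card) :
    ∑ m, ∑ n ∈ N, pw L (n + h m) * v n ^ 2 ≤ L * (K * ∑ n ∈ N, (1:ℝ) / n * v n ^ 2 +
      (k:ℝ) / B * ∑ j, ∑ p, ∑ n ∈ N.filter (fun n => pr p ∣ n + h' j), (1:ℝ) / n * v n ^ 2) := by
  rw [sum_comm]
  have h1 : ∀ n ∈ N, ∑ m, pw L (n + h m) * v n ^ 2 ≤
      L * (1 / (n:ℝ)) * (K + (k:ℝ) / B * ∑ j, ∑ p, if pr p ∣ n + h' j then (1:ℝ) else 0) * v n ^ 2 := by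
    intro n hn
    rw [← sum_mul]
    exact mul_le_mul_of_nonneg_right (upper_n L hL pr k K B hB h h' n (hN n hn) (hbad n hn)) (sq_nonneg _)
  refine (sum_le_sum h1).trans (le_of_eq ?_)
  have h2 : ∑ j, ∑ p, ∑ n ∈ N.filter (fun n => pr p ∣ n + h' j), (1:ℝ) / n * v n ^ 2 =
      ∑ n ∈ N, (∑ j, ∑ p, if pr p ∣ n + h' j then (1:ℝ) else 0) * ((1:ℝ) / n * v n ^ 2) := by
    calc _ = ∑ j, ∑ p, ∑ n ∈ N, (if pr p ∣ n + h' j then (1:ℝ) else 0) * ((1:ℝ) / n * v n ^ 2) := by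
          refine sum_congr rfl fun j _ => sum_congr rfl fun p _ => ?_
          rw [sum_filter]
          refine sum_congr rfl fun n _ => ?_
          split_ifs <;> simp
      _ = ∑ j, ∑ n ∈ N, (∑ p, (if pr p ∣ n + h' j then (1:ℝ) else 0)) * ((1:ℝ) / n * v n ^ 2) := by
          refine sum_congr rfl fun j _ => ?_
          rw [sum_comm]
          exact sum_congr rfl fun n _ => by rw [sum_mul]
      _ = _ := by
          rw [sum_comm]
          exact sum_congr rfl fun n _ => by rw [sum_mul]
  rw [h2, mul_sum, mul_sum, ← sum_add_distrib, mul_sum]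
  refine sum_congr rfl fun n _ => ?_
  ring

/-- main term of the third sum -/
theorem S3_total (D0 : ℕ) (hD0 : 1 ≤ D0) (L : ℝ) (hL : 100 ≤ L) (l : ℕ) (β κ : ℝ) (hβ : 0 ≤ β) :
    ∑ p : PS D0 L l, 1 / (prS D0 L l p : ℝ) * ((β + 4) * dlS D0 L l p + κ / prS D0 L l p) ^ 2 ≤ 8 * (β + 4) ^ 2 + 2 * κ ^ 2 := by
  have hL0 : 0 < L := by linarith
  have h1 : ∀ p : PS D0 L l, 1 / (prS D0 L l p : ℝ) * ((β + 4) * dlS D0 L l p + κ / prS D0 L l p) ^ 2 ≤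
      2 * (β + 4) ^ 2 * (dlS D0 L l p / prS D0 L l p) + 2 * κ ^ 2 * (1 / (prS D0 L l p : ℝ)) ^ 2 := by
    intro p
    have hp1 : (1:ℝ) ≤ prS D0 L l p := by exact_mod_cast prS_pos D0 L l p
    have hp0 : (0:ℝ) < prS D0 L l p := by linarith
    have hd0 := dlS_nonneg D0 L hL0 l p
    have hd1 : dlS D0 L l p ≤ 1 := by
      unfold dlS
      rw [div_le_one (by positivity)]
      exact (Real.log_le_iff_le_exp hp0).mpr (prS_le_exp D0 L l p)
    set d := dlS D0 L l p
    set q := (prS D0 L l p : ℝ)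
    have hq : 1 / q ≤ 1 := by rw [div_le_one hp0]; exact hp1
    have hq0 : 0 ≤ 1 / q := by positivity
    have e1 : ((β + 4) * d + κ / q) ^ 2 ≤ 2 * ((β + 4) ^ 2 * d ^ 2) + 2 * (κ ^ 2 * (1 / q) ^ 2) := by
      have := sq_nonneg ((β + 4) * d - κ / q)
      have e : κ / q = κ * (1 / q) := by ring
      rw [e] at this ⊢
      nlinarith
    have e2 : d ^ 2 ≤ d := by nlinarith
    calc 1 / q * ((β + 4) * d + κ / q) ^ 2 ≤ 1 / q * (2 * ((β + 4) ^ 2 * d ^ 2) + 2 * (κ ^ 2 * (1 / q) ^ 2)) := mul_le_mul_of_nonneg_left e1 hq0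
      _ = 2 * (β + 4) ^ 2 * (d ^ 2 * (1 / q)) + (2 * κ ^ 2 * (1 / q) ^ 2) * (1 / q) := by ring
      _ ≤ 2 * (β + 4) ^ 2 * (d * (1 / q)) + (2 * κ ^ 2 * (1 / q) ^ 2) * 1 := by gcongr
      _ = _ := by ring
  refine (sum_le_sum fun p _ => h1 p).trans ?_
  rw [sum_add_distrib, ← mul_sum, ← mul_sum]
  have h2 := PS_logsum D0 hD0 L hL l
  have h3 := PS_sqsum D0 hD0 L l
  have h4 : (1:ℝ) / D0 ≤ 1 := by rw [div_le_one (by exact_mod_cast hD0)]; exact_mod_cast hD0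
  have h5 := mul_le_mul_of_nonneg_left h2 (by positivity : 0 ≤ 2 * (β + 4) ^ 2)
  have h6 := mul_le_mul_of_nonneg_left (h3.trans h4) (by positivity : 0 ≤ 2 * κ ^ 2)
  linarith

theorem PS_card (D0 : ℕ) (L : ℝ) (l : ℕ) : (Fintype.card (PS D0 L l) : ℝ) ≤ Real.exp (L / 100) := by
  rw [Fintype.card_coe]
  have h1 : (PS D0 L l).card ≤ ⌊Real.exp (L / 100)⌋₊ := by
    unfold PS
    refine (card_filter_le _ _).trans ?_
    rw [Nat.card_Ioc]; omega
  exact le_trans (by exact_mod_cast h1) (Nat.floor_le (Real.exp_pos _).le)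

/-- the asymptotic inequality on the local densities -/
theorem F_lower {ι : Type*} [Fintype ι] [DecidableEq ι] (D0 : ℕ) (L : ℝ) (hL : 0 < L) (l W : ℕ) (J : ℕ) (a : ι → ℕ)
    (ha : ∀ p : PS D0 L l, ∀ n i j, prS D0 L l p ∣ n + a i → prS D0 L l p ∣ n + a j → i = j) (m : ι) (hD16 : 16 ≤ D0)
    (hDκ : 16 * Fintype.card ι ≤ D0) (hDκ2 : 24 * Fintype.card ι ^ 2 ≤ D0) (hJκ : 32768 * Fintype.card ι * (J + 1) ≤ 8 ^ J)
    (hW0 : 0 < W)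
    (hNc : ∀ j ≤ J, ((W.totient : ℝ) / W * (L / 100)) / 4 * (8 ^ j / 8 ^ J) ≤ Nc (dlS D0 L l) (prS D0 L l) (8 ^ j / 8 ^ J) ∧
      Nc (dlS D0 L l) (prS D0 L l) (8 ^ j / 8 ^ J) ≤ 2 * ((W.totient : ℝ) / W * (L / 100)) * (8 ^ j / 8 ^ J)) :
    ((W.totient : ℝ) / W * (L / 100)) / (16 * 8 ^ J) ≤ ∑ S, wv (8 ^ J) (dlS D0 L l) (prS D0 L l) S ∧
    (J:ℝ) ^ 2 * ((W.totient : ℝ) / W * (L / 100)) / (393216 * 8 ^ J) * (∑ S, wv (8 ^ J) (dlS D0 L l) (prS D0 L l) S) ^ Fintype.card ι ≤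
      ∑ r, ∑ r', cv (8 ^ J) (dlS D0 L l) (prS D0 L l) r * cv (8 ^ J) (dlS D0 L l) (prS D0 L l) r' *
      ∏ p, Gk a (prS D0 L l p) ((range (prS D0 L l p)).filter (fun w => ¬ prS D0 L l p ∣ w + a m)) (r p) (r' p) := by
  have hδ := dlS_nonneg D0 L hL l
  have hpr := prS_pos D0 L l
  have hW' : (0:ℝ) < W := by exact_mod_cast hW0
  have hφ : (0:ℝ) < (W.totient : ℝ) / W := div_pos (by exact_mod_cast Nat.totient_pos.mpr hW0) hW'
  set Λ := (W.totient : ℝ) / W * (L / 100) with hΛdef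
  have hΛ : 0 < Λ := by positivity
  have hβ : (0:ℝ) ≤ 8 ^ J := by positivity
  have hβ0 : (0:ℝ) < 8 ^ J := by positivity
  obtain ⟨u1, u2⟩ := oneD_A_up (dlS D0 L l) hδ (prS D0 L l) hpr J Λ hΛ (fun j hj => (hNc j hj).2)
  obtain ⟨l1, l2⟩ := oneD_low (dlS D0 L l) hδ (prS D0 L l) hpr J Λ hΛ (fun j hj => (hNc j hj).1)
  set A := ∑ S, wv (8 ^ J) (dlS D0 L l) (prS D0 L l) S with hA
  have hA0 : 0 < A := lt_of_lt_of_le (by positivity) l1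
  refine ⟨l1, ?_⟩
  have hκ1 : 1 ≤ Fintype.card ι := Fintype.card_pos_iff.mpr ⟨m⟩
  have hD0' : (16:ℝ) ≤ D0 := by exact_mod_cast hD16
  have hsqs := PS_sqsum D0 (by omega) L l
  have hinv : (1:ℝ) / D0 ≤ 1 / 16 := one_div_le_one_div_of_le (by norm_num) hD0'
  have key := main_S2 (8 ^ J) hβ (dlS D0 L l) hδ (prS D0 L l) (fun p => hDκ.trans (prS_gt D0 L l p).le) a ha m (hsqs.trans hinv) hA0 ?_
  · refine le_trans ?_ key
    have e1 : A ^ Fintype.card ι = A * A ^ (Fintype.card ι - 1) := by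
      rw [← pow_succ', Nat.sub_add_cancel hκ1]
    rw [e1, ← mul_assoc]
    refine mul_le_mul_of_nonneg_right ?_ (pow_nonneg hA0.le _)
    have hJ0 : (0:ℝ) ≤ 7 / 64 * J * Λ / 8 ^ J := by positivity
    calc (J:ℝ) ^ 2 * Λ / (393216 * 8 ^ J) * A ≤ (J:ℝ) ^ 2 * Λ / (393216 * 8 ^ J) * (147 * Λ / 8 ^ J) := by gcongr
      _ = (7 / 64 * J * Λ / 8 ^ J) ^ 2 / 32 := by field_simp; ring
      _ ≤ _ := by gcongr
  · have hJκ' : 32768 * (Fintype.card ι : ℝ) * (J + 1) ≤ 8 ^ J := by exact_mod_cast hJκ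
    have hDκ' : 24 * (Fintype.card ι : ℝ) ^ 2 ≤ D0 := by exact_mod_cast hDκ2
    have t1 : (∑ S, wv (8 ^ J) (dlS D0 L l) (prS D0 L l) S * us (dlS D0 L l) S) / A ≤ 2048 * (J + 1) / 8 ^ J := by
      rw [div_le_iff₀ hA0]
      refine u2.trans ?_
      calc 128 * ((J:ℝ) + 1) * Λ / (8 ^ J) ^ 2 = 2048 * (J + 1) / 8 ^ J * (Λ / (16 * 8 ^ J)) := by field_simp; norm_num
        _ ≤ _ := by gcongr
    have t2 : 2 * (Fintype.card ι : ℝ) * (2048 * (J + 1) / 8 ^ J) ≤ 1 / 8 := by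
      rw [← mul_div_assoc, div_le_iff₀ hβ0]; nlinarith
    have t3 : 9 * (Fintype.card ι : ℝ) ^ 2 * (1 / D0) ≤ 3 / 8 := by
      rw [mul_one_div, div_le_iff₀ (by linarith)]; nlinarith
    have t4 := mul_le_mul_of_nonneg_left t1 (by positivity : 0 ≤ 2 * (Fintype.card ι : ℝ))
    have t5 := mul_le_mul_of_nonneg_left hsqs (by positivity : 0 ≤ 9 * (Fintype.card ι : ℝ) ^ 2)
    linarith

end OIR
end

section
open Finset MeasureTheory
namespace OIR

theorem err_small (M : ℝ) (hM : 0 ≤ M) (W C : ℕ) : ∀ᶠ L : ℝ in Filter.atTop, L * (M * (Real.exp (L / 100) * err1 L W C)) ≤ 1 := by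
  filter_upwards [poly_exp_ev (M * 2 ^ C * (4 * W)) (C + 1) (11 / 25) (by norm_num), Filter.eventually_ge_atTop 1] with L h1 hL
  refine le_trans ?_ h1
  have h2 : (1 + L) ^ C ≤ 2 ^ C * L ^ C := by
    rw [← mul_pow]; exact pow_le_pow_left₀ (by linarith) (by linarith) C
  have he : Real.exp (L / 100) * (Real.exp (L / 50) * (Real.exp (3 * L / 100) * Real.exp (-(L / 2)))) = Real.exp (-(11 / 25 * L)) := by
    rw [← Real.exp_add, ← Real.exp_add, ← Real.exp_add]; congr 1; ring
  unfold err1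
  calc _ = (M * L * (4 * W)) * (1 + L) ^ C * (Real.exp (L / 100) * (Real.exp (L / 50) * (Real.exp (3 * L / 100) * Real.exp (-(L / 2))))) := by ring
    _ ≤ (M * L * (4 * W)) * (2 ^ C * L ^ C) * (Real.exp (L / 100) * (Real.exp (L / 50) * (Real.exp (3 * L / 100) * Real.exp (-(L / 2))))) := by gcongr
    _ = _ := by rw [he]; ring

theorem choose_J (K : ℕ) : ∃ J k : ℕ, 1 ≤ k ∧ 65536 * k * (J + 1) ≤ 8 ^ J ∧
    (2 * K + 2 : ℝ) * (1572864000 * 8 ^ J) ≤ k * (J:ℝ) ^ 2 := by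
  set J := (2 * K + 2) * 262144 * 1572864000 with hJ
  have hJ8 : 8 ≤ J := by
    rw [hJ]; nlinarith [Nat.zero_le K]
  have h1 : 65536 * (J + 1) ≤ 8 ^ J := by
    have a1 : J + 1 ≤ 2 ^ J := Nat.lt_two_pow_self
    have a2 : 65536 ≤ 4 ^ J := le_trans (by norm_num : 65536 ≤ 4 ^ 8) (Nat.pow_le_pow_right (by norm_num) hJ8)
    calc 65536 * (J + 1) ≤ 4 ^ J * 2 ^ J := Nat.mul_le_mul a2 a1
      _ = 8 ^ J := by rw [← mul_pow]; norm_num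
  have hd : 0 < 65536 * (J + 1) := by omega
  have h2 : 1 ≤ 8 ^ J / (65536 * (J + 1)) := (Nat.one_le_div_iff hd).mpr h1
  refine ⟨J, 8 ^ J / (65536 * (J + 1)), h2, ?_, ?_⟩
  · calc 65536 * (8 ^ J / (65536 * (J + 1))) * (J + 1) = 8 ^ J / (65536 * (J + 1)) * (65536 * (J + 1)) := by ring
      _ ≤ 8 ^ J := Nat.div_mul_le_self _ _
  · have h3 : 8 ^ J < 65536 * (J + 1) * (8 ^ J / (65536 * (J + 1)) + 1) := Nat.lt_mul_div_succ _ hd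
    generalize hk : 8 ^ J / (65536 * (J + 1)) = k at *
    have h3' : (8:ℝ) ^ J ≤ 65536 * (J + 1) * (k + 1) := by exact_mod_cast h3.le
    have hk1 : (1:ℝ) ≤ k := by exact_mod_cast h2
    have hJ1 : (1:ℝ) ≤ J := by exact_mod_cast (by omega : 1 ≤ J)
    have h4 : (8:ℝ) ^ J ≤ 262144 * J * k := by
      refine h3'.trans ?_
      have e1 : (J:ℝ) + 1 ≤ 2 * J := by linarith
      have e2 : (k:ℝ) + 1 ≤ 2 * k := by linarith
      calc 65536 * ((J:ℝ) + 1) * (k + 1) ≤ 65536 * (2 * J) * (2 * k) := by gcongr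
        _ = _ := by ring
    have hJr : (J:ℝ) = (2 * K + 2) * 262144 * 1572864000 := by rw [hJ]; push_cast; ring
    calc (2 * K + 2 : ℝ) * (1572864000 * 8 ^ J) ≤ (2 * K + 2 : ℝ) * (1572864000 * (262144 * J * k)) := by gcongr
      _ = k * ((2 * K + 2) * 262144 * 1572864000) * J := by ring
      _ = k * (J:ℝ) ^ 2 := by rw [← hJr]; ring

theorem final_arith (K k B : ℕ) (L W φ X E β M G2 J T2 T1 T3 P : ℝ) (hL : 1 ≤ L) (hW : 0 < W) (hφ : 0 < φ) (hX : 1 ≤ X) (hE : 0 ≤ E) (hβ : 0 < β)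
    (hB : 0 < B) (hG2 : L / 40 ≤ G2) (hk : 1 ≤ k) (hM : 0 ≤ M) (hBM : (B:ℝ) = 2 * k ^ 2 * M) (hP : 1 ≤ P)
    (hJ : (2 * K + 2 : ℝ) * (1572864000 * β) ≤ k * J ^ 2)
    (h2 : k * (G2 / φ * (J ^ 2 * (φ / W * (L / 100)) / (393216 * β) * X) - 1 / L) ≤ T2)
    (h23 : T2 ≤ L * (K * T1 + k / B * T3)) (h1 : T1 ≤ (1 + L) / W * X + E)
    (h3 : T3 ≤ k * ((1 + L) / W * (X * M) + P * E)) (herr : L * ((K + k * k) * (P * E)) ≤ 1) (hkL : k ≤ L) (hLW : 3 * W ≤ L) : False := by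
  have hL0 : 0 < L := by linarith
  have hB' : (0:ℝ) < B := by exact_mod_cast hB
  have hB1 : (1:ℝ) ≤ B := by exact_mod_cast hB
  have hk' : (1:ℝ) ≤ k := by exact_mod_cast hk
  set Y := L ^ 2 / W * X with hY
  have hY3 : 3 ≤ Y := by
    have : 3 ≤ L ^ 2 / W := by
      rw [le_div_iff₀ hW]; nlinarith
    nlinarith
  have lo : (2 * K + 2 : ℝ) * Y - 1 ≤ T2 := by
    refine le_trans ?_ h2
    have a1 : (L / 40) / φ * (J ^ 2 * (φ / W * (L / 100)) / (393216 * β) * X) ≤ G2 / φ * (J ^ 2 * (φ / W * (L / 100)) / (393216 * β) * X) := by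
      gcongr
    have a2 : (L / 40) / φ * (J ^ 2 * (φ / W * (L / 100)) / (393216 * β) * X) = J ^ 2 / (1572864000 * β) * Y := by
      rw [hY]; field_simp; ring
    have a3 : (2 * K + 2 : ℝ) * Y ≤ k * (J ^ 2 / (1572864000 * β) * Y) := by
      rw [← mul_assoc (k:ℝ)]
      refine mul_le_mul_of_nonneg_right ?_ (by linarith)
      rw [← mul_div_assoc, le_div_iff₀ (by positivity)]
      exact hJ
    have a4 : (k:ℝ) * (1 / L) ≤ 1 := by rw [mul_one_div, div_le_one hL0]; exact hkL
    have a5 := mul_le_mul_of_nonneg_left (a2 ▸ a1) (by linarith : (0:ℝ) ≤ k)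
    rw [mul_sub]
    linarith
  have hkB : (k:ℝ) / B * k * M * 2 = 1 := by
    rw [hBM] at hB' ⊢
    have : M ≠ 0 := fun h => by rw [h] at hB'; simp at hB'
    field_simp
  have up : T2 ≤ (2 * K + 1) * Y + 1 := by
    refine h23.trans ?_
    have b0 : (1 + L) / W * X ≤ 2 * (L / W * X) := by
      have : (1 + L) / W ≤ 2 * (L / W) := by rw [← mul_div_assoc]; gcongr; linarith
      calc _ ≤ 2 * (L / W) * X := by gcongr
        _ = _ := by ring
    have b1 : K * T1 ≤ K * (2 * (L / W * X) + P * E) := by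
      refine mul_le_mul_of_nonneg_left (h1.trans ?_) (by positivity)
      nlinarith
    have b2 : k / B * T3 ≤ k / B * (k * (2 * (L / W * X) * M + P * E)) := by
      refine mul_le_mul_of_nonneg_left (h3.trans ?_) (by positivity)
      refine mul_le_mul_of_nonneg_left ?_ (by positivity)
      have := mul_le_mul_of_nonneg_right b0 hM
      linarith
    have b3 : k / B * (k * (2 * (L / W * X) * M + P * E)) = L / W * X + k / B * k * (P * E) := by
      calc _ = (k / B * k * M * 2) * (L / W * X) + k / B * k * (P * E) := by ring
        _ = _ := by rw [hkB, one_mul]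
    have b4 : (k:ℝ) / B * k * (P * E) ≤ k * k * (P * E) := by
      have : (k:ℝ) / B ≤ k := div_le_self (by positivity) hB1
      gcongr
    calc L * (K * T1 + k / B * T3) ≤ L * (K * (2 * (L / W * X) + P * E) + (L / W * X + k * k * (P * E))) :=
          mul_le_mul_of_nonneg_left (by linarith) hL0.le
      _ = (2 * K + 1) * Y + L * ((K + k * k) * (P * E)) := by rw [hY]; ring
      _ ≤ _ := by linarith
  linarith

end OIR
end

section
open Finset MeasureTheory
namespace OIR

theorem err1_nonneg (L : ℝ) (hL : 0 ≤ L) (W C : ℕ) : 0 ≤ err1 L W C := by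
  unfold err1
  have : 0 ≤ 1 + L := by linarith
  positivity

theorem sieve_ev (K : ℕ) : ∃ k B : ℕ, 1 ≤ k ∧ ∀ h : Fin k → ℕ,
    Function.Injective (Sum.elim h (fun i => h i - 1)) → ∃ D1 : ℕ, ∀ D0 ≥ D1, ∀ W : ℕ, 0 < W →
    (∀ p : ℕ, p.Prime → (p ∣ W ↔ p ≤ D0)) → ∀ b : ℕ, (∀ i, (b + h i).Coprime W) →
    ∀ᶠ L : ℝ in Filter.atTop, ∃ l : ℕ, ∃ n ∈ N1 L W b, K ≤ (univ.filter (fun m => (n + h m).Prime)).card ∧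
      ∀ j, (univ.filter (fun p : PS D0 L l => prS D0 L l p ∣ n + (h j - 1))).card ≤ B := by
  obtain ⟨J, k, hk, hkJ, hKJ⟩ := choose_J K
  set M : ℕ := 8 * (8 ^ J + 4) ^ 2 + 2 * (2 * k) ^ 2 with hM
  have hM0 : 0 < M := by positivity
  refine ⟨k, 2 * k ^ 2 * M, hk, fun h hinj => ?_⟩
  have hB : 0 < 2 * k ^ 2 * M := by positivity
  have hκ : Fintype.card (Fin k ⊕ Fin k) = 2 * k := by simp; ring
  refine ⟨16 + 16 * (2 * k) + 24 * (2 * k) ^ 2 + ∑ i, h i, fun D0 hD0 W hW0 hW b hb => ?_⟩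
  have hsum : ∀ i, h i ≤ ∑ i, h i := fun i => single_le_sum (f := h) (fun _ _ => Nat.zero_le _) (mem_univ i)
  have hWr : (0:ℝ) < W := by exact_mod_cast hW0
  have hφ : (0:ℝ) < W.totient := by exact_mod_cast Nat.totient_pos.mpr hW0
  filter_upwards [BV W hW0 (2 * (2 * k + 1) ^ 2) (by nlinarith), Nc_bounds D0 W J hW0 hW, G2_lower,
    err_small (K + k * k) (by positivity) W (2 * (2 * k + 1) ^ 2), Filter.eventually_ge_atTop 200,
    Filter.eventually_ge_atTop (3 * W : ℝ), Filter.eventually_ge_atTop (k:ℝ),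
    Filter.eventually_ge_atTop (16 * 8 ^ J * 100 * W : ℝ), Filter.eventually_ge_atTop (4 * (∑ i, h i : ℕ) : ℝ)]
    with L hBV hNc hG2 herr hL hLW hkL hLΛ hLh
  obtain ⟨l, hl, hlW, hBV⟩ := hBV
  by_contra hcon
  push Not at hcon
  have hL0 : 0 < L := by linarith
  have ha : ∀ p : PS D0 L l, ∀ n i j, prS D0 L l p ∣ n + Sum.elim h (fun i => h i - 1) i →
      prS D0 L l p ∣ n + Sum.elim h (fun i => h i - 1) j → i = j := by
    intro p n i j hi hj
    apply hinj
    have hlt : ∀ i, Sum.elim h (fun i => h i - 1) i < prS D0 L l p := by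
      intro i
      have h1 := prS_gt D0 L l p
      rcases i with i | i
      · have := hsum i; simp only [Sum.elim_inl]; omega
      · have := hsum i; simp only [Sum.elim_inr]; omega
    have hmod : (n + Sum.elim h (fun i => h i - 1) i) ≡ (n + Sum.elim h (fun i => h i - 1) j) [MOD prS D0 L l p] :=
      ((Nat.modEq_zero_iff_dvd).mpr hi).trans ((Nat.modEq_zero_iff_dvd).mpr hj).symm
    have h2 := Nat.ModEq.add_left_cancel' n hmod
    exact Nat.ModEq.eq_of_lt_of_lt h2 (hlt i) (hlt j)
  have hW' : ∀ p : ℕ, p.Prime → p ∣ W → p ≤ D0 := fun p hp => (hW p hp).mp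
  have hexpL : L / 2 + 1 ≤ Real.exp (L / 2) := Real.add_one_le_exp _
  have hWL : (W:ℝ) * Real.exp (L / 50) ≤ Real.exp (L / 2) := by
    have h1 : (W:ℝ) ≤ Real.exp (L / 2 - L / 50) := by
      have := Real.add_one_le_exp (L / 2 - L / 50); linarith
    calc _ ≤ Real.exp (L / 2 - L / 50) * Real.exp (L / 50) := by gcongr
      _ = _ := by rw [← Real.exp_add]; congr 1; ring
  have hFl := fun m => F_lower D0 L hL0 l W J (Sum.elim h (fun i => h i - 1)) ha m (by omega) (by rw [hκ]; omega) (by rw [hκ]; omega)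
    (by rw [hκ]; calc 32768 * (2 * k) * (J + 1) = 65536 * k * (J + 1) := by ring
          _ ≤ _ := hkJ) hW0 (hNc l hl)
  have h1 := S1_bound D0 L hL0 l W hl hW0 hW' b (8 ^ J) (by positivity) _ ha
  have h3 := S3_bound D0 L hL0 l W hl hW0 hW' b (8 ^ J) (by positivity) _ ha
  have h2 := fun m => S2_bound D0 L hL0 l W hl hW0 hW' b (8 ^ J) (by positivity) (Sum.elim h (fun i => h i - 1)) hWL (Sum.inl m)
    (by have : ((h m : ℕ):ℝ) ≤ (∑ i, h i : ℕ) := by exact_mod_cast hsum m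
        simp only [Sum.elim_inl]; linarith) (by simpa using hb m) (by rw [hκ]; exact hBV) _ (hFl (Sum.inl m)).2
  have hwv := (hFl (Sum.inl ⟨0, hk⟩)).1
  rw [hκ] at h1 h3 h2
  have hup := upper_sum L hL0 (prS D0 L l) k K (2 * k ^ 2 * M) hB h (fun i => h i - 1) (N1 L W b)
    (fun n hn => by
      have := (mem_Ioc.mp (mem_filter.mp hn).1).1; omega)
    (nu (Sum.elim h (fun i => h i - 1)) (prS D0 L l) (cv (8 ^ J) (dlS D0 L l) (prS D0 L l)))
    (fun n hn => by
      by_cases hK : (univ.filter (fun m => (n + h m).Prime)).card < K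
      · exact Or.inl hK
      · exact Or.inr (hcon l n hn (not_lt.mp hK)))
  have hS3 := S3_total D0 (by omega) L (by linarith) l (8 ^ J) ((2 * k : ℕ):ℝ) (by positivity)
  have hcard := PS_card D0 L l
  have hE := err1_nonneg L hL0.le W (2 * (2 * k + 1) ^ 2)
  generalize (∑ S, wv (8 ^ J) (dlS D0 L l) (prS D0 L l) S) = S at *
  have hS : 1 ≤ S := by
    refine le_trans ?_ hwv
    have hφ1 : (1:ℝ) ≤ W.totient := by exact_mod_cast Nat.totient_pos.mpr hW0
    rw [le_div_iff₀ (by positivity), one_mul]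
    calc (16 * 8 ^ J : ℝ) = 1 / W * (16 * 8 ^ J * 100 * W / 100) := by field_simp
      _ ≤ W.totient / W * (L / 100) := by gcongr
  refine final_arith K k (2 * k ^ 2 * M) L W W.totient (S ^ (2 * k)) (err1 L W (2 * (2 * k + 1) ^ 2)) (8 ^ J) M _ J _ _ _ (Real.exp (L / 100))
    (by linarith) hWr hφ (one_le_pow₀ hS) hE (by positivity) hB hG2 hk (by positivity) (by push_cast; ring) (Real.one_le_exp (by positivity))
    hKJ ?_ hup h1 ?_ herr hkL hLW
  · calc _ = ∑ m : Fin k, ((∑ n ∈ Ioc 0 ⌊Real.exp L⌋₊, pw L n) / W.totient *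
          ((J:ℝ) ^ 2 * ((W.totient : ℝ) / W * (L / 100)) / (393216 * 8 ^ J) * S ^ (2 * k)) - 1 / L) := by
          rw [sum_const, card_univ, Fintype.card_fin, nsmul_eq_mul]
      _ ≤ _ := sum_le_sum (fun m _ => by simpa using h2 m)
  · calc _ ≤ ∑ j : Fin k, ((1 + L) / W * (S ^ (2 * k) * M) + Real.exp (L / 100) * err1 L W (2 * (2 * k + 1) ^ 2)) := by
          refine sum_le_sum (fun j _ => ?_)
          calc _ ≤ ∑ p : PS D0 L l, ((1 + L) / (W * prS D0 L l p) * (S ^ (2 * k) *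
                ((8 ^ J + 4) * dlS D0 L l p + (2 * k : ℕ) / prS D0 L l p) ^ 2) + err1 L W (2 * (2 * k + 1) ^ 2)) :=
                sum_le_sum (fun p _ => h3 p (Sum.inr j))
            _ = (1 + L) / W * (S ^ (2 * k) * ∑ p : PS D0 L l, 1 / (prS D0 L l p : ℝ) * ((8 ^ J + 4) * dlS D0 L l p + (2 * k : ℕ) / prS D0 L l p) ^ 2)
                + (Fintype.card (PS D0 L l)) * err1 L W (2 * (2 * k + 1) ^ 2) := by
                rw [sum_add_distrib, sum_const, card_univ, nsmul_eq_mul, mul_sum, mul_sum]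
                congr 1
                refine sum_congr rfl (fun p _ => ?_)
                rw [← div_div]; ring
            _ ≤ _ := by
                have : 0 ≤ (1 + L) / W := by positivity
                have : 0 ≤ S ^ (2 * k) := by positivity
                gcongr
                refine hS3.trans (le_of_eq ?_)
                rw [hM]; push_cast; ring
      _ = _ := by
          rw [sum_const, card_univ, Fintype.card_fin, nsmul_eq_mul]

end OIR
end

section
open Finset MeasureTheory
namespace OIR

theorem big_factors (x : ℕ) (hx : 0 < x) (y : ℝ) (hy : 0 ≤ y) (S : Finset ℕ) (hS : S ⊆ x.primeFactors) (hSy : ∀ p ∈ S, y ≤ p) :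
    y ^ S.card ≤ x := by
  have h1 : ∏ p ∈ S, p ≤ x := Nat.le_of_dvd hx ((prod_dvd_prod_of_subset _ _ _ hS).trans (Nat.prod_primeFactors_dvd x))
  calc y ^ S.card = ∏ p ∈ S, y := by rw [prod_const]
    _ ≤ ∏ p ∈ S, (p:ℝ) := prod_le_prod (fun _ _ => hy) hSy
    _ = ((∏ p ∈ S, p : ℕ) : ℝ) := by push_cast; rfl
    _ ≤ x := by exact_mod_cast h1

theorem sieve_fin (K : ℕ) : ∃ k B : ℕ, 1 ≤ k ∧ ∀ h : Fin k → ℕ,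
    Function.Injective (Sum.elim h (fun i => h i - 1)) → ∃ D1 : ℕ, ∀ D0 ≥ D1, ∀ W : ℕ, 0 < W →
    (∀ p : ℕ, p.Prime → (p ∣ W ↔ p ≤ D0)) → ∀ b : ℕ, (∀ i, (b + h i).Coprime W) →
    ∀ N : ℕ, ∃ n, N ≤ n ∧ n ≡ b [MOD W] ∧ K ≤ (univ.filter (fun m => (n + h m).Prime)).card ∧
      ∀ j, ((n + (h j - 1)).primeFactors.filter (D0 < ·)).card ≤ B := by
  obtain ⟨k, B, hk, H⟩ := sieve_ev K
  refine ⟨k, B + (1 + 200), hk, fun h hinj => ?_⟩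
  obtain ⟨D1, H⟩ := H h hinj
  refine ⟨D1, fun D0 hD0 W hW0 hW b hb N => ?_⟩
  have H := H D0 hD0 W hW0 hW b hb
  obtain ⟨L, ⟨l, n, hn, hK, hB⟩, hLN, hL1, hLh⟩ := (H.and ((Filter.eventually_ge_atTop (4 * N : ℝ)).and
    ((Filter.eventually_ge_atTop 1).and (Filter.eventually_ge_atTop ((∑ i, h i : ℕ) : ℝ))))).exists
  have hsum : ∀ i, h i ≤ ∑ i, h i := fun i => single_le_sum (f := h) (fun _ _ => Nat.zero_le _) (mem_univ i)
  obtain ⟨hn1, hn2⟩ := mem_filter.mp hn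
  obtain ⟨hn3, hn4⟩ := mem_Ioc.mp hn1
  have hNn : N ≤ n := by
    refine le_trans (Nat.le_floor ?_) hn3.le
    have := Real.add_one_le_exp (L / 2)
    linarith
  refine ⟨n, hNn, hn2, hK, fun j => ?_⟩
  set x := n + (h j - 1) with hx
  have hx0 : 0 < x := by omega
  have hxL : (x:ℝ) < Real.exp (2 * L) := by
    have h1 : (n:ℝ) ≤ Real.exp L := (Nat.le_floor_iff (Real.exp_pos _).le).mp hn4
    have h2 : ((h j - 1 : ℕ):ℝ) ≤ (∑ i, h i : ℕ) := by
      have := hsum j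
      exact_mod_cast (by omega : h j - 1 ≤ ∑ i, h i)
    have h3 := Real.add_one_le_exp L
    have h4 : Real.exp (2 * L) = Real.exp L * Real.exp L := by rw [← Real.exp_add]; congr 1; ring
    rw [hx, h4]; push_cast
    nlinarith
  have hbig : (x.primeFactors.filter (fun p : ℕ => Real.exp (L / 100) < p)).card ≤ 200 := by
    by_contra hc
    push Not at hc
    have h1 := big_factors x hx0 (Real.exp (L / 100)) (Real.exp_pos _).le _ (filter_subset _ _) (fun p hp => le_of_lt (mem_filter.mp hp).2)
    have h2 : Real.exp (2 * L) ≤ Real.exp (L / 100) ^ (x.primeFactors.filter (fun p : ℕ => Real.exp (L / 100) < p)).card := by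
      calc Real.exp (2 * L) = Real.exp (L / 100) ^ 200 := by rw [← Real.exp_nat_mul]; congr 1; push_cast; ring
        _ ≤ _ := pow_le_pow_right₀ (Real.one_le_exp (by linarith)) hc.le
    linarith
  have hsub : x.primeFactors.filter (D0 < ·) ⊆ ((univ.filter (fun p : PS D0 L l => prS D0 L l p ∣ x)).image (prS D0 L l)) ∪
      ({l} ∪ x.primeFactors.filter (fun p : ℕ => Real.exp (L / 100) < p)) := by
    intro p hp
    obtain ⟨hp1, hp2⟩ := mem_filter.mp hp
    by_cases hpl : p = l
    · simp [hpl]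
    by_cases hpe : Real.exp (L / 100) < p
    · simp only [mem_union, mem_filter]; exact Or.inr (Or.inr ⟨hp1, hpe⟩)
    · refine mem_union_left _ (mem_image.mpr ⟨⟨p, (mem_PS D0 L l p).mpr ⟨⟨hp2, not_lt.mp hpe⟩, Nat.prime_of_mem_primeFactors hp1, hpl⟩⟩, ?_, rfl⟩)
      exact mem_filter.mpr ⟨mem_univ _, Nat.dvd_of_mem_primeFactors hp1⟩
  calc _ ≤ _ := card_le_card hsub
    _ ≤ _ := card_union_le _ _
    _ ≤ B + (1 + 200) := by
        refine Nat.add_le_add (card_image_le.trans (hB j)) ((card_union_le _ _).trans (Nat.add_le_add (by simp) hbig))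

end OIR
end

section
open Finset
namespace OIR

theorem avoid (p : ℕ) (hp : p.Prime) (A : Finset ℕ) (hA : A.card < p) : ∃ r : ℕ, ∀ x ∈ A, ¬ p ∣ r + x := by
  have : Fact p.Prime := ⟨hp⟩
  have : NeZero p := ⟨hp.ne_zero⟩
  have h1 : (A.image (fun x : ℕ => -(x : ZMod p))).card < (univ : Finset (ZMod p)).card := by
    rw [card_univ, ZMod.card]; exact card_image_le.trans_lt hA
  obtain ⟨z, -, hz⟩ := exists_mem_notMem_of_card_lt_card h1
  refine ⟨z.val, fun x hx hd => hz (mem_image.mpr ⟨x, hx, ?_⟩)⟩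
  rw [← ZMod.natCast_eq_zero_iff] at hd
  push_cast [ZMod.natCast_zmod_val] at hd
  exact (eq_neg_of_add_eq_zero_left hd).symm

/-- disjoint sets of primes above `T` with prescribed cardinalities -/
theorem prime_sets (T : ℕ) (cnt : ℕ → ℕ) : ∃ E : ℕ → Finset ℕ, (∀ a, ∀ p ∈ E a, p.Prime ∧ T < p) ∧ (∀ a, (E a).card = cnt a) ∧
    ∀ a a' p, p ∈ E a → p ∈ E a' → a = a' := by
  have hinf := Nat.infinite_setOfPred_prime
  have hmono := Nat.nth_strictMono hinf
  have hinj : ∀ a u a' u', Nat.nth Nat.Prime (T + Nat.pair a u) = Nat.nth Nat.Prime (T + Nat.pair a' u') → a = a' ∧ u = u' := by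
    intro a u a' u' h
    have := hmono.injective h
    exact Nat.pair_eq_pair.mp (by omega)
  refine ⟨fun a => (range (cnt a)).image (fun u => Nat.nth Nat.Prime (T + Nat.pair a u)), ?_, ?_, ?_⟩
  · intro a p hp
    obtain ⟨u, -, rfl⟩ := mem_image.mp hp
    have := Nat.add_two_le_nth_prime (T + Nat.pair a u)
    exact ⟨Nat.prime_nth_prime _, by omega⟩
  · intro a
    rw [card_image_of_injective _ (fun u u' h => (hinj _ _ _ _ h).2), card_range]
  · intro a a' p hp hp'
    obtain ⟨u, -, rfl⟩ := mem_image.mp hp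
    obtain ⟨u', -, h⟩ := mem_image.mp hp'
    exact (hinj _ _ _ _ h).1.symm

theorem crt_primes (D0 : ℕ) (r : ℕ → ℕ) : ∃ W b : ℕ, 0 < W ∧ (∀ p : ℕ, p.Prime → (p ∣ W ↔ p ≤ D0)) ∧
    ∀ p : ℕ, p.Prime → p ≤ D0 → b ≡ r p [MOD p] := by
  have hmem : ∀ p, p ∈ (range (D0 + 1)).filter Nat.Prime ↔ p ≤ D0 ∧ p.Prime := by
    intro p; rw [mem_filter, mem_range]; constructor <;> rintro ⟨h1, h2⟩ <;> exact ⟨by omega, h2⟩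
  refine ⟨∏ p ∈ (range (D0 + 1)).filter Nat.Prime, p, (Nat.chineseRemainderOfFinset r id ((range (D0 + 1)).filter Nat.Prime)
    (fun p hp => ((hmem p).mp hp).2.ne_zero) ?_).1, ?_, ?_, ?_⟩
  · intro p hp q hq hpq
    exact (Nat.coprime_primes ((hmem p).mp hp).2 ((hmem q).mp hq).2).mpr hpq
  · exact prod_pos (fun p hp => ((hmem p).mp hp).2.pos)
  · intro p hp
    constructor
    · intro h
      obtain ⟨q, hq, hpq⟩ := (Prime.dvd_finsetProd_iff hp.prime _).mp h
      rw [(Nat.prime_dvd_prime_iff_eq hp ((hmem q).mp hq).2).mp hpq]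
      exact ((hmem q).mp hq).1
    · exact fun h => dvd_prod_of_mem _ ((hmem p).mpr ⟨h, hp⟩)
  · intro p hp hpD
    exact (Nat.chineseRemainderOfFinset r id ((range (D0 + 1)).filter Nat.Prime) _ _).2 p ((hmem p).mpr ⟨hpD, hp⟩)

/-- from one good `n` to a run of consecutive primes -/
theorem run_of_good (K k n T : ℕ) (h : Fin k → ℕ) (hmono : StrictMono h) (hT : ∀ i, h i < T)
    (hgap : ∀ t < T, (n + t).Prime → ∃ i, t = h i) (hK : K ≤ (univ.filter (fun m => (n + h m).Prime)).card)
    (hω : ∀ i j, i < j → (n + h i - 1).primeFactors.card < (n + h j - 1).primeFactors.card) :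
    ∀ i : ℕ, i + 1 < K → (Nat.nth Nat.Prime (Nat.count Nat.Prime n + i) - 1).primeFactors.card <
      (Nat.nth Nat.Prime (Nat.count Nat.Prime n + i + 1) - 1).primeFactors.card := by
  have hcount : Nat.count Nat.Prime n + K ≤ Nat.count Nat.Prime (n + T) := by
    rw [Nat.count_add]
    refine Nat.add_le_add_left (hK.trans ?_) _
    rw [Nat.count_eq_card_filter_range, ← card_image_of_injective _ hmono.injective]
    refine card_le_card (fun t ht => ?_)
    obtain ⟨i, hi, rfl⟩ := mem_image.mp ht
    exact mem_filter.mpr ⟨mem_range.mpr (hT i), (mem_filter.mp hi).2⟩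
  have hex : ∀ i < K, ∃ m, Nat.nth Nat.Prime (Nat.count Nat.Prime n + i) = n + h m := by
    intro i hi
    have h1 : Nat.nth Nat.Prime (Nat.count Nat.Prime n + i) < n + T := Nat.nth_lt_of_lt_count (by omega)
    have h2 : n ≤ Nat.nth Nat.Prime (Nat.count Nat.Prime n + i) :=
      (Nat.count_le_iff_le_nth Nat.infinite_setOfPred_prime).mp (Nat.le_add_right _ _)
    obtain ⟨t, ht⟩ := Nat.exists_eq_add_of_le h2
    obtain ⟨m, hm⟩ := hgap t (by omega) (ht ▸ Nat.prime_nth_prime _)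
    exact ⟨m, by rw [ht, hm]⟩
  intro i hi
  obtain ⟨m, hm⟩ := hex i (by omega)
  obtain ⟨m', hm'⟩ := hex (i + 1) hi
  rw [← add_assoc] at hm'
  have hlt := Nat.nth_strictMono Nat.infinite_setOfPred_prime (Nat.lt_succ_self (Nat.count Nat.Prime n + i))
  rw [Nat.succ_eq_add_one, hm, hm'] at hlt
  rw [hm, hm']
  exact hω m m' (hmono.lt_iff_lt.mp (by omega))

end OIR
end

section
open Finset
namespace OIR

theorem main_run (K : ℕ) : {n : ℕ | ∀ i : ℕ, i + 1 < K → (Nat.nth Nat.Prime (n + i) - 1).primeFactors.card <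
      (Nat.nth Nat.Prime (n + i + 1) - 1).primeFactors.card}.Infinite := by
  obtain ⟨k, B, hk, hS⟩ := sieve_fin K
  set H := (2 * k).factorial with hH
  have hH2 : 2 ∣ H := Nat.dvd_factorial (by norm_num) (by omega)
  have hHpos : 0 < H := Nat.factorial_pos _
  have hH2le : 2 ≤ H := Nat.le_of_dvd hHpos hH2
  have hkH : 2 * k ≤ H := Nat.self_le_factorial _
  set h : Fin k → ℕ := fun i => (i.1 + 1) * H with hh
  have hmono : StrictMono h := fun i j hij => Nat.mul_lt_mul_of_pos_right (Nat.succ_lt_succ hij) hHpos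
  have hHh : ∀ i, H ∣ h i := fun i => dvd_mul_left _ _
  have hh2 : ∀ i, 2 ≤ h i := fun i => hH2le.trans (Nat.le_mul_of_pos_left _ (Nat.succ_pos _))
  have hne : ∀ i j, h i ≠ h j - 1 := by
    intro i j hij
    obtain ⟨a, ha⟩ := hH2.trans (hHh i)
    obtain ⟨c, hc⟩ := hH2.trans (hHh j)
    have := hh2 j
    omega
  have hinj : Function.Injective (Sum.elim h (fun i => h i - 1)) := by
    rintro (i | i) (j | j) hij <;> simp only [Sum.elim_inl, Sum.elim_inr] at hij
    · rw [hmono.injective hij]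
    · exact absurd hij (hne i j)
    · exact absurd hij.symm (hne j i)
    · have h1 := hh2 i
      have h2 := hh2 j
      rw [hmono.injective (by omega : h i = h j)]
  obtain ⟨D1, hS⟩ := hS h hinj
  set T := (k + 1) * H with hT
  have hhT : ∀ i, h i < T := fun i => Nat.mul_lt_mul_of_pos_right (Nat.succ_lt_succ i.2) hHpos
  have hkT : 2 * k ≤ T := hkH.trans (Nat.le_mul_of_pos_left _ (Nat.succ_pos _))
  classical
  -- prescribed numbers of primes
  obtain ⟨E, hE1, hE2, hE3⟩ := prime_sets T (fun a => if ∃ i, a = h i then 0 else if a + 1 ∈ Set.range h then (a + 1) / H * (B + 1) else 1)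
  have hEh : ∀ i, E (h i) = ∅ := by
    intro i; rw [← card_eq_zero, hE2, if_pos ⟨i, rfl⟩]
  have hEf : ∀ i : Fin k, (E (h i - 1)).card = (i.1 + 1) * (B + 1) := by
    intro i
    have e : h i - 1 + 1 = h i := by have := hh2 i; omega
    rw [hE2, if_neg (by rintro ⟨j, hj⟩; exact hne j i hj.symm), if_pos ⟨i, e.symm⟩, e]
    rw [hh, Nat.mul_div_cancel _ hHpos]
  have hEg : ∀ t, (∀ i, t ≠ h i) → (∀ i, t ≠ h i - 1) → (E t).Nonempty := by
    intro t h1 h2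
    rw [← card_pos, hE2, if_neg (by rintro ⟨j, hj⟩; exact h1 j hj), if_neg]
    · norm_num
    · rintro ⟨i, hi⟩; exact h2 i (by omega)
  set A : Finset ℕ := univ.image (Sum.elim h (fun i => h i - 1)) with hA
  have hAcard : A.card ≤ 2 * k := by
    refine card_image_le.trans (le_of_eq ?_)
    rw [card_univ, Fintype.card_sum, Fintype.card_fin]; ring
  have hAh : ∀ i, h i ∈ A := fun i => mem_image.mpr ⟨Sum.inl i, mem_univ _, rfl⟩
  have hAh' : ∀ i, h i - 1 ∈ A := fun i => mem_image.mpr ⟨Sum.inr i, mem_univ _, rfl⟩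
  -- residues
  have hr : ∀ p : ℕ, ∃ r : ℕ, p.Prime → (p ≤ 2 * k → r = 1) ∧ (∀ a < T, p ∈ E a → p ∣ r + a) ∧
      (2 * k < p → (∀ a < T, p ∉ E a) → ∀ x ∈ A, ¬ p ∣ r + x) := by
    intro p
    by_cases hp : p.Prime
    swap
    · exact ⟨0, fun h => absurd h hp⟩
    by_cases h1 : ∃ a < T, p ∈ E a
    · obtain ⟨a, haT, ha⟩ := h1
      have hpT := (hE1 a p ha).2
      refine ⟨p - a, fun _ => ⟨fun h => by omega, fun a' _ ha' => ?_, fun _ h => absurd ha (h a haT)⟩⟩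
      rw [hE3 a' a p ha' ha, Nat.sub_add_cancel (by omega)]
    · push Not at h1
      by_cases h2 : p ≤ 2 * k
      · exact ⟨1, fun _ => ⟨fun _ => rfl, fun a haT ha => absurd ha (h1 a haT), fun h => by omega⟩⟩
      · obtain ⟨r, hr⟩ := avoid p hp A (by omega)
        exact ⟨r, fun _ => ⟨fun h => absurd h h2, fun a haT ha => absurd ha (h1 a haT), fun _ _ => hr⟩⟩
  choose r hr using hr
  set D0 := D1 + T + ∑ a ∈ range T, ∑ p ∈ E a, p with hD0
  have hED : ∀ a < T, ∀ p ∈ E a, p ≤ D0 := by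
    intro a ha p hp
    have h1 : p ≤ ∑ p ∈ E a, p := single_le_sum (f := fun p => p) (fun _ _ => Nat.zero_le _) hp
    have h2 : ∑ p ∈ E a, p ≤ ∑ a ∈ range T, ∑ p ∈ E a, p :=
      single_le_sum (f := fun a => ∑ p ∈ E a, p) (fun _ _ => Nat.zero_le _) (mem_range.mpr ha)
    omega
  obtain ⟨W, b, hW0, hW, hb⟩ := crt_primes D0 r
  -- local facts for any n congruent to b
  have hmod : ∀ n, n ≡ b [MOD W] → ∀ p : ℕ, p.Prime → p ≤ D0 → n ≡ r p [MOD p] := fun n hn p hp hpD =>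
    (hn.of_dvd ((hW p hp).mpr hpD)).trans (hb p hp hpD)
  have hdvd : ∀ n, n ≡ b [MOD W] → ∀ p : ℕ, p.Prime → p ≤ D0 → ∀ x, p ∣ n + x ↔ p ∣ r p + x := fun n hn p hp hpD x =>
    ((hmod n hn p hp hpD).add_right x).dvd_iff dvd_rfl
  have f1 : ∀ n, n ≡ b [MOD W] → ∀ a < T, ∀ p ∈ E a, p ∣ n + a := fun n hn a ha p hp =>
    (hdvd n hn p (hE1 a p hp).1 (hED a ha p hp) a).mpr ((hr p (hE1 a p hp).1).2.1 a ha hp)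
  have hAT : ∀ x ∈ A, x < T := by
    intro x hx
    obtain ⟨i | i, -, rfl⟩ := mem_image.mp hx
    · exact hhT i
    · have := hhT i; simp only [Sum.elim_inr]; omega
  have f2 : ∀ n, n ≡ b [MOD W] → ∀ p : ℕ, p.Prime → p ≤ D0 → 2 * k < p → ∀ x ∈ A, (p ∣ n + x ↔ p ∈ E x) := by
    intro n hn p hp hpD hpk x hx
    refine ⟨fun hd => ?_, fun hm => f1 n hn x (hAT x hx) p hm⟩
    by_cases h1 : ∃ a < T, p ∈ E a
    · obtain ⟨a, haT, ha⟩ := h1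
      have hpT := (hE1 a p ha).2
      have hd' := f1 n hn a haT p ha
      have h2 : n + a ≡ n + x [MOD p] := ((Nat.modEq_zero_iff_dvd).mpr hd').trans ((Nat.modEq_zero_iff_dvd).mpr hd).symm
      have h3 := Nat.ModEq.eq_of_lt_of_lt (Nat.ModEq.add_left_cancel' n h2) (by omega) ((hAT x hx).trans hpT)
      rwa [← h3]
    · push Not at h1
      exact absurd ((hdvd n hn p hp hpD x).mp hd) ((hr p hp).2.2 hpk h1 x hx)
  have hpH : ∀ p : ℕ, p.Prime → p ≤ 2 * k → ∀ i, p ∣ h i := fun p hp hpk i => (Nat.dvd_factorial hp.pos hpk).trans (hHh i)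
  have f3 : ∀ n, n ≡ b [MOD W] → ∀ p : ℕ, p.Prime → p ≤ 2 * k → ∀ i, p ∣ n + (h i - 1) := by
    intro n hn p hp hpk i
    rw [hdvd n hn p hp (by omega), (hr p hp).1 hpk]
    have : 1 + (h i - 1) = h i := by have := hh2 i; omega
    rw [this]; exact hpH p hp hpk i
  have hcop : ∀ i, (b + h i).Coprime W := by
    intro i
    refine Nat.Coprime.symm (Nat.coprime_of_dvd fun p hp hpW hpb => ?_)
    have hpD := (hW p hp).mp hpW
    by_cases hpk : p ≤ 2 * k
    · rw [hdvd b rfl p hp hpD, (hr p hp).1 hpk] at hpb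
      exact hp.one_lt.ne' (Nat.dvd_one.mp ((Nat.dvd_add_left (hpH p hp hpk i)).mp hpb))
    · rw [f2 b rfl p hp hpD (by omega) _ (hAh i), hEh] at hpb
      exact absurd hpb (notMem_empty _)
  refine Set.infinite_of_not_bddAbove ?_
  rintro ⟨N, hN⟩
  obtain ⟨n, hn1, hn2, hn3, hn4⟩ := hS D0 (by omega) W hW0 hW b hcop (Nat.nth Nat.Prime (N + 1) + D0 + 1)
  have hω : ∀ i, ((n + h i - 1).primeFactors.filter (fun p => ¬ D0 < p)).card =
      ((range (2 * k + 1)).filter Nat.Prime).card + (i.1 + 1) * (B + 1) := by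
    intro i
    have e : n + h i - 1 = n + (h i - 1) := by have := hh2 i; omega
    rw [e, ← hEf i, ← card_union_of_disjoint]
    · congr 1
      ext p
      simp only [mem_filter, mem_union, mem_range, Nat.mem_primeFactors]
      constructor
      · rintro ⟨⟨hp, hd, -⟩, hpD⟩
        by_cases hpk : p ≤ 2 * k
        · exact Or.inl ⟨by omega, hp⟩
        · exact Or.inr ((f2 n hn2 p hp (by omega) (by omega) _ (hAh' i)).mp hd)
      · rintro (⟨hpk, hp⟩ | hp)
        · exact ⟨⟨hp, f3 n hn2 p hp (by omega) i, by omega⟩, by omega⟩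
        · have h1 := hAT _ (hAh' i)
          have := hED _ h1 p hp
          exact ⟨⟨(hE1 _ p hp).1, f1 n hn2 _ h1 p hp, by omega⟩, by omega⟩
    · rw [disjoint_left]
      intro p hp hp'
      have h1 := mem_range.mp (mem_filter.mp hp).1
      have h2 := (hE1 _ p hp').2
      omega
  have hrun := run_of_good K k n T h hmono hhT ?_ hn3 ?_
  · have h1 := hN hrun
    have h2 : Nat.count Nat.Prime (Nat.nth Nat.Prime (N + 1)) ≤ Nat.count Nat.Prime n := Nat.count_monotone _ (by omega)
    rw [Nat.count_nth_of_infinite Nat.infinite_setOfPred_prime] at h2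
    exact absurd (h2.trans h1) (by omega)
  · intro t ht hp
    by_contra hc
    push Not at hc
    by_cases hc' : ∀ i, t ≠ h i - 1
    · obtain ⟨p, hpE⟩ := hEg t hc hc'
      have h1 := (Nat.prime_dvd_prime_iff_eq (hE1 t p hpE).1 hp).mp (f1 n hn2 t ht p hpE)
      have h2 := hED t ht p hpE
      omega
    · push Not at hc'
      obtain ⟨i, rfl⟩ := hc'
      have h1 := (Nat.prime_dvd_prime_iff_eq Nat.prime_two hp).mp (f3 n hn2 2 Nat.prime_two (by omega) i)
      omega
  · intro i j hij
    have hi := hω i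
    have hj := hω j
    have hBi := hn4 i
    have e : n + h i - 1 = n + (h i - 1) := by have := hh2 i; omega
    rw [← e] at hBi
    rw [← card_filter_add_card_filter_not (s := (n + h i - 1).primeFactors) (fun p => D0 < p),
      ← card_filter_add_card_filter_not (s := (n + h j - 1).primeFactors) (fun p => D0 < p), hi, hj]
    have h1 : (i.1 + 1 + 1) * (B + 1) ≤ (j.1 + 1) * (B + 1) := Nat.mul_le_mul_right _ (Nat.succ_le_succ hij)
    nlinarith [Nat.zero_le ((n + h j - 1).primeFactors.filter (fun p => D0 < p)).card]

end OIR
end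

/-- Pollack–Thompson: for every `K ≥ 1`, there are infinitely many `n` such that
the number of distinct prime factors of `p - 1` is strictly increasing along the run
of `K` consecutive primes `p_n, p_{n+1}, …, p_{n+K-1}`. -/
theorem omega_increasing_runs (K : ℕ) (hK : 1 ≤ K) :
    {n : ℕ | ∀ i : ℕ, i + 1 < K →
      (Nat.nth Nat.Prime (n + i) - 1).primeFactors.card <
        (Nat.nth Nat.Prime (n + i + 1) - 1).primeFactors.card}.Infinite := by
  exact OIR.main_run K
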